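/- Let K be an abelian number field (K/ℚ Galois with abelian Galois group). Assume the Riemann hypothesis for ζ_K, and assume that J_{-1}^K(T) ≪ T^{1+α} as T → ∞ for some fixed 0 ≤ α < 2 − √3. Then the function φ_K(y) = e^{−y/2} M_K(e^y) possesses a limiting distribution on ℝ: there exists a Borel probability measure ν_K on ℝ such that lim_{Y→∞} (1/Y) ∫_0^Y f(e^{−y/2} M_K(e^y)) dy = ∫_ℝ f dν_K for every bounded continuous real-valued function f on ℝ. -/

import Mathlib

noncomputable section

open NumberField Filter Topology MeasureTheory Complex

open scoped Classical

/-- The Möbius function on integral ideals of a number field `K`. -/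
def moebiusK (K : Type) [Field K] [NumberField K] (I : Ideal (𝓞 K)) : ℤ :=
  if Squarefree I then (-1) ^ (UniqueFactorizationMonoid.factors I).card else 0

/-- The Mertens function of a number field `K`: the sum of `μ_K(𝔞)` over nonzero integral
ideals `𝔞` of norm at most `x`, where ideals of norm exactly `x` count with weight `1/2`. -/
def mertensK (K : Type) [Field K] [NumberField K] (x : ℝ) : ℝ :=
  ∑' I : Ideal (𝓞 K),
    if I ≠ ⊥ ∧ (Ideal.absNorm I : ℝ) < x then (moebiusK K I : ℝ)
    else if I ≠ ⊥ ∧ (Ideal.absNorm I : ℝ) = x then (moebiusK K I : ℝ) / 2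
    else 0

/-- `M_K^- = liminf_{x → ∞} M_K(x) / x^{1/2}`, as an extended real number. -/
def MKminus (K : Type) [Field K] [NumberField K] : EReal :=
  Filter.liminf (fun x : ℝ => ((mertensK K x / Real.sqrt x : ℝ) : EReal)) Filter.atTop

/-- `M_K^+ = limsup_{x → ∞} M_K(x) / x^{1/2}`, as an extended real number. -/
def MKplus (K : Type) [Field K] [NumberField K] : EReal :=
  Filter.limsup (fun x : ℝ => ((mertensK K x / Real.sqrt x : ℝ) : EReal)) Filter.atTop

/-- The naïve Mertens-type conjecture over `K`: `-1 ≤ M_K^- ≤ M_K^+ ≤ 1`. -/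
def NaiveMertensConj (K : Type) [Field K] [NumberField K] : Prop :=
  -1 ≤ MKminus K ∧ MKminus K ≤ MKplus K ∧ MKplus K ≤ 1

/-- A predicate identifying the Dedekind zeta function of `K`: a function analytic away
from `s = 1` agreeing with the Dirichlet series `∑ N(𝔞)^{-s}` on `Re s > 1`. -/
def IsDedekindZeta (K : Type) [Field K] [NumberField K] (Z : ℂ → ℂ) : Prop :=
  (∀ s : ℂ, s ≠ 1 → DifferentiableAt ℂ Z s) ∧
  ∀ s : ℂ, 1 < s.re →
    Z s = ∑' I : {I : Ideal (𝓞 K) // I ≠ ⊥}, (Ideal.absNorm I.1 : ℂ) ^ (-s)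

/-- The Riemann hypothesis for a zeta function `Z`: all nontrivial zeros lie on `Re s = 1/2`. -/
def ZetaRH (Z : ℂ → ℂ) : Prop :=
  ∀ ρ : ℂ, Z ρ = 0 → 0 < ρ.re → ρ.re < 1 → ρ.re = 1 / 2

set_option linter.unusedSectionVars false
set_option linter.deprecated false

namespace LimDist

section Theta
variable {ι : Type*} [Fintype ι]

lemma summable_int_exp_neg_mul_sq {a : ℝ} (ha : 0 < a) :
    Summable fun m : ℤ => Real.exp (-a * (m : ℝ) ^ 2) := by
  have h := (summable_geometric_of_lt_one (Real.exp_nonneg (-a)) (by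
    rw [Real.exp_lt_one_iff]; linarith))
  have h1 : Summable fun n : ℕ => Real.exp (-a * (n : ℝ) ^ 2) := by
    refine Summable.of_nonneg_of_le (fun _ => Real.exp_nonneg _) (fun n => ?_) h
    rw [← Real.exp_nat_mul]
    apply Real.exp_le_exp.mpr
    have : (n : ℝ) ≤ (n : ℝ) ^ 2 := by exact_mod_cast Nat.le_self_pow (by norm_num) n
    nlinarith
  refine Summable.of_nat_of_neg (by simpa using h1) (by simpa using h1)

lemma summable_exp_neg_mul_sum_sq {a : ℝ} (ha : 0 < a) :
    Summable fun m : ι → ℤ => Real.exp (-a * ∑ i, (m i : ℝ) ^ 2) := by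
  have h1 := summable_int_exp_neg_mul_sq ha
  refine summable_of_sum_le (c := ∏ _i : ι, ∑' m : ℤ, Real.exp (-a * (m : ℝ) ^ 2))
    (fun _ => Real.exp_nonneg _) fun u => ?_
  calc ∑ m ∈ u, Real.exp (-a * ∑ i, (m i : ℝ) ^ 2)
      ≤ ∑ m ∈ Fintype.piFinset (fun i => u.image (fun m : ι → ℤ => m i)),
          Real.exp (-a * ∑ i, ((m i : ℤ) : ℝ) ^ 2) := by
        refine Finset.sum_le_sum_of_subset_of_nonneg (fun m hm => ?_)
          (fun _ _ _ => Real.exp_nonneg _)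
        rw [Fintype.mem_piFinset]
        exact fun i => Finset.mem_image_of_mem _ hm
    _ = ∏ i : ι, ∑ m ∈ u.image (fun m : ι → ℤ => m i), Real.exp (-a * ((m : ℤ) : ℝ) ^ 2) := by
        rw [Finset.prod_univ_sum]
        refine Finset.sum_congr rfl fun m _ => ?_
        rw [Finset.mul_sum, Real.exp_sum]
    _ ≤ _ := Finset.prod_le_prod (fun _ _ => Finset.sum_nonneg fun _ _ => Real.exp_nonneg _)
        fun i _ => h1.sum_le_tsum _ (fun _ _ => Real.exp_nonneg _)

/-- The quadratic form `|C x|²`. -/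
def qForm (C : Matrix ι ι ℝ) (x : ι → ℝ) : ℝ := ∑ i, (C.mulVec x i) ^ 2

lemma qForm_nonneg (C : Matrix ι ι ℝ) (x : ι → ℝ) : 0 ≤ qForm C x :=
  Finset.sum_nonneg fun _ _ => sq_nonneg _

lemma continuous_qForm (C : Matrix ι ι ℝ) : Continuous (qForm C) := by
  unfold qForm
  exact continuous_finsetSum _ fun i _ => by
    simp only [Matrix.mulVec, dotProduct]; fun_prop

lemma exists_le_qForm [DecidableEq ι] {C : Matrix ι ι ℝ} (hC : C.det ≠ 0) :
    ∃ c > 0, ∀ x : ι → ℝ, c * ∑ i, x i ^ 2 ≤ qForm C x := by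
  set K : ℝ := ∑ i, ∑ j, (C⁻¹ i j) ^ 2 with hK
  have hK0 : 0 ≤ K := Finset.sum_nonneg fun _ _ => Finset.sum_nonneg fun _ _ => sq_nonneg _
  have key : ∀ x : ι → ℝ, ∑ i, x i ^ 2 ≤ K * qForm C x := fun x => by
    rw [hK, Finset.sum_mul]
    refine Finset.sum_le_sum fun i _ => ?_
    have : x i = ∑ j, C⁻¹ i j * C.mulVec x j := by
      have h : (C⁻¹).mulVec (C.mulVec x) = x := by
        rw [Matrix.mulVec_mulVec, Matrix.nonsing_inv_mul _ (isUnit_iff_ne_zero.mpr hC),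
          Matrix.one_mulVec]
      exact (congrFun h i).symm
    rw [this]
    exact Finset.sum_mul_sq_le_sq_mul_sq _ _ _
  refine ⟨1 / (K + 1), by positivity, fun x => ?_⟩
  rw [one_div_mul_eq_div, div_le_iff₀ (by positivity)]
  nlinarith [key x, qForm_nonneg C x]

/-- The Gaussian attached to `C`. -/
def gaussM (C : Matrix ι ι ℝ) (x : ι → ℝ) : ℝ := Real.exp (-Real.pi * qForm C x)

lemma continuous_gaussM (C : Matrix ι ι ℝ) : Continuous (gaussM C) := by
  unfold gaussM
  exact Real.continuous_exp.comp (continuous_const.mul (continuous_qForm C))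

lemma gaussM_shift_le {C : Matrix ι ι ℝ} {c : ℝ} (hc : 0 < c)
    (h : ∀ x : ι → ℝ, c * ∑ i, x i ^ 2 ≤ qForm C x) (R : ℝ) (x y : ι → ℝ)
    (hx : ∀ i, |x i| ≤ R) :
    gaussM C (fun i => x i + y i) ≤ Real.exp (Real.pi * c * ∑ _i : ι, R ^ 2) *
      Real.exp (-(Real.pi * c / 2) * ∑ i, y i ^ 2) := by
  rw [← Real.exp_add, gaussM, Real.exp_le_exp]
  have h1 := h (fun i => x i + y i)
  have h2 : ∑ i, y i ^ 2 ≤ 2 * ∑ i, (x i + y i) ^ 2 + 2 * ∑ _i : ι, R ^ 2 := by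
    rw [Finset.mul_sum, Finset.mul_sum, ← Finset.sum_add_distrib]
    refine Finset.sum_le_sum fun i _ => ?_
    have h3 : x i ^ 2 ≤ R ^ 2 := by
      rw [← sq_abs]; exact pow_le_pow_left₀ (abs_nonneg _) (hx i) 2
    nlinarith [sq_nonneg (x i + y i + x i)]
  have hp : 0 < Real.pi * c := by positivity
  have h4 := mul_le_mul_of_nonneg_left h1 Real.pi_pos.le
  have h5 := mul_le_mul_of_nonneg_left h2 hp.le
  linarith

lemma summable_gaussM_bound [DecidableEq ι] {C : Matrix ι ι ℝ} (hC : C.det ≠ 0) (R : ℝ) :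
    ∃ u : (ι → ℤ) → ℝ, Summable u ∧ ∀ m (x : ι → ℝ), (∀ i, |x i| ≤ R) →
      gaussM C (fun i => x i + m i) ≤ u m := by
  obtain ⟨c, hc, h⟩ := exists_le_qForm hC
  have h0 : 0 < Real.pi * c / 2 := by positivity
  exact ⟨_, (summable_exp_neg_mul_sum_sq h0).mul_left (Real.exp (Real.pi * c * ∑ _i : ι, R ^ 2)),
    fun m x hx => gaussM_shift_le hc h R x (fun i => m i) hx⟩

lemma gaussM_summable [DecidableEq ι] {C : Matrix ι ι ℝ} (hC : C.det ≠ 0) (x : ι → ℝ) :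
    Summable fun m : ι → ℤ => gaussM C (fun i => x i + m i) := by
  obtain ⟨u, hu, h⟩ := summable_gaussM_bound hC (∑ i, |x i|)
  exact Summable.of_nonneg_of_le (fun _ => Real.exp_nonneg _) (fun m => h m x fun i =>
    Finset.single_le_sum (f := fun i => |x i|) (fun _ _ => abs_nonneg _) (Finset.mem_univ i)) hu

lemma continuous_tsum_gaussM [DecidableEq ι] {C : Matrix ι ι ℝ} (hC : C.det ≠ 0) :
    Continuous fun x : ι → ℝ => ∑' m : ι → ℤ, gaussM C (fun i => x i + m i) := by
  rw [continuous_iff_continuousAt]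
  intro x
  obtain ⟨u, hu, h⟩ := summable_gaussM_bound hC (‖x‖ + 1)
  have : ContinuousOn (fun x : ι → ℝ => ∑' m : ι → ℤ, gaussM C (fun i => x i + m i))
      (Metric.ball 0 (‖x‖ + 1)) := by
    refine continuousOn_tsum (u := u) (fun m => ?_) hu (fun m y hy => ?_)
    · exact ((continuous_gaussM C).comp (by fun_prop)).continuousOn
    · rw [Real.norm_eq_abs, gaussM, abs_of_pos (Real.exp_pos _), ← gaussM]
      refine h m y fun i => ?_
      have h1 : ‖y‖ < ‖x‖ + 1 := by simpa using hy
      exact (norm_le_pi_norm y i).trans h1.le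
  exact this.continuousAt (Metric.isOpen_ball.mem_nhds (by simp))

lemma integral_comp_mulVec [DecidableEq ι] {C : Matrix ι ι ℝ} (hC : C.det ≠ 0)
    (g : (ι → ℝ) → ℂ) (hg : Continuous g) :
    ∫ x, g (C.mulVec x) = ((|C.det|⁻¹ : ℝ) : ℂ) * ∫ x, g x := by
  have h := Real.map_matrix_volume_pi_eq_smul_volume_pi hC
  have hm : Measurable (Matrix.toLin' C) :=
    (LinearMap.continuous_of_finiteDimensional _).measurable
  have h2 := integral_map (μ := (volume : Measure (ι → ℝ))) hm.aemeasurable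
    (f := g) hg.aestronglyMeasurable
  rw [h, integral_smul_measure] at h2
  rw [ENNReal.toReal_ofReal (abs_nonneg _), abs_inv] at h2
  simp only [Matrix.toLin'_apply] at h2
  rw [← h2, Complex.real_smul]

lemma integrable_comp_mulVec [DecidableEq ι] {C : Matrix ι ι ℝ} (hC : C.det ≠ 0)
    {g : (ι → ℝ) → ℂ} (hg : Integrable g) : Integrable fun x => g (C.mulVec x) := by
  have h := Real.map_matrix_volume_pi_eq_smul_volume_pi hC
  have hm : Measurable (Matrix.toLin' C) :=
    (LinearMap.continuous_of_finiteDimensional _).measurable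
  have : Integrable g (Measure.map (Matrix.toLin' C) volume) := by
    rw [h]; exact hg.smul_measure ENNReal.ofReal_ne_top
  exact this.comp_measurable hm

lemma sum_mul_eq_transpose_inv [DecidableEq ι] {C : Matrix ι ι ℝ} (hC : C.det ≠ 0)
    (n x : ι → ℝ) :
    ∑ i, n i * x i = ∑ i, (C⁻¹.transpose.mulVec n) i * C.mulVec x i := by
  change n ⬝ᵥ x = (C⁻¹.transpose.mulVec n) ⬝ᵥ C.mulVec x
  rw [Matrix.mulVec_transpose, ← Matrix.dotProduct_mulVec, Matrix.mulVec_mulVec,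
    Matrix.nonsing_inv_mul _ (isUnit_iff_ne_zero.mpr hC), Matrix.one_mulVec]

lemma gaussM_character_eq [DecidableEq ι] {C : Matrix ι ι ℝ} (hC : C.det ≠ 0)
    (n x : ι → ℝ) :
    cexp (-(2 * Real.pi * I * ∑ i, (n i : ℂ) * x i)) * (gaussM C x : ℂ) =
      cexp (-(Real.pi : ℂ) * ∑ i, ((C.mulVec x i : ℝ) : ℂ) ^ 2 +
        ∑ i, (-(2 * Real.pi * I * (C⁻¹.transpose.mulVec n i : ℝ))) * (C.mulVec x i : ℝ)) := by
  have h := sum_mul_eq_transpose_inv hC n x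
  have h' : ∑ i, (n i : ℂ) * x i =
      ∑ i, ((C⁻¹.transpose.mulVec n i : ℝ) : ℂ) * (C.mulVec x i : ℝ) := by exact_mod_cast h
  rw [gaussM, qForm, h']
  push_cast
  rw [← Complex.exp_add]
  congr 1
  rw [Finset.mul_sum, add_comm, ← Finset.sum_neg_distrib]
  congr 1
  exact Finset.sum_congr rfl fun i _ => by ring

lemma integral_gaussM_character [DecidableEq ι] {C : Matrix ι ι ℝ} (hC : C.det ≠ 0)
    (n : ι → ℝ) :
    ∫ x : ι → ℝ, cexp (-(2 * Real.pi * I * ∑ i, (n i : ℂ) * x i)) * (gaussM C x : ℂ) =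
      ((|C.det|⁻¹ * gaussM (C⁻¹.transpose) n : ℝ) : ℂ) := by
  simp_rw [gaussM_character_eq hC]
  rw [integral_comp_mulVec hC (fun v => cexp (-(Real.pi : ℂ) * ∑ i, (v i : ℂ) ^ 2 +
        ∑ i, (-(2 * Real.pi * I * (C⁻¹.transpose.mulVec n i : ℝ))) * (v i : ℝ)))
    (by fun_prop), GaussianFourier.integral_cexp_neg_mul_sum_add (by simpa using Real.pi_pos),
    div_self (by exact_mod_cast Real.pi_ne_zero), one_cpow, one_mul, gaussM, qForm]
  push_cast
  congr 2
  rw [Finset.mul_sum, Finset.sum_div]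
  refine Finset.sum_congr rfl fun i _ => ?_
  have : (Real.pi : ℂ) ≠ 0 := by exact_mod_cast Real.pi_ne_zero
  field_simp
  rw [I_sq]; ring

lemma integrable_gaussM_character [DecidableEq ι] {C : Matrix ι ι ℝ} (hC : C.det ≠ 0)
    (n : ι → ℝ) :
    Integrable fun x : ι → ℝ =>
      cexp (-(2 * Real.pi * I * ∑ i, (n i : ℂ) * x i)) * (gaussM C x : ℂ) := by
  simp_rw [gaussM_character_eq hC]
  exact integrable_comp_mulVec hC
    (GaussianFourier.integrable_cexp_neg_mul_sum_add (by simpa using Real.pi_pos) _)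

end Theta
end LimDist

namespace LimDist

section Poisson
variable {ι : Type*} [Fintype ι] [DecidableEq ι]

/-- The periodisation of `gaussM C`, as a complex function. -/
def gaussPer (C : Matrix ι ι ℝ) (x : ι → ℝ) : ℂ :=
  ((∑' m : ι → ℤ, gaussM C (fun i => x i + m i) : ℝ) : ℂ)

lemma gaussPer_add (C : Matrix ι ι ℝ) (x : ι → ℝ) (k : ι → ℤ) :
    gaussPer C (fun i => x i + k i) = gaussPer C x := by
  unfold gaussPer
  congr 1
  rw [← (Equiv.addLeft k).tsum_eq (fun m : ι → ℤ => gaussM C (fun i => x i + m i))]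
  refine tsum_congr fun m => ?_
  congr 1
  ext i
  simp [add_assoc]

lemma exists_torus_gaussPer {C : Matrix ι ι ℝ} (hC : C.det ≠ 0) :
    ∃ F : C(UnitAddTorus ι, ℂ), ∀ x : ι → ℝ, F (fun i => (x i : UnitAddCircle)) = gaussPer C x := by
  have hq : IsOpenQuotientMap (fun (x : ι → ℝ) (i : ι) => (x i : UnitAddCircle)) :=
    IsOpenQuotientMap.piMap (f := fun (_ : ι) (x : ℝ) => (x : UnitAddCircle))
      fun _ => QuotientAddGroup.isOpenQuotientMap_mk
  choose s hs using hq.surjective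
  have hF : ∀ x : ι → ℝ, gaussPer C (s (fun i => (x i : UnitAddCircle))) = gaussPer C x := by
    intro x
    have h1 := hs (fun i => (x i : UnitAddCircle))
    have h2 : ∀ i, ∃ k : ℤ, s (fun i => (x i : UnitAddCircle)) i = x i + k := fun i => by
      have h3 := congrFun h1 i
      dsimp only at h3
      rw [← sub_eq_zero, ← AddCircle.coe_sub, AddCircle.coe_eq_zero_iff] at h3
      obtain ⟨k, hk⟩ := h3
      refine ⟨k, ?_⟩
      simp only [zsmul_eq_mul, mul_one] at hk
      linarith
    choose k hk using h2
    have h5 : s (fun i => (x i : UnitAddCircle)) = fun i => x i + k i := funext hk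
    rw [h5, gaussPer_add]
  refine ⟨⟨fun t => gaussPer C (s t), ?_⟩, fun x => hF x⟩
  rw [hq.isQuotientMap.continuous_iff]
  have : (fun t => gaussPer C (s t)) ∘ (fun (x : ι → ℝ) (i : ι) => (x i : UnitAddCircle)) =
      gaussPer C := funext hF
  rw [this]
  exact continuous_ofReal.comp (continuous_tsum_gaussM hC)

/-- The half-open unit cube with corner `m`. -/
def unitCube (m : ι → ℤ) : Set (ι → ℝ) := {x | ∀ i, x i ∈ Set.Ioc (m i : ℝ) (m i + 1)}

lemma measurableSet_unitCube (m : ι → ℤ) : MeasurableSet (unitCube m) := by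
  have : unitCube m = Set.univ.pi fun i => Set.Ioc (m i : ℝ) (m i + 1) := by
    ext x; simp [unitCube]
  rw [this]
  exact MeasurableSet.univ_pi fun _ => measurableSet_Ioc

lemma iUnion_unitCube : ⋃ m : ι → ℤ, unitCube m = Set.univ := by
  ext x
  simp only [Set.mem_iUnion, Set.mem_univ, iff_true]
  refine ⟨fun i => ⌈x i⌉ - 1, fun i => ⟨?_, ?_⟩⟩
  · push_cast; linarith [Int.ceil_lt_add_one (x i)]
  · push_cast; linarith [Int.le_ceil (x i)]

lemma pairwise_disjoint_unitCube :
    Pairwise (Function.onFun Disjoint (unitCube : (ι → ℤ) → Set (ι → ℝ))) := by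
  intro m k hmk
  rw [Function.onFun, Set.disjoint_left]
  intro x hx hy
  apply hmk
  ext i
  have h1 := hx i
  have h2 := hy i
  have h3 : (m i : ℝ) < k i + 1 := h1.1.trans_le h2.2
  have h4 : (k i : ℝ) < m i + 1 := h2.1.trans_le h1.2
  have h5 : m i < k i + 1 := by exact_mod_cast h3
  have h6 : k i < m i + 1 := by exact_mod_cast h4
  omega

lemma mFourier_neg_coe (n : ι → ℤ) (x : ι → ℝ) :
    UnitAddTorus.mFourier (-n) (fun i => (x i : UnitAddCircle)) =
      cexp (-(2 * Real.pi * I * ∑ i, ((n i : ℝ) : ℂ) * x i)) := by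
  simp only [UnitAddTorus.mFourier, ContinuousMap.coe_mk, fourier_coe_apply, Pi.neg_apply]
  rw [← Complex.exp_sum, Finset.mul_sum, ← Finset.sum_neg_distrib]
  congr 1
  refine Finset.sum_congr rfl fun i _ => ?_
  push_cast
  ring

lemma character_shift (n : ι → ℤ) (m : ι → ℤ) (x : ι → ℝ) :
    cexp (-(2 * Real.pi * I * ∑ i, ((n i : ℝ) : ℂ) * ((x i + m i : ℝ) : ℂ))) =
      cexp (-(2 * Real.pi * I * ∑ i, ((n i : ℝ) : ℂ) * x i)) := by
  rw [Complex.exp_eq_exp_iff_exists_int]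
  refine ⟨-∑ i, n i * m i, ?_⟩
  push_cast
  simp only [mul_add, Finset.sum_add_distrib]
  ring

lemma integral_unitCube_shift (m : ι → ℤ) (g : (ι → ℝ) → ℂ) :
    ∫ x in unitCube (0 : ι → ℤ), g (fun i => x i + m i) = ∫ x in unitCube m, g x := by
  have h := (measurePreserving_add_right (volume : Measure (ι → ℝ)) (fun i => (m i : ℝ)))
  have h2 := h.setIntegral_preimage_emb (measurableEmbedding_addRight _) g (unitCube m)
  rw [← h2]
  congr 1
  congr 1
  ext x
  simp only [unitCube, Set.mem_setOf_eq, Set.mem_preimage, Pi.add_apply, Set.mem_Ioc, Pi.zero_apply]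
  refine forall_congr' fun i => ?_
  push_cast
  constructor <;> rintro ⟨a, b⟩ <;> constructor <;> linarith

lemma norm_character (n : ι → ℤ) (x : ι → ℝ) :
    ‖cexp (-(2 * Real.pi * I * ∑ i, ((n i : ℝ) : ℂ) * x i))‖ = 1 := by
  have : -(2 * Real.pi * I * ∑ i, ((n i : ℝ) : ℂ) * x i) =
      ((-(2 * Real.pi * ∑ i, (n i : ℝ) * x i) : ℝ) : ℂ) * I := by
    push_cast; ring
  rw [this, Complex.norm_exp_ofReal_mul_I]

lemma mFourierCoeff_gaussPer {C : Matrix ι ι ℝ} (hC : C.det ≠ 0) {F : C(UnitAddTorus ι, ℂ)}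
    (hF : ∀ x : ι → ℝ, F (fun i => (x i : UnitAddCircle)) = gaussPer C x) (n : ι → ℤ) :
    UnitAddTorus.mFourierCoeff F n =
      ((|C.det|⁻¹ * gaussM (C⁻¹.transpose) (fun i => n i) : ℝ) : ℂ) := by
  rw [UnitAddTorus.mFourierCoeff_eq_integral F n (fun _ => 0),
    ← integral_gaussM_character hC]
  set g : (ι → ℝ) → ℂ := fun x =>
    cexp (-(2 * Real.pi * I * ∑ i, ((n i : ℝ) : ℂ) * x i)) * (gaussM C x : ℂ) with hg
  have hgi : Integrable g := integrable_gaussM_character hC _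
  have h1 := hasSum_integral_iUnion (f := g) (μ := volume) measurableSet_unitCube
    pairwise_disjoint_unitCube (by rw [iUnion_unitCube]; exact hgi.integrableOn)
  rw [iUnion_unitCube, Measure.restrict_univ] at h1
  rw [← h1.tsum_eq]
  have hset : {x : ι → ℝ | ∀ i, x i ∈ Set.Ioc (0 : ℝ) (0 + 1)} = unitCube 0 := by
    ext; simp [unitCube]
  rw [hset]
  have hptw : ∀ x : ι → ℝ, UnitAddTorus.mFourier (-n) (fun i => (x i : UnitAddCircle)) •
      F (fun i => (x i : UnitAddCircle)) = ∑' m : ι → ℤ, g (fun i => x i + m i) := fun x => by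
    rw [hF, mFourier_neg_coe, gaussPer, ofReal_tsum, smul_eq_mul, ← tsum_mul_left]
    exact tsum_congr fun m => by rw [hg]; dsimp only; rw [character_shift]
  simp_rw [hptw]
  obtain ⟨u, hu, hb⟩ := summable_gaussM_bound hC 1
  have hvol : volume (unitCube (0 : ι → ℤ)) ≠ ⊤ := by
    rw [← hset]
    have : {x : ι → ℝ | ∀ i, x i ∈ Set.Ioc (0 : ℝ) (0 + 1)} =
      Set.univ.pi fun _ => Set.Ioc (0:ℝ) (0 + 1) := by ext x; simp
    rw [this, Real.volume_pi_Ioc]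
    exact ENNReal.prod_ne_top fun _ _ => ENNReal.ofReal_ne_top
  have hcont : ∀ m : ι → ℤ, Continuous fun x : ι → ℝ => g (fun i => x i + m i) := fun m => by
    have := continuous_gaussM C
    have hgc : Continuous g := by rw [hg]; fun_prop
    exact hgc.comp (by fun_prop)
  have hbd : ∀ m : ι → ℤ, ∀ x ∈ unitCube (0 : ι → ℤ), ‖g (fun i => x i + m i)‖ ≤ u m := by
    intro m x hx
    rw [hg]; dsimp only
    rw [norm_mul, character_shift, norm_character, one_mul, Complex.norm_real, Real.norm_eq_abs,
      gaussM, abs_of_pos (Real.exp_pos _), ← gaussM]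
    refine hb m x fun i => ?_
    have := hx i
    simp only [Pi.zero_apply, Int.cast_zero, zero_add, Set.mem_Ioc] at this
    rw [abs_of_pos this.1]; exact this.2
  have hintg : ∀ m : ι → ℤ, IntegrableOn (fun x : ι → ℝ => g (fun i => x i + m i))
      (unitCube (0 : ι → ℤ)) := fun m =>
    Measure.integrableOn_of_bounded hvol (hcont m).aestronglyMeasurable (M := u m)
      ((ae_restrict_iff' (measurableSet_unitCube _)).mpr (ae_of_all _ (hbd m)))
  rw [← (hasSum_integral_of_summable_integral_norm hintg ?_).tsum_eq]
  · exact tsum_congr fun m => integral_unitCube_shift m g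
  · refine Summable.of_nonneg_of_le (fun m => integral_nonneg fun _ => norm_nonneg _) (fun m => ?_)
      (hu.mul_right (volume.real (unitCube (0 : ι → ℤ))))
    have h7 := norm_setIntegral_le_of_norm_le_const (μ := volume)
      (f := fun x : ι → ℝ => ‖g (fun i => x i + m i)‖)
      (s := unitCube 0) (C := u m) hvol.lt_top (fun x hx => by
        rw [norm_norm]; exact hbd m x hx)
    exact (Real.le_norm_self _).trans h7

lemma det_transpose_inv_ne_zero {C : Matrix ι ι ℝ} (hC : C.det ≠ 0) :
    (C⁻¹.transpose).det ≠ 0 := by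
  rw [Matrix.det_transpose, Matrix.det_nonsing_inv]
  simpa using hC

lemma gaussM_summable_zero {C : Matrix ι ι ℝ} (hC : C.det ≠ 0) :
    Summable fun m : ι → ℤ => gaussM C (fun i => (m i : ℝ)) := by
  simpa using gaussM_summable hC 0

/-- Inversion formula for the theta series of the lattice `C ℤ^ι`. -/
lemma theta_inversion {C : Matrix ι ι ℝ} (hC : C.det ≠ 0) :
    ∑' m : ι → ℤ, gaussM C (fun i => (m i : ℝ)) =
      |C.det|⁻¹ * ∑' n : ι → ℤ, gaussM (C⁻¹.transpose) (fun i => (n i : ℝ)) := by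
  obtain ⟨F, hF⟩ := exists_torus_gaussPer hC
  have hc := mFourierCoeff_gaussPer hC hF
  have hs : Summable (UnitAddTorus.mFourierCoeff F) := by
    rw [funext hc, Complex.summable_ofReal]
    exact (gaussM_summable_zero (det_transpose_inv_ne_zero hC)).mul_left _
  have h := UnitAddTorus.hasSum_mFourier_series_apply_of_summable hs
    (fun i => ((0 : ℝ) : UnitAddCircle))
  have h0 := hF 0
  simp only [Pi.zero_apply] at h0
  rw [h0] at h
  have h1 : ∀ n : ι → ℤ, UnitAddTorus.mFourier n (fun _ => ((0 : ℝ) : UnitAddCircle)) = 1 := by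
    intro n
    simp [UnitAddTorus.mFourier]
  simp only [hc, h1, smul_eq_mul, mul_one] at h
  have h2 := h.tsum_eq
  rw [← ofReal_tsum, tsum_mul_left, gaussPer] at h2
  simp only [Pi.zero_apply, zero_add] at h2
  exact_mod_cast h2.symm

end Poisson
end LimDist

namespace LimDist

section Hartley
variable {K : Type} [Field K] [NumberField K]

/-- The matrix `√y_σ (Re σ(b_i) + Im σ(b_i))` attached to a family `b` of elements of `K`. -/
def hartM (y : (K →+* ℂ) → ℝ) (b : (K →+* ℂ) → K) : Matrix (K →+* ℂ) (K →+* ℂ) ℝ :=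
  Matrix.of fun σ i => √(y σ) * ((σ (b i)).re + (σ (b i)).im)

/-- The matrix `√y_σ⁻¹ (Re σ(b_i) - Im σ(b_i))` attached to a family `b` of elements of `K`. -/
def hartM' (y : (K →+* ℂ) → ℝ) (b : (K →+* ℂ) → K) : Matrix (K →+* ℂ) (K →+* ℂ) ℝ :=
  Matrix.of fun σ i => √((y σ)⁻¹) * ((σ (b i)).re - (σ (b i)).im)

/-- The positive definite form `Σ_σ y_σ |σ(x)|²`. -/
def embForm (y : (K →+* ℂ) → ℝ) (x : K) : ℝ := ∑ σ : K →+* ℂ, y σ * ‖σ x‖ ^ 2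

/-- Invariance of a weight on embeddings under complex conjugation. -/
def ConjInv (y : (K →+* ℂ) → ℝ) : Prop := ∀ σ, y (ComplexEmbedding.conjugate σ) = y σ

lemma sum_conj_eq_zero (f : (K →+* ℂ) → ℝ)
    (hf : ∀ σ, f (ComplexEmbedding.conjugate σ) = -f σ) : ∑ σ : K →+* ℂ, f σ = 0 := by
  have h := (ComplexEmbedding.involutive_conjugate K).toPerm.sum_comp Finset.univ f (by simp)
  simp only [Function.Involutive.coe_toPerm, hf, Finset.sum_neg_distrib] at h
  linarith

lemma sum_re_im_sq (y : (K →+* ℂ) → ℝ) (hy : ConjInv y) (x : K) :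
    ∑ σ : K →+* ℂ, y σ * ((σ x).re + (σ x).im) ^ 2 = embForm y x := by
  have h := sum_conj_eq_zero (fun σ : K →+* ℂ => y σ * (2 * (σ x).re * (σ x).im)) fun σ => by
    rw [hy]; simp
  rw [← sub_eq_zero, ← h, embForm, ← Finset.sum_sub_distrib]
  refine Finset.sum_congr rfl fun σ _ => ?_
  rw [Complex.sq_norm, Complex.normSq_apply]; ring

lemma sum_re_im_sq' (y : (K →+* ℂ) → ℝ) (hy : ConjInv y) (x : K) :
    ∑ σ : K →+* ℂ, y σ * ((σ x).re - (σ x).im) ^ 2 = embForm y x := by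
  have h := sum_conj_eq_zero (fun σ : K →+* ℂ => -(y σ * (2 * (σ x).re * (σ x).im))) fun σ => by
    rw [hy]; simp
  rw [← sub_eq_zero, ← h, embForm, ← Finset.sum_sub_distrib]
  refine Finset.sum_congr rfl fun σ _ => ?_
  rw [Complex.sq_norm, Complex.normSq_apply]; ring

lemma qForm_hartM (y : (K →+* ℂ) → ℝ) (hy : ConjInv y) (hpos : ∀ σ, 0 < y σ)
    (b : (K →+* ℂ) → K) (m : (K →+* ℂ) → ℤ) :
    qForm (hartM y b) (fun i => (m i : ℝ)) = embForm y (∑ i, m i • b i) := by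
  rw [← sum_re_im_sq y hy, qForm]
  refine Finset.sum_congr rfl fun σ _ => ?_
  have : (hartM y b).mulVec (fun i => (m i : ℝ)) σ =
      √(y σ) * ((σ (∑ i, m i • b i)).re + (σ (∑ i, m i • b i)).im) := by
    simp only [hartM, Matrix.mulVec, dotProduct, Matrix.of_apply, map_sum, map_zsmul,
      Complex.re_sum, Complex.im_sum, ← Finset.sum_add_distrib, Finset.mul_sum]
    refine Finset.sum_congr rfl fun i _ => ?_
    simp; ring
  rw [this, mul_pow, Real.sq_sqrt (hpos σ).le]

lemma qForm_hartM' (y : (K →+* ℂ) → ℝ) (hy : ConjInv y) (hpos : ∀ σ, 0 < y σ)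
    (b : (K →+* ℂ) → K) (m : (K →+* ℂ) → ℤ) :
    qForm (hartM' y b) (fun i => (m i : ℝ)) = embForm (fun σ => (y σ)⁻¹) (∑ i, m i • b i) := by
  rw [← sum_re_im_sq' _ (fun σ => by rw [hy]), qForm]
  refine Finset.sum_congr rfl fun σ _ => ?_
  have : (hartM' y b).mulVec (fun i => (m i : ℝ)) σ =
      √((y σ)⁻¹) * ((σ (∑ i, m i • b i)).re - (σ (∑ i, m i • b i)).im) := by
    simp only [hartM', Matrix.mulVec, dotProduct, Matrix.of_apply, map_sum, map_zsmul,
      Complex.re_sum, Complex.im_sum, ← Finset.sum_sub_distrib, Finset.mul_sum]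
    refine Finset.sum_congr rfl fun i _ => ?_
    simp; ring
  rw [this, mul_pow, Real.sq_sqrt (inv_pos.mpr (hpos σ)).le]

lemma hartM_transpose_mul (y : (K →+* ℂ) → ℝ) (hpos : ∀ σ, 0 < y σ)
    (b b' : (K →+* ℂ) → K)
    (hb : ∀ i j, Algebra.trace ℚ K (b i * b' j) = if i = j then 1 else 0) :
    (hartM y b).transpose * hartM' y b' = 1 := by
  ext i j
  rw [Matrix.mul_apply]
  have h1 : ∑ σ : K →+* ℂ, σ (b i * b' j) = if i = j then 1 else 0 := by
    have := trace_eq_sum_embeddings (K := ℚ) (L := K) ℂ (x := b i * b' j)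
    rw [hb] at this
    rw [← (RingHom.equivRatAlgHom K ℂ).symm.sum_comp]
    simp only [RingHom.equivRatAlgHom] at *
    rw [show (if i = j then (1:ℂ) else 0) = algebraMap ℚ ℂ (if i = j then 1 else 0) by
      split_ifs <;> simp, this]
    rfl
  have h2 := sum_conj_eq_zero (fun σ : K →+* ℂ =>
    (σ (b i)).im * (σ (b' j)).re - (σ (b i)).re * (σ (b' j)).im) fun σ => by simp; ring
  have h3 := congrArg Complex.re h1
  simp only [map_mul, Complex.re_sum, Complex.mul_re] at h3
  have h4 : (1 : Matrix (K →+* ℂ) (K →+* ℂ) ℝ) i j = if i = j then 1 else 0 := Matrix.one_apply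
  rw [h4, show (if i = j then (1:ℝ) else 0) = (if i = j then (1:ℂ) else 0).re by
    split_ifs <;> simp, ← h3, ← sub_eq_zero, ← h2, ← Finset.sum_sub_distrib]
  refine Finset.sum_congr rfl fun σ _ => ?_
  simp only [hartM, hartM', Matrix.transpose_apply, Matrix.of_apply]
  rw [Real.sqrt_inv]
  have : √(y σ) ≠ 0 := (Real.sqrt_pos.mpr (hpos σ)).ne'
  field_simp
  ring

lemma det_hartM (y : (K →+* ℂ) → ℝ) (b : (K →+* ℂ) → K) :
    (hartM y b).det = (∏ σ, √(y σ)) * (hartM (fun _ => 1) b).det := by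
  rw [← Matrix.det_diagonal, ← Matrix.det_mul]
  congr 1
  ext σ i
  simp [hartM, Matrix.diagonal_mul]

lemma hartM_basis_change (b : Module.Basis (K →+* ℂ) ℚ K) (b' : (K →+* ℂ) → K) :
    (hartM (fun _ => 1) b').det = (hartM (fun _ => 1) b).det * ((b.det b' : ℚ) : ℝ) := by
  have : ((b.det b' : ℚ) : ℝ) = ((b.toMatrix b').map (algebraMap ℚ ℝ)).det := by
    rw [Module.Basis.det_apply, ← RingHom.mapMatrix_apply, ← RingHom.map_det]; rfl
  rw [this, ← Matrix.det_mul]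
  congr 1
  ext σ i
  rw [Matrix.mul_apply]
  simp only [hartM, Matrix.of_apply, Real.sqrt_one, one_mul, Matrix.map_apply]
  have h : σ (b' i) = ∑ j, ((b.toMatrix b' j i : ℚ) : ℂ) * σ (b j) := by
    conv_lhs => rw [← b.sum_repr (b' i)]
    rw [map_sum]
    refine Finset.sum_congr rfl fun j _ => ?_
    rw [Algebra.smul_def, map_mul, Module.Basis.toMatrix_apply, eq_ratCast, map_ratCast]
  rw [h, Complex.re_sum, Complex.im_sum, ← Finset.sum_add_distrib]
  refine Finset.sum_congr rfl fun j _ => ?_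
  simp
  ring

end Hartley
end LimDist

namespace LimDist
open scoped nonZeroDivisors

section IdealTheta
variable {K : Type} [Field K] [NumberField K]

/-- Theta series of a fractional ideal. -/
def thetaJ (J : FractionalIdeal (𝓞 K)⁰ K) (y : (K →+* ℂ) → ℝ) : ℝ :=
  ∑' α : {x : K // x ∈ J}, Real.exp (-Real.pi * embForm y α.1)

variable (K) in
/-- A `ℚ`-basis of `K` made of an integral basis, indexed by embeddings. -/
def embBasis : Module.Basis (K →+* ℂ) ℚ K := (integralBasis K).reindex (equivReindex K).symm

variable (K) in
/-- The covolume constant. -/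
def covolK : ℝ := |(hartM (fun _ => 1) (embBasis K)).det|

lemma trace_mul_traceDual (b : Module.Basis (K →+* ℂ) ℚ K) (i j : K →+* ℂ) :
    Algebra.trace ℚ K (b i * b.traceDual j) = if i = j then 1 else 0 := by
  rw [mul_comm, Module.Basis.trace_traceDual_mul]

lemma hartM_det_ne_zero (y : (K →+* ℂ) → ℝ) (hpos : ∀ σ, 0 < y σ)
    (b : Module.Basis (K →+* ℂ) ℚ K) : (hartM y b).det ≠ 0 := by
  have h := congrArg Matrix.det (hartM_transpose_mul y hpos b b.traceDual (trace_mul_traceDual b))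
  rw [Matrix.det_mul, Matrix.det_transpose, Matrix.det_one] at h
  exact left_ne_zero_of_mul_eq_one h

lemma hartM_inv_transpose (y : (K →+* ℂ) → ℝ) (hpos : ∀ σ, 0 < y σ)
    (b : Module.Basis (K →+* ℂ) ℚ K) :
    (hartM y b)⁻¹.transpose = hartM' y b.traceDual := by
  have h := hartM_transpose_mul y hpos b b.traceDual (trace_mul_traceDual b)
  rw [Matrix.transpose_nonsing_inv]
  exact Matrix.inv_eq_right_inv h

lemma covolK_pos : 0 < covolK K :=
  abs_pos.mpr (hartM_det_ne_zero _ (fun _ => one_pos) _)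

/-- Parametrisation of a lattice in `K` by integer vectors. -/
lemma exists_equiv_of_span (b : Module.Basis (K →+* ℂ) ℚ K) (J : FractionalIdeal (𝓞 K)⁰ K)
    (hJ : ∀ x, x ∈ Submodule.span ℤ (Set.range b) ↔ x ∈ J) :
    ∃ e : ((K →+* ℂ) → ℤ) ≃ {x : K // x ∈ J}, ∀ m, (e m).1 = ∑ i, m i • b i := by
  have hmem : ∀ m : (K →+* ℂ) → ℤ, ∑ i, m i • b i ∈ J := fun m => by
    rw [← hJ]
    exact Submodule.sum_mem _ fun i _ =>
      Submodule.smul_mem _ _ (Submodule.subset_span (Set.mem_range_self i))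
  refine ⟨Equiv.ofBijective (fun m => ⟨∑ i, m i • b i, hmem m⟩) ⟨?_, ?_⟩, fun m => rfl⟩
  · intro m m' h
    have h1 : ∑ i, m i • b i = ∑ i, m' i • b i := congrArg Subtype.val h
    ext i
    have h2 := congrArg (fun x => b.repr x i) h1
    have h3 : ∀ m : (K →+* ℂ) → ℤ, b.repr (∑ i, m i • b i) i = m i := fun m => by
      have : ∑ i, m i • b i = ∑ i, (m i : ℚ) • b i :=
        Finset.sum_congr rfl fun i _ => (Int.cast_smul_eq_zsmul ℚ (m i) (b i)).symm
      rw [this, Module.Basis.repr_sum_self]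
    simp only [h3] at h2
    exact_mod_cast h2
  · rintro ⟨x, hx⟩
    rw [← hJ, Submodule.mem_span_range_iff_exists_fun] at hx
    obtain ⟨c, hc⟩ := hx
    exact ⟨c, Subtype.ext hc⟩

/-- A `ℚ`-basis of `K` which is a `ℤ`-basis of `J`, together with its covolume. -/
lemma exists_basis_ideal (J : (FractionalIdeal (𝓞 K)⁰ K)ˣ) :
    ∃ b : Module.Basis (K →+* ℂ) ℚ K,
      (∀ x, x ∈ Submodule.span ℤ (Set.range b) ↔ x ∈ J.1) ∧
      |(hartM (fun _ => 1) b).det| = covolK K * (FractionalIdeal.absNorm J.1 : ℝ) := by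
  have hcard : Fintype.card (Module.Free.ChooseBasisIndex ℤ (𝓞 K)) =
      Fintype.card (Module.Free.ChooseBasisIndex ℤ J) := by
    rw [← Module.finrank_eq_card_chooseBasisIndex, ← Module.finrank_eq_card_chooseBasisIndex,
      fractionalIdeal_rank]
  have e := Fintype.equivOfCardEq hcard
  have h := det_basisOfFractionalIdeal_eq_absNorm K J e
  set b := ((basisOfFractionalIdeal K J).reindex e.symm).reindex (equivReindex K).symm with hb
  refine ⟨b, fun x => ?_, ?_⟩
  · rw [hb, Module.Basis.range_reindex, Module.Basis.range_reindex,
      mem_span_basisOfFractionalIdeal]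
    rfl
  · rw [hartM_basis_change (embBasis K), abs_mul, ← covolK, ← Rat.cast_abs]
    congr 2
    rw [← h]
    congr 1
    rw [embBasis, Module.Basis.det_reindex]
    congr 1
    ext i
    simp [hb]

lemma summable_thetaJ_of_basis (b : Module.Basis (K →+* ℂ) ℚ K) (J : FractionalIdeal (𝓞 K)⁰ K)
    (hJ : ∀ x, x ∈ Submodule.span ℤ (Set.range b) ↔ x ∈ J) (y : (K →+* ℂ) → ℝ)
    (hy : ConjInv y) (hpos : ∀ σ, 0 < y σ) :
    Summable fun α : {x : K // x ∈ J} => Real.exp (-Real.pi * embForm y α.1) := by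
  obtain ⟨e, he⟩ := exists_equiv_of_span b J hJ
  rw [← e.summable_iff]
  refine (gaussM_summable_zero (hartM_det_ne_zero y hpos b)).congr fun m => ?_
  rw [Function.comp_apply, he, gaussM, qForm_hartM y hy hpos]

lemma summable_thetaJ (J : (FractionalIdeal (𝓞 K)⁰ K)ˣ) (y : (K →+* ℂ) → ℝ)
    (hy : ConjInv y) (hpos : ∀ σ, 0 < y σ) :
    Summable fun α : {x : K // x ∈ J.1} => Real.exp (-Real.pi * embForm y α.1) := by
  obtain ⟨b, hb, -⟩ := exists_basis_ideal J
  exact summable_thetaJ_of_basis b J.1 hb y hy hpos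

/-- Inversion formula for the theta series of a fractional ideal. -/
lemma thetaJ_inversion (J J' : (FractionalIdeal (𝓞 K)⁰ K)ˣ)
    (hJ' : J'.1 = FractionalIdeal.dual ℤ ℚ J.1) (y : (K →+* ℂ) → ℝ)
    (hy : ConjInv y) (hpos : ∀ σ, 0 < y σ) :
    thetaJ J.1 y = ((∏ σ, √(y σ)) * (covolK K * (FractionalIdeal.absNorm J.1 : ℝ)))⁻¹ *
      thetaJ J'.1 (fun σ => (y σ)⁻¹) := by
  obtain ⟨b, hb, hdet⟩ := exists_basis_ideal J
  have hspan : ∀ x, x ∈ Submodule.span ℤ (Set.range b.traceDual) ↔ x ∈ J'.1 := fun x => by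
    have h := Submodule.traceDual_span_of_basis (A := ℤ) (K := ℚ) (J.1 : Submodule (𝓞 K) K) b (by
      ext z
      rw [hb, Submodule.restrictScalars_mem]; rfl)
    rw [← h, Submodule.restrictScalars_mem, hJ', ← FractionalIdeal.coe_dual ℤ ℚ J.ne_zero]
    rfl
  obtain ⟨e, he⟩ := exists_equiv_of_span b J.1 hb
  obtain ⟨e', he'⟩ := exists_equiv_of_span b.traceDual J'.1 hspan
  have hth := theta_inversion (hartM_det_ne_zero y hpos b)
  rw [thetaJ, thetaJ, ← e.tsum_eq, ← e'.tsum_eq]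
  rw [hartM_inv_transpose y hpos, det_hartM, abs_mul, hdet,
    abs_of_nonneg (Finset.prod_nonneg fun _ _ => Real.sqrt_nonneg _)] at hth
  simp_rw [gaussM, qForm_hartM y hy hpos, qForm_hartM' y hy hpos] at hth
  simp_rw [he, he']
  exact hth

end IdealTheta
end LimDist

namespace LimDist
open scoped nonZeroDivisors
open NumberField.Units NumberField.Units.dirichletUnitTheorem NumberField.InfinitePlace

section Weights
variable {K : Type} [Field K] [NumberField K]

/-- The trace-zero exponents attached to a point of the logarithmic space. -/
def xw (z : logSpace K) (w : InfinitePlace K) : ℝ :=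
  2 / (mult w : ℝ) * (if h : w = w₀ then -∑ v, z v else z ⟨w, h⟩)

lemma xw_add (z z' : logSpace K) (w : InfinitePlace K) : xw (z + z') w = xw z w + xw z' w := by
  unfold xw
  split_ifs
  · simp only [Pi.add_apply, Finset.sum_add_distrib]; ring
  · simp only [Pi.add_apply]; ring

lemma xw_neg (z : logSpace K) (w : InfinitePlace K) : xw (-z) w = -xw z w := by
  unfold xw
  split_ifs
  · simp only [Pi.neg_apply, Finset.sum_neg_distrib]; ring
  · simp only [Pi.neg_apply]; ring

lemma xw_smul (c : ℝ) (z : logSpace K) (w : InfinitePlace K) : xw (c • z) w = c * xw z w := by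
  unfold xw
  split_ifs
  · simp only [Pi.smul_apply, smul_eq_mul, ← Finset.mul_sum]; ring
  · simp only [Pi.smul_apply, smul_eq_mul]; ring

lemma continuous_xw (w : InfinitePlace K) : Continuous fun z : logSpace K => xw z w := by
  unfold xw
  split_ifs
  · fun_prop
  · fun_prop

lemma mult_pos' (w : InfinitePlace K) : (0 : ℝ) < mult w := by exact_mod_cast mult_pos

lemma sum_mult_xw (z : logSpace K) : ∑ w : InfinitePlace K, (mult w : ℝ) * xw z w = 0 := by
  rw [Fintype.sum_eq_add_sum_subtype_ne _ (w₀ : InfinitePlace K)]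
  have h : ∀ w : {w : InfinitePlace K // w ≠ w₀}, (mult w.1 : ℝ) * xw z w.1 = 2 * z w :=
    fun w => by
      rw [xw, dif_neg w.2]
      have := (mult_pos' w.1).ne'
      field_simp
  simp only [h, ← Finset.mul_sum]
  rw [xw, dif_pos rfl]
  have := (mult_pos' (w₀ : InfinitePlace K)).ne'
  field_simp
  ring

lemma xw_logEmbedding (u : (𝓞 K)ˣ) (w : InfinitePlace K) :
    xw (logEmbedding K (Additive.ofMul u)) w = 2 * Real.log (w (u : K)) := by
  have := (mult_pos' w).ne'
  unfold xw
  split_ifs with h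
  · subst h
    rw [sum_logEmbedding_component]
    field_simp
  · rw [logEmbedding_component]
    field_simp

lemma sum_emb_eq_sum_place (g : InfinitePlace K → ℝ) :
    ∑ σ : K →+* ℂ, g (InfinitePlace.mk σ) = ∑ w : InfinitePlace K, (mult w : ℝ) * g w := by
  rw [← Finset.sum_fiberwise_of_maps_to (t := Finset.univ) (g := InfinitePlace.mk)
    (fun _ _ => Finset.mem_univ _)]
  refine Finset.sum_congr rfl fun w _ => ?_
  rw [← InfinitePlace.card_filter_mk_eq w, ← nsmul_eq_mul, ← Finset.sum_const]
  refine Finset.sum_congr rfl fun σ hσ => ?_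
  rw [(Finset.mem_filter.mp hσ).2]

/-- The weight `t e^{x(z)}`. -/
def wt (t : ℝ) (z : logSpace K) (σ : K →+* ℂ) : ℝ := t * Real.exp (xw z (InfinitePlace.mk σ))

lemma wt_conj (t : ℝ) (z : logSpace K) : ConjInv (wt t z) := fun σ => by
  simp [wt]

lemma wt_pos {t : ℝ} (ht : 0 < t) (z : logSpace K) (σ : K →+* ℂ) : 0 < wt t z σ := by
  unfold wt; positivity

lemma wt_inv (t : ℝ) (z : logSpace K) : (fun σ => (wt t z σ)⁻¹) = wt t⁻¹ (-z) := by
  ext σ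
  rw [wt, wt, xw_neg, Real.exp_neg, mul_inv]

lemma prod_wt {t : ℝ} (ht : 0 < t) (z : logSpace K) :
    ∏ σ : K →+* ℂ, √(wt t z σ) = t ^ ((Module.finrank ℚ K : ℝ) / 2) := by
  have h1 : ∀ σ : K →+* ℂ, √(wt t z σ) =
      Real.exp ((Real.log t + xw z (InfinitePlace.mk σ)) / 2) := fun σ => by
    rw [wt, Real.exp_half, Real.exp_add, Real.exp_log ht]
  simp_rw [h1]
  rw [← Real.exp_sum, ← Finset.sum_div, Finset.sum_add_distrib,
    sum_emb_eq_sum_place (fun w => xw z w), sum_mult_xw, add_zero, Finset.sum_const,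
    Finset.card_univ, NumberField.Embeddings.card, Real.rpow_def_of_pos ht, nsmul_eq_mul]
  congr 1
  ring

lemma embForm_wt (t : ℝ) (z : logSpace K) (x : K) : embForm (wt t z) x =
    t * ∑ w : InfinitePlace K, (mult w : ℝ) * (Real.exp (xw z w) * w x ^ 2) := by
  rw [← sum_emb_eq_sum_place (fun w => Real.exp (xw z w) * w x ^ 2), embForm, Finset.mul_sum]
  refine Finset.sum_congr rfl fun σ _ => ?_
  rw [wt, InfinitePlace.apply]; ring

lemma embForm_wt_unit (t : ℝ) (z : logSpace K) (u : (𝓞 K)ˣ) (x : K) :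
    embForm (wt t (logEmbedding K (Additive.ofMul u) + z)) x =
      embForm (wt t z) ((u : K) * x) := by
  rw [embForm_wt, embForm_wt]
  congr 1
  refine Finset.sum_congr rfl fun w _ => ?_
  rw [xw_add, xw_logEmbedding, map_mul, Real.exp_add, mul_comm (2 : ℝ), Real.exp_mul,
    Real.exp_log (Units.pos_at_place u w)]
  norm_cast
  ring

/-- Multiplication by a unit on a fractional ideal. -/
def unitMulEquiv (J : FractionalIdeal (𝓞 K)⁰ K) (u : (𝓞 K)ˣ) :
    {x : K // x ∈ J} ≃ {x : K // x ∈ J} where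
  toFun x := ⟨(u : K) * x.1, by
    have := Submodule.smul_mem (J : Submodule (𝓞 K) K) (u : 𝓞 K) x.2
    rwa [Algebra.smul_def] at this⟩
  invFun x := ⟨((u⁻¹ : (𝓞 K)ˣ) : K) * x.1, by
    have := Submodule.smul_mem (J : Submodule (𝓞 K) K) ((u⁻¹ : (𝓞 K)ˣ) : 𝓞 K) x.2
    rwa [Algebra.smul_def] at this⟩
  left_inv x := by
    ext
    simp
  right_inv x := by
    ext
    simp

lemma thetaJ_unit (J : FractionalIdeal (𝓞 K)⁰ K) (u : (𝓞 K)ˣ) (t : ℝ) (z : logSpace K) :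
    thetaJ J (wt t (logEmbedding K (Additive.ofMul u) + z)) = thetaJ J (wt t z) := by
  simp only [thetaJ, embForm_wt_unit]
  exact (unitMulEquiv J u).tsum_eq fun α => Real.exp (-Real.pi * embForm (wt t z) α.1)

variable (K) in
/-- A fundamental domain for the unit lattice. -/
def unitDom : Set (logSpace K) :=
  ZSpan.fundamentalDomain ((basisUnitLattice K).ofZLatticeBasis ℝ)

lemma isAddFundamentalDomain_unitDom : IsAddFundamentalDomain (unitLattice K) (unitDom K)
    (volume : Measure (logSpace K)) := ZLattice.isAddFundamentalDomain _ _

lemma measurableSet_unitDom : MeasurableSet (unitDom K) :=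
  ZSpan.fundamentalDomain_measurableSet _

lemma bounded_unitDom : Bornology.IsBounded (unitDom K) :=
  ZSpan.fundamentalDomain_isBounded _

lemma volume_unitDom_lt_top : volume (unitDom K) < ⊤ := bounded_unitDom.measure_lt_top

lemma thetaJ_lattice (J : FractionalIdeal (𝓞 K)⁰ K) (l : unitLattice K) (t : ℝ)
    (z : logSpace K) : thetaJ J (wt t (l +ᵥ z)) = thetaJ J (wt t z) := by
  obtain ⟨l, hl⟩ := l
  obtain ⟨u, -, rfl⟩ := hl
  exact thetaJ_unit J u.toMul t z

instance : VAddInvariantMeasure (unitLattice K) (logSpace K) (volume : Measure (logSpace K)) where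
  measure_preimage_vadd c s _ := measure_preimage_add volume (c : logSpace K) s

lemma lintegral_unitDom_neg (f : logSpace K → ENNReal)
    (hf : ∀ (l : unitLattice K) z, f (l +ᵥ z) = f z) :
    ∫⁻ z in unitDom K, f (-z) = ∫⁻ z in unitDom K, f z := by
  have h1 : IsAddFundamentalDomain (unitLattice K) ((Equiv.neg (logSpace K)) '' (unitDom K))
      (volume : Measure (logSpace K)) :=
    isAddFundamentalDomain_unitDom.image_of_equiv (Equiv.neg _)
      (by exact (Measure.measurePreserving_neg volume).quasiMeasurePreserving) (Equiv.neg _)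
      (fun g x => by
        change -((-g : unitLattice K) +ᵥ x) = g +ᵥ (-x)
        simp only [Submodule.vadd_def, vadd_eq_add]
        push_cast
        abel)
  rw [← h1.setLIntegral_eq isAddFundamentalDomain_unitDom f hf]
  have h2 := (Measure.measurePreserving_neg (volume : Measure (logSpace K))).setLIntegral_comp_emb
    (MeasurableEquiv.neg _).measurableEmbedding f (unitDom K)
  exact h2

end Weights
end LimDist

namespace LimDist
open scoped nonZeroDivisors ENNReal
open NumberField.Units NumberField.Units.dirichletUnitTheorem NumberField.InfinitePlace

section HeckeTheta
variable {K : Type} [Field K] [NumberField K]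

/-- The covolume of `J`. -/
def cJ (J : (FractionalIdeal (𝓞 K)⁰ K)ˣ) : ℝ := covolK K * (FractionalIdeal.absNorm J.1 : ℝ)

lemma absNorm_pos (J : (FractionalIdeal (𝓞 K)⁰ K)ˣ) :
    (0 : ℝ) < (FractionalIdeal.absNorm J.1 : ℝ) := by
  have h1 : FractionalIdeal.absNorm J.1 ≠ 0 := by
    rw [Ne, FractionalIdeal.absNorm_eq_zero_iff]; exact J.ne_zero
  have h2 := FractionalIdeal.absNorm_nonneg J.1
  exact_mod_cast lt_of_le_of_ne h2 h1.symm

lemma cJ_pos (J : (FractionalIdeal (𝓞 K)⁰ K)ˣ) : 0 < cJ J :=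
  mul_pos covolK_pos (absNorm_pos J)

/-- The averaged theta series. -/
def bigF (J : (FractionalIdeal (𝓞 K)⁰ K)ˣ) (t : ℝ) : ℝ :=
  (∫⁻ z in unitDom K, ENNReal.ofReal (thetaJ J.1 (wt t z))).toReal

lemma thetaJ_one_pos (J : (FractionalIdeal (𝓞 K)⁰ K)ˣ) (y : (K →+* ℂ) → ℝ)
    (hy : ConjInv y) (hpos : ∀ σ, 0 < y σ) : 0 < thetaJ J.1 y :=
  (summable_thetaJ J y hy hpos).tsum_pos (fun _ => (Real.exp_pos _).le)
    ⟨0, Submodule.zero_mem (J.1 : Submodule (𝓞 K) K)⟩ (Real.exp_pos _)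

lemma bigF_inversion (J J' : (FractionalIdeal (𝓞 K)⁰ K)ˣ)
    (hJ' : J'.1 = FractionalIdeal.dual ℤ ℚ J.1) {t : ℝ} (ht : 0 < t) :
    bigF J t = (t ^ ((Module.finrank ℚ K : ℝ) / 2) * cJ J)⁻¹ * bigF J' t⁻¹ := by
  have hc : 0 < (t ^ ((Module.finrank ℚ K : ℝ) / 2) * cJ J)⁻¹ := by
    have := cJ_pos J; positivity
  have h1 : ∀ z : logSpace K, ENNReal.ofReal (thetaJ J.1 (wt t z)) =
      ENNReal.ofReal (t ^ ((Module.finrank ℚ K : ℝ) / 2) * cJ J)⁻¹ *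
        ENNReal.ofReal (thetaJ J'.1 (wt t⁻¹ (-z))) := fun z => by
    rw [thetaJ_inversion J J' hJ' _ (wt_conj t z) (wt_pos ht z), prod_wt ht, wt_inv,
      ← cJ, ENNReal.ofReal_mul hc.le]
  unfold bigF
  simp_rw [h1]
  rw [lintegral_const_mul' _ _ ENNReal.ofReal_ne_top, ENNReal.toReal_mul,
    ENNReal.toReal_ofReal hc.le]
  rw [lintegral_unitDom_neg (fun z => ENNReal.ofReal (thetaJ J'.1 (wt t⁻¹ z)))
    (fun l z => by rw [thetaJ_lattice])]

lemma cJ_dual (J J' : (FractionalIdeal (𝓞 K)⁰ K)ˣ)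
    (hJ' : J'.1 = FractionalIdeal.dual ℤ ℚ J.1) : cJ J' = (cJ J)⁻¹ := by
  have hJ : J.1 = FractionalIdeal.dual ℤ ℚ J'.1 := by rw [hJ', FractionalIdeal.dual_dual]
  have h1 := thetaJ_inversion J J' hJ' (fun _ => 1) (fun _ => rfl) (fun _ => one_pos)
  have h2 := thetaJ_inversion J' J hJ (fun _ => 1) (fun _ => rfl) (fun _ => one_pos)
  have h3 := thetaJ_one_pos J (fun _ => 1) (fun _ => rfl) (fun _ => one_pos)
  simp only [Real.sqrt_one, Finset.prod_const_one, one_mul, inv_one] at h1 h2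
  rw [← cJ] at h1 h2
  rw [h2] at h1
  have := cJ_pos J
  have := cJ_pos J'
  field_simp at h1 ⊢
  linarith

/-- The normalised averaged theta series. -/
def hatF (J : (FractionalIdeal (𝓞 K)⁰ K)ˣ) (t : ℝ) : ℝ :=
  bigF J (t * cJ J ^ (-2 / (Module.finrank ℚ K : ℝ)))

lemma finrank_pos' : (0 : ℝ) < Module.finrank ℚ K := by exact_mod_cast Module.finrank_pos

lemma hatF_inversion (J J' : (FractionalIdeal (𝓞 K)⁰ K)ˣ)
    (hJ' : J'.1 = FractionalIdeal.dual ℤ ℚ J.1) {t : ℝ} (ht : 0 < t) :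
    hatF J (1 / t) = t ^ ((Module.finrank ℚ K : ℝ) / 2) * hatF J' t := by
  have hc := cJ_pos J
  have hn := (finrank_pos' (K := K)).ne'
  unfold hatF
  rw [bigF_inversion J J' hJ' (by positivity), cJ_dual J J' hJ']
  have e1 : (1 / t * cJ J ^ (-2 / (Module.finrank ℚ K : ℝ)))⁻¹ =
      t * (cJ J)⁻¹ ^ (-2 / (Module.finrank ℚ K : ℝ)) := by
    rw [mul_inv, one_div, inv_inv, Real.inv_rpow hc.le]
  have e2 : (1 / t * cJ J ^ (-2 / (Module.finrank ℚ K : ℝ))) ^ ((Module.finrank ℚ K : ℝ) / 2) *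
      cJ J = (t ^ ((Module.finrank ℚ K : ℝ) / 2))⁻¹ := by
    rw [Real.mul_rpow (by positivity) (by positivity), ← Real.rpow_mul hc.le, one_div,
      Real.inv_rpow ht.le]
    have : -2 / (Module.finrank ℚ K : ℝ) * ((Module.finrank ℚ K : ℝ) / 2) = -1 := by
      field_simp
    rw [this, Real.rpow_neg_one]
    field_simp
  rw [e1, e2, inv_inv]

/-- The theta series without its zero term. -/
def thE (J : (FractionalIdeal (𝓞 K)⁰ K)ˣ) (t : ℝ) (z : logSpace K) : ℝ≥0∞ :=
  ∑' α : {x : K // x ∈ J.1}, if α.1 = 0 then 0 else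
    ENNReal.ofReal (Real.exp (-Real.pi * embForm (wt t z) α.1))

lemma ofReal_thetaJ (J : (FractionalIdeal (𝓞 K)⁰ K)ˣ) {t : ℝ} (ht : 0 < t) (z : logSpace K) :
    ENNReal.ofReal (thetaJ J.1 (wt t z)) = 1 + thE J t z := by
  rw [thetaJ, ENNReal.ofReal_tsum_of_nonneg (fun _ => (Real.exp_pos _).le)
    (summable_thetaJ J _ (wt_conj t z) (wt_pos ht z)),
    ENNReal.summable.tsum_eq_add_tsum_ite'
      (⟨0, Submodule.zero_mem (J.1 : Submodule (𝓞 K) K)⟩ : {x : K // x ∈ J.1})]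
  congr 1
  · simp [embForm]
  · refine tsum_congr fun α => ?_
    simp only [Subtype.ext_iff]

lemma countable_ideal (J : (FractionalIdeal (𝓞 K)⁰ K)ˣ) : Countable {x : K // x ∈ J.1} := by
  obtain ⟨b, hb, -⟩ := exists_basis_ideal J
  obtain ⟨e, -⟩ := exists_equiv_of_span b J.1 hb
  exact e.symm.injective.countable

lemma continuous_embForm_wt (x : K) :
    Continuous fun p : ℝ × logSpace K => embForm (wt p.1 p.2) x := by
  unfold embForm wt
  have := fun w => (continuous_xw (K := K) w).comp (continuous_snd (X := ℝ))
  refine continuous_finsetSum _ fun σ _ => ?_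
  have h := this (InfinitePlace.mk σ)
  simp only [Function.comp_def] at h
  fun_prop

lemma measurable_thE (J : (FractionalIdeal (𝓞 K)⁰ K)ˣ) :
    Measurable fun p : ℝ × logSpace K => thE J p.1 p.2 := by
  have := countable_ideal J
  refine Measurable.ennreal_tsum fun α => ?_
  split_ifs
  · exact measurable_const
  · exact (ENNReal.measurable_ofReal.comp
      (Real.continuous_exp.comp (continuous_const.mul (continuous_embForm_wt α.1))).measurable)

lemma exists_xw_bound : ∃ δ > 0, ∀ z ∈ unitDom K, ∀ w : InfinitePlace K,
    δ ≤ Real.exp (xw z w) := by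
  have h : ∀ w : InfinitePlace K, ∃ δ > 0, ∀ z ∈ unitDom K, δ ≤ Real.exp (xw z w) := fun w => by
    have hb := (bounded_unitDom (K := K)).isCompact_closure.image (continuous_xw w)
    obtain ⟨m, hm⟩ := hb.bddBelow
    exact ⟨Real.exp m, Real.exp_pos _, fun z hz => Real.exp_le_exp.mpr
      (hm ⟨z, subset_closure hz, rfl⟩)⟩
  choose δ hδ h using h
  refine ⟨Finset.univ.inf' Finset.univ_nonempty δ, ?_, fun z hz w => ?_⟩
  · simp [Finset.lt_inf'_iff, hδ]
  · exact (Finset.inf'_le _ (Finset.mem_univ w)).trans (h w z hz)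

lemma exists_embForm_lower (J : (FractionalIdeal (𝓞 K)⁰ K)ˣ) :
    ∃ q > 0, ∀ x ∈ J.1, x ≠ 0 → q ≤ embForm (fun _ => 1) x := by
  obtain ⟨b, hb, -⟩ := exists_basis_ideal J
  obtain ⟨e, he⟩ := exists_equiv_of_span b J.1 hb
  obtain ⟨c, hc, h⟩ := exists_le_qForm (hartM_det_ne_zero (fun _ => 1) (fun _ => one_pos) b)
  refine ⟨c, hc, fun x hx hx0 => ?_⟩
  obtain ⟨m, hm⟩ := e.surjective ⟨x, hx⟩
  have h1 : x = ∑ i, m i • b i := by rw [← he, hm]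
  rw [h1, ← qForm_hartM _ (fun _ => rfl) (fun _ => one_pos)]
  refine le_trans ?_ (h _)
  have h2 : ∃ i, m i ≠ 0 := by
    by_contra hcon
    push Not at hcon
    exact hx0 (by rw [h1]; simp [hcon])
  obtain ⟨i, hi⟩ := h2
  have h3 : (1 : ℝ) ≤ (m i : ℝ) ^ 2 := by
    have : 0 < (m i) ^ 2 := by positivity
    have : 1 ≤ (m i) ^ 2 := this
    exact_mod_cast this
  have h4 : (m i : ℝ) ^ 2 ≤ ∑ j, (m j : ℝ) ^ 2 :=
    Finset.single_le_sum (f := fun j => (m j : ℝ) ^ 2) (fun _ _ => sq_nonneg _)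
      (Finset.mem_univ i)
  nlinarith

lemma embForm_wt_lower {δ : ℝ} (t : ℝ) (ht : 0 < t) (z : logSpace K)
    (h : ∀ w : InfinitePlace K, δ ≤ Real.exp (xw z w)) (x : K) :
    δ * t * embForm (fun _ => 1) x ≤ embForm (wt t z) x := by
  unfold embForm wt
  rw [Finset.mul_sum]
  refine Finset.sum_le_sum fun σ _ => ?_
  have := mul_le_mul_of_nonneg_right (mul_le_mul_of_nonneg_left (h (InfinitePlace.mk σ)) ht.le)
    (sq_nonneg ‖σ x‖)
  linarith

lemma thE_decay (J : (FractionalIdeal (𝓞 K)⁰ K)ˣ) (t₀ : ℝ) (ht₀ : 0 < t₀) :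
    ∃ A c : ℝ, 0 < c ∧ 0 ≤ A ∧ ∀ t, t₀ ≤ t → ∀ z ∈ unitDom K,
      thE J t z ≤ ENNReal.ofReal (A * Real.exp (-c * t)) := by
  obtain ⟨δ, hδ, h1⟩ := exists_xw_bound (K := K)
  obtain ⟨q, hq, h2⟩ := exists_embForm_lower J
  have hs := summable_thetaJ J (fun _ => δ * t₀ / 2) (fun _ => rfl) (fun _ => by positivity)
  refine ⟨∑' α : {x : K // x ∈ J.1}, Real.exp (-Real.pi * embForm (fun _ => δ * t₀ / 2) α.1),
    Real.pi * δ * q / 2, by positivity, tsum_nonneg fun _ => (Real.exp_pos _).le,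
    fun t ht z hz => ?_⟩
  rw [mul_comm, ENNReal.ofReal_mul (Real.exp_pos _).le,
    ENNReal.ofReal_tsum_of_nonneg (fun _ => (Real.exp_pos _).le) hs, ← ENNReal.tsum_mul_left, thE]
  refine ENNReal.tsum_le_tsum fun α => ?_
  split_ifs with h0
  · simp
  · rw [← ENNReal.ofReal_mul (Real.exp_pos _).le, ← Real.exp_add]
    apply ENNReal.ofReal_le_ofReal
    apply Real.exp_le_exp.mpr
    have h3 := embForm_wt_lower t (ht₀.trans_le ht) z (h1 z hz) α.1
    have h4 := h2 α.1 α.2 h0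
    have h5 : embForm (fun _ => δ * t₀ / 2) α.1 = δ * t₀ / 2 * embForm (fun _ => 1) α.1 := by
      simp [embForm, Finset.mul_sum]
    rw [h5]
    set E := embForm (fun _ => 1) α.1
    have h6 : δ * t * E ≥ δ * t₀ / 2 * E + δ * q / 2 * t := by
      have : 0 ≤ E := hq.le.trans h4
      have e1 : δ * t / 2 * q ≤ δ * t / 2 * E :=
        mul_le_mul_of_nonneg_left h4 (by have := ht₀.trans_le ht; positivity)
      have e2 : δ * E / 2 * t₀ ≤ δ * E / 2 * t := mul_le_mul_of_nonneg_left ht (by positivity)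
      linarith
    have h7 := mul_le_mul_of_nonneg_left (h6.le.trans h3) Real.pi_pos.le
    linarith

/-- The nonconstant part of the averaged theta series. -/
def bigE (J : (FractionalIdeal (𝓞 K)⁰ K)ˣ) (t : ℝ) : ℝ≥0∞ := ∫⁻ z in unitDom K, thE J t z

lemma measurable_bigE (J : (FractionalIdeal (𝓞 K)⁰ K)ˣ) : Measurable (bigE J) :=
  (measurable_thE J).lintegral_prod_right

lemma bigE_decay (J : (FractionalIdeal (𝓞 K)⁰ K)ˣ) (t₀ : ℝ) (ht₀ : 0 < t₀) :
    ∃ A c : ℝ, 0 < c ∧ 0 ≤ A ∧ ∀ t, t₀ ≤ t →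
      bigE J t ≤ ENNReal.ofReal (A * Real.exp (-c * t)) := by
  obtain ⟨A, c, hc, hA, h⟩ := thE_decay J t₀ ht₀
  refine ⟨A * (volume (unitDom K)).toReal, c, hc, by positivity, fun t ht => ?_⟩
  calc bigE J t ≤ ∫⁻ _z in unitDom K, ENNReal.ofReal (A * Real.exp (-c * t)) :=
        setLIntegral_mono' measurableSet_unitDom fun z hz => h t ht z hz
    _ = _ := by
        rw [setLIntegral_const, mul_right_comm, ENNReal.ofReal_mul (p := A * Real.exp (-c * t)) (by positivity),
          ENNReal.ofReal_toReal volume_unitDom_lt_top.ne]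

lemma bigE_ne_top (J : (FractionalIdeal (𝓞 K)⁰ K)ˣ) {t : ℝ} (ht : 0 < t) : bigE J t ≠ ⊤ := by
  obtain ⟨A, c, -, -, h⟩ := bigE_decay J t ht
  exact ((h t le_rfl).trans_lt ENNReal.ofReal_lt_top).ne

lemma bigF_eq (J : (FractionalIdeal (𝓞 K)⁰ K)ˣ) {t : ℝ} (ht : 0 < t) :
    bigF J t = (volume (unitDom K)).toReal + (bigE J t).toReal := by
  unfold bigF
  simp_rw [ofReal_thetaJ J ht]
  rw [lintegral_add_left measurable_const, setLIntegral_one, ← bigE,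
    ENNReal.toReal_add volume_unitDom_lt_top.ne (bigE_ne_top J ht)]

end HeckeTheta
end LimDist

namespace LimDist
open scoped nonZeroDivisors ENNReal
open NumberField.Units NumberField.Units.dirichletUnitTheorem NumberField.InfinitePlace

section Arch

lemma lintegral_Ioi_exp (r : ℝ) (h : ℝ → ℝ≥0∞) :
    ∫⁻ t in Set.Ioi (0 : ℝ), ENNReal.ofReal (t ^ (r - 1)) * h t =
      ∫⁻ τ : ℝ, ENNReal.ofReal (Real.exp (r * τ)) * h (Real.exp τ) := by
  have h1 := lintegral_image_eq_lintegral_abs_deriv_mul (s := Set.univ) (f := Real.exp)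
    (f' := Real.exp) MeasurableSet.univ (fun x _ => (Real.hasDerivAt_exp x).hasDerivWithinAt)
    Real.exp_injective.injOn (fun t => ENNReal.ofReal (t ^ (r - 1)) * h t)
  rw [Set.image_univ, Real.range_exp, Measure.restrict_univ] at h1
  rw [h1]
  refine lintegral_congr fun τ => ?_
  rw [← mul_assoc, ← ENNReal.ofReal_mul (abs_nonneg _), abs_of_pos (Real.exp_pos _),
    ← Real.exp_mul, ← Real.exp_add]
  congr 3; ring

lemma lintegral_Ioi_mul (r : ℝ) (h : ℝ → ℝ≥0∞) {a : ℝ} (ha : 0 < a) :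
    ∫⁻ t in Set.Ioi (0 : ℝ), ENNReal.ofReal (t ^ (r - 1)) * h (t * a) =
      ENNReal.ofReal (a ^ (-r)) * ∫⁻ t in Set.Ioi (0 : ℝ), ENNReal.ofReal (t ^ (r - 1)) * h t := by
  rw [lintegral_Ioi_exp r h, lintegral_Ioi_exp r (fun t => h (t * a)),
    ← lintegral_add_right_eq_self
      (fun τ => ENNReal.ofReal (Real.exp (r * τ)) * h (Real.exp τ)) (Real.log a),
    ← lintegral_const_mul' _ _ ENNReal.ofReal_ne_top]
  refine lintegral_congr fun τ => ?_
  rw [← mul_assoc, ← ENNReal.ofReal_mul (by positivity), Real.rpow_def_of_pos ha,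
    ← Real.exp_add, Real.exp_add τ, Real.exp_log ha]
  congr 3; ring

lemma lintegral_gamma (a b : ℝ) (ha : 0 < a) (hb : 0 < b) :
    ∫⁻ v : ℝ, ENNReal.ofReal (Real.exp (a * v) * Real.exp (-(b * Real.exp v))) =
      ENNReal.ofReal ((1 / b) ^ a * Real.Gamma a) := by
  have h1 := lintegral_Ioi_exp a (fun t => ENNReal.ofReal (Real.exp (-(b * t))))
  simp_rw [ENNReal.ofReal_mul (Real.exp_pos _).le]
  rw [← h1, ← Real.integral_rpow_mul_exp_neg_mul_Ioi ha hb, ofReal_integral_eq_lintegral_ofReal]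
  · refine setLIntegral_congr_fun measurableSet_Ioi fun t ht => ?_
    exact (ENNReal.ofReal_mul (Real.rpow_nonneg (le_of_lt ht) _)).symm
  · have := Real.GammaIntegral_convergent ha
    by_contra hcon
    have h2 := integral_undef hcon
    rw [Real.integral_rpow_mul_exp_neg_mul_Ioi ha hb] at h2
    have : 0 < (1 / b) ^ a * Real.Gamma a := mul_pos (by positivity) (Real.Gamma_pos_of_pos ha)
    exact this.ne' h2
  · filter_upwards [ae_restrict_mem measurableSet_Ioi] with t ht
    exact mul_nonneg (Real.rpow_nonneg (le_of_lt ht) _) (Real.exp_pos _).le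

variable {K : Type} [Field K] [NumberField K]

lemma xw_surj (v : InfinitePlace K → ℝ) (hv : ∑ w, (mult w : ℝ) * v w = 0) :
    ∃ z : logSpace K, ∀ w, xw z w = v w := by
  refine ⟨fun w => (mult w.1 : ℝ) / 2 * v w.1, fun w => ?_⟩
  have hm := (mult_pos' w).ne'
  unfold xw
  split_ifs with h
  · rw [Fintype.sum_eq_add_sum_subtype_ne _ (w₀ : InfinitePlace K)] at hv
    subst h
    have : ∑ w : {w : InfinitePlace K // w ≠ w₀}, (mult w.1 : ℝ) / 2 * v w.1 =
        (∑ w : {w : InfinitePlace K // w ≠ w₀}, (mult w.1 : ℝ) * v w.1) / 2 := by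
      rw [Finset.sum_div]; exact Finset.sum_congr rfl fun _ _ => by ring
    rw [this]
    field_simp
    linarith
  · field_simp

lemma sum_mult_eq' : ∑ w : InfinitePlace K, (mult w : ℝ) = Module.finrank ℚ K := by
  exact_mod_cast sum_mult_eq

/-- The linear map `(τ, z) ↦ (τ + x_w(z))_w`. -/
def archMap : (ℝ × logSpace K) →ₗ[ℝ] (InfinitePlace K → ℝ) where
  toFun p w := p.1 + xw p.2 w
  map_add' p q := by ext w; simp only [Prod.fst_add, Prod.snd_add, xw_add, Pi.add_apply]; ring
  map_smul' c p := by
    ext w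
    simp only [Prod.smul_fst, Prod.smul_snd, xw_smul, Pi.smul_apply, smul_eq_mul,
      RingHom.id_apply]
    ring

lemma sum_archMap (p : ℝ × logSpace K) :
    ∑ w, (mult w : ℝ) * archMap p w = Module.finrank ℚ K * p.1 := by
  simp only [archMap, LinearMap.coe_mk, AddHom.coe_mk, mul_add, Finset.sum_add_distrib,
    sum_mult_xw, add_zero, ← Finset.sum_mul, sum_mult_eq']

lemma archMap_bijective : Function.Bijective (archMap (K := K)) := by
  have hn := (finrank_pos' (K := K)).ne'
  constructor
  · rw [injective_iff_map_eq_zero]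
    intro p hp
    have h1 := sum_archMap p
    rw [hp] at h1
    have h2 : p.1 = 0 := by simpa [hn] using h1.symm
    refine Prod.ext h2 ?_
    ext w
    have h3 := congrFun hp w.1
    simp only [archMap, LinearMap.coe_mk, AddHom.coe_mk, h2, zero_add, Pi.zero_apply, xw,
      dif_neg w.2] at h3
    have := (mult_pos' w.1).ne'
    simpa [this] using h3
  · intro v
    set τ : ℝ := (∑ w, (mult w : ℝ) * v w) / Module.finrank ℚ K
    obtain ⟨z, hz⟩ := xw_surj (fun w => v w - τ) (by
      simp only [mul_sub, Finset.sum_sub_distrib, ← Finset.sum_mul, sum_mult_eq', τ]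
      field_simp
      ring)
    refine ⟨(τ, z), ?_⟩
    ext w
    simp [archMap, hz]

/-- `archMap` as an isomorphism. -/
def archEquiv : (ℝ × logSpace K) ≃L[ℝ] (InfinitePlace K → ℝ) :=
  (LinearEquiv.ofBijective archMap archMap_bijective).toContinuousLinearEquiv

lemma archEquiv_apply (p : ℝ × logSpace K) (w : InfinitePlace K) :
    archEquiv p w = p.1 + xw p.2 w := rfl

lemma exists_archConst : ∃ c : ℝ, 0 < c ∧ ∀ g : (InfinitePlace K → ℝ) → ℝ≥0∞, Measurable g →
    ∫⁻ p : ℝ × logSpace K, g (archEquiv p) = ENNReal.ofReal c * ∫⁻ v, g v := by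
  have hm : Measure.IsAddHaarMeasure ((volume : Measure (ℝ × logSpace K)).map archEquiv) :=
    by rw [Measure.volume_eq_prod]; exact ContinuousLinearEquiv.isAddHaarMeasure_map _ _
  obtain ⟨c, hc, h1⟩ : ∃ c : NNReal, 0 < c ∧
      (volume : Measure (ℝ × logSpace K)).map archEquiv = c • volume :=
    ⟨_, Measure.addHaarScalarFactor_pos_of_isAddHaarMeasure
      ((volume : Measure (ℝ × logSpace K)).map archEquiv) volume,
      Measure.isAddLeftInvariant_eq_smul _ _⟩
  refine ⟨c, hc, fun g hg => ?_⟩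
  rw [← lintegral_map hg (archEquiv (K := K)).continuous.measurable, h1, lintegral_smul_measure,
    ENNReal.ofReal_coe_nnreal]
  rfl

lemma lintegral_pi_prod {ι : Type} [Fintype ι] (f : ι → ℝ → ℝ) (hf : ∀ i, Measurable (f i))
    (h0 : ∀ i x, 0 ≤ f i x) (hfin : ∀ i, ∫⁻ x, ENNReal.ofReal (f i x) ≠ ⊤) :
    ∫⁻ v : ι → ℝ, ∏ i, ENNReal.ofReal (f i (v i)) = ∏ i, ∫⁻ x, ENNReal.ofReal (f i x) := by
  have hi : ∀ i, Integrable (f i) := fun i =>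
    ⟨(hf i).aestronglyMeasurable, by
      rw [hasFiniteIntegral_iff_ofReal (ae_of_all _ (h0 i))]; exact lt_top_iff_ne_top.mpr (hfin i)⟩
  have h1 : ∀ v : ι → ℝ, ∏ i, ENNReal.ofReal (f i (v i)) = ENNReal.ofReal (∏ i, f i (v i)) :=
    fun v => (ENNReal.ofReal_prod_of_nonneg fun i _ => h0 i _).symm
  simp_rw [h1]
  rw [← ofReal_integral_eq_lintegral_ofReal, integral_fintype_prod_volume_eq_prod,
    ENNReal.ofReal_prod_of_nonneg fun i _ => integral_nonneg (h0 i)]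
  · exact Finset.prod_congr rfl fun i _ =>
      ofReal_integral_eq_lintegral_ofReal (hi i) (ae_of_all _ (h0 i))
  · exact Integrable.fintype_prod hi
  · exact ae_of_all _ fun v => Finset.prod_nonneg fun i _ => h0 i _

/-- The archimedean integral. -/
def archPhi (K : Type) [Field K] [NumberField K] (r : ℝ) : ℝ≥0∞ :=
  ∫⁻ t in Set.Ioi (0 : ℝ), ENNReal.ofReal (t ^ (r - 1)) *
    ∫⁻ z : logSpace K, ENNReal.ofReal (Real.exp (-Real.pi * embForm (wt t z) (1 : K)))

lemma exists_archPhi : ∃ c : ℝ, 0 < c ∧ ∀ r : ℝ, 0 < r → archPhi K r = ENNReal.ofReal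
    (c * ∏ w : InfinitePlace K, (1 / (Real.pi * mult w)) ^ (r * mult w / Module.finrank ℚ K) *
      Real.Gamma (r * mult w / Module.finrank ℚ K)) := by
  obtain ⟨c, hc, h⟩ := exists_archConst (K := K)
  refine ⟨c, hc, fun r hr => ?_⟩
  have hn := finrank_pos' (K := K)
  set n : ℝ := (Module.finrank ℚ K : ℝ)
  have hpos : ∀ w : InfinitePlace K, 0 < r * mult w / n := fun w => by
    have := mult_pos' w; positivity
  set g : (InfinitePlace K → ℝ) → ℝ≥0∞ := fun v => ∏ w : InfinitePlace K,
    ENNReal.ofReal (Real.exp (r * mult w / n * v w) * Real.exp (-(Real.pi * mult w *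
      Real.exp (v w)))) with hg
  have hgm : Measurable g := by
    refine Finset.measurable_fun_prod _ fun w _ => ?_
    fun_prop
  have h1 : ∫⁻ v, g v = ∏ w : InfinitePlace K, ENNReal.ofReal
      ((1 / (Real.pi * mult w)) ^ (r * mult w / n) * Real.Gamma (r * mult w / n)) := by
    have hb : ∀ w : InfinitePlace K, 0 < Real.pi * mult w := fun w => by
      have := mult_pos' w; positivity
    rw [hg, lintegral_pi_prod (fun (w : InfinitePlace K) (v : ℝ) =>
      Real.exp (r * mult w / n * v) * Real.exp (-(Real.pi * mult w * Real.exp v)))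
      (fun w => by fun_prop) (fun w x => by positivity)
      (fun w => by rw [lintegral_gamma _ _ (hpos w) (hb w)]; exact ENNReal.ofReal_ne_top)]
    refine Finset.prod_congr rfl fun w _ => ?_
    rw [lintegral_gamma _ _ (hpos w) (by have := mult_pos' w; positivity)]
  rw [ENNReal.ofReal_mul hc.le, ENNReal.ofReal_prod_of_nonneg (fun w _ => by
    have := Real.Gamma_pos_of_pos (hpos w)
    have := mult_pos' w
    positivity), ← h1, ← h g hgm, archPhi, lintegral_Ioi_exp r (fun t => ∫⁻ z : logSpace K,
    ENNReal.ofReal (Real.exp (-Real.pi * embForm (wt t z) (1 : K)))), Measure.volume_eq_prod,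
    lintegral_prod (fun p => g (archEquiv p))
      (hgm.comp archEquiv.continuous.measurable).aemeasurable]
  refine lintegral_congr fun τ => ?_
  rw [← lintegral_const_mul' _ _ ENNReal.ofReal_ne_top]
  refine lintegral_congr fun z => ?_
  rw [← ENNReal.ofReal_mul (Real.exp_pos _).le, hg]
  simp only
  rw [← ENNReal.ofReal_prod_of_nonneg (fun w _ => by positivity), Finset.prod_mul_distrib,
    ← Real.exp_sum, ← Real.exp_sum]
  congr 3
  · have := sum_archMap (τ, z)
    have e : ∀ w, r * mult w / n * archEquiv (τ, z) w = r / n * (mult w * archMap (τ, z) w) :=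
      fun w => by rw [show archEquiv (τ, z) w = archMap (τ, z) w from rfl]; ring
    simp only [e]
    rw [← Finset.mul_sum, this]
    simp only [n] at *
    field_simp
  · rw [embForm_wt, Finset.sum_neg_distrib, Finset.mul_sum, Finset.mul_sum,
      ← Finset.sum_neg_distrib]
    refine Finset.sum_congr rfl fun w _ => ?_
    rw [archEquiv_apply, Real.exp_add]
    simp
    ring

lemma exists_shift (x : K) (hx : x ≠ 0) : ∃ z₀ : logSpace K, ∀ (t : ℝ) (z : logSpace K),
    embForm (wt t z) x = embForm (wt (t * |(Algebra.norm ℚ x : ℝ)| ^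
      (2 / (Module.finrank ℚ K : ℝ))) (z + z₀)) 1 := by
  have hn := (finrank_pos' (K := K))
  set n : ℝ := (Module.finrank ℚ K : ℝ)
  have hN : 0 < |(Algebra.norm ℚ x : ℝ)| := by
    simpa [Algebra.norm_ne_zero_iff] using hx
  have hw : ∀ w : InfinitePlace K, 0 < w x := fun w => InfinitePlace.pos_iff.mpr hx
  have hprod : ∑ w : InfinitePlace K, (mult w : ℝ) * Real.log (w x) =
      Real.log |(Algebra.norm ℚ x : ℝ)| := by
    have := InfinitePlace.prod_eq_abs_norm x
    rw [← Rat.cast_abs, ← this, Real.log_prod fun w _ => (pow_pos (hw w) _).ne']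
    exact Finset.sum_congr rfl fun w _ => (Real.log_pow _ _).symm
  obtain ⟨z₀, hz₀⟩ := xw_surj (fun w : InfinitePlace K => 2 * Real.log (w x) -
    2 / n * Real.log |(Algebra.norm ℚ x : ℝ)|) (by
      have e : ∀ w : InfinitePlace K, (mult w : ℝ) * (2 * Real.log (w x) -
        2 / n * Real.log |(Algebra.norm ℚ x : ℝ)|) = 2 * (mult w * Real.log (w x)) -
        mult w * (2 / n * Real.log |(Algebra.norm ℚ x : ℝ)|) := fun w => by ring
      simp only [e]
      rw [Finset.sum_sub_distrib, ← Finset.mul_sum, ← Finset.sum_mul, sum_mult_eq', hprod]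
      simp only [n] at *
      field_simp
      ring)
  refine ⟨z₀, fun t z => ?_⟩
  rw [embForm_wt, embForm_wt, mul_assoc]
  congr 1
  rw [Finset.mul_sum]
  refine (Finset.sum_congr rfl fun w _ => ?_)
  rw [xw_add, Real.exp_add, hz₀, Real.exp_sub, Real.rpow_def_of_pos hN]
  have : Real.exp (2 * Real.log (w x)) = w x ^ 2 := by
    rw [mul_comm, Real.exp_mul, Real.exp_log (hw w)]; norm_num
  rw [this, mul_comm (Real.log |_|)]
  simp only [map_one, one_pow, mul_one]
  field_simp

lemma arch_translate (x : K) (hx : x ≠ 0) (r : ℝ) {a : ℝ} (ha : 0 < a) :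
    ∫⁻ t in Set.Ioi (0 : ℝ), ENNReal.ofReal (t ^ (r - 1)) *
      ∫⁻ z : logSpace K, ENNReal.ofReal (Real.exp (-Real.pi * embForm (wt (t * a) z) x)) =
    ENNReal.ofReal ((a * |(Algebra.norm ℚ x : ℝ)| ^ (2 / (Module.finrank ℚ K : ℝ))) ^ (-r)) *
      archPhi K r := by
  obtain ⟨z₀, hz₀⟩ := exists_shift x hx
  have hN : 0 < |(Algebra.norm ℚ x : ℝ)| := by
    simpa [Algebra.norm_ne_zero_iff] using hx
  rw [archPhi, ← lintegral_Ioi_mul r _ (by positivity)]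
  refine lintegral_congr fun t => ?_
  congr 1
  simp_rw [hz₀]
  rw [lintegral_add_right_eq_self (fun z => ENNReal.ofReal (Real.exp (-Real.pi * embForm (wt
    (t * a * |(Algebra.norm ℚ x : ℝ)| ^ (2 / (Module.finrank ℚ K : ℝ))) z) 1))) z₀, mul_assoc]

end Arch
end LimDist

namespace LimDist
open scoped nonZeroDivisors ENNReal
open NumberField.Units NumberField.Units.dirichletUnitTheorem NumberField.InfinitePlace

section Classes
variable {K : Type} [Field K] [NumberField K]

lemma tsum_units_log (h : logSpace K → ℝ≥0∞) :
    ∑' u : (𝓞 K)ˣ, h (logEmbedding K (Additive.ofMul u)) =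
      (Nat.card (torsion K) : ℝ≥0∞) * ∑' l : unitLattice K, h l := by
  have hfst : ∀ u : (𝓞 K)ˣ, ((Subgroup.groupEquivQuotientProdSubgroup
      (s := torsion K)) u).1 = (u : (𝓞 K)ˣ ⧸ torsion K) := fun u => rfl
  have h1 : ∀ u : (𝓞 K)ˣ, h (logEmbedding K (Additive.ofMul u)) =
      (fun p : ((𝓞 K)ˣ ⧸ torsion K) × torsion K => h (logEmbeddingEquiv K (Additive.ofMul p.1)))
        (Subgroup.groupEquivQuotientProdSubgroup u) := fun u => by
    simp only [hfst]
    rw [logEmbeddingEquiv_apply]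
  rw [tsum_congr h1, (Subgroup.groupEquivQuotientProdSubgroup (s := torsion K)).tsum_eq
      (fun p : ((𝓞 K)ˣ ⧸ torsion K) × torsion K =>
        h (logEmbeddingEquiv K (Additive.ofMul p.1))), ENNReal.tsum_prod
    (f := fun p _ => h (logEmbeddingEquiv K (Additive.ofMul p)))]
  simp_rw [ENNReal.tsum_const]
  rw [ENNReal.tsum_mul_left]
  congr 1
  · simp [ENat.card_eq_coe_natCard]
  · exact ((Additive.ofMul).trans (logEmbeddingEquiv K).toEquiv).tsum_eq
      (fun l : unitLattice K => h l)

lemma unfold_units (x : K) (t : ℝ) :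
    ∑' u : (𝓞 K)ˣ, ∫⁻ z in unitDom K, ENNReal.ofReal (Real.exp (-Real.pi *
      embForm (wt t z) ((u : K) * x))) =
    (Nat.card (torsion K) : ℝ≥0∞) * ∫⁻ z : logSpace K, ENNReal.ofReal (Real.exp (-Real.pi *
      embForm (wt t z) x)) := by
  rw [isAddFundamentalDomain_unitDom.lintegral_eq_tsum'' (fun z => ENNReal.ofReal
    (Real.exp (-Real.pi * embForm (wt t z) x)))]
  simp_rw [← embForm_wt_unit]
  exact tsum_units_log (fun l => ∫⁻ z in unitDom K, ENNReal.ofReal (Real.exp (-Real.pi *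
      embForm (wt t (l + z)) x)))

/-- Nonzero integral ideals as invertible fractional ideals. -/
def idealUnit (I : {I : Ideal (𝓞 K) // I ≠ ⊥}) : (FractionalIdeal (𝓞 K)⁰ K)ˣ :=
  Units.mk0 (I.1 : FractionalIdeal (𝓞 K)⁰ K) (FractionalIdeal.coeIdeal_ne_zero.mpr I.2)

lemma idealUnit_injective : Function.Injective (idealUnit (K := K)) := fun I I' h => by
  have := congrArg Units.val h
  exact Subtype.ext (FractionalIdeal.coeIdeal_injective this)

lemma mk_eq_one_iff' (A : (FractionalIdeal (𝓞 K)⁰ K)ˣ) : ClassGroup.mk K A = 1 ↔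
    ∃ x : K, x ≠ 0 ∧ A.1 = FractionalIdeal.spanSingleton (𝓞 K)⁰ x := by
  rw [ClassGroup.mk_eq_one_iff, FractionalIdeal.isPrincipal_iff]
  constructor
  · rintro ⟨x, hx⟩
    refine ⟨x, ?_, hx⟩
    rintro rfl
    exact A.ne_zero (by rw [hx]; simp)
  · rintro ⟨x, -, hx⟩
    exact ⟨x, hx⟩

lemma spanSingleton_eq_iff (x y : K) (hx : x ≠ 0) :
    FractionalIdeal.spanSingleton (𝓞 K)⁰ x = FractionalIdeal.spanSingleton (𝓞 K)⁰ y ↔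
      ∃ u : (𝓞 K)ˣ, (u : K) * x = y := by
  constructor
  · intro h
    have h1 : x ∈ FractionalIdeal.spanSingleton (𝓞 K)⁰ y :=
      h ▸ FractionalIdeal.mem_spanSingleton_self _ _
    have h2 : y ∈ FractionalIdeal.spanSingleton (𝓞 K)⁰ x :=
      h ▸ FractionalIdeal.mem_spanSingleton_self _ _
    rw [FractionalIdeal.mem_spanSingleton] at h1 h2
    obtain ⟨a, ha⟩ := h1
    obtain ⟨b, hb⟩ := h2
    have hab : b * a = 1 := by
      have : algebraMap (𝓞 K) K (b * a) = 1 := by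
        rw [← hb, Algebra.smul_def, Algebra.smul_def] at ha
        rw [map_mul]
        have : (algebraMap (𝓞 K) K b * algebraMap (𝓞 K) K a - 1) * x = 0 := by
          linear_combination ha
        rcases mul_eq_zero.mp this with h | h
        · linear_combination h
        · exact absurd h hx
      exact FaithfulSMul.algebraMap_injective (𝓞 K) K (by rw [this, map_one])
    refine ⟨⟨b, a, hab, by rw [mul_comm, hab]⟩, ?_⟩
    rw [← hb, Algebra.smul_def]
  · rintro ⟨u, rfl⟩
    refine le_antisymm ?_ ?_ <;>
      rw [FractionalIdeal.spanSingleton_le_iff_mem, FractionalIdeal.mem_spanSingleton]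
    · refine ⟨(u⁻¹ : (𝓞 K)ˣ), ?_⟩
      rw [Algebra.smul_def, ← mul_assoc]
      change ((u⁻¹ : (𝓞 K)ˣ) : K) * (u : K) * x = x
      simp
    · exact ⟨u, by rw [Algebra.smul_def]⟩

/-- A family of fractional ideals representing all classes. -/
def IsClassFam (J : ClassGroup (𝓞 K) → (FractionalIdeal (𝓞 K)⁰ K)ˣ) : Prop :=
  Function.Bijective fun c => ClassGroup.mk K (J c)

lemma class_param (J : ClassGroup (𝓞 K) → (FractionalIdeal (𝓞 K)⁰ K)ˣ) (hJ : IsClassFam J) :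
    ∃ (cl : {I : Ideal (𝓞 K) // I ≠ ⊥} → ClassGroup (𝓞 K))
      (gen : {I : Ideal (𝓞 K) // I ≠ ⊥} → K),
      (∀ I, gen I ≠ 0 ∧ |((Algebra.norm ℚ (gen I) : ℚ) : ℝ)| = Ideal.absNorm I.1 *
        (FractionalIdeal.absNorm (J (cl I)).1 : ℝ)) ∧
      ∀ f : ClassGroup (𝓞 K) → K → ℝ≥0∞,
        ∑' c, ∑' x : {x : K // x ∈ (J c).1}, (if x.1 = 0 then 0 else f c x) =
          ∑' I, ∑' u : (𝓞 K)ˣ, f (cl I) ((u : K) * gen I) := by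
  have h1 : ∀ I : {I : Ideal (𝓞 K) // I ≠ ⊥}, ∃ c : ClassGroup (𝓞 K), ∃ x : K, x ≠ 0 ∧
      (idealUnit I * J c).1 = FractionalIdeal.spanSingleton (𝓞 K)⁰ x := fun I => by
    obtain ⟨c, hc⟩ := hJ.2 (ClassGroup.mk K (idealUnit I))⁻¹
    refine ⟨c, (mk_eq_one_iff' _).mp ?_⟩
    simp only at hc
    rw [map_mul, hc, mul_inv_cancel]
  choose cl gen hgen0 hgen using h1
  refine ⟨cl, gen, fun I => ⟨hgen0 I, ?_⟩, fun f => ?_⟩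
  · have := congrArg FractionalIdeal.absNorm (hgen I)
    rw [FractionalIdeal.absNorm_span_singleton, Units.val_mul, map_mul, idealUnit,
      Units.val_mk0, FractionalIdeal.coeIdeal_absNorm] at this
    rw [← Rat.cast_abs, ← this]
    push_cast
    ring
  have h2 : ∀ c, ∑' x : {x : K // x ∈ (J c).1}, (if x.1 = 0 then 0 else f c x) =
      ∑' x : K, if x ∈ (J c).1 ∧ x ≠ 0 then f c x else 0 := fun c => by
    rw [← tsum_subtype_eq_of_support_subset (s := {x : K | x ∈ (J c).1})]
    · refine tsum_congr fun x => ?_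
      by_cases hx : x.1 = 0
      · simp [hx]
      · have := x.2
        rw [if_neg hx, if_pos ⟨this, hx⟩]
    · intro x hx
      by_contra hcon
      exact hx (if_neg fun h => hcon h.1)
  simp_rw [h2]
  rw [← ENNReal.tsum_prod (f := fun c x => if x ∈ (J c).1 ∧ x ≠ 0 then f c x else 0),
    ← ENNReal.tsum_prod (f := fun I (u : (𝓞 K)ˣ) => f (cl I) ((u : K) * gen I))]
  set S : Set (ClassGroup (𝓞 K) × K) := {q | q.2 ∈ (J q.1).1 ∧ q.2 ≠ 0} with hS
  rw [← tsum_subtype_eq_of_support_subset (s := S)]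
  swap
  · intro q hq
    by_contra hcon
    exact hq (if_neg fun h => hcon h)
  have hmem : ∀ p : {I : Ideal (𝓞 K) // I ≠ ⊥} × (𝓞 K)ˣ,
      (cl p.1, (p.2 : K) * gen p.1) ∈ S := fun p => by
    refine ⟨?_, mul_ne_zero (by simp) (hgen0 _)⟩
    rw [← FractionalIdeal.spanSingleton_le_iff_mem,
      ← (spanSingleton_eq_iff _ _ (hgen0 p.1)).mpr ⟨p.2, rfl⟩, ← hgen, Units.val_mul]
    refine (mul_le_mul_left (FractionalIdeal.coeIdeal_le_one (I := p.1.1)) _).trans ?_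
    rw [one_mul]
  let e : {I : Ideal (𝓞 K) // I ≠ ⊥} × (𝓞 K)ˣ → S := fun p => ⟨_, hmem p⟩
  have he : Function.Bijective e := by
    constructor
    · rintro ⟨I, u⟩ ⟨I', u'⟩ h
      have h3 := congrArg Subtype.val h
      simp only [e, Prod.mk.injEq] at h3
      have h4 : FractionalIdeal.spanSingleton (𝓞 K)⁰ (gen I) =
          FractionalIdeal.spanSingleton (𝓞 K)⁰ (gen I') := by
        rw [(spanSingleton_eq_iff _ _ (hgen0 I)).mpr ⟨u, rfl⟩,
          (spanSingleton_eq_iff _ _ (hgen0 I')).mpr ⟨u', rfl⟩, h3.2]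
      rw [← hgen, ← hgen, h3.1] at h4
      have h5 : I = I' := idealUnit_injective (mul_right_cancel (Units.ext h4))
      subst h5
      have h6 : (u : K) = u' := mul_right_cancel₀ (hgen0 I) h3.2
      have h7 : u = u' := by
        apply Units.ext
        exact RingOfIntegers.coe_injective h6
      rw [h7]
    · rintro ⟨⟨c, x⟩, hx, hx0⟩
      simp only at hx hx0
      set X : (FractionalIdeal (𝓞 K)⁰ K)ˣ := Units.mk0
        (FractionalIdeal.spanSingleton (𝓞 K)⁰ x)
        (by rwa [Ne, FractionalIdeal.spanSingleton_eq_zero_iff]) with hX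
      have hle : (X * (J c)⁻¹).1 ≤ 1 := by
        have : X.1 ≤ (J c).1 := by
          rw [hX, Units.val_mk0, FractionalIdeal.spanSingleton_le_iff_mem]; exact hx
        calc (X * (J c)⁻¹).1 = X.1 * ((J c)⁻¹).1 := rfl
          _ ≤ (J c).1 * ((J c)⁻¹).1 := mul_le_mul_left this _
          _ = 1 := by rw [← Units.val_mul, mul_inv_cancel, Units.val_one]
      obtain ⟨I, hI⟩ := FractionalIdeal.le_one_iff_exists_coeIdeal.mp hle
      have hI0 : I ≠ ⊥ := by
        rintro rfl
        exact (X * (J c)⁻¹).ne_zero (by rw [← hI]; simp)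
      have hII : idealUnit ⟨I, hI0⟩ = X * (J c)⁻¹ := Units.ext hI
      have hcl : cl ⟨I, hI0⟩ = c := by
        apply hJ.1
        simp only
        have h3 : ClassGroup.mk K (idealUnit ⟨I, hI0⟩ * J (cl ⟨I, hI0⟩)) = 1 :=
          (mk_eq_one_iff' _).mpr ⟨_, hgen0 _, hgen _⟩
        have h4 : ClassGroup.mk K (idealUnit ⟨I, hI0⟩ * J c) = 1 :=
          (mk_eq_one_iff' _).mpr ⟨x, hx0, by rw [hII, inv_mul_cancel_right]; rfl⟩
        rw [map_mul] at h3 h4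
        exact mul_left_cancel (h3.trans h4.symm)
      obtain ⟨u, hu⟩ := (spanSingleton_eq_iff _ x (hgen0 ⟨I, hI0⟩)).mp (by
        rw [← hgen, hcl, hII, inv_mul_cancel_right]; rfl)
      exact ⟨(⟨I, hI0⟩, u), Subtype.ext (Prod.ext hcl hu)⟩
  rw [← (Equiv.ofBijective e he).tsum_eq]
  refine tsum_congr fun p => ?_
  exact if_pos (hmem p)

end Classes
end LimDist

namespace LimDist
open scoped nonZeroDivisors ENNReal
open NumberField.Units NumberField.Units.dirichletUnitTheorem NumberField.InfinitePlace

section TotalMellin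
variable {K : Type} [Field K] [NumberField K]

/-- The scaling factor attached to a fractional ideal. -/
def scJ (J : (FractionalIdeal (𝓞 K)⁰ K)ˣ) : ℝ := cJ J ^ (-2 / (Module.finrank ℚ K : ℝ))

lemma scJ_pos (J : (FractionalIdeal (𝓞 K)⁰ K)ˣ) : 0 < scJ J := Real.rpow_pos_of_pos (cJ_pos J) _

lemma measurable_expForm (x : K) (a : ℝ) : Measurable fun p : ℝ × logSpace K =>
    ENNReal.ofReal (Real.exp (-Real.pi * embForm (wt (p.1 * a) p.2) x)) := by
  have h1 : Continuous fun p : ℝ × logSpace K => ((p.1 * a, p.2) : ℝ × logSpace K) := by fun_prop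
  exact ENNReal.measurable_ofReal.comp (Real.continuous_exp.comp
    (continuous_const.mul ((continuous_embForm_wt x).comp h1))).measurable

lemma measurable_rpow_sub (r : ℝ) : Measurable fun t : ℝ => ENNReal.ofReal (t ^ (r - 1)) := by
  fun_prop

lemma bigE_eq_tsum (J : (FractionalIdeal (𝓞 K)⁰ K)ˣ) (t a : ℝ) : bigE J (t * a) =
    ∑' x : {x : K // x ∈ J.1}, if x.1 = 0 then 0 else
      ∫⁻ z in unitDom K, ENNReal.ofReal (Real.exp (-Real.pi * embForm (wt (t * a) z) x.1)) := by
  have := countable_ideal J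
  unfold bigE thE
  rw [lintegral_tsum]
  · refine tsum_congr fun x => ?_
    split_ifs <;> simp
  · intro x
    split_ifs
    · exact aemeasurable_const
    · exact ((measurable_expForm x.1 a).comp measurable_prodMk_left).aemeasurable

lemma mellin_total (J : ClassGroup (𝓞 K) → (FractionalIdeal (𝓞 K)⁰ K)ˣ) (hJ : IsClassFam J)
    (r : ℝ) :
    ∑' c, ∫⁻ t in Set.Ioi (0 : ℝ), ENNReal.ofReal (t ^ (r - 1)) * bigE (J c) (t * scJ (J c)) =
      (Nat.card (torsion K) : ℝ≥0∞) * archPhi K r *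
        ∑' I : {I : Ideal (𝓞 K) // I ≠ ⊥}, ENNReal.ofReal
          (((Ideal.absNorm I.1 : ℝ) / covolK K) ^ (-(2 * r / (Module.finrank ℚ K : ℝ)))) := by
  obtain ⟨cl, gen, hgen, hsum⟩ := class_param J hJ
  set f : ClassGroup (𝓞 K) → K → ℝ≥0∞ := fun c x => ∫⁻ t in Set.Ioi (0 : ℝ),
    ENNReal.ofReal (t ^ (r - 1)) * ∫⁻ z in unitDom K,
      ENNReal.ofReal (Real.exp (-Real.pi * embForm (wt (t * scJ (J c)) z) x)) with hf
  have hfm : ∀ (c : ClassGroup (𝓞 K)) (x : K), Measurable fun t : ℝ => ENNReal.ofReal (t ^ (r - 1)) *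
      ∫⁻ z in unitDom K, ENNReal.ofReal (Real.exp (-Real.pi * embForm (wt (t * scJ (J c)) z) x)) :=
    fun c x => (measurable_rpow_sub r).mul (measurable_expForm x _).lintegral_prod_right
  have h1 : ∀ c, ∫⁻ t in Set.Ioi (0 : ℝ), ENNReal.ofReal (t ^ (r - 1)) *
      bigE (J c) (t * scJ (J c)) = ∑' x : {x : K // x ∈ (J c).1},
        (if x.1 = 0 then 0 else f c x) := fun c => by
    have := countable_ideal (J c)
    simp_rw [bigE_eq_tsum, ← ENNReal.tsum_mul_left]
    rw [lintegral_tsum]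
    · refine tsum_congr fun x => ?_
      split_ifs <;> simp [hf]
    · intro x
      split_ifs
      · simp
      · exact (hfm c x.1).aemeasurable
  simp_rw [h1]
  rw [hsum, ← ENNReal.tsum_mul_left]
  refine tsum_congr fun I => ?_
  have hcount : Countable (𝓞 K)ˣ := by
    have : Countable K := (Module.finBasis ℚ K).equivFun.toEquiv.injective.countable
    have : Countable (𝓞 K) := (RingOfIntegers.coe_injective (K := K)).countable
    exact Units.val_injective.countable
  simp only [hf]
  rw [← lintegral_tsum (fun u => (hfm _ _).aemeasurable)]
  simp_rw [ENNReal.tsum_mul_left, unfold_units]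
  have h2 : ∀ t : ℝ, ENNReal.ofReal (t ^ (r - 1)) * ((Nat.card (torsion K) : ℝ≥0∞) *
      ∫⁻ z : logSpace K, ENNReal.ofReal (Real.exp (-Real.pi *
        embForm (wt (t * scJ (J (cl I))) z) (gen I)))) = (Nat.card (torsion K) : ℝ≥0∞) *
      (ENNReal.ofReal (t ^ (r - 1)) * ∫⁻ z : logSpace K, ENNReal.ofReal (Real.exp (-Real.pi *
        embForm (wt (t * scJ (J (cl I))) z) (gen I)))) := fun t => by ring
  simp_rw [h2]
  rw [lintegral_const_mul' _ _ (by simp), arch_translate _ (hgen I).1 r (scJ_pos _), (hgen I).2]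
  rw [mul_assoc, mul_comm (ENNReal.ofReal _)]
  congr 3
  have hn := (finrank_pos' (K := K))
  have hc := covolK_pos (K := K)
  have hA := absNorm_pos (J (cl I))
  have hI : (0 : ℝ) < Ideal.absNorm I.1 := by
    have : Ideal.absNorm I.1 ≠ 0 := by rw [Ne, Ideal.absNorm_eq_zero_iff]; exact I.2
    positivity
  have e1 : scJ (J (cl I)) * (Ideal.absNorm I.1 * (FractionalIdeal.absNorm (J (cl I)).1 : ℝ)) ^
      (2 / (Module.finrank ℚ K : ℝ)) =
      ((Ideal.absNorm I.1 : ℝ) / covolK K) ^ (2 / (Module.finrank ℚ K : ℝ)) := by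
    rw [scJ, cJ, neg_div, Real.rpow_neg (by positivity), ← Real.inv_rpow (by positivity),
      ← Real.mul_rpow (by positivity) (by positivity)]
    congr 1
    field_simp
  rw [e1, ← Real.rpow_mul (by positivity)]
  congr 1
  ring

end TotalMellin
end LimDist

namespace LimDist
open scoped nonZeroDivisors ENNReal
open NumberField.Units NumberField.Units.dirichletUnitTheorem NumberField.InfinitePlace

section FEPair

lemma mellin_strip_bound (f : ℝ → ℂ) (A B : ℝ) (hA : MellinConvergent f A)
    (hB : MellinConvergent f B) : ∃ M, ∀ s : ℂ, A ≤ s.re → s.re ≤ B → ‖mellin f s‖ ≤ M := by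
  have hn : ∀ (s : ℂ) (t : ℝ), t ∈ Set.Ioi (0 : ℝ) →
      ‖(t : ℂ) ^ (s - 1) • f t‖ = t ^ (s.re - 1) * ‖f t‖ := fun s t ht => by
    rw [norm_smul, Complex.norm_cpow_eq_rpow_re_of_pos ht]; simp
  refine ⟨(∫ t in Set.Ioi (0 : ℝ), ‖(t : ℂ) ^ ((A : ℂ) - 1) • f t‖) +
    ∫ t in Set.Ioi (0 : ℝ), ‖(t : ℂ) ^ ((B : ℂ) - 1) • f t‖, fun s h1 h2 => ?_⟩
  rw [← integral_add hA.norm hB.norm]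
  refine norm_integral_le_of_norm_le (hA.norm.add hB.norm) ?_
  filter_upwards [ae_restrict_mem measurableSet_Ioi] with t ht
  rw [hn _ _ ht, hn _ _ ht, hn _ _ ht, ← add_mul]
  refine mul_le_mul_of_nonneg_right ?_ (norm_nonneg _)
  have ht0 : 0 < t := ht
  simp only [ofReal_re]
  rcases le_total 1 t with h | h
  · have := Real.rpow_le_rpow_of_exponent_le h (sub_le_sub_right h2 1)
    have := Real.rpow_nonneg ht0.le (A - 1)
    linarith
  · have := Real.rpow_le_rpow_of_exponent_ge ht0 h (sub_le_sub_right h1 1)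
    have := Real.rpow_nonneg ht0.le (B - 1)
    linarith

variable {K : Type} [Field K] [NumberField K]

/-- The volume of the fundamental domain. -/
def volD (K : Type) [Field K] [NumberField K] : ℝ := (volume (unitDom K)).toReal

lemma volD_pos : 0 < volD K := by
  refine ENNReal.toReal_pos ?_ volume_unitDom_lt_top.ne
  intro h
  have h1 := (isAddFundamentalDomain_unitDom (K := K)).lintegral_eq_tsum'' (fun _ => 1)
  have h2 : volume (Set.univ : Set (logSpace K)) = 0 := by simpa [h] using h1
  exact (NeZero.ne (volume : Measure (logSpace K))) (Measure.measure_univ_eq_zero.mp h2)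

/-- The nonconstant part of the Hecke theta function of a class family. -/
def famE (J : ClassGroup (𝓞 K) → (FractionalIdeal (𝓞 K)⁰ K)ˣ) (t : ℝ) : ℝ :=
  ∑ c, (bigE (J c) (t * scJ (J c))).toReal

/-- The Hecke theta function of a class family. -/
def famF (J : ClassGroup (𝓞 K) → (FractionalIdeal (𝓞 K)⁰ K)ˣ) (t : ℝ) : ℝ :=
  Fintype.card (ClassGroup (𝓞 K)) * volD K + famE J t

lemma famF_eq (J : ClassGroup (𝓞 K) → (FractionalIdeal (𝓞 K)⁰ K)ˣ) {t : ℝ} (ht : 0 < t) :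
    famF J t = ∑ c, hatF (J c) t := by
  unfold famF famE hatF
  have : ∀ c, bigF (J c) (t * cJ (J c) ^ (-2 / (Module.finrank ℚ K : ℝ))) =
      volD K + (bigE (J c) (t * scJ (J c))).toReal := fun c =>
    bigF_eq (J c) (mul_pos ht (scJ_pos (J c)))
  simp_rw [this]
  rw [Finset.sum_add_distrib]
  simp

lemma measurable_famE (J : ClassGroup (𝓞 K) → (FractionalIdeal (𝓞 K)⁰ K)ˣ) :
    Measurable (famE J) :=
  Finset.measurable_fun_sum _ fun c _ =>
    ((measurable_bigE (J c)).comp (measurable_id.mul_const _)).ennreal_toReal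

lemma famE_nonneg (J : ClassGroup (𝓞 K) → (FractionalIdeal (𝓞 K)⁰ K)ˣ) (t : ℝ) :
    0 ≤ famE J t := Finset.sum_nonneg fun _ _ => ENNReal.toReal_nonneg

lemma famE_decay (J : ClassGroup (𝓞 K) → (FractionalIdeal (𝓞 K)⁰ K)ˣ) (t₀ : ℝ) (ht₀ : 0 < t₀) :
    ∃ A c : ℝ, 0 < c ∧ 0 ≤ A ∧ ∀ t, t₀ ≤ t → famE J t ≤ A * Real.exp (-c * t) := by
  have h := fun k => bigE_decay (J k) (t₀ * scJ (J k)) (mul_pos ht₀ (scJ_pos _))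
  choose A c hc hA h using h
  obtain ⟨c₀, hc₀, hle⟩ : ∃ c₀ > 0, ∀ k, c₀ ≤ c k * scJ (J k) := by
    obtain ⟨k₀, -, hk₀⟩ := Finset.exists_min_image Finset.univ (fun k => c k * scJ (J k))
      Finset.univ_nonempty
    exact ⟨_, mul_pos (hc k₀) (scJ_pos _), fun k => hk₀ k (Finset.mem_univ k)⟩
  refine ⟨∑ k, A k, c₀, hc₀, Finset.sum_nonneg fun k _ => hA k, fun t ht => ?_⟩
  rw [famE, Finset.sum_mul]
  refine Finset.sum_le_sum fun k _ => ?_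
  refine ENNReal.toReal_le_of_le_ofReal (mul_nonneg (hA k) (Real.exp_pos _).le) ?_
  refine (h k _ (mul_le_mul_of_nonneg_right ht (scJ_pos _).le)).trans ?_
  refine ENNReal.ofReal_le_ofReal (mul_le_mul_of_nonneg_left ?_ (hA k))
  apply Real.exp_le_exp.mpr
  have := mul_le_mul_of_nonneg_right (hle k) (ht₀.le.trans ht)
  linarith

lemma famF_locInt (J : ClassGroup (𝓞 K) → (FractionalIdeal (𝓞 K)⁰ K)ˣ) :
    LocallyIntegrableOn (fun t => (famF J t : ℂ)) (Set.Ioi 0) := by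
  intro x hx
  have hx0 : 0 < x := hx
  obtain ⟨A, c, hc, hA, h⟩ := famE_decay J (x / 2) (by positivity)
  refine ⟨Set.Ioo (x / 2) (2 * x), mem_nhdsWithin_of_mem_nhds (Ioo_mem_nhds (by linarith)
    (by linarith)), ?_⟩
  refine Measure.integrableOn_of_bounded (M := Fintype.card (ClassGroup (𝓞 K)) * volD K + A)
    (by simp) ?_ ?_
  · exact (Complex.measurable_ofReal.comp
      (measurable_const.add (measurable_famE J))).aestronglyMeasurable
  · filter_upwards [ae_restrict_mem measurableSet_Ioo] with t ht
    have h0 := famE_nonneg J t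
    have hv := volD_pos (K := K)
    rw [Complex.norm_real, Real.norm_of_nonneg (by unfold famF; positivity), famF]
    have h1 := h t ht.1.le
    have h2 : Real.exp (-c * t) ≤ 1 := Real.exp_le_one_iff.mpr (by nlinarith [ht.1])
    nlinarith

lemma famE_isBigO (J : ClassGroup (𝓞 K) → (FractionalIdeal (𝓞 K)⁰ K)ˣ) (r : ℝ) :
    (fun t => (famF J t : ℂ) - ((Fintype.card (ClassGroup (𝓞 K)) * volD K : ℝ) : ℂ))
      =O[atTop] (fun t : ℝ => t ^ r) := by
  obtain ⟨A, c, hc, hA, h⟩ := famE_decay J 1 one_pos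
  have h1 : (fun t => (famF J t : ℂ) - ((Fintype.card (ClassGroup (𝓞 K)) * volD K : ℝ) : ℂ))
      =O[atTop] (fun t : ℝ => Real.exp (-c * t)) := by
    refine Asymptotics.IsBigO.of_bound A ?_
    filter_upwards [eventually_ge_atTop 1] with t ht
    rw [← Complex.ofReal_sub, famF, add_sub_cancel_left, Complex.norm_real,
      Real.norm_of_nonneg (famE_nonneg J t), Real.norm_of_nonneg (Real.exp_pos _).le]
    exact h t ht
  exact h1.trans (isLittleO_exp_neg_mul_rpow_atTop hc r).isBigO

/-- Two class families dual to each other give a functional equation pair. -/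
def famPair (J J' : ClassGroup (𝓞 K) → (FractionalIdeal (𝓞 K)⁰ K)ˣ)
    (hd : ∀ c, (J' c).1 = FractionalIdeal.dual ℤ ℚ (J c).1) : WeakFEPair ℂ where
  f t := famF J t
  g t := famF J' t
  k := (Module.finrank ℚ K : ℝ) / 2
  ε := 1
  f₀ := ((Fintype.card (ClassGroup (𝓞 K)) * volD K : ℝ) : ℂ)
  g₀ := ((Fintype.card (ClassGroup (𝓞 K)) * volD K : ℝ) : ℂ)
  hf_int := famF_locInt J
  hg_int := famF_locInt J'
  hk := by have := finrank_pos' (K := K); positivity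
  hε := one_ne_zero
  h_feq t ht := by
    have ht' : 0 < t := ht
    rw [famF_eq J (by positivity), famF_eq J' ht']
    simp_rw [fun c => hatF_inversion (J c) (J' c) (hd c) ht']
    rw [← Finset.mul_sum]
    push_cast
    simp
  hf_top := famE_isBigO J
  hg_top := famE_isBigO J'

lemma exists_famPair : ∃ J J' : ClassGroup (𝓞 K) → (FractionalIdeal (𝓞 K)⁰ K)ˣ,
    IsClassFam J ∧ IsClassFam J' ∧ ∀ c, (J' c).1 = FractionalIdeal.dual ℤ ℚ (J c).1 := by
  have hs : ∀ c : ClassGroup (𝓞 K), ∃ J : (FractionalIdeal (𝓞 K)⁰ K)ˣ, ClassGroup.mk K J = c :=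
    fun c => by
      obtain ⟨I, rfl⟩ := ClassGroup.mk0_surjective c
      exact ⟨FractionalIdeal.mk0 K I, ClassGroup.mk_mk0 K I⟩
  choose J hJ using hs
  have hne : FractionalIdeal.dual ℤ ℚ (1 : FractionalIdeal (𝓞 K)⁰ K) ≠ 0 :=
    FractionalIdeal.dual_ne_zero ℤ ℚ one_ne_zero
  set δ : (FractionalIdeal (𝓞 K)⁰ K)ˣ := Units.mk0 _ hne
  refine ⟨J, fun c => δ * (J c)⁻¹, ?_, ?_, fun c => ?_⟩
  · simp only [IsClassFam, hJ]; exact Function.bijective_id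
  · have h : (fun c => ClassGroup.mk K (δ * (J c)⁻¹)) = Equiv.divLeft (ClassGroup.mk K δ) :=
      funext fun c => by rw [map_mul, map_inv, hJ, Equiv.divLeft_apply, div_eq_mul_inv]
    rw [IsClassFam, h]
    exact (Equiv.divLeft (ClassGroup.mk K δ)).bijective
  · rw [FractionalIdeal.dual_eq_mul_inv]
    simp [δ]

end FEPair
end LimDist

namespace LimDist
open scoped nonZeroDivisors ENNReal
open NumberField.Units NumberField.Units.dirichletUnitTheorem NumberField.InfinitePlace

section FE
variable {K : Type} [Field K] [NumberField K]

/-- The torsion order times the archimedean factor. -/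
def archW (K : Type) [Field K] [NumberField K] (r : ℝ) : ℝ :=
  Nat.card (torsion K) * (archPhi K r).toReal

/-- The archimedean factor in product form. -/
def gamR (K : Type) [Field K] [NumberField K] (s : ℝ) : ℝ :=
  ∏ w : InfinitePlace K, (1 / (Real.pi * mult w)) ^ (mult w * s / 2) * Real.Gamma (mult w * s / 2)

lemma gamR_pos {s : ℝ} (hs : 0 < s) : 0 < gamR K s :=
  Finset.prod_pos fun w _ => by
    have := mult_pos' w
    have := Real.Gamma_pos_of_pos (show 0 < mult w * s / 2 by positivity)
    positivity

lemma exists_archW : ∃ c : ℝ, 0 < c ∧ ∀ s : ℝ, 0 < s →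
    archPhi K (Module.finrank ℚ K * s / 2) ≠ ⊤ ∧ archPhi K (Module.finrank ℚ K * s / 2) ≠ 0 ∧
    archW K (Module.finrank ℚ K * s / 2) = c * gamR K s := by
  obtain ⟨c, hc, h⟩ := exists_archPhi (K := K)
  have hn := finrank_pos' (K := K)
  have hW : (0 : ℝ) < Nat.card (torsion K) := by exact_mod_cast Nat.card_pos
  refine ⟨Nat.card (torsion K) * c, by positivity, fun s hs => ?_⟩
  have hg := gamR_pos (K := K) hs
  have e : archPhi K (Module.finrank ℚ K * s / 2) = ENNReal.ofReal (c * gamR K s) := by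
    rw [h _ (by positivity), gamR]
    congr 2
    refine Finset.prod_congr rfl fun w _ => ?_
    have : (Module.finrank ℚ K : ℝ) * s / 2 * mult w / Module.finrank ℚ K = mult w * s / 2 := by
      field_simp
    rw [this]
  rw [archW, e, ENNReal.toReal_ofReal (by positivity)]
  exact ⟨ENNReal.ofReal_ne_top, by simpa using mul_pos hc hg, by ring⟩

lemma famPair_real (J J' : ClassGroup (𝓞 K) → (FractionalIdeal (𝓞 K)⁰ K)ˣ)
    (hd : ∀ c, (J' c).1 = FractionalIdeal.dual ℤ ℚ (J c).1) (hJ : IsClassFam J) {s : ℝ}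
    (hs : 1 < s) :
    (Summable fun I : {I : Ideal (𝓞 K) // I ≠ ⊥} =>
      ((Ideal.absNorm I.1 : ℝ) / covolK K) ^ (-s)) ∧
    (famPair J J' hd).Λ ((Module.finrank ℚ K * s / 2 : ℝ) : ℂ) =
      ((archW K (Module.finrank ℚ K * s / 2) * ∑' I : {I : Ideal (𝓞 K) // I ≠ ⊥},
        ((Ideal.absNorm I.1 : ℝ) / covolK K) ^ (-s) : ℝ) : ℂ) := by
  have hn := finrank_pos' (K := K)
  have hcv := covolK_pos (K := K)
  obtain ⟨c, hc, hW⟩ := exists_archW (K := K)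
  obtain ⟨hW1, hW2, -⟩ := hW s (by linarith)
  set r : ℝ := Module.finrank ℚ K * s / 2 with hr
  have hk : (famPair J J' hd).k < ((r : ℝ) : ℂ).re := by
    simp only [famPair, ofReal_re, hr]
    nlinarith
  obtain ⟨hconv, hval⟩ := (famPair J J' hd).hasMellin hk
  have e1 : ∀ t ∈ Set.Ioi (0 : ℝ), (t : ℂ) ^ ((r : ℂ) - 1) •
      ((famPair J J' hd).f t - (famPair J J' hd).f₀) = ((t ^ (r - 1) * famE J t : ℝ) : ℂ) :=
    fun t ht => by
      have ht0 : 0 < t := ht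
      simp only [famPair, famF]
      rw [← Complex.ofReal_sub, add_sub_cancel_left, smul_eq_mul, ofReal_mul,
        ofReal_cpow ht0.le]
      simp
  have hintg : IntegrableOn (fun t : ℝ => t ^ (r - 1) * famE J t) (Set.Ioi 0) := by
    have h1 : IntegrableOn (fun t : ℝ => ((t ^ (r - 1) * famE J t : ℝ) : ℂ)) (Set.Ioi 0) :=
      IntegrableOn.congr_fun hconv e1 measurableSet_Ioi
    exact h1.re
  have h0 : 0 ≤ᵐ[volume.restrict (Set.Ioi (0 : ℝ))] fun t : ℝ => t ^ (r - 1) * famE J t := by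
    filter_upwards [ae_restrict_mem measurableSet_Ioi] with t ht
    exact mul_nonneg (Real.rpow_nonneg (le_of_lt ht) _) (famE_nonneg J t)
  have hlint : ∫⁻ t in Set.Ioi (0 : ℝ), ENNReal.ofReal (t ^ (r - 1) * famE J t) =
      (Nat.card (torsion K) : ℝ≥0∞) * archPhi K r *
        ∑' I : {I : Ideal (𝓞 K) // I ≠ ⊥}, ENNReal.ofReal
          (((Ideal.absNorm I.1 : ℝ) / covolK K) ^ (-s)) := by
    have e2 : 2 * r / (Module.finrank ℚ K : ℝ) = s := by rw [hr]; field_simp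
    rw [← e2, ← mellin_total J hJ r, tsum_fintype, ← lintegral_finsetSum]
    · refine setLIntegral_congr_fun measurableSet_Ioi fun t ht => ?_
      have ht0 : 0 < t := ht
      rw [famE, ENNReal.ofReal_mul (by positivity), ENNReal.ofReal_sum_of_nonneg
        (fun _ _ => ENNReal.toReal_nonneg), Finset.mul_sum]
      refine Finset.sum_congr rfl fun k _ => ?_
      rw [ENNReal.ofReal_toReal (bigE_ne_top _ (mul_pos ht0 (scJ_pos _)))]
    · intro k _
      exact (measurable_rpow_sub r).mul
        ((measurable_bigE (J k)).comp (measurable_id.mul_const _))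
  have hcard : (Nat.card (torsion K) : ℝ≥0∞) ≠ 0 := by
    exact_mod_cast (Nat.card_pos (α := torsion K)).ne'
  have hfin : ∑' I : {I : Ideal (𝓞 K) // I ≠ ⊥}, ENNReal.ofReal
      (((Ideal.absNorm I.1 : ℝ) / covolK K) ^ (-s)) ≠ ⊤ := by
    intro htop
    rw [htop, ENNReal.mul_top (mul_ne_zero hcard hW2)] at hlint
    have := hintg.lintegral_lt_top
    rw [hlint] at this
    exact lt_irrefl _ this
  have hsum : Summable fun I : {I : Ideal (𝓞 K) // I ≠ ⊥} =>
      ((Ideal.absNorm I.1 : ℝ) / covolK K) ^ (-s) := by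
    have := ENNReal.summable_toReal hfin
    refine this.congr fun I => ENNReal.toReal_ofReal ?_
    positivity
  refine ⟨hsum, ?_⟩
  have e3 : ∫ t in Set.Ioi (0 : ℝ), ((t ^ (r - 1) * famE J t : ℝ) : ℂ) =
      ((∫ t in Set.Ioi (0 : ℝ), t ^ (r - 1) * famE J t : ℝ) : ℂ) := integral_complex_ofReal
  rw [← hval, mellin, setIntegral_congr_fun measurableSet_Ioi e1, e3,
    integral_eq_lintegral_of_nonneg_ae h0 hintg.aestronglyMeasurable, hlint, ENNReal.toReal_mul,
    ENNReal.toReal_mul, archW, ← ENNReal.ofReal_tsum_of_nonneg (fun I => by positivity) hsum,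
    ENNReal.toReal_ofReal (tsum_nonneg fun I => by positivity)]
  simp

end FE
end LimDist

namespace LimDist
open scoped nonZeroDivisors ENNReal
open NumberField.Units NumberField.Units.dirichletUnitTheorem NumberField.InfinitePlace

section FE

lemma frequently_of_real {P : ℂ → Prop} (h : ∀ x : ℝ, 1 < x → P x) : ∃ᶠ z in 𝓝[≠] (2 : ℂ), P z := by
  have ht : Tendsto (fun x : ℝ => (x : ℂ)) (𝓝[≠] 2) (𝓝[≠] 2) := by
    refine tendsto_nhdsWithin_iff.2 ⟨?_, ?_⟩
    · have : Tendsto (fun x : ℝ => (x : ℂ)) (𝓝 2) (𝓝 ((2 : ℝ) : ℂ)) :=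
        continuous_ofReal.tendsto 2
      simpa using this.mono_left nhdsWithin_le_nhds
    · filter_upwards [self_mem_nhdsWithin] with x hx h2
      have h3 : (x : ℂ) = 2 := h2
      exact hx (show x = 2 by exact_mod_cast h3)
  refine ht.frequently (Eventually.frequently ?_)
  filter_upwards [nhdsWithin_le_nhds (lt_mem_nhds (by norm_num : (1 : ℝ) < 2))] with x hx
  exact h x hx

lemma entire_eq_of_real {f g : ℂ → ℂ} (hf : Differentiable ℂ f) (hg : Differentiable ℂ g)
    (h : ∀ x : ℝ, 1 < x → f x = g x) : f = g :=
  AnalyticOnNhd.eq_of_frequently_eq (z₀ := 2) (fun z _ => hf.analyticAt z)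
    (fun z _ => hg.analyticAt z) (frequently_of_real h)

variable {K : Type} [Field K] [NumberField K]

/-- The reciprocal of the archimedean factor. -/
def invGam (K : Type) [Field K] [NumberField K] (s : ℂ) : ℂ :=
  (Gammaℝ s)⁻¹ ^ nrRealPlaces K * (Gammaℂ s)⁻¹ ^ nrComplexPlaces K

lemma differentiable_Gammaℂ_inv' : Differentiable ℂ fun s => (Gammaℂ s)⁻¹ := by
  have : (fun s => (Gammaℂ s)⁻¹) = fun s => 2⁻¹ * (2 * Real.pi : ℂ) ^ s * (Gamma s)⁻¹ := by
    funext s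
    rw [Gammaℂ_def, mul_inv, mul_inv, ← cpow_neg, neg_neg]
  rw [this]
  have h2 : (2 * Real.pi : ℂ) ≠ 0 := by simp [Real.pi_ne_zero]
  have h3 : Differentiable ℂ fun s : ℂ => (2 * Real.pi : ℂ) ^ s := fun s =>
    (differentiableAt_id.const_cpow (Or.inl h2))
  exact (h3.const_mul _).mul differentiable_one_div_Gamma

lemma differentiable_invGam : Differentiable ℂ (invGam K) :=
  (differentiable_Gammaℝ_inv.pow _).mul (differentiable_Gammaℂ_inv'.pow _)

lemma gamR_mul_invGam {s : ℝ} (hs : 0 < s) :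
    (gamR K s : ℂ) * invGam K s = 2⁻¹ ^ nrComplexPlaces K := by
  have e : (gamR K s : ℂ) = (Gammaℝ s) ^ nrRealPlaces K * (2⁻¹ * Gammaℂ s) ^ nrComplexPlaces K := by
    rw [gamR, ofReal_prod, ← Finset.prod_mul_prod_compl (Finset.univ.filter
      fun w : InfinitePlace K => w.IsReal)]
    congr 1
    · rw [nrRealPlaces, Fintype.card_subtype]
      refine Finset.prod_eq_pow_card fun w hw => ?_
      have hw' : IsReal w := (Finset.mem_filter.1 hw).2
      rw [mult, if_pos hw', Gammaℝ_def, ofReal_mul, Complex.ofReal_cpow (by positivity),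
        ← Complex.Gamma_ofReal]
      push_cast
      rw [one_mul, mul_one, one_div, inv_cpow _ _ (by
        rw [arg_ofReal_of_nonneg Real.pi_pos.le]; exact Real.pi_pos.ne), ← cpow_neg]
      congr 2
      ring
    · have hc : Finset.card ((Finset.univ.filter fun w : InfinitePlace K => w.IsReal)ᶜ) =
          nrComplexPlaces K := by
        rw [nrComplexPlaces, Fintype.card_subtype]
        congr 1
        ext w
        simp [not_isReal_iff_isComplex]
      rw [← hc]
      refine Finset.prod_eq_pow_card fun w hw => ?_
      have hw' : ¬ IsReal w := by simpa using hw
      rw [mult, if_neg hw', Gammaℂ_def, ofReal_mul, Complex.ofReal_cpow (by positivity),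
        ← Complex.Gamma_ofReal]
      push_cast
      have e2 : (2 * Real.pi : ℂ) = ((2 * Real.pi : ℝ) : ℂ) := by push_cast; ring
      rw [mul_comm (Real.pi : ℂ), one_div, e2, inv_cpow _ _ (by
        rw [arg_ofReal_of_nonneg (by positivity)]; exact Real.pi_pos.ne), ← cpow_neg,
        mul_div_cancel_left₀ _ (two_ne_zero' ℂ)]
      ring
  rw [e, invGam, mul_pow]
  have h1 : Gammaℝ s ≠ 0 := Gammaℝ_ne_zero_of_re_pos (by simpa)
  have h2 : Gammaℂ s ≠ 0 := by
    rw [Gammaℂ_def]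
    refine mul_ne_zero (mul_ne_zero two_ne_zero ?_) (Gamma_ne_zero_of_re_pos (by simpa))
    exact fun h => by simp [cpow_eq_zero_iff, Real.pi_ne_zero] at h
  have h1' : Gammaℝ s ^ nrRealPlaces K ≠ 0 := pow_ne_zero _ h1
  have h2' : Gammaℂ s ^ nrComplexPlaces K ≠ 0 := pow_ne_zero _ h2
  simp only [inv_pow]
  rw [mul_mul_mul_comm, mul_inv_cancel₀ h1', mul_assoc, mul_inv_cancel₀ h2', one_mul, mul_one]

lemma famPair_symm (J J' : ClassGroup (𝓞 K) → (FractionalIdeal (𝓞 K)⁰ K)ˣ)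
    (hd : ∀ c, (J' c).1 = FractionalIdeal.dual ℤ ℚ (J c).1)
    (hd' : ∀ c, (J c).1 = FractionalIdeal.dual ℤ ℚ (J' c).1) :
    (famPair J J' hd).symm = famPair J' J hd' := by
  simp only [WeakFEPair.symm, famPair]
  congr 1
  exact inv_one

theorem exists_completed {Z : ℂ → ℂ} (hZd : ∀ s : ℂ, s ≠ 1 → DifferentiableAt ℂ Z s)
    (hZ : ∀ s : ℂ, 1 < s.re →
      Z s = ∑' I : {I : Ideal (𝓞 K) // I ≠ ⊥}, (Ideal.absNorm I.1 : ℂ) ^ (-s)) :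
    (∀ s : ℝ, 1 < s → Summable fun I : {I : Ideal (𝓞 K) // I ≠ ⊥} =>
      (Ideal.absNorm I.1 : ℝ) ^ (-s)) ∧
    ∃ (d a : ℝ) (L : ℂ → ℂ), 0 < d ∧ 0 < a ∧ Differentiable ℂ L ∧ (∀ s, L (1 - s) = L s) ∧
      (∀ A B : ℝ, ∃ M : ℝ, ∀ s : ℂ, A ≤ s.re → s.re ≤ B → ‖L s‖ ≤ M) ∧
      ∀ s : ℂ, s ≠ 0 → s ≠ 1 → (L s - a / s - a / (1 - s)) * invGam K s = (d : ℂ) ^ s * Z s := by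
  have hn := finrank_pos' (K := K)
  have hcv := covolK_pos (K := K)
  set n : ℝ := (Module.finrank ℚ K : ℝ) with hndef
  obtain ⟨J, J', hJ, hJ', hd⟩ := exists_famPair (K := K)
  have hd' : ∀ c, (J c).1 = FractionalIdeal.dual ℤ ℚ (J' c).1 := fun c => by
    rw [hd, FractionalIdeal.dual_dual]
  set P := famPair J J' hd with hP
  have hsumm : ∀ s : ℝ, 1 < s → Summable fun I : {I : Ideal (𝓞 K) // I ≠ ⊥} =>
      (Ideal.absNorm I.1 : ℝ) ^ (-s) := fun s hs => by
    refine ((famPair_real J J' hd hJ hs).1.mul_left (covolK K ^ (-s))).congr fun I => ?_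
    rw [← Real.mul_rpow hcv.le (by positivity), mul_div_cancel₀ _ hcv.ne']
  refine ⟨hsumm, ?_⟩
  obtain ⟨c, hc, hcW⟩ := exists_archW (K := K)
  set A₀ : ℝ := Fintype.card (ClassGroup (𝓞 K)) * volD K with hA₀
  have hA₀pos : 0 < A₀ := mul_pos (by exact_mod_cast Fintype.card_pos) volD_pos
  set c' : ℝ := c * 2⁻¹ ^ nrComplexPlaces K with hc'
  have hc'pos : 0 < c' := by positivity
  have hPk : P.k = n / 2 := rfl
  have hPΛ : ∀ s : ℂ, s ≠ 0 → s ≠ 1 → P.Λ₀ (n * s / 2) = P.Λ (n * s / 2) + (2 * A₀ / n : ℝ) / s +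
      (2 * A₀ / n : ℝ) / (1 - s) := fun s h0 h1 => by
    have h1' : 1 - s ≠ 0 := sub_ne_zero.2 h1.symm
    have hn' : (n : ℂ) ≠ 0 := by exact_mod_cast hn.ne'
    have h2 : (n : ℂ) / 2 - n * s / 2 ≠ 0 := by
      have : (n : ℂ) / 2 - n * s / 2 = n * (1 - s) / 2 := by ring
      rw [this]; exact div_ne_zero (mul_ne_zero hn' h1') two_ne_zero
    rw [P.Λ₀_eq, hPk]
    simp only [hP, famPair, smul_eq_mul, ← hA₀]
    push_cast
    rw [show (n : ℂ) / 2 - n * s / 2 = n * (1 - s) / 2 by ring]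
    field_simp
  have hdiff : Differentiable ℂ fun s : ℂ => P.Λ₀ (n * s / 2) :=
    P.differentiable_Λ₀.comp (by fun_prop)
  have hsymm : P.symm = famPair J' J hd' := famPair_symm J J' hd hd'
  have hsymmΛ : ∀ s : ℝ, 1 < s → P.symm.Λ (n * s / 2) = P.Λ (n * s / 2) := fun s hs => by
    have h1 := (famPair_real J J' hd hJ hs).2
    have h2 := (famPair_real J' J hd' hJ' hs).2
    have e4 : ((n * s / 2 : ℝ) : ℂ) = n * s / 2 := by push_cast; ring
    rw [← hndef, e4] at h1 h2
    rw [hsymm, h2, hP, h1]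
  have hsymm₀ : (fun s : ℂ => P.symm.Λ₀ (n * s / 2)) = fun s : ℂ => P.Λ₀ (n * s / 2) := by
    refine entire_eq_of_real (P.symm.differentiable_Λ₀.comp (by fun_prop)) hdiff fun s hs => ?_
    rw [WeakFEPair.Λ₀_eq, WeakFEPair.Λ₀_eq, hsymmΛ s hs]
    simp only [hP, famPair, WeakFEPair.symm, inv_one]
  set L : ℂ → ℂ := fun s => P.Λ₀ (n * s / 2) / c' with hL
  have hLd : Differentiable ℂ L := hdiff.div_const _
  have hc'0 : (c' : ℂ) ≠ 0 := by exact_mod_cast hc'pos.ne'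
  refine ⟨covolK K, 2 * A₀ / n / c', L, hcv, by positivity, hLd, fun s => ?_, fun A B => ?_, ?_⟩
  · simp only [hL]
    have h1 := P.functional_equation₀ (n * s / 2)
    have h2 := congrFun hsymm₀ s
    rw [show P.symm.Λ₀ (n * s / 2) = P.Λ₀ (n * s / 2) from h2, hPk] at h1
    have h3 : P.ε = 1 := rfl
    rw [h3, one_smul] at h1
    rw [← h1]
    push_cast
    ring_nf
  · have hconv : ∀ s, MellinConvergent P.f_modif s := fun s =>
      (P.isStrongFEPair_toStrongFEPair.hasMellin s).1
    obtain ⟨M, hM⟩ := mellin_strip_bound P.f_modif (n * A / 2) (n * B / 2) (hconv _) (hconv _)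
    refine ⟨M / c', fun s hA hB => ?_⟩
    simp only [hL]
    rw [norm_div, norm_real, Real.norm_of_nonneg hc'pos.le]
    refine div_le_div_of_nonneg_right (hM _ ?_ ?_) hc'pos.le
    · have : ((n : ℂ) * s / 2).re = n * s.re / 2 := by simp
      rw [this]; gcongr
    · have : ((n : ℂ) * s / 2).re = n * s.re / 2 := by simp
      rw [this]; gcongr
  · set a : ℝ := 2 * A₀ / n / c' with ha
    have hcv0 : (covolK K : ℂ) ≠ 0 := by exact_mod_cast hcv.ne'
    have key : Set.EqOn (fun s => (L s * (s * (1 - s)) - a) * invGam K s)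
        (fun s => (covolK K : ℂ) ^ s * Z s * (s * (1 - s))) {1}ᶜ := by
      refine AnalyticOnNhd.eqOn_of_preconnected_of_frequently_eq (z₀ := 2) ?_ ?_
        (isConnected_compl_singleton_of_one_lt_rank (by simp) _).isPreconnected (by simp) ?_
      · refine fun z _ => Differentiable.analyticAt ?_ z
        exact ((hLd.mul (by fun_prop)).sub_const _).mul differentiable_invGam
      · refine DifferentiableOn.analyticOnNhd (fun z hz => ?_) isOpen_compl_singleton
        have h1 := hZd z hz
        have h2 : DifferentiableAt ℂ (fun s : ℂ => (covolK K : ℂ) ^ s) z :=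
          differentiableAt_id.const_cpow (Or.inl hcv0)
        exact ((h2.mul h1).mul (by fun_prop)).differentiableWithinAt
      · refine frequently_of_real fun s hs => ?_
        have hs0 : (s : ℂ) ≠ 0 := by exact_mod_cast (by linarith : s ≠ 0)
        have hs1 : (s : ℂ) ≠ 1 := by exact_mod_cast (by linarith : s ≠ 1)
        have h1' : 1 - (s : ℂ) ≠ 0 := sub_ne_zero.2 hs1.symm
        have h1 := (famPair_real J J' hd hJ hs).2
        obtain ⟨-, -, hW⟩ := hcW s (by linarith)
        rw [hW] at h1
        have hts : ∑' I : {I : Ideal (𝓞 K) // I ≠ ⊥}, ((Ideal.absNorm I.1 : ℝ) / covolK K) ^ (-s) =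
            covolK K ^ s * ∑' I : {I : Ideal (𝓞 K) // I ≠ ⊥}, (Ideal.absNorm I.1 : ℝ) ^ (-s) := by
          rw [← tsum_mul_left]
          congr 1
          funext I
          rw [Real.div_rpow (by positivity) hcv.le, Real.rpow_neg hcv.le, div_inv_eq_mul, mul_comm]
        have hZs : Z s = ((∑' I : {I : Ideal (𝓞 K) // I ≠ ⊥}, (Ideal.absNorm I.1 : ℝ) ^ (-s) : ℝ) : ℂ) := by
          rw [hZ s (by simpa), ofReal_tsum]
          congr 1
          funext I
          rw [ofReal_cpow (by positivity)]
          push_cast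
          rfl
        have hg := gamR_mul_invGam (K := K) (s := s) (by linarith)
        have h3 := hPΛ s hs0 hs1
        have e4 : ((n * s / 2 : ℝ) : ℂ) = n * s / 2 := by push_cast; ring
        rw [← hndef, e4] at h1
        rw [h1, hts] at h3
        simp only [hL]
        rw [h3]
        simp only [ofReal_mul]
        rw [← hZs, ofReal_cpow hcv.le, ha, hc']
        have h20 : ((2 : ℂ)⁻¹ ^ nrComplexPlaces K) ≠ 0 := pow_ne_zero _ (inv_ne_zero two_ne_zero)
        have hc0 : (c : ℂ) ≠ 0 := by exact_mod_cast hc.ne'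
        push_cast
        rw [← hg] at h20 ⊢
        have hg0 : (gamR K s : ℂ) ≠ 0 := left_ne_zero_of_mul h20
        have hi0 : invGam K s ≠ 0 := right_ne_zero_of_mul h20
        field_simp
        ring
    intro s h0 h1
    have h1' : 1 - s ≠ 0 := sub_ne_zero.2 h1.symm
    have := key (show s ∈ ({1}ᶜ : Set ℂ) from h1)
    simp only at this
    have e5 : L s - a / s - a / (1 - s) = (L s * (s * (1 - s)) - a) / (s * (1 - s)) := by
      field_simp
      ring
    rw [e5, div_mul_eq_mul_div, this, mul_div_cancel_right₀ _ (mul_ne_zero h0 h1')]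

end FE
end LimDist

namespace LimDist
section Moebius
variable {K : Type} [Field K] [NumberField K]

/-- The nonzero ideals. -/
abbrev NI (K : Type) [Field K] [NumberField K] : Type := {I : Ideal (𝓞 K) // I ≠ ⊥}

/-- The nonzero prime ideals. -/
abbrev PI (K : Type) [Field K] [NumberField K] : Type := {p : Ideal (𝓞 K) // Prime p}

/-- The product of a finite set of primes. -/
def prodT (T : Finset (PI K)) : Ideal (𝓞 K) := ∏ p ∈ T, p.1

lemma prodT_ne (T : Finset (PI K)) : prodT T ≠ ⊥ := by
  rw [prodT, ← Ideal.zero_eq_bot, Finset.prod_ne_zero_iff]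
  exact fun p _ => p.2.ne_zero

lemma factors_prodT (T : Finset (PI K)) :
    UniqueFactorizationMonoid.normalizedFactors (prodT T) = T.1.map Subtype.val := by
  refine UniqueFactorizationMonoid.normalizedFactors_prod_of_prime fun p hp => ?_
  obtain ⟨q, -, rfl⟩ := Multiset.mem_map.1 hp
  exact q.2

lemma prodT_injective : Function.Injective (prodT (K := K)) := fun T S h => by
  have := (factors_prodT T).symm.trans ((congrArg _ h).trans (factors_prodT S))
  exact Finset.val_injective (Multiset.map_injective Subtype.val_injective this)

lemma moebiusK_prodT (T : Finset (PI K)) : moebiusK K (prodT T) = (-1) ^ T.card := by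
  have h : Squarefree (prodT T) := by
    rw [UniqueFactorizationMonoid.squarefree_iff_nodup_normalizedFactors (prodT_ne T),
      factors_prodT]
    exact T.2.map Subtype.val_injective
  rw [moebiusK, if_pos h, UniqueFactorizationMonoid.factors_eq_normalizedFactors, factors_prodT]
  simp

lemma exists_prodT {I : Ideal (𝓞 K)} (hI : I ≠ ⊥) (h : moebiusK K I ≠ 0) : ∃ T, prodT T = I := by
  have hsq : Squarefree I := by
    by_contra hn
    rw [moebiusK, if_neg hn] at h
    exact h rfl
  rw [UniqueFactorizationMonoid.squarefree_iff_nodup_normalizedFactors hI] at hsq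
  have hp : ∀ p ∈ UniqueFactorizationMonoid.normalizedFactors I, Prime p :=
    fun p hp => UniqueFactorizationMonoid.prime_of_normalized_factor p hp
  refine ⟨⟨(UniqueFactorizationMonoid.normalizedFactors I).attach.map fun p => ⟨p.1, hp p.1 p.2⟩,
    (Multiset.nodup_attach.2 hsq).map fun a b hab => Subtype.ext (congrArg (fun x : PI K => x.1) hab)⟩, ?_⟩
  have h2 := UniqueFactorizationMonoid.prod_normalizedFactors_eq hI
  rw [normalize_eq] at h2
  rw [prodT, Finset.prod_eq_multiset_prod, Multiset.map_map]
  simp only [Function.comp_def]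
  rw [Multiset.attach_map_val]
  exact h2

lemma moebiusK_abs_le (I : Ideal (𝓞 K)) : |(moebiusK K I : ℝ)| ≤ 1 := by
  rw [moebiusK]
  split_ifs <;> simp

/-- The primes dividing an ideal. -/
def primesOf (I : NI K) : Finset (PI K) :=
  (UniqueFactorizationMonoid.normalizedFactors I.1).toFinset.preimage Subtype.val
    Subtype.val_injective.injOn

lemma mem_primesOf {I : NI K} {p : PI K} : p ∈ primesOf I ↔ p.1 ∣ I.1 := by
  rw [primesOf, Finset.mem_preimage, Multiset.mem_toFinset,
    UniqueFactorizationMonoid.mem_normalizedFactors_iff' I.2]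
  refine ⟨fun h => h.2.2, fun h => ⟨p.2.irreducible, normalize_eq _, h⟩⟩

lemma prodT_dvd {I : NI K} {T : Finset (PI K)} : prodT T ∣ I.1 ↔ T ⊆ primesOf I := by
  constructor
  · exact fun h p hp => mem_primesOf.2 ((Finset.dvd_prod_of_mem _ hp).trans h)
  · intro h
    have := Finset.prod_primes_dvd (s := T.map ⟨Subtype.val, Subtype.val_injective⟩) I.1
      (fun a ha => by
        obtain ⟨q, -, rfl⟩ := Finset.mem_map.1 ha
        exact q.2)
      (fun a ha => by
        obtain ⟨q, hq, rfl⟩ := Finset.mem_map.1 ha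
        exact mem_primesOf.1 (h hq))
    rwa [Finset.prod_map] at this

/-- The multiplication map. -/
def mulT (x : Finset (PI K) × NI K) : NI K :=
  ⟨prodT x.1 * x.2.1, by
    exact mul_ne_zero (M₀ := Ideal (𝓞 K)) (prodT_ne x.1) x.2.2⟩

/-- The indicator of the unit ideal. -/
def unitInd (I : NI K) : ℂ := if primesOf I = ∅ then 1 else 0

lemma fiber_sum (I : NI K) :
    HasSum (fun x : {x : Finset (PI K) × NI K // mulT x = I} => (-1 : ℂ) ^ x.1.1.card)
      (unitInd I) := by
  rw [unitInd]
  have hex : ∀ T ∈ (primesOf I).powerset, ∃ L : NI K, mulT (T, L) = I := fun T hT => by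
    obtain ⟨L, hL⟩ := prodT_dvd.2 (Finset.mem_powerset.1 hT)
    refine ⟨⟨L, fun h0 => I.2 ?_⟩, Subtype.ext hL.symm⟩
    rw [hL, h0, ← Ideal.zero_eq_bot, mul_zero]
  choose L hL using hex
  let e : (primesOf I).powerset ≃ {x : Finset (PI K) × NI K // mulT x = I} :=
    { toFun := fun T => ⟨(T.1, L T.1 T.2), hL T.1 T.2⟩
      invFun := fun x => ⟨x.1.1, by
        rw [Finset.mem_powerset, ← prodT_dvd]
        exact ⟨x.1.2.1, (congrArg Subtype.val x.2).symm⟩⟩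
      left_inv := fun T => rfl
      right_inv := fun x => by
        refine Subtype.ext (Prod.ext rfl (Subtype.ext ?_))
        have h1 := congrArg Subtype.val (hL x.1.1 (by
          rw [Finset.mem_powerset, ← prodT_dvd]
          exact ⟨x.1.2.1, (congrArg Subtype.val x.2).symm⟩))
        have h2 := congrArg Subtype.val x.2
        exact mul_left_cancel₀ (prodT_ne x.1.1) (h1.trans h2.symm) }
  rw [← e.hasSum_iff]
  have h3 := hasSum_fintype (fun T : (primesOf I).powerset => (-1 : ℂ) ^ T.1.card)
  have h6 : (fun x : {x : Finset (PI K) × NI K // mulT x = I} => (-1 : ℂ) ^ x.1.1.card) ∘ e =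
      fun T : (primesOf I).powerset => (-1 : ℂ) ^ T.1.card := rfl
  rw [h6]
  convert h3 using 1
  rw [Finset.sum_coe_sort (primesOf I).powerset (fun T => (-1 : ℂ) ^ T.card)]
  have h4 := Finset.sum_powerset_neg_one_pow_card (x := primesOf I)
  have h5 := congrArg (fun n : ℤ => (n : ℂ)) h4
  push_cast at h5
  rw [h5]

lemma primesOf_eq_empty {I : NI K} : primesOf I = ∅ ↔ I.1 = ⊤ := by
  constructor
  · intro h
    by_contra h1
    obtain ⟨p, hp, hpI⟩ := WfDvdMonoid.exists_irreducible_factor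
      (by rwa [Ideal.isUnit_iff]) (show I.1 ≠ 0 from I.2)
    have : (⟨p, hp.prime⟩ : PI K) ∈ primesOf I := mem_primesOf.2 hpI
    simp [h] at this
  · intro h
    refine Finset.eq_empty_of_forall_notMem fun p hp => p.2.not_unit ?_
    have h2 := mem_primesOf.1 hp
    rw [h, ← Ideal.one_eq_top] at h2
    exact isUnit_of_dvd_one h2

end Moebius
end LimDist

namespace LimDist
section Dirichlet
variable {K : Type} [Field K] [NumberField K]

lemma absNorm_posN (I : NI K) : 0 < Ideal.absNorm I.1 :=
  Nat.pos_of_ne_zero fun h => I.2 (Ideal.absNorm_eq_zero_iff.1 h)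

/-- `N(I)^{-s}`. -/
def nrm (s : ℂ) (I : Ideal (𝓞 K)) : ℂ := (Ideal.absNorm I : ℂ) ^ (-s)

lemma norm_nrm (s : ℂ) (I : NI K) : ‖nrm s I.1‖ = (Ideal.absNorm I.1 : ℝ) ^ (-s.re) := by
  rw [nrm, Complex.norm_natCast_cpow_of_pos (absNorm_posN I), neg_re]

lemma nrm_mul (s : ℂ) (I J : Ideal (𝓞 K)) : nrm s (I * J) = nrm s I * nrm s J := by
  rw [nrm, nrm, nrm, map_mul, Nat.cast_mul, natCast_mul_natCast_cpow]

variable (hS : ∀ s : ℝ, 1 < s → Summable fun I : NI K => (Ideal.absNorm I.1 : ℝ) ^ (-s))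
include hS

lemma summable_nrm {s : ℂ} (hs : 1 < s.re) : Summable fun I : NI K => ‖nrm s I.1‖ := by
  simp_rw [norm_nrm]; exact hS _ hs

lemma summable_prodT {s : ℂ} (hs : 1 < s.re) :
    Summable fun T : Finset (PI K) => ‖(-1 : ℂ) ^ T.card * nrm s (prodT T)‖ := by
  have := (summable_nrm hS hs).comp_injective
    (i := fun T : Finset (PI K) => (⟨prodT T, prodT_ne T⟩ : NI K))
    fun T S h => prodT_injective (congrArg Subtype.val h)
  refine this.congr fun T => ?_
  simp

lemma tsum_moebius {s : ℂ} (hs : 1 < s.re) :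
    ∑' I : NI K, (moebiusK K I.1 : ℂ) * nrm s I.1 =
      ∑' T : Finset (PI K), (-1 : ℂ) ^ T.card * nrm s (prodT T) := by
  have hi : Function.Injective (fun T : Finset (PI K) => (⟨prodT T, prodT_ne T⟩ : NI K)) :=
    fun T S h => prodT_injective (congrArg Subtype.val h)
  rw [← hi.tsum_eq]
  · simp only [moebiusK_prodT]
    push_cast
    rfl
  · intro I hI
    have : moebiusK K I.1 ≠ 0 := fun h => hI (by simp [h])
    obtain ⟨T, hT⟩ := exists_prodT I.2 this
    exact ⟨T, Subtype.ext hT⟩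

lemma moebius_mul_zeta {s : ℂ} (hs : 1 < s.re) :
    (∑' I : NI K, (moebiusK K I.1 : ℂ) * nrm s I.1) * ∑' I : NI K, nrm s I.1 = 1 := by
  rw [tsum_moebius hS hs, tsum_mul_tsum_of_summable_norm (summable_prodT hS hs)
    (summable_nrm hS hs), ← (Equiv.sigmaFiberEquiv (mulT (K := K))).tsum_eq]
  have hsm : Summable fun x : Finset (PI K) × NI K =>
      ((-1 : ℂ) ^ x.1.card * nrm s (prodT x.1)) * nrm s x.2.1 :=
    summable_mul_of_summable_norm (f := fun T : Finset (PI K) => (-1 : ℂ) ^ T.card * nrm s (prodT T))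
      (g := fun L : NI K => nrm s L.1) (summable_prodT hS hs) (summable_nrm hS hs)
  have h1 : ∀ I : NI K, HasSum (fun x : {x : Finset (PI K) × NI K // mulT x = I} =>
      ((-1 : ℂ) ^ x.1.1.card * nrm s (prodT x.1.1)) * nrm s x.1.2.1)
      (unitInd I * nrm s I.1) := fun I => by
    have h0 := (fiber_sum I).mul_right (nrm s I.1)
    have e : (fun x : {x : Finset (PI K) × NI K // mulT x = I} =>
        ((-1 : ℂ) ^ x.1.1.card * nrm s (prodT x.1.1)) * nrm s x.1.2.1) =
        fun x => (-1 : ℂ) ^ x.1.1.card * nrm s I.1 := funext fun x => by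
      have hx : prodT x.1.1 * x.1.2.1 = I.1 := congrArg Subtype.val x.2
      rw [mul_assoc, ← nrm_mul, hx]
    rw [e]
    exact h0
  have h3 : Summable fun y : (I : NI K) × {x : Finset (PI K) × NI K // mulT x = I} =>
      ((-1 : ℂ) ^ y.2.1.1.card * nrm s (prodT y.2.1.1)) * nrm s y.2.1.2.1 :=
    hsm.comp_injective (Equiv.sigmaFiberEquiv (mulT (K := K))).injective
  have h2 := h3.hasSum.sigma h1
  have h4 := h2.unique (a₂ := 1) ?_
  · exact h4
  have htop : (⊤ : Ideal (𝓞 K)) ≠ ⊥ := top_ne_bot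
  convert hasSum_ite_eq (⟨⊤, htop⟩ : NI K) (1 : ℂ) using 2 with I
  by_cases h : I.1 = ⊤
  · have : I = ⟨⊤, htop⟩ := Subtype.ext h
    rw [unitInd, if_pos (primesOf_eq_empty.2 h), if_pos this, nrm, h]
    simp
  · have : I ≠ ⟨⊤, htop⟩ := fun h' => h (congrArg Subtype.val h')
    rw [unitInd, if_neg (fun h' => h (primesOf_eq_empty.1 h')), if_neg this, zero_mul]

lemma hasProd_moebius {s : ℂ} (hs : 1 < s.re) :
    HasProd (fun p : PI K => 1 - nrm s p.1) (∑' I : NI K, (moebiusK K I.1 : ℂ) * nrm s I.1) := by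
  rw [tsum_moebius hS hs]
  have h := (summable_prodT hS hs).of_norm.hasSum
  have e : (fun T : Finset (PI K) => (-1 : ℂ) ^ T.card * nrm s (prodT T)) =
      fun T => ∏ p ∈ T, -nrm s p.1 := by
    funext T
    rw [Finset.prod_neg]
    congr 1
    rw [prodT]
    induction T using Finset.induction_on with
    | empty => simp [nrm]
    | insert p T hp ih => rw [Finset.prod_insert hp, Finset.prod_insert hp, nrm_mul, ih]
  rw [e] at h ⊢
  simpa [sub_eq_add_neg] using hasProd_one_add_of_hasSum_prod h

end Dirichlet

lemma re_log_comb_nonneg' {a : ℝ} (ha₀ : 0 ≤ a) (ha₁ : a < 1) {z : ℂ} (hz : ‖z‖ = 1) :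
      0 ≤ 3 * (-log (1 - a)).re + 4 * (-log (1 - a * z)).re + (-log (1 - a * z ^ 2)).re := by
  have hac₀ : ‖(a : ℂ)‖ < 1 := by
    simp only [Complex.norm_of_nonneg ha₀, ha₁]
  have hac₁ : ‖a * z‖ < 1 := by rwa [norm_mul, hz, mul_one]
  have hac₂ : ‖a * z ^ 2‖ < 1 := by rwa [norm_mul, norm_pow, hz, one_pow, mul_one]
  rw [← ((hasSum_re <| hasSum_taylorSeries_neg_log hac₀).mul_left 3).add
    ((hasSum_re <| hasSum_taylorSeries_neg_log hac₁).mul_left 4) |>.add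
    (hasSum_re <| hasSum_taylorSeries_neg_log hac₂) |>.tsum_eq]
  refine tsum_nonneg fun n ↦ ?_
  simp only [← ofReal_pow, div_natCast_re, ofReal_re, mul_pow, mul_re, ofReal_im, zero_mul,
    sub_zero]
  rcases n.eq_zero_or_pos with rfl | hn
  · simp
  · simp only [← mul_div_assoc, ← add_div]
    refine div_nonneg ?_ n.cast_nonneg
    rw [← pow_mul, pow_mul', sq, mul_re, ← sq, ← sq, ← sq_norm_sub_sq_re, norm_pow, hz]
    convert! (show 0 ≤ 2 * a ^ n * ((z ^ n).re + 1) ^ 2 by positivity) using 1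
    ring

lemma norm_comb_le_one {a : ℝ} (ha₀ : 0 ≤ a) (ha₁ : a < 1) {z : ℂ} (hz : ‖z‖ = 1) :
    ‖(1 - a : ℂ)‖ ^ 3 * ‖1 - a * z‖ ^ 4 * ‖1 - a * z ^ 2‖ ≤ 1 := by
  have h := re_log_comb_nonneg' ha₀ ha₁ hz
  simp only [neg_re, log_re] at h
  have hne : ∀ w : ℂ, ‖w‖ < 1 → 0 < ‖1 - w‖ := fun w hw => by
    rw [norm_pos_iff, sub_ne_zero]; rintro rfl; simp at hw
  have hac₀ : ‖(a : ℂ)‖ < 1 := by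
    simp only [Complex.norm_of_nonneg ha₀, ha₁]
  have hac₁ : ‖a * z‖ < 1 := by rwa [norm_mul, hz, mul_one]
  have hac₂ : ‖a * z ^ 2‖ < 1 := by rwa [norm_mul, norm_pow, hz, one_pow, mul_one]
  have h0 := hne _ hac₀
  have h1 := hne _ hac₁
  have h2 := hne _ hac₂
  rw [← Real.log_nonpos_iff (by positivity), Real.log_mul (by positivity) (by positivity),
    Real.log_mul (by positivity) (by positivity), Real.log_pow, Real.log_pow]
  push_cast
  linarith

section Dirichlet
variable {K : Type} [Field K] [NumberField K]
variable (hS : ∀ s : ℝ, 1 < s → Summable fun I : NI K => (Ideal.absNorm I.1 : ℝ) ^ (-s))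
include hS

lemma one_le_comb {x t : ℝ} (hx : 1 < x) :
    1 ≤ ‖∑' J : NI K, nrm (x : ℂ) J.1‖ ^ 3 * ‖∑' J : NI K, nrm (x + t * I : ℂ) J.1‖ ^ 4 *
      ‖∑' J : NI K, nrm (x + 2 * t * I : ℂ) J.1‖ := by
  have r0 : 1 < (x : ℂ).re := by simpa
  have r1 : 1 < (x + t * Complex.I : ℂ).re := by simpa
  have r2 : 1 < (x + 2 * t * Complex.I : ℂ).re := by simpa
  set D : ℂ → ℂ := fun s => ∑' I : NI K, (moebiusK K I.1 : ℂ) * nrm s I.1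
  have hle : ‖D x‖ ^ 3 * ‖D (x + t * Complex.I)‖ ^ 4 * ‖D (x + 2 * t * Complex.I)‖ ≤ 1 := by
    have h0 : Tendsto _ _ _ := (hasProd_moebius hS r0).norm
    have h1 : Tendsto _ _ _ := (hasProd_moebius hS r1).norm
    have h2 : Tendsto _ _ _ := (hasProd_moebius hS r2).norm
    refine le_of_tendsto (((h0.pow 3).mul (h1.pow 4)).mul h2) (Eventually.of_forall fun T => ?_)
    simp only
    rw [← Finset.prod_pow, ← Finset.prod_pow, ← Finset.prod_mul_distrib,
      ← Finset.prod_mul_distrib]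
    refine Finset.prod_le_one (fun p _ => by positivity) fun p _ => ?_
    have hN1 : Ideal.absNorm p.1 ≠ 1 := fun h => p.2.not_unit
      (Ideal.isUnit_iff.2 (Ideal.absNorm_eq_one_iff.1 h))
    have hN0 : 0 < Ideal.absNorm p.1 := absNorm_posN ⟨p.1, p.2.ne_zero⟩
    have hN2 : (1 : ℝ) < Ideal.absNorm p.1 := by exact_mod_cast (by omega : 1 < Ideal.absNorm p.1)
    have hNc : (Ideal.absNorm p.1 : ℂ) ≠ 0 := by exact_mod_cast hN0.ne'
    have hz : ‖(Ideal.absNorm p.1 : ℂ) ^ (-(t * Complex.I))‖ = 1 := by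
      rw [Complex.norm_natCast_cpow_of_pos hN0]; simp
    have hc := norm_comb_le_one (a := (Ideal.absNorm p.1 : ℝ) ^ (-x)) (by positivity)
      (by rw [Real.rpow_neg (by positivity)]
          exact inv_lt_one_of_one_lt₀ (Real.one_lt_rpow hN2 (by linarith))) hz
    have ea : (((Ideal.absNorm p.1 : ℝ) ^ (-x) : ℝ) : ℂ) = (Ideal.absNorm p.1 : ℂ) ^ (-x : ℂ) := by
      rw [ofReal_cpow (by positivity)]; push_cast; rfl
    rw [ea, ← cpow_add _ _ hNc, ← cpow_nat_mul, ← cpow_add _ _ hNc] at hc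
    rw [show (-x + -(t * Complex.I) : ℂ) = -(x + t * Complex.I) by ring,
      show (-x + ((2 : ℕ) : ℂ) * -(t * Complex.I) : ℂ) = -(x + 2 * t * Complex.I) by
        push_cast; ring] at hc
    exact hc
  have m0 := congrArg norm (moebius_mul_zeta hS r0)
  have m1 := congrArg norm (moebius_mul_zeta hS r1)
  have m2 := congrArg norm (moebius_mul_zeta hS r2)
  rw [norm_mul, norm_one] at m0 m1 m2
  set A := ‖∑' J : NI K, nrm (x : ℂ) J.1‖
  set B := ‖∑' J : NI K, nrm (x + t * Complex.I : ℂ) J.1‖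
  set C := ‖∑' J : NI K, nrm (x + 2 * t * Complex.I : ℂ) J.1‖
  calc (1 : ℝ) = (‖D x‖ * A) ^ 3 * (‖D (x + t * Complex.I)‖ * B) ^ 4 *
        (‖D (x + 2 * t * Complex.I)‖ * C) := by rw [m0, m1, m2]; norm_num
    _ = (‖D x‖ ^ 3 * ‖D (x + t * Complex.I)‖ ^ 4 * ‖D (x + 2 * t * Complex.I)‖) *
        (A ^ 3 * B ^ 4 * C) := by ring
    _ ≤ 1 * (A ^ 3 * B ^ 4 * C) := by gcongr
    _ = _ := one_mul _

end Dirichlet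
end LimDist

namespace LimDist
section ZetaBasic
variable {K : Type} [Field K] [NumberField K]

lemma zeta_basic {Z : ℂ → ℂ}
    (hS : ∀ s : ℝ, 1 < s → Summable fun I : NI K => (Ideal.absNorm I.1 : ℝ) ^ (-s))
    (hZ : ∀ s : ℂ, 1 < s.re → Z s = ∑' I : NI K, (Ideal.absNorm I.1 : ℂ) ^ (-s)) :
    (∀ s : ℂ, 1 < s.re → Z s ≠ 0) ∧
    (∀ s : ℂ, 1 < s.re → (Z s)⁻¹ = ∑' I : NI K, (moebiusK K I.1 : ℂ) * nrm s I.1) ∧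
    (∃ B : ℝ, 0 < B ∧ ∀ s : ℂ, 3 / 2 ≤ s.re → ‖Z s‖ ≤ B ∧ ‖(Z s)⁻¹‖ ≤ B) ∧
    (∀ s : ℂ, 1 < s.re → Z ((starRingEnd ℂ) s) = (starRingEnd ℂ) (Z s)) := by
  have hmul : ∀ s : ℂ, 1 < s.re →
      (∑' I : NI K, (moebiusK K I.1 : ℂ) * nrm s I.1) * Z s = 1 := fun s hs => by
    rw [hZ s hs]; exact moebius_mul_zeta hS hs
  have hinv : ∀ s : ℂ, 1 < s.re →
      (Z s)⁻¹ = ∑' I : NI K, (moebiusK K I.1 : ℂ) * nrm s I.1 := fun s hs =>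
    (eq_inv_of_mul_eq_one_left (hmul s hs)).symm
  refine ⟨fun s hs h0 => ?_, hinv, ?_, fun s hs => ?_⟩
  · have := hmul s hs
    rw [h0, mul_zero] at this
    exact zero_ne_one this
  · set B := ∑' I : NI K, (Ideal.absNorm I.1 : ℝ) ^ (-(3 / 2 : ℝ)) with hB
    have hSB := hS (3 / 2) (by norm_num)
    have hle : ∀ s : ℂ, 3 / 2 ≤ s.re → ∀ I : NI K,
        ‖nrm s I.1‖ ≤ (Ideal.absNorm I.1 : ℝ) ^ (-(3 / 2 : ℝ)) := fun s hs I => by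
      rw [norm_nrm]
      refine Real.rpow_le_rpow_of_exponent_le ?_ (by linarith)
      exact_mod_cast absNorm_posN I
    have hBpos : 0 ≤ B := tsum_nonneg fun I => by positivity
    refine ⟨B + 1, by linarith, fun s hs => ⟨?_, ?_⟩⟩
    · rw [hZ s (by linarith)]
      exact (tsum_of_norm_bounded hSB.hasSum (hle s hs)).trans (by linarith)
    · rw [hinv s (by linarith)]
      refine (tsum_of_norm_bounded hSB.hasSum fun I => ?_).trans (by linarith)
      rw [norm_mul]
      have : ‖(moebiusK K I.1 : ℂ)‖ ≤ 1 := by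
        rw [Complex.norm_intCast]; exact moebiusK_abs_le _
      exact (mul_le_of_le_one_left (norm_nonneg _) this).trans (hle s hs I)
  · rw [hZ s hs, hZ _ (by simpa using hs), conj_tsum]
    congr 1
    funext I
    have harg : (Ideal.absNorm I.1 : ℂ).arg ≠ Real.pi := by
      rw [Complex.natCast_arg]; exact Real.pi_pos.ne
    rw [← map_neg, cpow_conj _ _ harg, Complex.conj_natCast]

lemma zeta_ne_zero_line {Z : ℂ → ℂ}
    (hS : ∀ s : ℝ, 1 < s → Summable fun I : NI K => (Ideal.absNorm I.1 : ℝ) ^ (-s))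
    (hZd : ∀ s : ℂ, s ≠ 1 → DifferentiableAt ℂ Z s)
    (hZ : ∀ s : ℂ, 1 < s.re → Z s = ∑' I : NI K, (Ideal.absNorm I.1 : ℂ) ^ (-s))
    {c : ℂ} (hpole : Tendsto (fun x : ℝ => (x - 1 : ℂ) * Z x) (𝓝[>] 1) (𝓝 c))
    {t : ℝ} (ht : t ≠ 0) : Z (1 + t * I) ≠ 0 := by
  intro h0
  have hne1 : (1 + t * I : ℂ) ≠ 1 := by simp [ht]
  have hne2 : (1 + 2 * t * I : ℂ) ≠ 1 := by simp [ht]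
  have hd := (hZd _ hne1).hasDerivAt
  have hline : ∀ u : ℂ, Tendsto (fun x : ℝ => (x + u : ℂ)) (𝓝[>] 1) (𝓝[≠] (1 + u)) := fun u => by
    refine tendsto_nhdsWithin_iff.2 ⟨?_, ?_⟩
    · have : Continuous fun x : ℝ => (x + u : ℂ) := by fun_prop
      have := this.tendsto 1
      simp only [ofReal_one] at this
      exact this.mono_left nhdsWithin_le_nhds
    · filter_upwards [self_mem_nhdsWithin] with x hx h
      have h1 : (x : ℂ) = 1 := add_right_cancel h
      have h2 : x = 1 := by exact_mod_cast h1
      exact (ne_of_gt hx) h2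
  have h1 := (hasDerivAt_iff_tendsto_slope.1 hd).comp (hline (t * I))
  have h2 : Tendsto (fun x : ℝ => Z (x + 2 * t * I)) (𝓝[>] 1) (𝓝 (Z (1 + 2 * t * I))) :=
    (hZd _ hne2).continuousAt.tendsto.comp ((hline (2 * t * I)).mono_right nhdsWithin_le_nhds)
  have h3 : Tendsto (fun x : ℝ => x - 1) (𝓝[>] 1) (𝓝 0) := by
    have : Continuous fun x : ℝ => x - 1 := by fun_prop
    have := this.tendsto 1
    rw [sub_self] at this
    exact this.mono_left nhdsWithin_le_nhds
  have h4 := (((hpole.norm.pow 3).mul (h1.norm.pow 4)).mul h2.norm).mul h3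
  rw [mul_zero] at h4
  have h5 : ∀ᶠ x : ℝ in 𝓝[>] 1, 1 ≤ ‖(x - 1 : ℂ) * Z x‖ ^ 3 *
      ‖(slope Z (1 + t * I) ∘ fun x : ℝ => (x + t * I : ℂ)) x‖ ^ 4 *
      ‖Z (x + 2 * t * I)‖ * (x - 1) := by
    filter_upwards [self_mem_nhdsWithin] with x hx
    have hx' : (1 : ℝ) < x := hx
    have hx0 : 0 < x - 1 := sub_pos.2 hx'
    have key := one_le_comb hS (t := t) hx'
    have e0 : Z x = ∑' J : NI K, nrm (x : ℂ) J.1 := hZ _ (by simpa)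
    have e1 : Z (x + t * I) = ∑' J : NI K, nrm (x + t * I : ℂ) J.1 := hZ _ (by simpa)
    have e2 : Z (x + 2 * t * I) = ∑' J : NI K, nrm (x + 2 * t * I : ℂ) J.1 := hZ _ (by simpa)
    rw [← e0, ← e1, ← e2] at key
    have e3 : ‖(x - 1 : ℂ)‖ = x - 1 := by
      rw [← ofReal_one, ← ofReal_sub, norm_real, Real.norm_of_nonneg hx0.le]
    simp only [Function.comp]
    rw [slope_def_field, h0, sub_zero, norm_div, add_sub_add_right_eq_sub, norm_mul, e3]
    refine key.trans (le_of_eq ?_)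
    field_simp
  exact absurd (ge_of_tendsto h4 h5) (by norm_num)

end ZetaBasic
end LimDist

namespace LimDist
section GammaBounds

lemma norm_Gamma_le_Gamma_re {s : ℂ} (hs : 0 < s.re) : ‖Gamma s‖ ≤ Real.Gamma s.re := by
  rw [Gamma_eq_integral hs, Real.Gamma_eq_integral hs, GammaIntegral]
  refine (norm_integral_le_integral_norm _).trans (le_of_eq ?_)
  refine setIntegral_congr_fun measurableSet_Ioi fun x hx => ?_
  have hx' : 0 < x := hx
  simp only [norm_mul, norm_real]
  rw [norm_cpow_eq_rpow_re_of_pos hx', Real.norm_of_nonneg (Real.exp_pos _).le]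
  simp

lemma norm_Gamma_bound {A B : ℝ} (hA : 0 < A) :
    ∃ M : ℝ, 0 < M ∧ ∀ s : ℂ, A ≤ s.re → s.re ≤ B → ‖Gamma s‖ ≤ M := by
  have hc : ContinuousOn Real.Gamma (Set.Icc A B) := fun x hx =>
    (Real.differentiableAt_Gamma fun m hm => by
      have : (0 : ℝ) ≤ m := m.cast_nonneg
      have := hx.1
      linarith).continuousAt.continuousWithinAt
  obtain ⟨M, hM⟩ := isCompact_Icc.exists_bound_of_continuousOn hc
  refine ⟨max M 1, by positivity, fun s h1 h2 => ?_⟩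
  refine (norm_Gamma_le_Gamma_re (hA.trans_le h1)).trans ?_
  exact ((le_abs_self _).trans (hM _ ⟨h1, h2⟩)).trans (le_max_left _ _)

lemma norm_sin_le_exp (z : ℂ) : ‖sin z‖ ≤ Real.exp |z.im| := by
  have h1 : ‖exp (-z * I)‖ ≤ Real.exp |z.im| := by
    rw [norm_exp]; refine Real.exp_le_exp.2 ?_; simpa using le_abs_self _
  have h2 : ‖exp (z * I)‖ ≤ Real.exp |z.im| := by
    rw [norm_exp]; refine Real.exp_le_exp.2 ?_; simpa using neg_le_abs _
  rw [sin, norm_div, norm_mul, norm_I, mul_one]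
  have := norm_sub_le (exp (-z * I)) (exp (z * I))
  rw [Complex.norm_ofNat]
  linarith

lemma norm_inv_Gamma_bound_left {A : ℝ} : ∃ C : ℝ, 0 < C ∧ ∀ s : ℂ, A ≤ s.re → s.re ≤ 0 →
    ‖(Gamma s)⁻¹‖ ≤ C * Real.exp (Real.pi * |s.im|) := by
  obtain ⟨M, hM0, hM⟩ := norm_Gamma_bound (A := 1) (B := 1 - A) one_pos
  refine ⟨M / Real.pi, div_pos hM0 Real.pi_pos, fun s h1 h2 => ?_⟩
  have h := Gamma_mul_Gamma_one_sub s
  have h3 := hM (1 - s) (by simpa using h2) (by simp; linarith)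
  have h4 : Gamma (1 - s) ≠ 0 := Gamma_ne_zero_of_re_pos (by simp; linarith)
  by_cases h5 : sin (Real.pi * s) = 0
  · rw [h5, div_zero, mul_eq_zero, or_iff_left h4] at h
    rw [h, inv_zero, norm_zero]; positivity
  · have hpi : (Real.pi : ℂ) ≠ 0 := by simp [Real.pi_ne_zero]
    have h6 : (Gamma s)⁻¹ = sin (Real.pi * s) * Gamma (1 - s) / Real.pi := by
      have : Gamma s ≠ 0 := by
        intro h0
        rw [h0, zero_mul, eq_comm, div_eq_zero_iff] at h
        tauto
      field_simp
      rw [eq_div_iff h5] at h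
      linear_combination -h
    rw [h6, norm_div, norm_mul, norm_real, Real.norm_of_nonneg Real.pi_pos.le]
    have h7 := norm_sin_le_exp (Real.pi * s)
    have h8 : |((Real.pi : ℂ) * s).im| = Real.pi * |s.im| := by
      simp [abs_mul, abs_of_pos Real.pi_pos]
    rw [h8] at h7
    rw [div_mul_eq_mul_div, mul_comm M]
    gcongr

lemma norm_inv_Gamma_bound_nat (n : ℕ) : ∀ A : ℝ, ∃ C : ℝ, 0 < C ∧ ∀ s : ℂ, A ≤ s.re → s.re ≤ n →
    ‖(Gamma s)⁻¹‖ ≤ C * Real.exp (Real.pi * |s.im|) := by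
  induction n with
  | zero => intro A; simpa using norm_inv_Gamma_bound_left (A := A)
  | succ n ih =>
    intro A
    obtain ⟨C, hC0, hC⟩ := ih (A - 1)
    obtain ⟨M, hM⟩ := ((isCompact_Icc (a := A) (b := (n + 1 : ℝ))).reProdIm
      (isCompact_Icc (a := (-1 : ℝ)) (b := 1))).exists_bound_of_continuousOn
      (differentiable_one_div_Gamma.continuous.continuousOn)
    refine ⟨max C M, lt_max_of_lt_left hC0, fun s h1 h2 => ?_⟩
    push_cast at h2
    by_cases h : |s.im| ≤ 1
    · have h3 := hM s ⟨⟨h1, h2⟩, abs_le.1 h⟩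
      have h4 : 1 ≤ Real.exp (Real.pi * |s.im|) := Real.one_le_exp (by positivity)
      calc _ ≤ M := h3
        _ ≤ max C M := le_max_right _ _
        _ ≤ _ := le_mul_of_one_le_right (lt_max_of_lt_left hC0).le h4
    · push Not at h
      have h5 : 1 ≤ ‖s - 1‖ := by
        have := abs_im_le_norm (s - 1)
        simp at this; linarith
      have h6 : s - 1 ≠ 0 := norm_pos_iff.1 (by linarith)
      have h7 := Gamma_add_one (s - 1) h6
      rw [sub_add_cancel] at h7
      have h8 := hC (s - 1) (by simpa using h1) (by simp; linarith)
      rw [h7, mul_inv, norm_mul, norm_inv]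
      have h9 : ‖s - 1‖⁻¹ ≤ 1 := inv_le_one_of_one_le₀ h5
      calc _ ≤ 1 * ‖(Gamma (s - 1))⁻¹‖ := by gcongr
        _ ≤ C * Real.exp (Real.pi * |s.im|) := by simpa using h8
        _ ≤ _ := by gcongr; exact le_max_left _ _

lemma norm_inv_Gamma_bound (A B : ℝ) : ∃ C : ℝ, 0 < C ∧ ∀ s : ℂ, A ≤ s.re → s.re ≤ B →
    ‖(Gamma s)⁻¹‖ ≤ C * Real.exp (Real.pi * |s.im|) := by
  obtain ⟨n, hn⟩ := exists_nat_ge B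
  obtain ⟨C, hC0, hC⟩ := norm_inv_Gamma_bound_nat n A
  exact ⟨C, hC0, fun s h1 h2 => hC s h1 (h2.trans hn)⟩

/-- `c ^ s` is bounded above on vertical strips. -/
lemma norm_cpow_strip {c : ℝ} (hc : 0 < c) (A B : ℝ) : ∃ C : ℝ, 0 < C ∧ ∀ s : ℂ, A ≤ s.re →
    s.re ≤ B → ‖(c : ℂ) ^ s‖ ≤ C := by
  refine ⟨max (c ^ A) (c ^ B), by positivity, fun s h1 h2 => ?_⟩
  rw [norm_cpow_eq_rpow_re_of_pos hc]
  rcases le_total 1 c with h | h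
  · exact (Real.rpow_le_rpow_of_exponent_le h h2).trans (le_max_right _ _)
  · exact (Real.rpow_le_rpow_of_exponent_ge hc h h1).trans (le_max_left _ _)

lemma norm_Gammaℝ_bound {A B : ℝ} (hA : 0 < A) :
    ∃ M : ℝ, 0 < M ∧ ∀ s : ℂ, A ≤ s.re → s.re ≤ B → ‖Gammaℝ s‖ ≤ M := by
  obtain ⟨M, h0, hM⟩ := norm_Gamma_bound (A := A / 2) (B := B / 2) (by positivity)
  obtain ⟨N, h0', hN⟩ := norm_cpow_strip Real.pi_pos (-B / 2) (-A / 2)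
  refine ⟨N * M, by positivity, fun s h1 h2 => ?_⟩
  rw [Gammaℝ_def, norm_mul]
  gcongr
  · apply hN <;> simp <;> linarith
  · apply hM <;> simp <;> linarith

lemma norm_Gammaℂ_bound {A B : ℝ} (hA : 0 < A) :
    ∃ M : ℝ, 0 < M ∧ ∀ s : ℂ, A ≤ s.re → s.re ≤ B → ‖Gammaℂ s‖ ≤ M := by
  obtain ⟨M, h0, hM⟩ := norm_Gamma_bound (A := A) (B := B) hA
  obtain ⟨N, h0', hN⟩ := norm_cpow_strip Real.two_pi_pos (-B) (-A)
  refine ⟨2 * N * M, by positivity, fun s h1 h2 => ?_⟩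
  rw [Gammaℂ_def, norm_mul, norm_mul]
  push_cast at hN
  gcongr
  · simp
  · apply hN <;> simp <;> linarith
  · exact hM s h1 h2

lemma norm_inv_Gammaℝ_bound (A B : ℝ) : ∃ C : ℝ, 0 < C ∧ ∀ s : ℂ, A ≤ s.re → s.re ≤ B →
    ‖(Gammaℝ s)⁻¹‖ ≤ C * Real.exp (Real.pi * |s.im|) := by
  obtain ⟨M, h0, hM⟩ := norm_inv_Gamma_bound (A / 2) (B / 2)
  obtain ⟨N, h0', hN⟩ := norm_cpow_strip Real.pi_pos (A / 2) (B / 2)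
  refine ⟨N * M, by positivity, fun s h1 h2 => ?_⟩
  rw [Gammaℝ_def, mul_inv, norm_mul, ← cpow_neg, neg_div, neg_neg, mul_assoc]
  gcongr
  · apply hN <;> simp <;> linarith
  · refine (hM (s / 2) (by simp; linarith) (by simp; linarith)).trans ?_
    have : |(s / 2).im| = |s.im| / 2 := by simp [abs_div]
    rw [this]
    have : |s.im| / 2 ≤ |s.im| := by linarith [abs_nonneg s.im]
    gcongr

lemma norm_inv_Gammaℂ_bound (A B : ℝ) : ∃ C : ℝ, 0 < C ∧ ∀ s : ℂ, A ≤ s.re → s.re ≤ B →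
    ‖(Gammaℂ s)⁻¹‖ ≤ C * Real.exp (Real.pi * |s.im|) := by
  obtain ⟨M, h0, hM⟩ := norm_inv_Gamma_bound A B
  obtain ⟨N, h0', hN⟩ := norm_cpow_strip Real.two_pi_pos A B
  refine ⟨N * M, by positivity, fun s h1 h2 => ?_⟩
  push_cast at hN
  rw [Gammaℂ_def, mul_inv, mul_inv, norm_mul, norm_mul, ← cpow_neg, neg_neg, mul_assoc N]
  have h2' : ‖(2 : ℂ)⁻¹‖ ≤ 1 := by norm_num
  have := hN s h1 h2
  have := hM s h1 h2
  calc _ ≤ 1 * N * (M * Real.exp (Real.pi * |s.im|)) := by gcongr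
    _ = _ := by ring

lemma Gammaℂ_ne_zero_of_re_pos {s : ℂ} (hs : 0 < s.re) : Gammaℂ s ≠ 0 := by
  rw [Gammaℂ_def]
  have h2 : (2 * Real.pi : ℂ) ≠ 0 := by simp [Real.pi_ne_zero]
  exact mul_ne_zero (mul_ne_zero two_ne_zero (by simp [cpow_eq_zero_iff, h2]))
    (Gamma_ne_zero_of_re_pos hs)

lemma Gammaℝ_conj (s : ℂ) : Gammaℝ (starRingEnd ℂ s) = starRingEnd ℂ (Gammaℝ s) := by
  have h : (Real.pi : ℂ).arg ≠ Real.pi := by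
    rw [arg_ofReal_of_nonneg Real.pi_pos.le]; exact Real.pi_ne_zero.symm
  rw [Gammaℝ_def, Gammaℝ_def, map_mul, ← Gamma_conj]
  congr 1
  · have := conj_cpow (Real.pi : ℂ) (starRingEnd ℂ (-s / 2)) h
    rw [conj_ofReal, conj_conj] at this
    rw [← this]; congr 1; rw [map_div₀, map_neg, map_ofNat]
  · rw [map_div₀, map_ofNat]

lemma Gammaℂ_conj (s : ℂ) : Gammaℂ (starRingEnd ℂ s) = starRingEnd ℂ (Gammaℂ s) := by
  have h : (2 * Real.pi : ℂ).arg ≠ Real.pi := by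
    have : (2 * Real.pi : ℂ) = ((2 * Real.pi : ℝ) : ℂ) := by push_cast; ring
    rw [this, arg_ofReal_of_nonneg Real.two_pi_pos.le]; exact Real.pi_ne_zero.symm
  rw [Gammaℂ_def, Gammaℂ_def, map_mul, ← Gamma_conj, map_mul, map_ofNat]
  congr 2
  have := conj_cpow (2 * Real.pi : ℂ) (starRingEnd ℂ (-s)) h
  rw [conj_conj] at this
  simp only [map_mul, conj_ofReal, map_ofNat] at this
  rw [← this, map_neg]

end GammaBounds
end LimDist

namespace LimDist
open NumberField.InfinitePlace
section GammaFactor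
variable {K : Type} [Field K] [NumberField K]

/-- The part of `invGam` that has no zeros in `Re s > -1`. -/
def invGamReg (K : Type) [Field K] [NumberField K] (s : ℂ) : ℂ :=
  ((2 * Real.pi : ℂ)⁻¹ * (Gammaℝ (s + 2))⁻¹) ^ nrRealPlaces K *
    ((2 * Real.pi : ℂ)⁻¹ * (Gammaℂ (s + 1))⁻¹) ^ nrComplexPlaces K

lemma differentiable_invGamReg : Differentiable ℂ (invGamReg K) := by
  have h1 : Differentiable ℂ fun s : ℂ => (Gammaℝ (s + 2))⁻¹ :=
    differentiable_Gammaℝ_inv.comp (differentiable_id.add_const _)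
  have h2 : Differentiable ℂ fun s : ℂ => (Gammaℂ (s + 1))⁻¹ :=
    differentiable_Gammaℂ_inv'.comp (differentiable_id.add_const _)
  exact ((h1.const_mul _).pow _).mul ((h2.const_mul _).pow _)

lemma invGam_eq {s : ℂ} (hs : s ≠ 0) :
    invGam K s = s ^ (nrRealPlaces K + nrComplexPlaces K) * invGamReg K s := by
  have hpi : (Real.pi : ℂ) ≠ 0 := by simp [Real.pi_ne_zero]
  rw [invGam, invGamReg, Gammaℝ_add_two hs, Gammaℂ_add_one hs, pow_add, mul_mul_mul_comm,
    ← mul_pow, ← mul_pow]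
  congr 2
  · rw [mul_div_assoc, mul_div_assoc, mul_inv]; field_simp
  · rw [mul_div_assoc, mul_div_assoc, mul_inv]; field_simp

lemma invGamReg_bound (A B : ℝ) : ∃ C : ℝ, 0 < C ∧ ∀ s : ℂ, A ≤ s.re → s.re ≤ B →
    ‖invGamReg K s‖ ≤ C * Real.exp (C * |s.im|) := by
  obtain ⟨M, h0, hM⟩ := norm_inv_Gammaℝ_bound (A + 2) (B + 2)
  obtain ⟨N, h0', hN⟩ := norm_inv_Gammaℂ_bound (A + 1) (B + 1)
  set r := nrRealPlaces K
  set k := nrComplexPlaces K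
  have h2 : ‖(2 * Real.pi : ℂ)⁻¹‖ = (2 * Real.pi)⁻¹ := by
    rw [norm_inv, norm_mul, norm_real, Real.norm_of_nonneg Real.pi_pos.le]; simp
  set c := (2 * Real.pi)⁻¹
  have hc : 0 < c := by positivity
  refine ⟨(c * M) ^ r * (c * N) ^ k + (r + k) * Real.pi, by positivity, fun s h3 h4 => ?_⟩
  have h5 := hM (s + 2) (by simpa using h3) (by simpa using h4)
  have h6 := hN (s + 1) (by simpa using h3) (by simpa using h4)
  have h7 : (s + 2).im = s.im := by simp
  have h8 : (s + 1).im = s.im := by simp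
  rw [h7] at h5
  rw [h8] at h6
  rw [invGamReg, norm_mul, norm_pow, norm_pow, norm_mul, norm_mul, h2]
  calc _ ≤ (c * (M * Real.exp (Real.pi * |s.im|))) ^ r *
        (c * (N * Real.exp (Real.pi * |s.im|))) ^ k := by gcongr
    _ = ((c * M) ^ r * (c * N) ^ k) * Real.exp ((r + k) * Real.pi * |s.im|) := by
      rw [add_mul, add_mul, Real.exp_add, mul_assoc (r : ℝ), Real.exp_nat_mul, mul_assoc (k : ℝ),
        Real.exp_nat_mul]
      ring
    _ ≤ _ := by
      gcongr
      · exact le_add_of_nonneg_right (by positivity)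
      · exact le_add_of_nonneg_left (by positivity)

lemma invGamReg_lower {A B : ℝ} (hA : -1 < A) : ∃ c : ℝ, 0 < c ∧ ∀ s : ℂ, A ≤ s.re → s.re ≤ B →
    c ≤ ‖invGamReg K s‖ := by
  obtain ⟨M, h0, hM⟩ := norm_Gammaℝ_bound (A := A + 2) (B := B + 2) (by linarith)
  obtain ⟨N, h0', hN⟩ := norm_Gammaℂ_bound (A := A + 1) (B := B + 1) (by linarith)
  set r := nrRealPlaces K
  set k := nrComplexPlaces K
  have h2 : ‖(2 * Real.pi : ℂ)⁻¹‖ = (2 * Real.pi)⁻¹ := by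
    rw [norm_inv, norm_mul, norm_real, Real.norm_of_nonneg Real.pi_pos.le]; simp
  set c := (2 * Real.pi)⁻¹
  have hc : 0 < c := by positivity
  refine ⟨(c * M⁻¹) ^ r * (c * N⁻¹) ^ k, by positivity, fun s h3 h4 => ?_⟩
  have h5 := hM (s + 2) (by simpa using h3) (by simpa using h4)
  have h6 := hN (s + 1) (by simpa using h3) (by simpa using h4)
  have h7 : 0 < ‖Gammaℝ (s + 2)‖ := norm_pos_iff.2 (Gammaℝ_ne_zero_of_re_pos (by simp; linarith))
  have h8 : 0 < ‖Gammaℂ (s + 1)‖ := norm_pos_iff.2 (Gammaℂ_ne_zero_of_re_pos (by simp; linarith))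
  rw [invGamReg, norm_mul, norm_pow, norm_pow, norm_mul, norm_mul, h2, norm_inv, norm_inv]
  gcongr

lemma invGamReg_ne_zero {s : ℂ} (hs : -1 < s.re) : invGamReg K s ≠ 0 := by
  obtain ⟨c, hc, h⟩ := invGamReg_lower (K := K) hs (B := s.re)
  exact norm_pos_iff.1 (hc.trans_le (h s le_rfl le_rfl))

lemma invGamReg_conj (s : ℂ) :
    invGamReg K (starRingEnd ℂ s) = starRingEnd ℂ (invGamReg K s) := by
  have h1 : starRingEnd ℂ s + 2 = starRingEnd ℂ (s + 2) := by rw [map_add, map_ofNat]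
  have h2 : starRingEnd ℂ s + 1 = starRingEnd ℂ (s + 1) := by rw [map_add, map_one]
  rw [invGamReg, invGamReg, h1, h2, Gammaℝ_conj, Gammaℂ_conj]
  simp only [map_mul, map_pow, map_inv₀, conj_ofReal, map_ofNat]

lemma invGamReg_shift {s : ℂ} (h1 : s + 1 ≠ 0) (h2 : s + 2 ≠ 0) :
    invGamReg K s = ((s + 2) / (2 * Real.pi)) ^ nrRealPlaces K *
      ((s + 1) * (s + 2) / (2 * Real.pi) ^ 2) ^ nrComplexPlaces K * invGamReg K (s + 2) := by
  have hpi : (Real.pi : ℂ) ≠ 0 := by simp [Real.pi_ne_zero]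
  rw [invGamReg, invGamReg, Gammaℝ_add_two h2]
  have e : s + 2 + 1 = (s + 1) + 1 + 1 := by ring
  have h3 : s + 1 + 1 ≠ 0 := by rwa [add_assoc, one_add_one_eq_two]
  rw [e, Gammaℂ_add_one h3, Gammaℂ_add_one h1, mul_mul_mul_comm, ← mul_pow, ← mul_pow]
  congr 2
  · simp only [mul_inv, div_eq_mul_inv]; field_simp
  · have e' : s + 2 = s + 1 + 1 := by ring
    rw [e']
    simp only [mul_inv, div_eq_mul_inv]; field_simp

end GammaFactor
end LimDist

namespace LimDist
open NumberField.InfinitePlace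

/-- The analytic data extracted from a zeta function `Z` satisfying RH with simple zeros:
`V` is the entire function with `(s - 1) Z s = s ^ m V s`. -/
structure VPack (Z V : ℂ → ℂ) (m : ℕ) : Prop where
  diff : Differentiable ℂ V
  zeta : ∀ s : ℂ, s ≠ 0 → s ≠ 1 → (s - 1) * Z s = s ^ m * V s
  growth : ∃ (C : ℝ) (k : ℕ), 0 < C ∧ ∀ s : ℂ, -(3 / 2) ≤ s.re → s.re ≤ 9 / 2 →
    ‖V s‖ ≤ C * (2 + |s.im|) ^ k
  zeros : ∀ s : ℂ, -1 < s.re → V s = 0 → Z s = 0 ∧ s.re = 1 / 2 ∧ deriv V s ≠ 0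
  lower : ∃ c : ℝ, 0 < c ∧ ∀ t : ℝ, c / (2 + |t|) ^ m ≤ ‖V (3 / 2 + t * I)‖
  bd : ∃ C : ℝ, ∀ s : ℂ, (s.re = -(1 / 2) ∨ s.re = 3 / 2) →
    ‖(s - 1) / ((s + 2) ^ m * V s)‖ ≤ C
  refl : ∃ c C : ℝ, 0 < c ∧ 0 < C ∧ ∀ s : ℂ, -(1 / 2) ≤ s.re → s.re ≤ 1 / 2 →
    c * Real.exp (-(C * |s.im|)) * ‖V (1 - starRingEnd ℂ s)‖ ≤ ‖V s‖
  conj : ∀ s, V (starRingEnd ℂ s) = starRingEnd ℂ (V s)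

lemma phragmen_lindelof_strip {V : ℂ → ℂ} (hV : Differentiable ℂ V) {C₁ C₂ : ℝ} {k : ℕ}
    (hC₁ : 0 < C₁)
    (h1 : ∀ s : ℂ, -(3 / 2) ≤ s.re → s.re ≤ 5 / 2 → ‖V s‖ ≤ C₁ * Real.exp (C₁ * |s.im|))
    (h2 : ∀ s : ℂ, s.re = -(3 / 2) ∨ s.re = 5 / 2 → ‖V s‖ ≤ C₂ * ‖s + 10‖ ^ k)
    {s : ℂ} (hs1 : -(3 / 2) ≤ s.re) (hs2 : s.re ≤ 5 / 2) : ‖V s‖ ≤ C₂ * ‖s + 10‖ ^ k := by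
  have hn : ∀ s : ℂ, -(3 / 2) ≤ s.re → 1 ≤ ‖s + 10‖ := fun s hs => by
    have := abs_re_le_norm (s + 10)
    have h' : (s + 10).re = s.re + 10 := by simp
    rw [h'] at this
    have := le_abs_self (s.re + 10)
    linarith
  have hn0 : ∀ s : ℂ, -(3 / 2) ≤ s.re → 0 < ‖s + 10‖ ^ k := fun s hs =>
    pow_pos (one_pos.trans_le (hn s hs)) k
  have key := PhragmenLindelof.vertical_strip (f := fun s => V s / (s + 10) ^ k) (C := C₂)
    (a := -(3 / 2)) (b := 5 / 2) (z := s) ?_ ?_ ?_ ?_ hs1 hs2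
  · rwa [norm_div, norm_pow, div_le_iff₀ (hn0 s hs1)] at key
  · refine DifferentiableOn.diffContOnCl fun z hz => ?_
    have hz' : -(3 / 2) ≤ z.re := by
      have := closure_mono (Set.preimage_mono Set.Ioo_subset_Icc_self) hz
      rw [IsClosed.closure_eq (isClosed_Icc.preimage continuous_re)] at this
      exact this.1
    have h0 : (z + 10) ^ k ≠ 0 := by
      have := hn0 z hz'
      rw [← norm_pow] at this
      exact norm_pos_iff.1 this
    have hp : DifferentiableAt ℂ (fun s : ℂ => (s + 10) ^ k) z :=
      (differentiableAt_id.add_const (10 : ℂ)).pow k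
    exact (hV.differentiableAt.div hp h0).differentiableWithinAt
  · refine ⟨1 / 2, ?_, 2 * C₁, ?_⟩
    · rw [lt_div_iff₀ (by norm_num)]
      linarith [Real.pi_gt_three]
    · refine Asymptotics.IsBigO.of_bound C₁ ?_
      refine Filter.eventually_inf_principal.2 (Eventually.of_forall fun z hz => ?_)
      have hz1 : -(3 / 2) ≤ z.re := hz.1.le
      have := h1 z hz1 hz.2.le
      rw [norm_div, norm_pow, Real.norm_of_nonneg (Real.exp_pos _).le]
      refine (div_le_self (norm_nonneg _) (one_le_pow₀ (hn z hz1))).trans (this.trans ?_)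
      refine mul_le_mul_of_nonneg_left (Real.exp_le_exp.2 ?_) hC₁.le
      have : |z.im| ≤ 2 * Real.exp (1 / 2 * |z.im|) := by
        have := Real.add_one_le_exp (1 / 2 * |z.im|)
        linarith
      nlinarith
  · intro z hz
    rw [norm_div, norm_pow, div_le_iff₀ (hn0 z hz.ge)]
    exact h2 z (Or.inl hz)
  · intro z hz
    rw [norm_div, norm_pow, div_le_iff₀ (hn0 z (by rw [hz]; norm_num))]
    exact h2 z (Or.inr hz)
end LimDist

namespace LimDist
open NumberField.InfinitePlace
variable {K : Type} [Field K] [NumberField K]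

lemma norm_two_pi : ‖(2 * Real.pi : ℂ)‖ = 2 * Real.pi := by
  rw [norm_mul, norm_real, Real.norm_of_nonneg Real.pi_pos.le]; simp

lemma invGamReg_shift_le {s : ℂ} (h1 : s + 1 ≠ 0) (h2 : s + 2 ≠ 0) {N : ℝ} (hN1 : ‖s + 1‖ ≤ N)
    (hN2 : ‖s + 2‖ ≤ N) :
    ‖invGamReg K s‖ ≤ N ^ (nrRealPlaces K + 2 * nrComplexPlaces K) * ‖invGamReg K (s + 2)‖ := by
  have hp : 1 ≤ 2 * Real.pi := by linarith [Real.pi_gt_three]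
  have hN : 0 ≤ N := (norm_nonneg _).trans hN1
  rw [invGamReg_shift h1 h2, norm_mul, norm_mul, norm_pow, norm_pow, norm_div, norm_div,
    norm_pow, norm_two_pi, norm_mul (s + 1), pow_add, pow_mul]
  gcongr
  · exact (div_le_self (norm_nonneg _) hp).trans hN2
  · refine (div_le_self (by positivity) (one_le_pow₀ hp)).trans ?_
    rw [sq]; gcongr

lemma invGamReg_shift_ge : ∃ c : ℝ, 0 < c ∧ ∀ s : ℂ, s + 1 ≠ 0 → s + 2 ≠ 0 → 1 / 2 ≤ ‖s + 1‖ →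
    c * ‖s + 2‖ ^ (nrRealPlaces K + nrComplexPlaces K) * ‖invGamReg K (s + 2)‖ ≤
      ‖invGamReg K s‖ := by
  have hp : 0 < 2 * Real.pi := Real.two_pi_pos
  refine ⟨(1 / (2 * Real.pi)) ^ nrRealPlaces K * (1 / 2 / (2 * Real.pi) ^ 2) ^ nrComplexPlaces K,
    by positivity, fun s h1 h2 h3 => ?_⟩
  rw [invGamReg_shift h1 h2, norm_mul, norm_mul, norm_pow, norm_pow, norm_div, norm_div,
    norm_pow, norm_two_pi, norm_mul (s + 1), pow_add, mul_mul_mul_comm, ← mul_pow, ← mul_pow]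
  gcongr
  · exact le_of_eq (by ring)
  · rw [div_mul_eq_mul_div]
    gcongr

set_option maxHeartbeats 1000000 in
theorem exists_VPack {Z : ℂ → ℂ} (hZd : ∀ s : ℂ, s ≠ 1 → DifferentiableAt ℂ Z s)
    (hZ : ∀ s : ℂ, 1 < s.re →
      Z s = ∑' I : {I : Ideal (𝓞 K) // I ≠ ⊥}, (Ideal.absNorm I.1 : ℂ) ^ (-s))
    (hRH : ∀ ρ : ℂ, Z ρ = 0 → 0 < ρ.re → ρ.re < 1 → ρ.re = 1 / 2)
    (hsimple : ∀ ρ : ℂ, Z ρ = 0 → 0 < ρ.re → ρ.re < 1 → deriv Z ρ ≠ 0) :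
    (∀ s : ℝ, 1 < s → Summable fun I : {I : Ideal (𝓞 K) // I ≠ ⊥} =>
      (Ideal.absNorm I.1 : ℝ) ^ (-s)) ∧ ∃ (V : ℂ → ℂ) (m : ℕ), VPack Z V m := by
  obtain ⟨hS, d, a, L, hd, ha, hL, hLs, hLb, hid⟩ := exists_completed hZd hZ
  obtain ⟨hZ0, -, ⟨B, hB0, hB⟩, hZc⟩ := zeta_basic hS hZ
  refine ⟨hS, ?_⟩
  have hd' : (d : ℂ) ≠ 0 := by exact_mod_cast hd.ne'
  have hdp : ∀ s : ℂ, (d : ℂ) ^ s ≠ 0 := fun s => by simp [cpow_eq_zero_iff, hd']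
  obtain ⟨q, hq⟩ : ∃ q, q = nrRealPlaces K + nrComplexPlaces K := ⟨_, rfl⟩
  have hq0 : q ≠ 0 := by
    have h1 := card_add_two_mul_card_eq_rank K
    have h2 := Module.finrank_pos (R := ℚ) (M := K)
    omega
  obtain ⟨m, rfl⟩ := Nat.exists_eq_succ_of_ne_zero hq0
  set X : ℂ → ℂ := fun s => L s * (s * (s - 1)) + a with hX
  set i1 : ℂ → ℂ := invGamReg K with hi1
  set V : ℂ → ℂ := fun s => (d : ℂ) ^ (-s) * X s * i1 s with hVdef
  have hXs : ∀ s, X (1 - s) = X s := fun s => by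
    simp only [hX, hLs]; ring
  have hVd : Differentiable ℂ V := by
    have h3 : Differentiable ℂ fun s : ℂ => (d : ℂ) ^ (-s) := fun s =>
      (differentiableAt_id.neg.const_cpow (Or.inl hd'))
    have h4 : Differentiable ℂ X :=
      (hL.mul (by fun_prop)).add_const _
    exact (h3.mul h4).mul differentiable_invGamReg
  have hzeta : ∀ s : ℂ, s ≠ 0 → s ≠ 1 → (s - 1) * Z s = s ^ m * V s := by
    intro s h0 h1
    have h := hid s h0 h1
    rw [invGam_eq h0, ← hq, Nat.succ_eq_add_one, pow_succ] at h
    change _ * (s ^ m * s * i1 s) = _ at h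
    have h1' : 1 - s ≠ 0 := sub_ne_zero.2 h1.symm
    have hX' : (L s - a / s - a / (1 - s)) * (s * (s - 1)) = X s := by
      simp only [hX]; field_simp; ring
    have e : (d : ℂ) ^ (-s) * (d : ℂ) ^ s = 1 := by
      rw [← cpow_add _ _ hd', neg_add_cancel, cpow_zero]
    refine mul_left_cancel₀ h0 ?_
    calc s * ((s - 1) * Z s) = (d : ℂ) ^ (-s) * (s * (s - 1)) * ((d : ℂ) ^ s * Z s) := by
          linear_combination (-(s * (s - 1) * Z s)) * e
      _ = (d : ℂ) ^ (-s) * ((L s - a / s - a / (1 - s)) * (s * (s - 1))) *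
          (s ^ m * s * i1 s) := by rw [← h]; ring
      _ = _ := by rw [hX']; simp only [hVdef]; ring
  have hne : ∀ s : ℂ, 1 < s.re → s ≠ 0 ∧ s ≠ 1 := fun s hs =>
    ⟨fun h => by rw [h] at hs; simp at hs; linarith, fun h => by rw [h] at hs; simp at hs⟩
  have hVeq : ∀ s : ℂ, 1 < s.re → V s = (s - 1) * Z s / s ^ m := fun s hs => by
    rw [hzeta s (hne s hs).1 (hne s hs).2, mul_div_cancel_left₀ _ (pow_ne_zero _ (hne s hs).1)]
  have hconj : ∀ s, V (starRingEnd ℂ s) = starRingEnd ℂ (V s) := by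
    have h2 : Differentiable ℂ fun s => starRingEnd ℂ (V (starRingEnd ℂ s)) := fun s => by
      have := (hVd (starRingEnd ℂ s)).conj_conj
      rw [conj_conj] at this
      exact this
    have h3 := entire_eq_of_real hVd h2 fun x hx => by
      rw [conj_ofReal, hVeq _ (by simpa using hx)]
      have := hZc x (by simpa using hx)
      rw [conj_ofReal] at this
      rw [map_div₀, map_mul, map_pow, map_sub, ← this, conj_ofReal, map_one]
    intro s
    have := congrFun h3 (starRingEnd ℂ s)
    simpa using this
  have hFE : ∀ s : ℂ, ‖V s‖ * d ^ s.re * ‖i1 (1 - starRingEnd ℂ s)‖ =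
      ‖V (1 - starRingEnd ℂ s)‖ * d ^ (1 - s.re) * ‖i1 s‖ := by
    intro s
    have e : starRingEnd ℂ (1 - s) = 1 - starRingEnd ℂ s := by rw [map_sub, map_one]
    have e1 : ‖V (1 - starRingEnd ℂ s)‖ = ‖V (1 - s)‖ := by rw [← e, hconj, norm_conj]
    have e2 : ‖i1 (1 - starRingEnd ℂ s)‖ = ‖i1 (1 - s)‖ := by
      rw [← e, hi1, invGamReg_conj, norm_conj]
    have e3 : 1 - s.re = (1 - s).re := by simp
    rw [e1, e2, ← norm_cpow_eq_rpow_re_of_pos hd, e3,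
      ← norm_cpow_eq_rpow_re_of_pos hd, ← norm_mul, ← norm_mul, ← norm_mul, ← norm_mul]
    congr 1
    simp only [hVdef, hXs]
    have a1 : (d : ℂ) ^ (-s) * (d : ℂ) ^ s = 1 := by
      rw [← cpow_add _ _ hd', neg_add_cancel, cpow_zero]
    have a2 : (d : ℂ) ^ (-(1 - s)) * (d : ℂ) ^ (1 - s) = 1 := by
      rw [← cpow_add _ _ hd', neg_add_cancel, cpow_zero]
    linear_combination (X s * i1 s * i1 (1 - s)) * a1 - (X s * i1 s * i1 (1 - s)) * a2
  have hpole : Tendsto (fun x : ℝ => (x - 1 : ℂ) * Z x) (𝓝[>] 1) (𝓝 (V 1)) := by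
    have h1 : Tendsto (fun x : ℝ => (x : ℂ) ^ m * V x) (𝓝[>] 1) (𝓝 ((1 : ℝ) ^ m * V (1 : ℝ))) := by
      have : Continuous fun x : ℝ => (x : ℂ) ^ m * V x :=
        (continuous_ofReal.pow m).mul (hVd.continuous.comp continuous_ofReal)
      exact (this.tendsto 1).mono_left nhdsWithin_le_nhds
    simp only [ofReal_one, one_pow, one_mul] at h1
    refine h1.congr' ?_
    filter_upwards [self_mem_nhdsWithin] with x hx
    have := hne x (by simpa using hx)
    rw [hzeta x this.1 this.2]
  have hZline : ∀ s : ℂ, 1 ≤ s.re → s ≠ 1 → Z s ≠ 0 := by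
    intro s hs h1
    rcases hs.eq_or_lt with h | h
    · have ht : s.im ≠ 0 := fun h0 => h1 (Complex.ext (by simp [h]) (by simp [h0]))
      have := zeta_ne_zero_line hS hZd hZ hpole ht
      convert this using 2
      refine Complex.ext (by simp [h]) (by simp)
    · exact hZ0 s h
  have hV0 : ∀ s : ℂ, -1 < s.re → V s = 0 → Z s = 0 ∧ 0 < s.re ∧ s.re < 1 := by
    intro s hs h0
    have hX0 : ∀ w : ℂ, X w = 0 → w.re < 1 := by
      intro w hw
      by_contra hcon
      push Not at hcon
      have h1 : w ≠ 1 := by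
        rintro rfl
        simp [hX] at hw
        exact ha.ne' hw
      have h2 : w ≠ 0 := by rintro rfl; simp at hcon; linarith
      have h3 := hzeta w h2 h1
      have h4 : V w = 0 := by simp [hVdef, hw]
      rw [h4, mul_zero] at h3
      exact mul_ne_zero (sub_ne_zero.2 h1) (hZline w hcon h1) h3
    have hXs0 : X s = 0 := by
      have := invGamReg_ne_zero (K := K) hs
      have h6 : (d : ℂ) ^ (-s) * X s * i1 s = 0 := h0
      have h7 := hdp (-s)
      simpa [h7, hi1, this] using h6
    have h1 := hX0 s hXs0
    have h2 := hX0 (1 - s) (by rw [hXs, hXs0])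
    have h3 : 0 < s.re := by simpa using h2
    have hs0 : s ≠ 0 := by rintro rfl; simp at h3
    have hs1 : s ≠ 1 := by rintro rfl; simp at h1
    have h4 := hzeta s hs0 hs1
    rw [h0, mul_zero, mul_eq_zero, or_iff_right (sub_ne_zero.2 hs1)] at h4
    exact ⟨h4, h3, h1⟩
  have hR : ∀ s : ℂ, 3 / 2 ≤ s.re → ‖V s‖ ≤ B * ‖s - 1‖ := by
    intro s hs
    rw [hVeq s (by linarith), norm_div, norm_mul, norm_pow, mul_comm B]
    have h1 : 1 ≤ ‖s‖ := by
      have := abs_re_le_norm s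
      have := le_abs_self s.re
      linarith
    exact (div_le_self (by positivity) (one_le_pow₀ h1)).trans
      (mul_le_mul_of_nonneg_left (hB s hs).1 (norm_nonneg _))
  have hRl : ∀ s : ℂ, 3 / 2 ≤ s.re → ‖s - 1‖ ≤ B * (‖s‖ ^ m * ‖V s‖) := by
    intro s hs
    have h1 := hne s (by linarith)
    rw [← norm_pow, ← norm_mul, ← hzeta s h1.1 h1.2, norm_mul]
    have h2 : 1 ≤ B * ‖Z s‖ := by
      have h3 := (hB s hs).2
      have h4 : 0 < ‖Z s‖ := norm_pos_iff.2 (hZ0 s (by linarith))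
      rw [norm_inv, inv_le_iff_one_le_mul₀ h4] at h3
      exact h3
    nlinarith [norm_nonneg (s - 1)]
  refine ⟨V, m, ⟨hVd, hzeta, ?_, ?_, ?_, ?_, ?_, hconj⟩⟩
  · set k := nrRealPlaces K + 2 * nrComplexPlaces K
    have hnn : ∀ s : ℂ, ∀ j : ℝ, -(3 / 2) ≤ s.re → 0 ≤ j → j ≤ 10 → ‖s + j‖ ≤ ‖s + 10‖ := by
      intro s j h1 h2 h3
      rw [← sq_le_sq₀ (norm_nonneg _) (norm_nonneg _), ← normSq_eq_norm_sq, ← normSq_eq_norm_sq,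
        normSq_apply, normSq_apply]
      simp only [add_re, ofReal_re, add_im, ofReal_im]
      norm_num
      nlinarith
    have hn1 : ∀ s : ℂ, -(3 / 2) ≤ s.re → 1 ≤ ‖s + 10‖ := fun s hs => by
      have := abs_re_le_norm (s + 10)
      have h' : (s + 10).re = s.re + 10 := by simp
      rw [h'] at this
      have := le_abs_self (s.re + 10)
      linarith
    have hn2 : ∀ s : ℂ, -(3 / 2) ≤ s.re → s.re ≤ 9 / 2 → ‖s + 10‖ ≤ 15 + |s.im| := fun s h1 h2 => by
      have := norm_le_abs_re_add_abs_im (s + 10)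
      have h' : (s + 10).re = s.re + 10 := by simp
      have h'' : (s + 10).im = s.im := by simp
      rw [h', h'', abs_of_nonneg (by linarith)] at this
      linarith
    have hsub : ∀ s : ℂ, -(3 / 2) ≤ s.re → 3 / 2 ≤ s.re → ‖s - 1‖ ≤ ‖s + 10‖ := by
      intro s _ h1
      rw [← sq_le_sq₀ (norm_nonneg _) (norm_nonneg _), ← normSq_eq_norm_sq, ← normSq_eq_norm_sq,
        normSq_apply, normSq_apply]
      simp only [add_re, sub_re, one_re, add_im, sub_im, one_im]
      norm_num
      nlinarith
    set C₂ := B + d ^ (4 : ℝ) * B with hC₂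
    have hC₂p : 0 < C₂ := by positivity
    have hright : ∀ s : ℂ, 3 / 2 ≤ s.re → ‖V s‖ ≤ C₂ * ‖s + 10‖ ^ (2 * k + 1) := by
      intro s h1
      calc ‖V s‖ ≤ B * ‖s - 1‖ := hR s h1
        _ ≤ C₂ * ‖s + 10‖ := by
          have := hsub s (by linarith) h1
          gcongr
          exact le_add_of_nonneg_right (by positivity)
        _ ≤ _ := by
          gcongr
          exact le_self_pow₀ (hn1 s (by linarith)) (by omega)
    have hleft : ∀ s : ℂ, s.re = -(3 / 2) → ‖V s‖ ≤ C₂ * ‖s + 10‖ ^ (2 * k + 1) := by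
      intro s h1
      have hw : 1 - starRingEnd ℂ s = s + 4 :=
        Complex.ext (by simp; linarith) (by simp)
      have h2 := hFE s
      rw [hw, h1] at h2
      have hj : ∀ j : ℝ, (∃ n : ℤ, j = n) → s + (j : ℂ) ≠ 0 := by
        rintro j ⟨n, rfl⟩ h
        have h3 := congrArg Complex.re h
        simp [h1] at h3
        have h4 : ((2 * n : ℤ) : ℝ) = ((3 : ℤ) : ℝ) := by push_cast; linarith
        have := Int.cast_injective h4
        omega
      have a1 := invGamReg_shift_le (K := K) (s := s) (N := ‖s + 10‖)
        (by have := hj 1 ⟨1, by simp⟩; simpa using this)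
        (by have := hj 2 ⟨2, by simp⟩; simpa using this)
        (by simpa using hnn s 1 h1.ge (by norm_num) (by norm_num))
        (by simpa using hnn s 2 h1.ge (by norm_num) (by norm_num))
      have e3 : s + 2 + 1 = s + 3 := by ring
      have e4 : s + 2 + 2 = s + 4 := by ring
      have a2 := invGamReg_shift_le (K := K) (s := s + 2) (N := ‖s + 10‖)
        (by rw [e3]; have := hj 3 ⟨3, by simp⟩; simpa using this)
        (by rw [e4]; have := hj 4 ⟨4, by simp⟩; simpa using this)
        (by rw [e3]; simpa using hnn s 3 h1.ge (by norm_num) (by norm_num))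
        (by rw [e4]; simpa using hnn s 4 h1.ge (by norm_num) (by norm_num))
      rw [e4] at a2
      have h5 : 0 < ‖i1 (s + 4)‖ := norm_pos_iff.2 (invGamReg_ne_zero (by simp [h1]; norm_num))
      have h6 := hR (s + 4) (by simp [h1]; norm_num)
      have h7 : ‖s + 4 - 1‖ ≤ ‖s + 10‖ := by
        have : s + 4 - 1 = s + (3 : ℝ) := by push_cast; ring
        rw [this]; exact hnn s 3 h1.ge (by norm_num) (by norm_num)
      have hdd : d ^ (1 - -(3 / 2 : ℝ)) = d ^ (4 : ℝ) * d ^ (-(3 / 2) : ℝ) := by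
        rw [← Real.rpow_add hd]; norm_num
      have h8 : 0 < d ^ (-(3 / 2) : ℝ) := by positivity
      set N := ‖s + 10‖
      have h9 : ‖i1 s‖ ≤ N ^ (2 * k) * ‖i1 (s + 4)‖ := by
        calc _ ≤ N ^ k * ‖i1 (s + 2)‖ := a1
          _ ≤ N ^ k * (N ^ k * ‖i1 (s + 4)‖) := by gcongr
          _ = _ := by ring
      have h10 : ‖V s‖ * (d ^ (-(3 / 2) : ℝ) * ‖i1 (s + 4)‖) ≤
          (d ^ (4 : ℝ) * B * N ^ (2 * k + 1)) * (d ^ (-(3 / 2) : ℝ) * ‖i1 (s + 4)‖) := by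
        calc _ = ‖V (s + 4)‖ * (d ^ (4 : ℝ) * d ^ (-(3 / 2) : ℝ)) * ‖i1 s‖ := by
              rw [← hdd, ← h2]; ring
          _ ≤ (B * N) * (d ^ (4 : ℝ) * d ^ (-(3 / 2) : ℝ)) * (N ^ (2 * k) * ‖i1 (s + 4)‖) := by
              have := h6.trans (mul_le_mul_of_nonneg_left h7 hB0.le)
              gcongr
          _ = _ := by ring
      refine (le_of_mul_le_mul_right h10 (by positivity)).trans ?_
      gcongr
      exact le_add_of_nonneg_left hB0.le
    have hexp : ∃ C₁ : ℝ, 0 < C₁ ∧ ∀ s : ℂ, -(3 / 2) ≤ s.re → s.re ≤ 5 / 2 →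
        ‖V s‖ ≤ C₁ * Real.exp (C₁ * |s.im|) := by
      obtain ⟨D, hD0, hD⟩ := norm_cpow_strip hd (-3) 3
      obtain ⟨C, hC0, hC⟩ := invGamReg_bound (K := K) (-(3 / 2)) (5 / 2)
      obtain ⟨M, hM⟩ := hLb (-(3 / 2)) (5 / 2)
      have hM0 : 0 ≤ M := (norm_nonneg _).trans (hM 0 (by norm_num) (by norm_num))
      refine ⟨D * (30 * M + a) * C + (C + 2), by positivity, fun s h1 h2 => ?_⟩
      have h3 := hD (-s) (by simp; linarith) (by simp; linarith)
      have h4 := hC s h1 h2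
      have h5 := hM s h1 h2
      set t := |s.im|
      have ht : 0 ≤ t := abs_nonneg _
      have h6 : ‖s‖ ≤ 5 * Real.exp t := by
        have := norm_le_abs_re_add_abs_im s
        have h7 : |s.re| ≤ 4 := abs_le.2 ⟨by linarith, by linarith⟩
        have := Real.add_one_le_exp t
        change ‖s‖ ≤ |s.re| + t at *
        linarith
      have h7 : ‖s - 1‖ ≤ 6 * Real.exp t := by
        have := norm_sub_le s 1
        rw [norm_one] at this
        have := Real.one_le_exp ht
        linarith
      have hX1 : ‖X s‖ ≤ (30 * M + a) * Real.exp (2 * t) := by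
        have e : Real.exp (2 * t) = Real.exp t * Real.exp t := by rw [← Real.exp_add]; ring_nf
        have h8 : 1 ≤ Real.exp (2 * t) := Real.one_le_exp (by positivity)
        calc ‖X s‖ ≤ ‖L s * (s * (s - 1))‖ + ‖(a : ℂ)‖ := norm_add_le _ _
          _ = ‖L s‖ * (‖s‖ * ‖s - 1‖) + a := by
            rw [norm_mul, norm_mul, norm_real, Real.norm_of_nonneg ha.le]
          _ ≤ M * (5 * Real.exp t * (6 * Real.exp t)) + a * Real.exp (2 * t) := by
            gcongr
            exact le_mul_of_one_le_right ha.le h8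
          _ = _ := by rw [e]; ring
      calc ‖V s‖ = ‖(d : ℂ) ^ (-s)‖ * ‖X s‖ * ‖i1 s‖ := by rw [← norm_mul, ← norm_mul]
        _ ≤ D * ((30 * M + a) * Real.exp (2 * t)) * (C * Real.exp (C * t)) := by gcongr
        _ = (D * (30 * M + a) * C) * Real.exp ((C + 2) * t) := by
          rw [add_mul C, Real.exp_add]; ring
        _ ≤ _ := by
          have q0 : 0 ≤ D * (30 * M + a) * C := by positivity
          have q1 : D * (30 * M + a) * C ≤ D * (30 * M + a) * C + (C + 2) :=
            le_add_of_nonneg_right (by positivity)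
          have q2 : C + 2 ≤ D * (30 * M + a) * C + (C + 2) := le_add_of_nonneg_left q0
          exact mul_le_mul q1 (Real.exp_le_exp.2 (mul_le_mul_of_nonneg_right q2 ht))
            (Real.exp_pos _).le (by positivity)
    obtain ⟨C₁, hC₁, hC₁b⟩ := hexp
    refine ⟨C₂ * 8 ^ (2 * k + 1), 2 * k + 1, by positivity, fun s h1 h2 => ?_⟩
    have h3 : ‖V s‖ ≤ C₂ * ‖s + 10‖ ^ (2 * k + 1) := by
      rcases le_total s.re (5 / 2) with h | h
      · exact phragmen_lindelof_strip hVd hC₁ hC₁b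
          (fun z hz => hz.elim (hleft z) (fun hz => hright z (by linarith))) h1 h
      · exact hright s (by linarith)
    refine h3.trans ?_
    rw [mul_assoc, ← mul_pow]
    have := hn2 s h1 h2
    have h4 : ‖s + 10‖ ≤ 8 * (2 + |s.im|) := by linarith [abs_nonneg s.im]
    gcongr
  · intro s hs h0
    obtain ⟨h1, h2, h3⟩ := hV0 s hs h0
    refine ⟨h1, hRH s h1 h2 h3, fun h4 => ?_⟩
    have hs0 : s ≠ 0 := by rintro rfl; simp at h2
    have hs1 : s ≠ 1 := by rintro rfl; simp at h3
    have e1 : (fun w => (w - 1) * Z w) =ᶠ[𝓝 s] fun w => w ^ m * V w := by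
      filter_upwards [isOpen_ne.mem_nhds hs0, isOpen_ne.mem_nhds hs1] with w h5 h6
      exact hzeta w h5 h6
    have e2 : HasDerivAt (fun w => (w - 1) * Z w) (1 * Z s + (s - 1) * deriv Z s) s :=
      ((hasDerivAt_id s).sub_const 1).mul (hZd s hs1).hasDerivAt
    have e3 : HasDerivAt (fun w => w ^ m * V w)
        (((m : ℂ) * s ^ (m - 1)) * V s + s ^ m * deriv V s) s :=
      (hasDerivAt_pow m s).mul (hVd s).hasDerivAt
    have e4 := (e2.congr_of_eventuallyEq e1.symm).unique e3
    rw [h0, h4, h1] at e4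
    simp only [mul_zero, add_zero, zero_add, mul_eq_zero] at e4
    rcases e4 with e4 | e4
    · exact sub_ne_zero.2 hs1 e4
    · exact hsimple s h1 h2 h3 e4
  · refine ⟨1 / (2 * B), by positivity, fun t => ?_⟩
    have hre : ((3 : ℂ) / 2 + t * I).re = 3 / 2 := by simp
    have him : ((3 : ℂ) / 2 + t * I).im = t := by simp
    set s : ℂ := 3 / 2 + t * I
    have h1 := hRl s hre.ge
    have h2 : ‖s‖ ≤ 2 + |t| := by
      have := norm_le_abs_re_add_abs_im s
      rw [hre, him, abs_of_pos (by norm_num)] at this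
      linarith
    have h3 : 1 / 2 ≤ ‖s - 1‖ := by
      have := abs_re_le_norm (s - 1)
      rw [sub_re, hre, one_re, abs_of_pos (by norm_num)] at this
      linarith
    have h4 : ‖s‖ ^ m * ‖V s‖ ≤ (2 + |t|) ^ m * ‖V s‖ := by gcongr
    rw [div_le_iff₀ (by positivity), div_le_iff₀ (by positivity)]
    nlinarith
  · obtain ⟨c, hc0, hc⟩ := invGamReg_shift_ge (K := K)
    refine ⟨B + 3 * B / (d ^ (2 : ℝ) * c), ?_⟩
    rintro s (hs | hs)
    · have hw : 1 - starRingEnd ℂ s = s + 2 := Complex.ext (by simp; linarith) (by simp)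
      have h2 := hFE s
      rw [hw, hs] at h2
      have hj1 : s + 1 ≠ 0 := fun h => by
        have := congrArg Complex.re h
        simp [hs] at this; linarith
      have hj2 : s + 2 ≠ 0 := fun h => by
        have := congrArg Complex.re h
        simp [hs] at this; linarith
      have h3 : 1 / 2 ≤ ‖s + 1‖ := by
        have := abs_re_le_norm (s + 1)
        rw [add_re, hs, one_re, abs_of_pos (by norm_num)] at this
        linarith
      have h4 := hc s hj1 hj2 h3
      rw [← hq, Nat.succ_eq_add_one] at h4
      have h5 : 0 < ‖i1 (s + 2)‖ := norm_pos_iff.2 (invGamReg_ne_zero (by simp [hs]; norm_num))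
      have h6 := hRl (s + 2) (by simp [hs]; norm_num)
      have e1 : s + 2 - 1 = s + 1 := by ring
      rw [e1] at h6
      have h7 : 1 ≤ ‖s + 2‖ := by
        have := abs_re_le_norm (s + 2)
        have h' : (s + 2).re = s.re + 2 := by simp
        rw [h', hs, abs_of_pos (by norm_num)] at this
        linarith
      have h8 : ‖s - 1‖ ≤ 3 * ‖s + 1‖ := by
        rw [← sq_le_sq₀ (norm_nonneg _) (by positivity), mul_pow, ← normSq_eq_norm_sq,
          ← normSq_eq_norm_sq, normSq_apply, normSq_apply]
        simp only [add_re, sub_re, one_re, add_im, sub_im, one_im, hs]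
        nlinarith [sq_nonneg s.im]
      have hdd : d ^ (1 - -(1 / 2 : ℝ)) = d ^ (2 : ℝ) * d ^ (-(1 / 2) : ℝ) := by
        rw [← Real.rpow_add hd]; norm_num
      have h9 : 0 < d ^ (-(1 / 2) : ℝ) := by positivity
      set N := ‖s + 2‖
      have h10 : (d ^ (2 : ℝ) * c * ‖s + 1‖) * (d ^ (-(1 / 2) : ℝ) * ‖i1 (s + 2)‖) ≤
          (B * (N ^ m * ‖V s‖)) * (d ^ (-(1 / 2) : ℝ) * ‖i1 (s + 2)‖) := by
        calc _ ≤ (d ^ (2 : ℝ) * c * (B * (N ^ m * ‖V (s + 2)‖))) *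
              (d ^ (-(1 / 2) : ℝ) * ‖i1 (s + 2)‖) * N ^ (m + 1) := by
              refine le_trans ?_ (le_mul_of_one_le_right (by positivity) (one_le_pow₀ h7))
              gcongr
          _ = (B * N ^ m) * (‖V (s + 2)‖ * (d ^ (2 : ℝ) * d ^ (-(1 / 2) : ℝ))) *
              (c * N ^ (m + 1) * ‖i1 (s + 2)‖) := by ring
          _ ≤ (B * N ^ m) * (‖V (s + 2)‖ * (d ^ (2 : ℝ) * d ^ (-(1 / 2) : ℝ))) * ‖i1 s‖ := by
              gcongr
          _ = _ := by rw [← hdd]; linear_combination (-(B * N ^ m)) * h2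
      have h11 := le_of_mul_le_mul_right h10 (by positivity)
      have h12 : 0 < N ^ m * ‖V s‖ := by
        have : 0 < d ^ (2 : ℝ) * c * ‖s + 1‖ := by positivity
        exact pos_of_mul_pos_right (this.trans_le h11) hB0.le
      rw [norm_div, norm_mul, norm_pow, div_le_iff₀ h12]
      have h13 : ‖s - 1‖ ≤ 3 * B / (d ^ (2 : ℝ) * c) * (N ^ m * ‖V s‖) := by
        rw [div_mul_eq_mul_div, le_div_iff₀ (by positivity)]
        have : 0 < d ^ (2 : ℝ) * c := by positivity
        nlinarith
      refine h13.trans ?_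
      gcongr
      exact le_add_of_nonneg_left hB0.le
    · have h1 := hRl s hs.ge
      have h2 : ‖s‖ ≤ ‖s + 2‖ := by
        rw [← sq_le_sq₀ (norm_nonneg _) (norm_nonneg _), ← normSq_eq_norm_sq, ← normSq_eq_norm_sq,
          normSq_apply, normSq_apply]
        simp only [add_re, add_im, hs]
        norm_num
      have h3 : 1 / 2 ≤ ‖s - 1‖ := by
        have := abs_re_le_norm (s - 1)
        rw [sub_re, hs, one_re, abs_of_pos (by norm_num)] at this
        linarith
      have h4 : ‖s - 1‖ ≤ B * (‖s + 2‖ ^ m * ‖V s‖) := h1.trans (by gcongr)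
      have h5 : 0 < ‖s + 2‖ ^ m * ‖V s‖ := pos_of_mul_pos_right (by linarith) hB0.le
      rw [norm_div, norm_mul, norm_pow, div_le_iff₀ h5]
      refine h4.trans ?_
      gcongr
      exact le_add_of_nonneg_right (by positivity)
  · obtain ⟨D, hD0, hD⟩ := norm_cpow_strip hd (-2) 2
    obtain ⟨c, hc0, hc⟩ := invGamReg_lower (K := K) (A := -(1 / 2)) (B := 1 / 2) (by norm_num)
    obtain ⟨C, hC0, hC⟩ := invGamReg_bound (K := K) (1 / 2) (3 / 2)
    refine ⟨c / (D * D * C), C, by positivity, hC0, fun s h1 h2 => ?_⟩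
    have h3 := hFE s
    have hD' : ∀ x : ℝ, -2 ≤ x → x ≤ 2 → d ^ x ≤ D := fun x h4 h5 => by
      have := hD x (by simpa using h4) (by simpa using h5)
      rwa [norm_cpow_eq_rpow_re_of_pos hd, ofReal_re] at this
    have h4 : 1 ≤ d ^ (1 - s.re) * D := by
      have := hD' (-(1 - s.re)) (by linarith) (by linarith)
      rw [Real.rpow_neg hd.le, inv_le_iff_one_le_mul₀' (by positivity)] at this
      exact this
    have h5 := hD' s.re (by linarith) (by linarith)
    have h6 := hC (1 - starRingEnd ℂ s) (by simp; linarith) (by simp; linarith)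
    have h7 : (1 - starRingEnd ℂ s).im = s.im := by simp
    rw [h7] at h6
    have h8 := hc s h1 h2
    set E := Real.exp (C * |s.im|)
    have hE : 0 < E := Real.exp_pos _
    rw [Real.exp_neg]
    change c / (D * D * C) * E⁻¹ * ‖V (1 - starRingEnd ℂ s)‖ ≤ ‖V s‖
    set v := ‖V (1 - starRingEnd ℂ s)‖
    have hv : 0 ≤ v := norm_nonneg _
    have h9 : c * v ≤ D * D * C * E * ‖V s‖ := by
      calc c * v ≤ ‖i1 s‖ * v * 1 := by rw [mul_one]; exact mul_le_mul_of_nonneg_right h8 hv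
        _ ≤ ‖i1 s‖ * v * (d ^ (1 - s.re) * D) := by gcongr
        _ = D * (‖V s‖ * d ^ s.re * ‖i1 (1 - starRingEnd ℂ s)‖) := by rw [h3]; ring
        _ ≤ D * (‖V s‖ * D * (C * E)) := by gcongr
        _ = _ := by ring
    calc _ = c * v / (D * D * C * E) := by field_simp
      _ ≤ _ := by rw [div_le_iff₀ (by positivity)]; linarith
end LimDist

namespace LimDist
open Metric

/-- Divide one zero out of an entire function. -/
lemma dslope_entire {f : ℂ → ℂ} (hf : Differentiable ℂ f) (c : ℂ) :
    Differentiable ℂ (dslope f c) := by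
  have := (Complex.differentiableOn_dslope (s := Set.univ) (c := c) (f := f) univ_mem).2
    hf.differentiableOn
  exact differentiableOn_univ.1 this

lemma eq_mul_dslope {f : ℂ → ℂ} {c : ℂ} (h : f c = 0) (s : ℂ) :
    f s = (s - c) * dslope f c s := by
  have := sub_smul_dslope f c s
  rw [smul_eq_mul, h, sub_zero] at this
  exact this.symm

lemma exists_factor (F : Finset ℂ) : ∀ {f : ℂ → ℂ}, Differentiable ℂ f → (∀ z ∈ F, f z = 0) →
    ∃ g : ℂ → ℂ, Differentiable ℂ g ∧ (∀ s, f s = (∏ z ∈ F, (s - z)) * g s) := by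
  induction F using Finset.induction_on with
  | empty => intro f hf _; exact ⟨f, hf, fun s => by simp⟩
  | insert a F ha ih =>
    intro f hf h
    have h0 := eq_mul_dslope (h a (Finset.mem_insert_self _ _))
    obtain ⟨g, hg, hfg⟩ := ih (dslope_entire hf a) (fun z hz => by
      have h1 := h0 z
      rw [h z (Finset.mem_insert_of_mem hz)] at h1
      rcases mul_eq_zero.1 h1.symm with h2 | h2
      · exact absurd (sub_eq_zero.1 h2 ▸ hz) ha
      · exact h2)
    refine ⟨g, hg, fun s => ?_⟩
    rw [h0 s, hfg s, Finset.prod_insert ha]; ring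

/-- The cofactor does not vanish at a simple zero. -/
lemma factor_ne_zero {F : Finset ℂ} {f g : ℂ → ℂ} (hg : Differentiable ℂ g)
    (hfg : ∀ s, f s = (∏ z ∈ F, (s - z)) * g s) {z : ℂ} (hz : z ∈ F) (hd : deriv f z ≠ 0) :
    g z ≠ 0 := by
  intro h0
  apply hd
  have h1 : f = fun s => (s - z) * ((∏ w ∈ F.erase z, (s - w)) * g s) := by
    funext s
    rw [hfg s, ← Finset.mul_prod_erase F _ hz]; ring
  have h2 : DifferentiableAt ℂ (fun s => (∏ w ∈ F.erase z, (s - w)) * g s) z := by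
    fun_prop
  have h3 : HasDerivAt (fun s => (s - z) * ((∏ w ∈ F.erase z, (s - w)) * g s))
      (1 * ((∏ w ∈ F.erase z, (z - w)) * g z) +
        (z - z) * deriv (fun s => (∏ w ∈ F.erase z, (s - w)) * g s) z) z :=
    ((hasDerivAt_id z).sub_const z).mul h2.hasDerivAt
  rw [h1, h3.deriv, h0]; ring

/-- A nonzero entire function has finitely many zeros in a compact set. -/
lemma finite_zeros {f : ℂ → ℂ} (hf : Differentiable ℂ f) {c : ℂ} (hc : f c ≠ 0) {S : Set ℂ}
    (hS : IsCompact S) : {z ∈ S | f z = 0}.Finite := by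
  by_contra hinf
  obtain ⟨z, -, hz⟩ := Set.Infinite.exists_accPt_of_subset_isCompact (K := S)
    (s := {z ∈ S | f z = 0}) hinf hS (fun z hz => hz.1)
  have hfr : ∃ᶠ w in 𝓝[≠] z, f w = 0 := by
    have := accPt_iff_frequently_nhdsNE.1 hz
    exact this.mono fun w hw => hw.2
  have ha : AnalyticOnNhd ℂ f Set.univ := fun w _ => hf.analyticAt w
  exact hc (ha.eqOn_zero_of_preconnected_of_frequently_eq_zero isPreconnected_univ
    (Set.mem_univ z) hfr (Set.mem_univ c))

end LimDist

namespace LimDist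
open Metric

/-- A nonvanishing holomorphic function on a disc centred at `0` has a logarithm. -/
lemma exists_log_ball {g : ℂ → ℂ} {R : ℝ} (hR : 0 < R) (hg : Differentiable ℂ g)
    (h0 : ∀ z ∈ ball (0 : ℂ) R, g z ≠ 0) :
    ∃ h : ℂ → ℂ, DifferentiableOn ℂ h (ball 0 R) ∧ h 0 = 0 ∧
      ∀ z ∈ ball (0 : ℂ) R, g z = g 0 * Complex.exp (h z) := by
  have hd : DifferentiableOn ℂ (fun z => deriv g z / g z) (ball 0 R) := by
    refine DifferentiableOn.div ?_ hg.differentiableOn h0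
    exact (hg.differentiableOn.deriv isOpen_univ).mono (Set.subset_univ _)
  obtain ⟨h, hh0, hh⟩ := (hd.isExactOn_ball).with_val_at 0 0
  refine ⟨h, fun z hz => (hh z hz).differentiableAt.differentiableWithinAt, hh0, fun z hz => ?_⟩
  have hder : ∀ w ∈ ball (0 : ℂ) R,
      HasDerivAt (fun w => g w * Complex.exp (-h w)) 0 w := by
    intro w hw
    have h1 := (hg w).hasDerivAt.mul (hh w hw).neg.cexp
    refine h1.congr_deriv ?_
    have hgw : g w ≠ 0 := h0 w hw
    have e : deriv g w / g w * g w = deriv g w := div_mul_cancel₀ _ hgw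
    linear_combination (-cexp (-h w)) * e
  have hconst := IsOpen.is_const_of_deriv_eq_zero (𝕜 := ℂ) isOpen_ball
    (convex_ball (0 : ℂ) R).isPreconnected
    (fun w hw => (hder w hw).differentiableAt.differentiableWithinAt)
    (fun w hw => (hder w hw).deriv) hz (mem_ball_self hR)
  simp only [hh0, neg_zero, Complex.exp_zero, mul_one] at hconst
  rw [← hconst, mul_assoc, ← Complex.exp_add]; simp

/-- Lower bound near the centre for a function with finitely many simple zeros, with a bound
for the number of zeros. -/
lemma local_bound {f : ℂ → ℂ} (hf : Differentiable ℂ f) {c : ℂ} {L M : ℝ}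
    (hM : ∀ s ∈ closedBall c 3, ‖f s‖ ≤ M) (hc : f c ≠ 0) (hL : 0 < L)
    (hML : M ≤ ‖f c‖ * Real.exp L) {F : Finset ℂ}
    (hF : ∀ z, z ∈ F ↔ z ∈ closedBall c (5 / 4) ∧ f z = 0) (hd : ∀ z ∈ F, deriv f z ≠ 0) :
    (7 / 5 : ℝ) ^ F.card ≤ Real.exp L ∧
      ∀ s ∈ closedBall c 1, ‖f c‖ * Real.exp (-(9 * L)) * ∏ z ∈ F, ‖s - z‖ ≤ ‖f s‖ := by
  obtain ⟨g, hg, hfg⟩ := exists_factor F hf (fun z hz => ((hF z).1 hz).2)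
  have hfc : 0 < ‖f c‖ := norm_pos_iff.2 hc
  have hnf : ∀ s, ‖f s‖ = (∏ z ∈ F, ‖s - z‖) * ‖g s‖ := fun s => by
    rw [hfg s, norm_mul, norm_prod]
  have hg0 : ∀ s ∈ closedBall c (5 / 4), g s ≠ 0 := by
    intro s hs h0
    have : f s = 0 := by rw [hfg s, h0, mul_zero]
    have hsF := (hF s).2 ⟨hs, this⟩
    exact factor_ne_zero hg hfg hsF (hd s hsF) h0
  have hPc : ∏ z ∈ F, ‖c - z‖ ≤ (5 / 4 : ℝ) ^ F.card := by
    rw [← Finset.prod_const]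
    refine Finset.prod_le_prod (fun _ _ => norm_nonneg _) fun z hz => ?_
    have := ((hF z).1 hz).1
    rw [mem_closedBall, dist_comm, dist_eq_norm] at this
    exact this
  have hM0 : 0 ≤ M := (norm_nonneg _).trans (hM c (by simp))
  -- maximum principle for the cofactor
  have hgM : ∀ s ∈ closedBall c 3, ‖g s‖ ≤ M * (4 / 7) ^ F.card := by
    intro s hs
    refine Complex.norm_le_of_forall_mem_frontier_norm_le (U := ball c 3) isBounded_ball
      hg.diffContOnCl (fun z hz => ?_) (by rwa [closure_ball c (by norm_num)])
    rw [frontier_ball c (by norm_num), mem_sphere, dist_eq_norm] at hz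
    have h1 : (7 / 4 : ℝ) ^ F.card ≤ ∏ w ∈ F, ‖z - w‖ := by
      rw [← Finset.prod_const]
      refine Finset.prod_le_prod (fun _ _ => by norm_num) fun w hw => ?_
      have := ((hF w).1 hw).1
      rw [mem_closedBall, dist_eq_norm] at this
      have h2 : ‖z - c‖ ≤ ‖z - w‖ + ‖w - c‖ := by
        have := norm_add_le (z - w) (w - c); simpa using this
      linarith
    have h2 := hM z (by rw [mem_closedBall, dist_eq_norm]; exact hz.le)
    rw [hnf z] at h2
    have h3 : (7 / 4 : ℝ) ^ F.card * ‖g z‖ ≤ M :=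
      (mul_le_mul_of_nonneg_right h1 (norm_nonneg _)).trans h2
    have h4 : (4 / 7 : ℝ) ^ F.card * (7 / 4) ^ F.card = 1 := by rw [← mul_pow]; norm_num
    calc ‖g z‖ = ((4 / 7 : ℝ) ^ F.card * (7 / 4) ^ F.card) * ‖g z‖ := by rw [h4, one_mul]
      _ = ((7 / 4 : ℝ) ^ F.card * ‖g z‖) * (4 / 7) ^ F.card := by ring
      _ ≤ _ := by gcongr
  have hgc : ‖f c‖ * (4 / 5) ^ F.card ≤ ‖g c‖ := by
    rw [hnf c]
    calc _ ≤ (5 / 4 : ℝ) ^ F.card * ‖g c‖ * (4 / 5) ^ F.card := by gcongr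
      _ = ((5 / 4 : ℝ) ^ F.card * (4 / 5) ^ F.card) * ‖g c‖ := by ring
      _ = ‖g c‖ := by rw [← mul_pow]; norm_num
  have hgcp : 0 < ‖g c‖ := norm_pos_iff.2 (hg0 c (by simp; norm_num))
  have hcard : (7 / 5 : ℝ) ^ F.card ≤ Real.exp L := by
    have h1 := hgc.trans (hgM c (by simp))
    have h2 : ‖f c‖ * (4 / 5) ^ F.card ≤ ‖f c‖ * Real.exp L * (4 / 7) ^ F.card :=
      h1.trans (by gcongr)
    have h3 : (4 / 5 : ℝ) ^ F.card ≤ Real.exp L * (4 / 7) ^ F.card := by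
      rw [mul_assoc] at h2; exact le_of_mul_le_mul_left h2 hfc
    calc (7 / 5 : ℝ) ^ F.card = (4 / 5) ^ F.card * (7 / 4) ^ F.card := by
          rw [← mul_pow]; norm_num
      _ ≤ Real.exp L * (4 / 7) ^ F.card * (7 / 4) ^ F.card := by gcongr
      _ = Real.exp L := by rw [mul_assoc, ← mul_pow]; norm_num
  refine ⟨hcard, fun s hs => ?_⟩
  obtain ⟨h, hhd, hh0, hh⟩ := exists_log_ball (g := fun z => g (c + z)) (R := 5 / 4)
    (by norm_num) (by fun_prop) (fun z hz => hg0 _ (by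
      rw [mem_closedBall, dist_eq_norm]; rw [mem_ball_zero_iff] at hz; simpa using hz.le))
  simp only [add_zero] at hh
  have hre : Set.MapsTo h (ball 0 (5 / 4)) {z | z.re ≤ L} := by
    intro z hz
    have h1 : ‖g (c + z)‖ ≤ M * (4 / 7) ^ F.card := hgM _ (by
      rw [mem_closedBall, dist_eq_norm]; rw [mem_ball_zero_iff] at hz
      simp; linarith)
    rw [hh z hz, norm_mul, Complex.norm_exp] at h1
    have h2 : ‖g c‖ * Real.exp (h z).re ≤ ‖g c‖ * Real.exp L := by
      refine h1.trans ?_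
      calc M * (4 / 7) ^ F.card ≤ ‖f c‖ * Real.exp L * (4 / 5) ^ F.card := by
            gcongr; norm_num
        _ = (‖f c‖ * (4 / 5) ^ F.card) * Real.exp L := by ring
        _ ≤ _ := by gcongr
    exact Real.exp_le_exp.1 (le_of_mul_le_mul_left h2 hgcp)
  have hz : s - c ∈ ball (0 : ℂ) (5 / 4) := by
    rw [mem_ball_zero_iff]; rw [mem_closedBall, dist_eq_norm] at hs; linarith
  have hbc := Complex.borelCaratheodory_zero hL hhd hre (by norm_num) hz hh0
  rw [mem_closedBall, dist_eq_norm] at hs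
  have hb8 : ‖h (s - c)‖ ≤ 8 * L := by
    refine hbc.trans ?_
    rw [div_le_iff₀ (by linarith)]
    nlinarith
  have hlow : -(8 * L) ≤ (h (s - c)).re := by
    have := Complex.abs_re_le_norm (h (s - c))
    have := abs_le.1 (this.trans hb8)
    exact this.1
  have hgs : ‖g s‖ = ‖g c‖ * Real.exp (h (s - c)).re := by
    have := hh _ hz
    rw [add_sub_cancel] at this
    rw [this, norm_mul, Complex.norm_exp]
  have h45 : Real.exp (-L) ≤ (4 / 5 : ℝ) ^ F.card := by
    rw [Real.exp_neg]
    calc (Real.exp L)⁻¹ ≤ ((7 / 5 : ℝ) ^ F.card)⁻¹ := by gcongr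
      _ = (5 / 7) ^ F.card := by rw [← inv_pow]; norm_num
      _ ≤ _ := pow_le_pow_left₀ (by norm_num) (by norm_num) _
  rw [hnf s, hgs]
  have hP : 0 ≤ ∏ z ∈ F, ‖s - z‖ := Finset.prod_nonneg fun _ _ => norm_nonneg _
  calc _ = (∏ z ∈ F, ‖s - z‖) * (‖f c‖ * Real.exp (-L) * Real.exp (-(8 * L))) := by
        rw [mul_assoc ‖f c‖ (Real.exp (-L)), ← Real.exp_add]; ring_nf
    _ ≤ (∏ z ∈ F, ‖s - z‖) * (‖f c‖ * (4 / 5) ^ F.card * Real.exp (h (s - c)).re) := by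
        gcongr
    _ ≤ _ := by gcongr

end LimDist

namespace LimDist
open Metric

lemma pow_le_exp_sqrt {B : ℝ} (hB : 0 < B) (n : ℕ) {x : ℝ} (hx : 1 ≤ x) :
    B * x ^ n ≤ Real.exp ((|Real.log B| + 2 * n) * √x) := by
  have hx0 : 0 < x := by linarith
  have hs : 1 ≤ √x := Real.one_le_sqrt.2 hx
  have hl : Real.log x ≤ 2 * √x := by
    have h1 : Real.log (√x) ≤ √x := (Real.log_le_sub_one_of_pos (by linarith)).trans (by linarith)
    rw [Real.log_sqrt hx0.le] at h1
    linarith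
  rw [← Real.exp_log (show 0 < B * x ^ n by positivity), Real.exp_le_exp,
    Real.log_mul hB.ne' (by positivity), Real.log_pow]
  have h2 : Real.log B ≤ |Real.log B| * √x :=
    (le_abs_self _).trans (le_mul_of_one_le_right (abs_nonneg _) hs)
  have h3 : (n : ℝ) * Real.log x ≤ n * (2 * √x) := by gcongr
  linarith

lemma im_abs_le_of_mem {T r : ℝ} {s : ℂ} (hs : s ∈ closedBall (3 / 2 + T * I : ℂ) r) :
    |s.re - 3 / 2| ≤ r ∧ |s.im - T| ≤ r := by
  rw [mem_closedBall, dist_eq_norm] at hs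
  have h1 := (Complex.abs_re_le_norm _).trans hs
  have h2 := (Complex.abs_im_le_norm _).trans hs
  constructor
  · simpa using h1
  · simpa using h2

namespace VPack
variable {Z V : ℂ → ℂ} {m : ℕ}

lemma ne_zero_center (h : VPack Z V m) (T : ℝ) : V (3 / 2 + T * I) ≠ 0 := by
  intro h0
  have := (h.zeros _ (by simp; norm_num) h0).2.1
  norm_num at this

lemma local_est (h : VPack Z V m) : ∃ A : ℝ, 0 < A ∧ ∀ (T : ℝ) (F : Finset ℂ),
    (∀ z, z ∈ F ↔ z ∈ closedBall (3 / 2 + T * I : ℂ) (5 / 4) ∧ V z = 0) →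
    (F.card : ℝ) ≤ A * √(2 + |T|) ∧ ∀ s ∈ closedBall (3 / 2 + T * I : ℂ) 1,
      Real.exp (-(A * √(2 + |T|))) * ∏ z ∈ F, ‖s - z‖ ≤ ‖V s‖ := by
  obtain ⟨C, k, hC, hg⟩ := h.growth
  obtain ⟨c, hc, hl⟩ := h.lower
  set L0 : ℝ := (|Real.log (C * (5 / 2) ^ k / c)| + 2 * ((k + m : ℕ) : ℝ)) +
    (|Real.log c⁻¹| + 2 * (m : ℝ)) + 1 with hL0
  have hL0p : 0 < L0 := by positivity
  have hlog : 0 < Real.log (7 / 5) := Real.log_pos (by norm_num)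
  refine ⟨L0 * (10 + 1 / Real.log (7 / 5)), by positivity, fun T F hF => ?_⟩
  set x : ℝ := 2 + |T| with hx
  have hx1 : 1 ≤ x := by have := abs_nonneg T; linarith
  have hx0 : 0 < x := by linarith
  have hsx : 1 ≤ √x := Real.one_le_sqrt.2 hx1
  set L : ℝ := L0 * √x with hL
  have hLp : 0 < L := by positivity
  have hcx : 0 < c / x ^ m := by positivity
  have hlT := hl T
  have hM : ∀ s ∈ closedBall (3 / 2 + T * I : ℂ) 3, ‖V s‖ ≤ C * (5 / 2) ^ k * x ^ k := by
    intro s hs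
    obtain ⟨h1, h2⟩ := im_abs_le_of_mem hs
    have h1' := abs_le.1 h1
    refine (hg s (by linarith) (by linarith)).trans ?_
    rw [mul_assoc, ← mul_pow]
    have h3 : |s.im| ≤ |T| + 3 := by
      have := abs_sub_abs_le_abs_sub s.im T; linarith
    have h4 : 2 + |s.im| ≤ 5 / 2 * x := by have := abs_nonneg T; rw [hx]; linarith
    exact mul_le_mul_of_nonneg_left
      (pow_le_pow_left₀ (by have := abs_nonneg s.im; linarith) h4 k) hC.le
  have hML : C * (5 / 2) ^ k * x ^ k ≤ ‖V (3 / 2 + T * I)‖ * Real.exp L := by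
    have h1 := pow_le_exp_sqrt (show 0 < C * (5 / 2) ^ k / c by positivity) (k + m) hx1
    have h2 : Real.exp ((|Real.log (C * (5 / 2) ^ k / c)| + 2 * ((k + m : ℕ) : ℝ)) * √x)
        ≤ Real.exp L := by
      rw [Real.exp_le_exp, hL]
      refine mul_le_mul_of_nonneg_right ?_ (by positivity)
      have : 0 ≤ |Real.log c⁻¹| + 2 * (m : ℝ) := by positivity
      linarith
    calc C * (5 / 2) ^ k * x ^ k = c / x ^ m * (C * (5 / 2) ^ k / c * x ^ (k + m)) := by
          rw [pow_add]; field_simp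
      _ ≤ c / x ^ m * Real.exp L := mul_le_mul_of_nonneg_left (h1.trans h2) hcx.le
      _ ≤ _ := mul_le_mul_of_nonneg_right hlT (Real.exp_pos _).le
  have hcL : Real.exp (-L) ≤ ‖V (3 / 2 + T * I)‖ := by
    refine le_trans ?_ hlT
    have h1 := pow_le_exp_sqrt (show 0 < c⁻¹ by positivity) m hx1
    have h2 : Real.exp ((|Real.log c⁻¹| + 2 * (m : ℝ)) * √x) ≤ Real.exp L := by
      rw [Real.exp_le_exp, hL]
      refine mul_le_mul_of_nonneg_right ?_ (by positivity)
      have : 0 ≤ |Real.log (C * (5 / 2) ^ k / c)| + 2 * ((k + m : ℕ) : ℝ) := by positivity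
      linarith
    rw [Real.exp_neg, inv_le_comm₀ (Real.exp_pos _) hcx]
    calc (c / x ^ m)⁻¹ = c⁻¹ * x ^ m := by rw [inv_div]; field_simp
      _ ≤ _ := h1.trans h2
  have hd : ∀ z ∈ F, deriv V z ≠ 0 := by
    intro z hz
    obtain ⟨h1, h2⟩ := (hF z).1 hz
    have h3 := abs_le.1 (im_abs_le_of_mem h1).1
    exact (h.zeros z (by linarith) h2).2.2
  obtain ⟨hcard, hlow⟩ := local_bound h.diff hM (h.ne_zero_center T) hLp hML hF hd
  constructor
  · have h1 : (F.card : ℝ) * Real.log (7 / 5) ≤ L := by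
      rw [← Real.log_pow, ← Real.log_exp L]
      exact Real.log_le_log (by positivity) hcard
    have h2 : (F.card : ℝ) ≤ L / Real.log (7 / 5) := by rwa [le_div_iff₀ hlog]
    refine h2.trans ?_
    have h3 : L0 * (10 + 1 / Real.log (7 / 5)) * √x = 10 * L + L / Real.log (7 / 5) := by
      rw [hL]; ring
    rw [h3]; linarith
  · intro s hs
    refine le_trans (mul_le_mul_of_nonneg_right ?_
      (Finset.prod_nonneg fun _ _ => norm_nonneg _)) (hlow s hs)
    calc Real.exp (-(L0 * (10 + 1 / Real.log (7 / 5)) * √x)) ≤ Real.exp (-L + -(9 * L)) := by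
          rw [Real.exp_le_exp]
          have h3 : L0 * (10 + 1 / Real.log (7 / 5)) * √x = 10 * L + L / Real.log (7 / 5) := by
            rw [hL]; ring
          have : 0 ≤ L / Real.log (7 / 5) := by positivity
          rw [h3]; linarith
      _ = Real.exp (-L) * Real.exp (-(9 * L)) := Real.exp_add _ _
      _ ≤ _ := mul_le_mul_of_nonneg_right hcL (Real.exp_pos _).le

/-- The zeros in the disc around `3/2 + iT` of radius `5/4`. -/
lemma exists_zeros (h : VPack Z V m) (T : ℝ) : ∃ F : Finset ℂ,
    ∀ z, z ∈ F ↔ z ∈ closedBall (3 / 2 + T * I : ℂ) (5 / 4) ∧ V z = 0 := by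
  have := finite_zeros h.diff (h.ne_zero_center T)
    (isCompact_closedBall (3 / 2 + T * I : ℂ) (5 / 4))
  exact ⟨this.toFinset, fun z => by simp⟩

lemma mem_of_near (h : VPack Z V m) {T : ℝ} {z : ℂ} (hz : -1 < z.re) (h0 : V z = 0)
    (hT : |z.im - T| ≤ 3 / 4) : z ∈ closedBall (3 / 2 + T * I : ℂ) (5 / 4) := by
  have hre := (h.zeros z hz h0).2.1
  rw [mem_closedBall, dist_eq_norm, ← abs_of_nonneg (show (0 : ℝ) ≤ 5 / 4 by norm_num),
    ← abs_norm, ← sq_le_sq, ← Complex.normSq_eq_norm_sq, Complex.normSq_apply]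
  have := abs_le.1 hT
  simp [hre]
  nlinarith

/-- Number of zeros with ordinate near `T`. -/
lemma count (h : VPack Z V m) : ∃ A : ℝ, 0 < A ∧ ∀ (T : ℝ) (F : Finset ℂ),
    (∀ z ∈ F, -1 < z.re ∧ V z = 0 ∧ |z.im - T| ≤ 3 / 4) → (F.card : ℝ) ≤ A * √(2 + |T|) := by
  obtain ⟨A, hA, hl⟩ := h.local_est
  refine ⟨A, hA, fun T F hF => ?_⟩
  obtain ⟨G, hG⟩ := h.exists_zeros T
  refine le_trans ?_ (hl T G hG).1
  exact_mod_cast Finset.card_le_card fun z hz =>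
    (hG z).2 ⟨h.mem_of_near (hF z hz).1 (hF z hz).2.1 (hF z hz).2.2, (hF z hz).2.1⟩

end VPack

end LimDist

namespace LimDist
open Metric

/-- Among `card F + 1` equally spaced points of `[n, n+1]`, one is far from the ordinates of `F`. -/
lemma exists_gap (F : Finset ℂ) (n : ℝ) : ∃ T : ℝ, n ≤ T ∧ T ≤ n + 1 ∧
    ∀ z ∈ F, 1 / (4 * ((F.card : ℝ) + 1)) ≤ |z.im - T| := by
  by_contra hcon
  push Not at hcon
  set N : ℝ := (F.card : ℝ) + 1 with hN
  have hN0 : 0 < N := by positivity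
  set p : Fin (F.card + 1) → ℝ := fun j => n + (j : ℕ) / N with hp
  have hpm : ∀ j, n ≤ p j ∧ p j ≤ n + 1 := by
    intro j
    have h1 : ((j : ℕ) : ℝ) ≤ N := by
      have := j.2.le
      rw [hN]; exact_mod_cast this
    have h2 : ((j : ℕ) : ℝ) / N ≤ 1 := (div_le_one hN0).2 h1
    have h3 : 0 ≤ ((j : ℕ) : ℝ) / N := by positivity
    exact ⟨by simp only [hp]; linarith, by simp only [hp]; linarith⟩
  choose f hf using fun j => hcon (p j) (hpm j).1 (hpm j).2
  have hinj : Function.Injective f := by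
    intro i j hij
    by_contra hne
    have h1 := (hf i).2
    have h2 := (hf j).2
    rw [← hij] at h2
    have h3 : |p i - p j| < 1 / N := by
      have e : (1 : ℝ) / (4 * N) + 1 / (4 * N) ≤ 1 / N := by
        rw [show (1 : ℝ) / (4 * N) + 1 / (4 * N) = (1 / 2) * (1 / N) by field_simp; norm_num]
        have : 0 < 1 / N := by positivity
        linarith
      have h4 := abs_sub_le (p i) (f i).im (p j)
      rw [abs_sub_comm (p i) (f i).im] at h4
      linarith
    have h4 : 1 / N ≤ |p i - p j| := by
      have e : p i - p j = (((i : ℕ) : ℤ) - ((j : ℕ) : ℤ) : ℤ) / N := by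
        simp only [hp]; push_cast; ring
      rw [e, abs_div, abs_of_pos hN0]
      gcongr
      rw [← Int.cast_abs]
      have : (1 : ℤ) ≤ |((i : ℕ) : ℤ) - ((j : ℕ) : ℤ)| := by
        apply Int.one_le_abs
        intro h0
        apply hne
        ext
        omega
      exact_mod_cast this
    linarith
  have := Fintype.card_le_of_injective (fun j => (⟨f j, (hf j).1⟩ : F)) (fun i j hij => by
    exact hinj (by simpa using hij))
  simp at this

namespace VPack
variable {Z V : ℂ → ℂ} {m : ℕ}

/-- Heights at which `V` is not too small. -/
lemma heights (h : VPack Z V m) : ∃ K : ℝ, 0 < K ∧ ∀ n : ℕ, ∃ T : ℝ, n ≤ T ∧ T ≤ n + 1 ∧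
    (∀ z : ℂ, -1 < z.re → V z = 0 →
      1 / (K * (n + 3)) ≤ |z.im - T| ∧ 1 / (K * (n + 3)) ≤ |z.im - -T|) ∧
    ∀ s : ℂ, -(1 / 2) ≤ s.re → s.re ≤ 3 / 2 → |s.im| = T → Real.exp (-(K * (n + 3))) ≤ ‖V s‖ := by
  obtain ⟨A, hA, hl⟩ := h.local_est
  obtain ⟨c, C, hc, hC, href⟩ := h.refl
  set K : ℝ := 4 + 4 * A + A + 4 * (A + 1) * A + C + |Real.log c| with hK
  have hK0 : 0 < K := by positivity
  refine ⟨K, hK0, fun n => ?_⟩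
  obtain ⟨G, hG⟩ := h.exists_zeros (n + 1 / 2)
  obtain ⟨T, hT1, hT2, hT⟩ := exists_gap G n
  have hn : (0 : ℝ) ≤ n := Nat.cast_nonneg n
  set x : ℝ := n + 3 with hx
  have hx1 : 1 ≤ x := by linarith
  have hsx : √x ≤ x := Real.sqrt_le_self_iff.2 (Or.inr hx1)
  have hsx1 : 1 ≤ √x := Real.one_le_sqrt.2 hx1
  have hN : (G.card : ℝ) ≤ A * √x := by
    refine (hl _ G (by exact_mod_cast hG)).1.trans ?_
    have : √(2 + |(n : ℝ) + 1 / 2|) ≤ √x := by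
      apply Real.sqrt_le_sqrt
      rw [abs_of_nonneg (by linarith)]; linarith
    have e : √(2 + |((n : ℝ) + 1 / 2)|) ≤ √x := this
    exact mul_le_mul_of_nonneg_left (by simpa using e) hA.le
  set η : ℝ := 1 / (4 * ((G.card : ℝ) + 1)) with hη
  have hη0 : 0 < η := by positivity
  have hη1 : η ≤ 1 / 4 := by
    rw [hη]; apply one_div_le_one_div_of_le (by norm_num)
    have : (0 : ℝ) ≤ G.card := Nat.cast_nonneg _
    linarith
  have hzT : ∀ z : ℂ, -1 < z.re → V z = 0 → η ≤ |z.im - T| := by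
    intro z hz h0
    by_cases hm : |z.im - (n + 1 / 2)| ≤ 3 / 4
    · refine hT z ((hG z).2 ⟨?_, h0⟩)
      have := h.mem_of_near hz h0 hm
      simpa using this
    · push Not at hm
      have h1 : |T - (n + 1 / 2)| ≤ 1 / 2 := by rw [abs_le]; constructor <;> linarith
      have h2 := abs_sub_le z.im T (n + 1 / 2)
      linarith
  have hηK : 1 / (K * x) ≤ η := by
    rw [hη]
    apply one_div_le_one_div_of_le (by positivity)
    have h1 : 4 * ((G.card : ℝ) + 1) ≤ (4 + 4 * A) * x := by nlinarith
    refine h1.trans (mul_le_mul_of_nonneg_right ?_ (by linarith))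
    rw [hK]
    have : 0 ≤ A + 4 * (A + 1) * A + C + |Real.log c| := by positivity
    linarith
  have hT0 : 0 ≤ T := hn.trans hT1
  -- right half
  set K1 : ℝ := A + 4 * (A + 1) * A with hK1
  have hK1' : 0 < K1 := by positivity
  have hright : ∀ s : ℂ, 1 / 2 ≤ s.re → s.re ≤ 3 / 2 → s.im = T →
      Real.exp (-(K1 * x)) ≤ ‖V s‖ := by
    intro s h1 h2 h3
    obtain ⟨F, hF⟩ := h.exists_zeros T
    obtain ⟨hNF, hlow⟩ := hl T F hF
    have hx2 : √(2 + |T|) ≤ √x := by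
      apply Real.sqrt_le_sqrt
      rw [abs_of_nonneg hT0]; linarith
    have hNF' : (F.card : ℝ) ≤ A * √x := hNF.trans (by gcongr)
    have hs : s ∈ closedBall (3 / 2 + T * I : ℂ) 1 := by
      rw [mem_closedBall, dist_eq_norm]
      have e : s - (3 / 2 + T * I) = ((s.re - 3 / 2 : ℝ) : ℂ) := by
        apply Complex.ext <;> simp [h3]
      rw [e, Complex.norm_real, Real.norm_eq_abs, abs_le]
      constructor <;> linarith
    refine le_trans ?_ (hlow s hs)
    have hp : η ^ F.card ≤ ∏ z ∈ F, ‖s - z‖ := by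
      rw [← Finset.prod_const]
      refine Finset.prod_le_prod (fun _ _ => hη0.le) fun z hz => ?_
      obtain ⟨hz1, hz2⟩ := (hF z).1 hz
      have hz3 := abs_le.1 (im_abs_le_of_mem hz1).1
      have := hzT z (by linarith) hz2
      refine this.trans ?_
      rw [abs_sub_comm, ← h3]
      exact Complex.abs_im_le_norm (s - z)
    have hηe : Real.exp (-(1 / η)) ≤ η := by
      rw [Real.exp_neg, inv_le_comm₀ (Real.exp_pos _) hη0, ← one_div]
      exact (by linarith [Real.add_one_le_exp (1 / η)])
    have hpe : Real.exp (-(4 * (A + 1) * A * x)) ≤ η ^ F.card := by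
      refine le_trans ?_ (pow_le_pow_left₀ (Real.exp_pos _).le hηe _)
      rw [← Real.exp_nat_mul, Real.exp_le_exp]
      have e1 : 1 / η = 4 * ((G.card : ℝ) + 1) := by rw [hη, one_div_one_div]
      rw [e1]
      have e2 : 4 * ((G.card : ℝ) + 1) ≤ 4 * (A + 1) * √x := by nlinarith
      have e3 : (F.card : ℝ) * (4 * ((G.card : ℝ) + 1)) ≤ (A * √x) * (4 * (A + 1) * √x) :=
        mul_le_mul hNF' e2 (by positivity) (by positivity)
      have e4 : √x * √x = x := Real.mul_self_sqrt (by linarith)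
      have e5 : (A * √x) * (4 * (A + 1) * √x) = 4 * (A + 1) * A * (√x * √x) := by ring
      rw [e5, e4] at e3
      linarith
    have hA' : Real.exp (-(A * x)) ≤ Real.exp (-(A * √(2 + |T|))) := by
      rw [Real.exp_le_exp, neg_le_neg_iff]
      exact mul_le_mul_of_nonneg_left (hx2.trans hsx) hA.le
    calc Real.exp (-(K1 * x)) = Real.exp (-(A * x)) * Real.exp (-(4 * (A + 1) * A * x)) := by
          rw [← Real.exp_add, hK1]; ring_nf
      _ ≤ _ := mul_le_mul hA' (hpe.trans hp) (Real.exp_pos _).le (Real.exp_pos _).le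
  have hconjn : ∀ s, ‖V (starRingEnd ℂ s)‖ = ‖V s‖ := fun s => by
    rw [h.conj, RCLike.norm_conj]
  have hright' : ∀ s : ℂ, 1 / 2 ≤ s.re → s.re ≤ 3 / 2 → |s.im| = T →
      Real.exp (-(K1 * x)) ≤ ‖V s‖ := by
    intro s h1 h2 h3
    rcases abs_choice s.im with h4 | h4
    · exact hright s h1 h2 (h4 ▸ h3)
    · rw [← hconjn]
      exact hright _ (by simpa using h1) (by simpa using h2) (by
        rw [Complex.conj_im, ← h4, h3])
  refine ⟨T, hT1, hT2, fun z hz h0 => ⟨hηK.trans (hzT z hz h0), ?_⟩, fun s h1 h2 h3 => ?_⟩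
  · have h4 := hzT (starRingEnd ℂ z) (by simpa using hz) (by rw [h.conj, h0, map_zero])
    refine hηK.trans (h4.trans_eq ?_)
    rw [Complex.conj_im, ← abs_neg]
    ring_nf
  · rcases le_total (1 / 2) s.re with h4 | h4
    · refine le_trans ?_ (hright' s h4 h2 h3)
      rw [Real.exp_le_exp, neg_le_neg_iff]
      refine mul_le_mul_of_nonneg_right ?_ (by linarith)
      rw [hK, hK1]
      have : 0 ≤ 4 + 4 * A + C + |Real.log c| := by positivity
      linarith
    · refine le_trans ?_ (href s h1 h4)
      have h5 := hright' (1 - starRingEnd ℂ s) (by simp; linarith) (by simp; linarith)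
        (by simp [h3])
      have hTx : T ≤ x := by linarith
      have hcl : Real.exp (-(|Real.log c| * x)) ≤ c := by
        rw [← Real.le_log_iff_exp_le hc]
        have : |Real.log c| * 1 ≤ |Real.log c| * x := by gcongr
        have := neg_abs_le (Real.log c)
        linarith
      have hCT : Real.exp (-(C * x)) ≤ Real.exp (-(C * |s.im|)) := by
        rw [h3, Real.exp_le_exp, neg_le_neg_iff]
        exact mul_le_mul_of_nonneg_left hTx hC.le
      calc Real.exp (-(K * x)) ≤ Real.exp (-(|Real.log c| * x) + -(C * x) + -(K1 * x)) := by
            rw [Real.exp_le_exp]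
            have : 0 ≤ (4 + 4 * A) * x := by positivity
            rw [hK, hK1]; linarith
        _ = Real.exp (-(|Real.log c| * x)) * Real.exp (-(C * x)) * Real.exp (-(K1 * x)) := by
            rw [Real.exp_add, Real.exp_add]
        _ ≤ _ := mul_le_mul (mul_le_mul hcl hCT (Real.exp_pos _).le hc.le) h5
            (Real.exp_pos _).le (by positivity)

end VPack

end LimDist

namespace LimDist
open Metric

/-- Maximum principle for a meromorphic function minus its principal parts. -/
lemma norm_sub_residues_le {U p : ℂ → ℂ} (hU : Differentiable ℂ U) (hp : Differentiable ℂ p)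
    {R : Set ℂ} (hR : Bornology.IsBounded R) {F : Finset ℂ}
    (hF : ∀ z, z ∈ F ↔ z ∈ closure R ∧ U z = 0) (hFr : ∀ z ∈ F, z ∉ frontier R)
    (hd : ∀ z ∈ F, deriv U z ≠ 0) {B : ℝ}
    (hB : ∀ s ∈ frontier R, ‖p s / U s - ∑ z ∈ F, p z / deriv U z / (s - z)‖ ≤ B) {s : ℂ}
    (hs : s ∈ closure R) (hs0 : U s ≠ 0) :
    ‖p s / U s - ∑ z ∈ F, p z / deriv U z / (s - z)‖ ≤ B := by
  set E : ℂ → ℂ := fun s => p s - ∑ z ∈ F, p z / deriv U z * dslope U z s with hE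
  have hEd : Differentiable ℂ E := by
    refine hp.sub (Differentiable.fun_sum fun z _ => ?_)
    exact (dslope_entire hU z).const_mul _
  have hUF : ∀ z ∈ F, U z = 0 := fun z hz => ((hF z).1 hz).2
  have hEF : ∀ z ∈ F, E z = 0 := by
    intro z hz
    simp only [hE]
    rw [Finset.sum_eq_single_of_mem z hz]
    · rw [dslope_same, div_mul_cancel₀ _ (hd z hz), sub_self]
    · intro w hw hne
      have h1 := eq_mul_dslope (hUF w hw) z
      rw [hUF z hz] at h1
      rcases mul_eq_zero.1 h1.symm with h2 | h2
      · exact absurd (sub_eq_zero.1 h2).symm hne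
      · rw [h2, mul_zero]
  obtain ⟨U0, hU0, hUU⟩ := exists_factor F hU hUF
  obtain ⟨E0, hE0, hEE⟩ := exists_factor F hEd hEF
  have hU0n : ∀ s ∈ closure R, U0 s ≠ 0 := by
    intro s hs h0
    have h1 : U s = 0 := by rw [hUU s, h0, mul_zero]
    have hsF := (hF s).2 ⟨hs, h1⟩
    exact factor_ne_zero hU0 hUU hsF (hd s hsF) h0
  have hD : ∀ s, U s ≠ 0 → E0 s / U0 s = p s / U s - ∑ z ∈ F, p z / deriv U z / (s - z) := by
    intro s hs
    have h1 : E s / U s = E0 s / U0 s := by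
      have hP : (∏ z ∈ F, (s - z)) ≠ 0 := by
        intro h0; apply hs; rw [hUU s, h0, zero_mul]
      rw [hUU s, hEE s, mul_div_mul_left _ _ hP]
    rw [← h1]
    simp only [hE]
    rw [sub_div, Finset.sum_div]
    congr 1
    refine Finset.sum_congr rfl fun z hz => ?_
    have h2 := eq_mul_dslope (hUF z hz) s
    have h3 : s - z ≠ 0 := by intro h0; apply hs; rw [h2, h0, zero_mul]
    have h4 : dslope U z s ≠ 0 := by intro h0; apply hs; rw [h2, h0, mul_zero]
    rw [h2]; field_simp
  have hdc : DiffContOnCl ℂ (fun s => E0 s / U0 s) R := by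
    have : DifferentiableOn ℂ (fun s => E0 s / U0 s) (closure R) :=
      hE0.differentiableOn.div hU0.differentiableOn hU0n
    exact this.diffContOnCl
  rw [← hD s hs0]
  refine Complex.norm_le_of_forall_mem_frontier_norm_le hR hdc (fun z hz => ?_) hs
  have hzc : z ∈ closure R := frontier_subset_closure hz
  have hz0 : U z ≠ 0 := fun h0 => hFr z ((hF z).2 ⟨hzc, h0⟩) hz
  rw [hD z hz0]
  exact hB z hz

/-- Gaussian decay beats powers. -/
lemma exp_neg_sq_le (x : ℝ) : Real.exp (-(x ^ 2 / 2)) ≤ 100 / (2 + |x|) ^ 3 := by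
  have h0 := abs_nonneg x
  have h1 : (2 + |x|) ^ 3 / 6 ≤ Real.exp (2 + |x|) := by
    have := Real.pow_div_factorial_le_exp (2 + |x|) (by linarith) 3
    norm_num [Nat.factorial] at this
    exact this
  have h2 : Real.exp (-(x ^ 2 / 2)) ≤ Real.exp (5 / 2) * Real.exp (-(2 + |x|)) := by
    rw [← Real.exp_add, Real.exp_le_exp, ← sq_abs]
    nlinarith [sq_nonneg (|x| - 1)]
  have h3 : Real.exp (5 / 2) ≤ 50 / 3 := by
    have e1 := Real.exp_one_lt_d9
    have e2 : Real.exp (5 / 2) ^ 2 = Real.exp 1 ^ 5 := by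
      rw [← Real.exp_nat_mul, ← Real.exp_nat_mul]; norm_num
    have e3 : Real.exp 1 ^ 5 ≤ (2.7182818286 : ℝ) ^ 5 :=
      pow_le_pow_left₀ (Real.exp_pos _).le e1.le 5
    refine (sq_le_sq₀ (Real.exp_pos _).le (by norm_num)).1 ?_
    rw [e2]
    refine e3.trans (by norm_num)
  rw [le_div_iff₀ (by positivity)]
  have h4 : Real.exp (-(2 + |x|)) * (2 + |x|) ^ 3 ≤ 6 := by
    rw [Real.exp_neg, inv_mul_le_iff₀ (Real.exp_pos _)]; linarith
  calc Real.exp (-(x ^ 2 / 2)) * (2 + |x|) ^ 3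
      ≤ (Real.exp (5 / 2) * Real.exp (-(2 + |x|))) * (2 + |x|) ^ 3 :=
        mul_le_mul_of_nonneg_right h2 (by positivity)
    _ = Real.exp (5 / 2) * (Real.exp (-(2 + |x|)) * (2 + |x|) ^ 3) := by ring
    _ ≤ 50 / 3 * 6 := mul_le_mul h3 h4 (by positivity) (by norm_num)
    _ = 100 := by norm_num

end LimDist

namespace LimDist
open Metric
open scoped ENNReal

/-- The nontrivial zeros of `V`. -/
def Zr (V : ℂ → ℂ) : Type := {z : ℂ // -1 < z.re ∧ V z = 0}

/-- The ordinate of a zero. -/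
def Zr.im {V : ℂ → ℂ} (z : Zr V) : ℝ := z.1.im

/-- The weight `(1+|x|)^{-3/2}`. -/
def wgt (x : ℝ) : ℝ := (1 + |x|) ^ (-(3 / 2) : ℝ)

lemma wgt_pos (x : ℝ) : 0 < wgt x := by unfold wgt; positivity

/-- Peetre's inequality. -/
lemma wgt_le_mul (t x : ℝ) : wgt t ≤ (1 + |x - t|) ^ (3 / 2 : ℝ) * wgt x := by
  unfold wgt
  have h1 : 1 + |x| ≤ (1 + |x - t|) * (1 + |t|) := by
    have h2 := abs_sub_abs_le_abs_sub x t
    nlinarith [abs_nonneg t, abs_nonneg (x - t), mul_nonneg (abs_nonneg t) (abs_nonneg (x - t))]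
  have h3 : (1 + |x|) ^ (3 / 2 : ℝ) ≤ (1 + |x - t|) ^ (3 / 2 : ℝ) * (1 + |t|) ^ (3 / 2 : ℝ) := by
    rw [← Real.mul_rpow (by positivity) (by positivity)]
    exact Real.rpow_le_rpow (by positivity) h1 (by norm_num)
  rw [Real.rpow_neg (by positivity), Real.rpow_neg (by positivity),
    inv_le_iff_one_le_mul₀ (by positivity)]
  have h4 : 0 < (1 + |x|) ^ (3 / 2 : ℝ) := by positivity
  calc (1 : ℝ) = (1 + |x|) ^ (3 / 2 : ℝ) * ((1 + |x|) ^ (3 / 2 : ℝ))⁻¹ := by field_simp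
    _ ≤ ((1 + |x - t|) ^ (3 / 2 : ℝ) * (1 + |t|) ^ (3 / 2 : ℝ)) * ((1 + |x|) ^ (3 / 2 : ℝ))⁻¹ := by
        gcongr
    _ = _ := by ring

lemma rpow_three_half_le (x : ℝ) : (1 + |x|) ^ (3 / 2 : ℝ) ≤ (2 + |x|) ^ 3 := by
  have h0 := abs_nonneg x
  calc (1 + |x|) ^ (3 / 2 : ℝ) ≤ (1 + |x|) ^ (3 : ℝ) :=
        Real.rpow_le_rpow_of_exponent_le (by linarith) (by norm_num)
    _ = (1 + |x|) ^ 3 := by norm_cast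
    _ ≤ _ := by gcongr; norm_num

lemma exp_mul_wgt_le (t x : ℝ) : Real.exp (-((x - t) ^ 2 / 2)) * wgt t ≤ 100 * wgt x := by
  have h1 := exp_neg_sq_le (x - t)
  have h2 := wgt_le_mul t x
  have h3 := rpow_three_half_le (x - t)
  calc Real.exp (-((x - t) ^ 2 / 2)) * wgt t
      ≤ (100 / (2 + |x - t|) ^ 3) * ((2 + |x - t|) ^ 3 * wgt x) :=
        mul_le_mul h1 (h2.trans (mul_le_mul_of_nonneg_right h3 (wgt_pos x).le)) (wgt_pos t).le
          (by positivity)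
    _ = 100 * wgt x := by field_simp

namespace VPack
variable {Z V : ℂ → ℂ} {m : ℕ}

/-- Gaussian sums over the zeros. -/
lemma gauss_sum (h : VPack Z V m) : ∃ K : ℝ, 0 < K ∧ ∀ t : ℝ,
    ∑' z : Zr V, ENNReal.ofReal (Real.exp (-((z.im - t) ^ 2 / 2))) ≤
      ENNReal.ofReal (K * √(2 + |t|)) := by
  obtain ⟨A, hA, hc⟩ := h.count
  have hsum : Summable fun k : ℤ => 1 / (1 + |(k : ℝ)|) ^ 2 := by
    have h1 : Summable fun k : ℤ => 1 / |(k : ℝ)| ^ (2 : ℝ) :=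
      Real.summable_one_div_int_add_rpow 0 2 |>.2 (by norm_num) |>.congr (fun k => by simp)
    have h2 : Summable fun k : ℤ => 1 / |(k : ℝ)| ^ (2 : ℝ) + if k = 0 then (1 : ℝ) else 0 :=
      h1.add (summable_of_ne_finset_zero (s := {0}) (fun k hk => by simp at hk; simp [hk]))
    refine Summable.of_nonneg_of_le (fun k => by positivity) (fun k => ?_) h2
    rcases eq_or_ne k 0 with rfl | hk
    · simp
    · have : 0 < |(k : ℝ)| := by simpa using hk
      simp only [hk, if_false, add_zero]
      rw [show |(k : ℝ)| ^ (2 : ℝ) = |(k : ℝ)| ^ 2 by norm_cast]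
      gcongr
      linarith
  set S : ℝ := ∑' k : ℤ, 1 / (1 + |(k : ℝ)|) ^ 2 with hS
  have hS0 : 0 ≤ S := tsum_nonneg fun k => by positivity
  refine ⟨200 * A * S + 1, by positivity, fun t => ?_⟩
  rw [← ENNReal.tsum_fiberwise _ (fun z : Zr V => ⌊z.im - t⌋)]
  have hsq : 0 ≤ √(2 + |t|) := Real.sqrt_nonneg _
  have hterm : ∀ k : ℤ, ∑' b : (fun z : Zr V => ⌊z.im - t⌋) ⁻¹' {k},
      ENNReal.ofReal (Real.exp (-((b.1.im - t) ^ 2 / 2))) ≤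
      ENNReal.ofReal (200 * A * √(2 + |t|) * (1 / (1 + |(k : ℝ)|) ^ 2)) := by
    intro k
    rw [ENNReal.tsum_eq_iSup_sum]
    refine iSup_le fun s => ?_
    have hfl : ∀ b ∈ s, (k : ℝ) ≤ b.1.im - t ∧ b.1.im - t < k + 1 := by
      intro b _
      have := b.2
      simp only [Set.mem_preimage, Set.mem_singleton_iff] at this
      exact Int.floor_eq_iff.1 this
    have hval : ∀ b ∈ s, ENNReal.ofReal (Real.exp (-((b.1.im - t) ^ 2 / 2))) ≤
        ENNReal.ofReal (100 / (1 + |(k : ℝ)|) ^ 3) := by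
      intro b hb
      apply ENNReal.ofReal_le_ofReal
      refine (exp_neg_sq_le _).trans ?_
      have h1 : |(k : ℝ)| ≤ |b.1.im - t| + 1 := by
        have h2 := abs_sub_abs_le_abs_sub (k : ℝ) (b.1.im - t)
        have h3 : |(k : ℝ) - (b.1.im - t)| ≤ 1 := by
          rw [abs_le]; constructor <;> linarith [hfl b hb]
        linarith
      have h4 := abs_nonneg (k : ℝ)
      apply div_le_div_of_nonneg_left (by norm_num) (by positivity)
      exact pow_le_pow_left₀ (by linarith) (by linarith) 3
    have hcard : (s.card : ℝ) ≤ A * √(2 + |t|) * (2 * (1 + |(k : ℝ)|)) := by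
      have h1 := hc (t + k + 1 / 2) (s.image fun b => b.1.1) (by
        intro z hz
        obtain ⟨b, hb, rfl⟩ := Finset.mem_image.1 hz
        refine ⟨b.1.2.1, b.1.2.2, ?_⟩
        have := hfl b hb
        unfold Zr.im at this
        rw [abs_le]; constructor <;> linarith)
      have hcard : (s.image fun b => b.1.1).card = s.card := Finset.card_image_of_injective _
        (fun a b (hab : a.1.1 = b.1.1) => Subtype.ext (Subtype.ext hab))
      rw [hcard] at h1
      refine h1.trans ?_
      rw [mul_assoc]
      refine mul_le_mul_of_nonneg_left ?_ hA.le
      have h2 : √(2 * (1 + |(k : ℝ)|)) ≤ 2 * (1 + |(k : ℝ)|) :=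
        Real.sqrt_le_self_iff.2 (Or.inr (by have := abs_nonneg (k : ℝ); linarith))
      refine le_trans ?_ (mul_le_mul_of_nonneg_left h2 hsq)
      rw [← Real.sqrt_mul (by positivity)]
      apply Real.sqrt_le_sqrt
      have h3 : |t + k + 1 / 2| ≤ |t| + |(k : ℝ)| + 1 / 2 := by
        refine (abs_add_le _ _).trans ?_
        have := abs_add_le t k
        rw [abs_of_pos (show (0 : ℝ) < 1 / 2 by norm_num)]
        linarith
      nlinarith [abs_nonneg t, abs_nonneg (k : ℝ), mul_nonneg (abs_nonneg t) (abs_nonneg (k : ℝ))]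
    refine (Finset.sum_le_card_nsmul s _ _ hval).trans ?_
    rw [nsmul_eq_mul, ← ENNReal.ofReal_natCast, ← ENNReal.ofReal_mul (by positivity)]
    apply ENNReal.ofReal_le_ofReal
    have h4 : 0 < 1 + |(k : ℝ)| := by have := abs_nonneg (k : ℝ); linarith
    calc (s.card : ℝ) * (100 / (1 + |(k : ℝ)|) ^ 3)
        ≤ (A * √(2 + |t|) * (2 * (1 + |(k : ℝ)|))) * (100 / (1 + |(k : ℝ)|) ^ 3) := by gcongr
      _ = _ := by field_simp; ring
  refine (ENNReal.tsum_le_tsum hterm).trans ?_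
  rw [← ENNReal.ofReal_tsum_of_nonneg (fun k => by positivity) (hsum.mul_left _), tsum_mul_left]
  apply ENNReal.ofReal_le_ofReal
  rw [← hS]
  nlinarith

end VPack

end LimDist

namespace LimDist
open Metric
open scoped ENNReal

/-- The size of the residue of `(s-1)/((s+2)^m V(s))` at a zero. -/
def cf (V : ℂ → ℂ) (m : ℕ) (z : ℂ) : ℝ := ‖(z - 1) / ((z + 2) ^ m * deriv V z)‖

lemma cf_nonneg (V : ℂ → ℂ) (m : ℕ) (z : ℂ) : 0 ≤ cf V m z := norm_nonneg _

lemma sum_le_tsum_zr {V : ℂ → ℂ} (F : Finset ℂ) (hF : ∀ z ∈ F, -1 < z.re ∧ V z = 0)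
    (f : ℂ → ℝ≥0∞) : ∑ z ∈ F, f z ≤ ∑' z : Zr V, f z.1 := by
  have h1 : ∑ z ∈ F.subtype (fun z => -1 < z.re ∧ V z = 0), f z.1 = ∑ z ∈ F, f z :=
    Finset.sum_subtype_of_mem f hF
  rw [← h1]
  exact ENNReal.sum_le_tsum (f := fun z : {z : ℂ // -1 < z.re ∧ V z = 0} => f z.1) _

lemma sum_real_le_of_tsum {V : ℂ → ℂ} (F : Finset ℂ) (hF : ∀ z ∈ F, -1 < z.re ∧ V z = 0)
    {f : ℂ → ℝ} (hf : ∀ z, 0 ≤ f z) {B : ℝ} (hB0 : 0 ≤ B)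
    (hB : ∑' z : Zr V, ENNReal.ofReal (f z.1) ≤ ENNReal.ofReal B) : ∑ z ∈ F, f z ≤ B := by
  have h1 := (sum_le_tsum_zr F hF (fun z => ENNReal.ofReal (f z))).trans hB
  rw [← ENNReal.ofReal_sum_of_nonneg (fun z _ => hf z)] at h1
  exact (ENNReal.ofReal_le_ofReal_iff hB0).1 h1

/-- Gaussians beat exponentials. -/
lemma exists_nat_small (K b D : ℝ) (hK : 0 < K) (hb : 0 ≤ b) : ∃ n : ℕ, b + 1 ≤ n ∧
    D * (((n : ℝ) + 3) * Real.exp (K * (n + 3) - (n - 1 - b) ^ 2 / 2)) ≤ 1 := by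
  obtain ⟨n, hn⟩ := exists_nat_ge (1 + b + (2 * (K + 2) + ((K + 1) * (4 + b) + |D|)))
  have hp : 0 ≤ (K + 1) * (4 + b) := by positivity
  have hD := abs_nonneg D
  set y : ℝ := n - 1 - b with hy
  have hy1 : 2 * (K + 2) ≤ y := by linarith
  have hy2 : (K + 1) * (4 + b) + |D| ≤ y := by linarith
  refine ⟨n, by linarith, ?_⟩
  have e1 : (n : ℝ) + 3 ≤ Real.exp (n + 3) := by linarith [Real.add_one_le_exp ((n : ℝ) + 3)]
  have e2 : ((n : ℝ) + 3) * Real.exp (K * (n + 3) - y ^ 2 / 2) ≤ Real.exp (-|D|) := by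
    calc _ ≤ Real.exp (n + 3) * Real.exp (K * (n + 3) - y ^ 2 / 2) := by gcongr
      _ = Real.exp (n + 3 + (K * (n + 3) - y ^ 2 / 2)) := (Real.exp_add _ _).symm
      _ ≤ _ := by
        rw [Real.exp_le_exp]
        have : (n : ℝ) = y + 1 + b := by rw [hy]; ring
        rw [this]
        nlinarith
  have e3 : |D| * Real.exp (-|D|) ≤ 1 := by
    rw [Real.exp_neg, ← div_eq_mul_inv, div_le_one (Real.exp_pos _)]
    linarith [Real.add_one_le_exp |D|]
  calc D * (((n : ℝ) + 3) * Real.exp (K * (n + 3) - y ^ 2 / 2))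
      ≤ |D| * (((n : ℝ) + 3) * Real.exp (K * (n + 3) - y ^ 2 / 2)) := by
        gcongr; exact le_abs_self D
    _ ≤ |D| * Real.exp (-|D|) := by gcongr
    _ ≤ 1 := e3

namespace VPack
variable {Z V : ℂ → ℂ} {m : ℕ}

lemma gauss_cf_poly (h : VPack Z V m)
    (hS : ∑' z : Zr V, ENNReal.ofReal (cf V m z.1 ^ 2 * wgt z.im) ≠ ∞) :
    ∃ C : ℝ, 0 ≤ C ∧ ∀ t : ℝ,
      ∑' z : Zr V, ENNReal.ofReal (Real.exp (-((z.1.im - t) ^ 2 / 2)) * cf V m z.1)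
        ≤ ENNReal.ofReal (C * (2 + |t|) ^ 3) := by
  obtain ⟨K, hK, hg⟩ := h.gauss_sum
  set S := (∑' z : Zr V, ENNReal.ofReal (cf V m z.1 ^ 2 * wgt z.im)).toReal with hSd
  have hS0 : 0 ≤ S := ENNReal.toReal_nonneg
  refine ⟨100 * S + K, by positivity, fun t => ?_⟩
  have hw := wgt_pos t
  have hle : ∀ z : Zr V, ENNReal.ofReal (Real.exp (-((z.1.im - t) ^ 2 / 2)) * cf V m z.1) ≤
      ENNReal.ofReal (100 / wgt t) * ENNReal.ofReal (cf V m z.1 ^ 2 * wgt z.im) +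
        ENNReal.ofReal (Real.exp (-((z.im - t) ^ 2 / 2))) := by
    intro z
    rw [← ENNReal.ofReal_mul (by positivity), ← ENNReal.ofReal_add
      (by have := wgt_pos z.im; positivity) (Real.exp_pos _).le]
    apply ENNReal.ofReal_le_ofReal
    have h1 := exp_mul_wgt_le t z.im
    have h2 : Real.exp (-((z.im - t) ^ 2 / 2)) ≤ 100 / wgt t * wgt z.im := by
      rw [div_mul_eq_mul_div, le_div_iff₀ hw]; exact h1
    have h3 : cf V m z.1 ≤ cf V m z.1 ^ 2 + 1 := by nlinarith [sq_nonneg (cf V m z.1 - 1)]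
    have h4 := mul_le_mul_of_nonneg_right h2 (sq_nonneg (cf V m z.1))
    have h5 := mul_le_mul_of_nonneg_left h3 (Real.exp_pos (-((z.im - t) ^ 2 / 2))).le
    change Real.exp (-((z.im - t) ^ 2 / 2)) * cf V m z.1 ≤ _
    linarith
  refine (ENNReal.tsum_le_tsum hle).trans ?_
  rw [ENNReal.tsum_add, ENNReal.tsum_mul_left, ← ENNReal.ofReal_toReal hS, ← hSd,
    ← ENNReal.ofReal_mul (by positivity)]
  refine (add_le_add_right (hg t) _).trans ?_
  rw [← ENNReal.ofReal_add (by positivity) (by positivity)]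
  apply ENNReal.ofReal_le_ofReal
  have h0 := abs_nonneg t
  have h1 : 1 / wgt t ≤ (2 + |t|) ^ 3 := by
    rw [wgt, Real.rpow_neg (by positivity), one_div, inv_inv]
    exact rpow_three_half_le t
  have h2 : √(2 + |t|) ≤ (2 + |t|) ^ 3 :=
    (Real.sqrt_le_self_iff.2 (Or.inr (by linarith))).trans (le_self_pow₀ (by linarith) (by norm_num))
  calc 100 / wgt t * S + K * √(2 + |t|) = 100 * S * (1 / wgt t) + K * √(2 + |t|) := by ring
    _ ≤ 100 * S * (2 + |t|) ^ 3 + K * (2 + |t|) ^ 3 := by gcongr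
    _ = _ := by ring

lemma gauss_cf_finite (h : VPack Z V m)
    (hS : ∑' z : Zr V, ENNReal.ofReal (cf V m z.1 ^ 2 * wgt z.im) ≠ ∞) (t : ℝ) :
    ∃ B : ℝ, 0 ≤ B ∧ ∑' z : Zr V, ENNReal.ofReal (Real.exp (-((z.1.im - t) ^ 2 / 2)) * cf V m z.1)
      ≤ ENNReal.ofReal B := by
  obtain ⟨C, hC, hb⟩ := h.gauss_cf_poly hS
  exact ⟨_, by positivity, hb t⟩

end VPack

end LimDist

namespace LimDist
open Metric
open scoped ENNReal

lemma mem_closure_rect {T : ℝ} (hT : 0 < T) {s : ℂ} :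
    s ∈ closure (Set.Ioo (-(1 / 2) : ℝ) (3 / 2) ×ℂ Set.Ioo (-T) T) ↔
      (-(1 / 2) ≤ s.re ∧ s.re ≤ 3 / 2) ∧ |s.im| ≤ T := by
  rw [closure_reProdIm, closure_Ioo (by norm_num), closure_Ioo (by linarith), mem_reProdIm,
    Set.mem_Icc, Set.mem_Icc, abs_le]

lemma mem_frontier_rect {T : ℝ} (hT : 0 < T) {s : ℂ}
    (hs : s ∈ frontier (Set.Ioo (-(1 / 2) : ℝ) (3 / 2) ×ℂ Set.Ioo (-T) T)) :
    (s.re = -(1 / 2) ∨ s.re = 3 / 2) ∨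
      (-(1 / 2) ≤ s.re ∧ s.re ≤ 3 / 2) ∧ |s.im| = T := by
  rw [frontier_reProdIm, closure_Ioo (by norm_num), closure_Ioo (by linarith),
    frontier_Ioo (show -T < T by linarith), frontier_Ioo (by norm_num)] at hs
  rcases hs with hs | hs
  · rw [mem_reProdIm] at hs
    right
    refine ⟨hs.1, ?_⟩
    rcases hs.2 with h | h
    · rw [h, abs_neg, abs_of_pos hT]
    · rw [h, abs_of_pos hT]
  · rw [mem_reProdIm] at hs
    left
    exact hs.1

lemma norm_gauss (s : ℂ) (t : ℝ) :
    ‖Complex.exp ((s - t * I) ^ 2)‖ = Real.exp (s.re ^ 2 - (s.im - t) ^ 2) := by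
  rw [Complex.norm_exp]
  congr 1
  rw [pow_two, Complex.mul_re]
  simp
  ring

namespace VPack
variable {Z V : ℂ → ℂ} {m : ℕ}

lemma deriv_U (h : VPack Z V m) {z : ℂ} (hz : V z = 0) :
    deriv (fun s => (s + 2) ^ m * V s) z = (z + 2) ^ m * deriv V z := by
  have h1 : HasDerivAt (fun s : ℂ => (s + 2) ^ m) (m * (z + 2) ^ (m - 1) * 1) z :=
    ((hasDerivAt_id z).add_const 2).pow m
  have h2 : HasDerivAt (fun s : ℂ => (s + 2) ^ m * V s) _ z := h1.mul (h.diff z).hasDerivAt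
  rw [h2.deriv, hz]
  ring

/-- Pointwise bound by finitely many zeros. -/
lemma pointwise (h : VPack Z V m)
    (hS : ∑' z : Zr V, ENNReal.ofReal (cf V m z.1 ^ 2 * wgt z.im) ≠ ∞) :
    ∃ C : ℝ, 0 < C ∧ ∀ (t : ℝ) (s : ℂ), 1 / 2 < s.re → s.re ≤ 3 / 2 → s.im = t →
      ∃ F : Finset ℂ, (∀ z ∈ F, -1 < z.re ∧ V z = 0) ∧
        ‖(s - 1) / ((s + 2) ^ m * V s)‖ ≤ C + 2 * ∑ z ∈ F,
          Real.exp (-(z.im - t) ^ 2) * cf V m z * (1 + 1 / ‖s - z‖) := by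
  obtain ⟨C0, hC0⟩ := h.bd
  have hC0p : 0 ≤ C0 := (norm_nonneg _).trans (hC0 (3 / 2) (Or.inr (by norm_num)))
  obtain ⟨K, hK, hh⟩ := h.heights
  set E : ℝ := Real.exp (9 / 4) with hE
  have hEp : 0 < E := Real.exp_pos _
  refine ⟨E * C0 + 1, by positivity, fun t s hs1 hs2 hst => ?_⟩
  obtain ⟨B, hB0, hB⟩ := h.gauss_cf_finite hS t
  obtain ⟨n, hn1, hn2⟩ := exists_nat_small K |t| (E + 2 * K * B) hK (abs_nonneg t)
  obtain ⟨T, hT1, hT2, hTz, hTV⟩ := hh n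
  have ht0 := abs_nonneg t
  have hT : 0 < T := by linarith
  have hn0 : (0 : ℝ) ≤ n := Nat.cast_nonneg n
  set R : Set ℂ := Set.Ioo (-(1 / 2) : ℝ) (3 / 2) ×ℂ Set.Ioo (-T) T with hR
  have hRb : Bornology.IsBounded R :=
    (Metric.isBounded_Ioo _ _).reProdIm (Metric.isBounded_Ioo _ _)
  have hfin := finite_zeros h.diff (h.ne_zero_center 0) hRb.isCompact_closure
  set F : Finset ℂ := hfin.toFinset with hFdef
  have hFm : ∀ z, z ∈ F ↔ z ∈ closure R ∧ V z = 0 := fun z => by rw [hFdef]; simp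
  have hFz : ∀ z ∈ F, -1 < z.re ∧ V z = 0 := fun z hz => by
    have := (hFm z).1 hz
    exact ⟨by linarith [((mem_closure_rect hT).1 this.1).1.1], this.2⟩
  have hFre : ∀ z ∈ F, z.re = 1 / 2 := fun z hz => (h.zeros z (hFz z hz).1 (hFz z hz).2).2.1
  have hs2' : ∀ z : ℂ, -(1 / 2) ≤ z.re → 1 ≤ ‖z + 2‖ := fun z hz => by
    have := Complex.re_le_norm (z + 2)
    simp at this
    linarith
  have hpne : ∀ z : ℂ, -(1 / 2) ≤ z.re → (z + 2) ^ m ≠ 0 := fun z hz => by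
    have := hs2' z hz
    exact pow_ne_zero _ (norm_pos_iff.1 (by linarith))
  set U : ℂ → ℂ := fun s => (s + 2) ^ m * V s with hU
  set p : ℂ → ℂ := fun s => Complex.exp ((s - t * I) ^ 2) * (s - 1) with hp
  have hUd : Differentiable ℂ U := by
    have := h.diff
    exact ((differentiable_id.add_const 2).pow m).mul this
  have hpd : Differentiable ℂ p := by simp only [hp]; fun_prop
  have hFU : ∀ z, z ∈ F ↔ z ∈ closure R ∧ U z = 0 := fun z => by
    rw [hFm]
    refine and_congr_right fun hz => ?_
    simp only [hU, mul_eq_zero, hpne z ((mem_closure_rect hT).1 hz).1.1, false_or]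
  have hgap : ∀ z ∈ F, |z.im| ≠ T := by
    intro z hz h0
    have h1 := hTz z (hFz z hz).1 (hFz z hz).2
    have h2 : 0 < 1 / (K * ((n : ℝ) + 3)) := by positivity
    rcases abs_choice z.im with h3 | h3
    · rw [h3] at h0
      rw [h0, sub_self, abs_zero] at h1
      linarith [h1.1]
    · have h4 : z.im = -T := by linarith
      rw [h4, sub_self, abs_zero] at h1
      linarith [h1.2]
  have hFr : ∀ z ∈ F, z ∉ frontier R := by
    intro z hz hzf
    have h1 := hFre z hz
    rcases mem_frontier_rect hT hzf with (h2 | h2) | h2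
    · rw [h1] at h2; norm_num at h2
    · rw [h1] at h2; norm_num at h2
    · exact hgap z hz h2.2
  have hdU : ∀ z ∈ F, deriv U z = (z + 2) ^ m * deriv V z := fun z hz => h.deriv_U (hFz z hz).2
  have hdne : ∀ z ∈ F, deriv U z ≠ 0 := fun z hz => by
    rw [hdU z hz]
    exact mul_ne_zero (hpne z ((mem_closure_rect hT).1 ((hFm z).1 hz).1).1.1)
      (h.zeros z (hFz z hz).1 (hFz z hz).2).2.2
  -- size of each principal part
  have hterm : ∀ z ∈ F, ∀ w : ℂ, ‖p z / deriv U z / (w - z)‖ ≤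
      2 * (Real.exp (-(z.im - t) ^ 2) * cf V m z) * (1 / ‖w - z‖) := by
    intro z hz w
    have e1 : ‖p z / deriv U z / (w - z)‖ =
        Real.exp ((z.re) ^ 2 - (z.im - t) ^ 2) * cf V m z * (1 / ‖w - z‖) := by
      simp only [hp]
      rw [norm_div, mul_div_assoc, norm_mul, norm_gauss, hdU z hz, cf]
      ring
    rw [e1]
    refine mul_le_mul_of_nonneg_right ?_ (by positivity)
    rw [← mul_assoc]
    refine mul_le_mul_of_nonneg_right ?_ (cf_nonneg _ _ _)
    rw [hFre z hz, sub_eq_add_neg, Real.exp_add]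
    refine mul_le_mul_of_nonneg_right ?_ (Real.exp_pos _).le
    have := Real.exp_one_lt_d9
    have h2 : Real.exp ((1 / 2) ^ 2) ^ 4 ≤ 2 ^ 4 := by
      rw [← Real.exp_nat_mul]; norm_num; linarith
    exact le_of_pow_le_pow_left₀ (by norm_num) (by norm_num) h2
  set A : ℝ := ∑ z ∈ F, Real.exp (-(z.im - t) ^ 2) * cf V m z with hA
  have hA0 : 0 ≤ A := Finset.sum_nonneg fun z _ => mul_nonneg (Real.exp_pos _).le (cf_nonneg _ _ _)
  set δ : ℝ := ((n : ℝ) + 3) * Real.exp (K * (n + 3) - (n - 1 - |t|) ^ 2 / 2) with hδ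
  have hδ0 : 0 ≤ δ := by positivity
  have hy : 0 ≤ (n : ℝ) - 1 - |t| := by linarith
  -- bound on the frontier
  have hfront : ∀ w ∈ frontier R, ‖p w / U w - ∑ z ∈ F, p z / deriv U z / (w - z)‖ ≤
      E * C0 + 1 + 2 * A := by
    intro w hw
    refine (norm_sub_le _ _).trans ?_
    have hwre : -(1 / 2) ≤ w.re ∧ w.re ≤ 3 / 2 :=
      ((mem_closure_rect hT).1 (frontier_subset_closure hw)).1
    have hre2 : w.re ^ 2 ≤ 9 / 4 := by nlinarith
    rcases mem_frontier_rect hT hw with h1 | h1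
    · have e1 : ‖p w / U w‖ ≤ E * C0 := by
        simp only [hp, hU]
        rw [mul_div_assoc, norm_mul, norm_gauss]
        refine mul_le_mul ?_ (hC0 w h1) (norm_nonneg _) hEp.le
        rw [hE, Real.exp_le_exp]
        nlinarith [sq_nonneg (w.im - t)]
      have e2 : ‖∑ z ∈ F, p z / deriv U z / (w - z)‖ ≤ 2 * A := by
        refine (norm_sum_le _ _).trans ?_
        rw [hA, Finset.mul_sum]
        refine Finset.sum_le_sum fun z hz => (hterm z hz w).trans ?_
        have h2 : 1 ≤ ‖w - z‖ := by
          have h3 := Complex.abs_re_le_norm (w - z)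
          rw [Complex.sub_re, hFre z hz] at h3
          refine le_trans ?_ h3
          rcases h1 with h1 | h1 <;> rw [h1] <;> norm_num
        refine mul_le_of_le_one_right ?_ ((div_le_one (by linarith)).2 h2)
        exact mul_nonneg (by norm_num) (mul_nonneg (Real.exp_pos _).le (cf_nonneg _ _ _))
      linarith
    · have hwt : (n : ℝ) - |t| ≤ |w.im - t| := by
        have := abs_sub_abs_le_abs_sub w.im t
        rw [h1.2] at this
        linarith
      have e1 : ‖p w / U w‖ ≤ E * δ := by
        simp only [hp, hU]
        rw [norm_div, norm_mul, norm_mul, norm_gauss, norm_pow]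
        have h2 : ‖w - 1‖ ≤ n + 3 := by
          refine (Complex.norm_le_abs_re_add_abs_im _).trans ?_
          have : |(w - 1).re| ≤ 3 / 2 := by
            rw [Complex.sub_re, Complex.one_re, abs_le]; constructor <;> linarith
          have h4 : (w - 1).im = w.im := by simp
          rw [h4, h1.2]
          linarith
        have h3 : Real.exp (w.re ^ 2 - (w.im - t) ^ 2) ≤
            E * Real.exp (-((n - 1 - |t|) ^ 2 / 2)) := by
          rw [hE, ← Real.exp_add, Real.exp_le_exp, ← sq_abs (w.im - t)]
          nlinarith [mul_nonneg hy hy]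
        have h4 : Real.exp (-(K * (n + 3))) ≤ ‖w + 2‖ ^ m * ‖V w‖ := by
          refine (hTV w h1.1.1 h1.1.2 h1.2).trans ?_
          exact le_mul_of_one_le_left (norm_nonneg _) (one_le_pow₀ (hs2' w hwre.1))
        rw [div_le_iff₀ ((Real.exp_pos _).trans_le h4)]
        calc Real.exp (w.re ^ 2 - (w.im - t) ^ 2) * ‖w - 1‖
            ≤ (E * Real.exp (-((n - 1 - |t|) ^ 2 / 2))) * (n + 3) :=
              mul_le_mul h3 h2 (norm_nonneg _) (by positivity)
          _ = E * δ * Real.exp (-(K * (n + 3))) := by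
              rw [hδ, sub_eq_add_neg (K * _), Real.exp_add, Real.exp_neg (K * (n + 3))]
              field_simp
          _ ≤ _ := mul_le_mul_of_nonneg_left h4 (by positivity)
      have e2 : ‖∑ z ∈ F, p z / deriv U z / (w - z)‖ ≤ 2 * A + 2 * K * B * δ := by
        have h2 : ∀ z ∈ F, ‖p z / deriv U z / (w - z)‖ ≤
            2 * (Real.exp (-(z.im - t) ^ 2) * cf V m z) +
            2 * K * δ * (Real.exp (-((z.im - t) ^ 2 / 2)) * cf V m z) := by
          intro z hz
          refine (hterm z hz w).trans ?_
          have hcf := cf_nonneg V m z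
          have hd : |w.im - z.im| ≤ ‖w - z‖ := by
            have := Complex.abs_im_le_norm (w - z); rwa [Complex.sub_im] at this
          by_cases h3 : 1 ≤ ‖w - z‖
          · have h4 : 2 * (Real.exp (-(z.im - t) ^ 2) * cf V m z) * (1 / ‖w - z‖) ≤
                2 * (Real.exp (-(z.im - t) ^ 2) * cf V m z) :=
              mul_le_of_le_one_right (by positivity) ((div_le_one (by linarith)).2 h3)
            have h5 : 0 ≤ 2 * K * δ * (Real.exp (-((z.im - t) ^ 2 / 2)) * cf V m z) := by
              positivity
            linarith
          · push Not at h3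
            have h4 : 1 / (K * ((n : ℝ) + 3)) ≤ ‖w - z‖ := by
              refine le_trans ?_ hd
              have h5 := hTz z (hFz z hz).1 (hFz z hz).2
              rw [abs_sub_comm]
              rcases abs_choice w.im with h6 | h6
              · rw [← h6, h1.2]; exact h5.1
              · have : w.im = -T := by linarith [h1.2]
                rw [this]; exact h5.2
            have h5 : 1 / ‖w - z‖ ≤ K * (n + 3) := by
              rw [one_div]
              refine inv_le_of_inv_le₀ (by positivity) ?_
              rwa [← one_div]
            have h6 : (n : ℝ) - 1 - |t| ≤ |z.im - t| := by
              have h7 := abs_sub_abs_le_abs_sub (w.im - t) (z.im - t)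
              rw [show w.im - t - (z.im - t) = w.im - z.im by ring] at h7
              linarith
            have h7 : Real.exp (-(z.im - t) ^ 2) ≤ Real.exp (-((n - 1 - |t|) ^ 2 / 2)) *
                Real.exp (-((z.im - t) ^ 2 / 2)) := by
              rw [← Real.exp_add, Real.exp_le_exp, ← sq_abs (z.im - t)]
              nlinarith
            have h8 : ((n : ℝ) + 3) * Real.exp (-((n - 1 - |t|) ^ 2 / 2)) ≤ δ := by
              rw [hδ]
              refine mul_le_mul_of_nonneg_left ?_ (by positivity)
              rw [Real.exp_le_exp]
              have : 0 ≤ K * ((n : ℝ) + 3) := by positivity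
              linarith
            have h9 : 0 ≤ 2 * (Real.exp (-(z.im - t) ^ 2) * cf V m z) := by positivity
            calc 2 * (Real.exp (-(z.im - t) ^ 2) * cf V m z) * (1 / ‖w - z‖)
                ≤ 2 * ((Real.exp (-((n - 1 - |t|) ^ 2 / 2)) *
                  Real.exp (-((z.im - t) ^ 2 / 2))) * cf V m z) * (K * (n + 3)) := by
                  refine mul_le_mul ?_ h5 (by positivity) (by positivity)
                  refine mul_le_mul_of_nonneg_left ?_ (by norm_num)
                  exact mul_le_mul_of_nonneg_right h7 hcf
              _ = 2 * K * (((n : ℝ) + 3) * Real.exp (-((n - 1 - |t|) ^ 2 / 2))) *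
                  (Real.exp (-((z.im - t) ^ 2 / 2)) * cf V m z) := by ring
              _ ≤ 2 * K * δ * (Real.exp (-((z.im - t) ^ 2 / 2)) * cf V m z) := by
                  refine mul_le_mul_of_nonneg_right ?_ (by positivity)
                  exact mul_le_mul_of_nonneg_left h8 (by positivity)
              _ ≤ _ := le_add_of_nonneg_left h9
        refine (norm_sum_le _ _).trans ((Finset.sum_le_sum h2).trans ?_)
        rw [Finset.sum_add_distrib, ← Finset.mul_sum, ← Finset.mul_sum, ← hA]
        have h3 := sum_real_le_of_tsum F hFz (f := fun z =>
          Real.exp (-((z.im - t) ^ 2 / 2)) * cf V m z)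
          (fun z => mul_nonneg (Real.exp_pos _).le (cf_nonneg _ _ _)) hB0 hB
        have h4 := mul_le_mul_of_nonneg_left h3 (show 0 ≤ 2 * K * δ by positivity)
        linarith
      have h3 : (E + 2 * K * B) * δ ≤ 1 := hn2
      have h4 : 0 ≤ E * C0 := by positivity
      linarith
  have hsT : |s.im| ≤ T := by rw [hst]; linarith
  have hsR : s ∈ closure R := (mem_closure_rect hT).2 ⟨⟨by linarith, hs2⟩, hsT⟩
  have hV0 : V s ≠ 0 := by
    intro h0
    have := (h.zeros s (by linarith) h0).2.1
    linarith
  have hU0 : U s ≠ 0 := mul_ne_zero (hpne s (by linarith)) hV0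
  have hmain := norm_sub_residues_le hUd hpd hRb hFU hFr hdne hfront hsR hU0
  refine ⟨F, hFz, ?_⟩
  have h1 : ‖(s - 1) / ((s + 2) ^ m * V s)‖ ≤ ‖p s / U s‖ := by
    simp only [hp, hU]
    rw [mul_div_assoc, norm_mul, norm_gauss]
    refine le_mul_of_one_le_left (norm_nonneg _) ?_
    rw [hst, sub_self]
    apply Real.one_le_exp
    nlinarith [sq_nonneg s.re]
  have h2 : ‖p s / U s‖ ≤ E * C0 + 1 + 2 * A + ∑ z ∈ F,
      2 * (Real.exp (-(z.im - t) ^ 2) * cf V m z) * (1 / ‖s - z‖) := by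
    have h3 : ‖p s / U s‖ ≤ ‖p s / U s - ∑ z ∈ F, p z / deriv U z / (s - z)‖ +
        ‖∑ z ∈ F, p z / deriv U z / (s - z)‖ := by
      have := norm_add_le (p s / U s - ∑ z ∈ F, p z / deriv U z / (s - z))
        (∑ z ∈ F, p z / deriv U z / (s - z))
      rwa [sub_add_cancel] at this
    have h4 := (norm_sum_le F fun z => p z / deriv U z / (s - z)).trans
      (Finset.sum_le_sum fun z hz => hterm z hz s)
    linarith
  refine h1.trans (h2.trans_eq ?_)
  rw [hA, Finset.mul_sum, add_assoc, ← Finset.sum_add_distrib, Finset.mul_sum]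
  congr 1
  refine Finset.sum_congr rfl fun z _ => ?_
  ring

end VPack

end LimDist

namespace LimDist
open scoped ENNReal

/-- The function `1 / (s Z(s))` in terms of `V`. -/
def Hf (V : ℂ → ℂ) (m : ℕ) (s : ℂ) : ℂ := (s - 1) / (s ^ (m + 1) * V s)

lemma norm_Hf_sq_le (V : ℂ → ℂ) (m : ℕ) {s : ℂ} (hs : 1 / 2 ≤ s.re) :
    ‖Hf V m s‖ ^ 2 ≤ 4 * 25 ^ m * ‖(s - 1) / ((s + 2) ^ m * V s)‖ ^ 2 / (1 + s.im ^ 2) := by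
  have hs0 : s ≠ 0 := by rintro rfl; norm_num at hs
  have hn : 1 / 2 ≤ ‖s‖ := hs.trans ((le_abs_self _).trans (Complex.abs_re_le_norm s))
  have hs2 : ‖s + 2‖ ≤ 5 * ‖s‖ := by
    refine (norm_add_le _ _).trans ?_
    rw [Complex.norm_ofNat]; linarith
  have hsq : 1 + s.im ^ 2 ≤ 4 * ‖s‖ ^ 2 := by
    rw [← Complex.normSq_eq_norm_sq, Complex.normSq_apply]; nlinarith
  have hs20 : s + 2 ≠ 0 := by
    intro h0
    have := congrArg Complex.re h0
    simp at this
    linarith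
  have e : Hf V m s = (s - 1) / ((s + 2) ^ m * V s) * ((s + 2) ^ m / s ^ m) / s := by
    rw [Hf, pow_succ]
    by_cases hV : V s = 0
    · simp [hV]
    field_simp
  have h1 : ‖(s + 2) ^ m / s ^ m‖ ≤ 5 ^ m := by
    rw [← div_pow, norm_pow, norm_div]
    refine pow_le_pow_left₀ (by positivity) ?_ m
    rw [div_le_iff₀ (by linarith)]; exact hs2
  have hp : 0 < ‖s‖ := by linarith
  rw [e, norm_div, norm_mul, div_pow, mul_pow, div_le_div_iff₀ (by positivity) (by positivity)]
  have h2 : ‖(s + 2) ^ m / s ^ m‖ ^ 2 ≤ 25 ^ m := by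
    refine (pow_le_pow_left₀ (norm_nonneg _) h1 2).trans_eq ?_
    rw [← pow_mul, mul_comm, pow_mul]; norm_num
  calc _ ≤ ‖(s - 1) / ((s + 2) ^ m * V s)‖ ^ 2 * 25 ^ m * (4 * ‖s‖ ^ 2) := by gcongr
    _ = _ := by ring

lemma sqrt_div_le_wgt (t : ℝ) : √(2 + |t|) / (1 + t ^ 2) ≤ 4 * wgt t := by
  have h0 := abs_nonneg t
  have h1 : wgt t = √(1 + |t|) / (1 + |t|) ^ 2 := by
    rw [wgt, Real.sqrt_eq_rpow, ← Real.rpow_natCast, ← Real.rpow_sub (by positivity)]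
    norm_num
  have h2 : √(2 + |t|) ≤ 2 * √(1 + |t|) := by
    rw [Real.sqrt_le_left (by positivity), mul_pow, Real.sq_sqrt (by positivity)]
    linarith
  rw [h1, ← mul_div_assoc, div_le_div_iff₀ (by positivity) (by positivity)]
  have h3 : (1 + |t|) ^ 2 ≤ 2 * (1 + t ^ 2) := by
    rw [← sq_abs t]; nlinarith [sq_nonneg (|t| - 1)]
  calc √(2 + |t|) * (1 + |t|) ^ 2 ≤ (2 * √(1 + |t|)) * (2 * (1 + t ^ 2)) := by gcongr
    _ = _ := by ring

/-- The kernel bounding the contribution of a zero at distance `x` from the height. -/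
def kern (σ x : ℝ) : ℝ := 2 / (1 + x ^ 2) + 1 / (σ ^ 2 + x ^ 2)

lemma kern_nonneg (σ x : ℝ) : 0 ≤ kern σ x := by unfold kern; positivity

lemma exp_mul_wgt_mul_le {t x d σ : ℝ} (hσ : 0 < σ) (hd : d ^ 2 = σ ^ 2 + (t - x) ^ 2)
    (hd0 : 0 < d) :
    wgt t * (Real.exp (-(x - t) ^ 2) * (1 + 1 / d) ^ 2) ≤ 200 * wgt x * kern σ (t - x) := by
  have h1 := exp_mul_wgt_le t x
  have e1 : Real.exp (-(x - t) ^ 2) =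
      Real.exp (-((x - t) ^ 2 / 2)) * Real.exp (-((x - t) ^ 2 / 2)) := by
    rw [← Real.exp_add]; congr 1; ring
  have h2 : (1 + 1 / d) ^ 2 ≤ 2 * (1 + 1 / (σ ^ 2 + (t - x) ^ 2)) := by
    rw [← hd, ← one_div_pow]; nlinarith [sq_nonneg (1 - 1 / d)]
  have hE := Real.exp_pos (-((x - t) ^ 2 / 2))
  have h3 : Real.exp (-((x - t) ^ 2 / 2)) ≤ 2 / (1 + (t - x) ^ 2) := by
    rw [Real.exp_neg, ← one_div, div_le_div_iff₀ (Real.exp_pos _) (by positivity)]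
    have := Real.add_one_le_exp ((x - t) ^ 2 / 2)
    nlinarith
  have h4 : Real.exp (-((x - t) ^ 2 / 2)) ≤ 1 := by
    rw [Real.exp_le_one_iff]; nlinarith [sq_nonneg (x - t)]
  have h5 : Real.exp (-((x - t) ^ 2 / 2)) * (1 + 1 / (σ ^ 2 + (t - x) ^ 2)) ≤ kern σ (t - x) := by
    have : 0 ≤ 1 / (σ ^ 2 + (t - x) ^ 2) := by positivity
    rw [kern]; nlinarith
  have hw := wgt_pos t
  have hwx := wgt_pos x
  calc _ ≤ wgt t * (Real.exp (-(x - t) ^ 2) * (2 * (1 + 1 / (σ ^ 2 + (t - x) ^ 2)))) := by gcongr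
    _ = 2 * (Real.exp (-((x - t) ^ 2 / 2)) * wgt t) *
        (Real.exp (-((x - t) ^ 2 / 2)) * (1 + 1 / (σ ^ 2 + (t - x) ^ 2))) := by rw [e1]; ring
    _ ≤ 2 * (100 * wgt x) * kern σ (t - x) := by
        have := kern_nonneg σ (t - x)
        gcongr
    _ = _ := by ring

namespace VPack
variable {Z V : ℂ → ℂ} {m : ℕ}

theorem Hf_sq_le (h : VPack Z V m)
    (hS : ∑' z : Zr V, ENNReal.ofReal (cf V m z.1 ^ 2 * wgt z.im) ≠ ∞) :
    ∃ C : ℝ, 0 < C ∧ ∀ σ t : ℝ, 0 < σ → σ ≤ 1 →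
      ENNReal.ofReal (‖Hf V m (1 / 2 + σ + t * I)‖ ^ 2) ≤ ENNReal.ofReal (C / (1 + t ^ 2)) +
        ∑' z : Zr V, ENNReal.ofReal (C * (cf V m z.1 ^ 2 * wgt z.im) * kern σ (t - z.im)) := by
  obtain ⟨C, hC, hp⟩ := h.pointwise hS
  obtain ⟨K, hK, hg⟩ := h.gauss_sum
  refine ⟨4 * 25 ^ m * (2 * C ^ 2 + 6400 * K), by positivity, fun σ t hσ hσ1 => ?_⟩
  set s : ℂ := 1 / 2 + σ + t * I with hs
  have hre : s.re = 1 / 2 + σ := by simp [hs]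
  have him : s.im = t := by simp [hs]
  obtain ⟨F, hF, hb⟩ := hp t s (by rw [hre]; linarith) (by rw [hre]; linarith) him
  have hg' : ∑ z ∈ F, Real.exp (-((z.im - t) ^ 2 / 2)) ≤ K * √(2 + |t|) :=
    sum_real_le_of_tsum F hF (f := fun z => Real.exp (-((z.im - t) ^ 2 / 2)))
      (fun z => (Real.exp_pos _).le) (by positivity) (hg t)
  set A : ℂ → ℝ := fun z => Real.exp (-(z.im - t) ^ 2) * cf V m z ^ 2 * (1 + 1 / ‖s - z‖) ^ 2
  have hCS : (∑ z ∈ F, Real.exp (-(z.im - t) ^ 2) * cf V m z * (1 + 1 / ‖s - z‖)) ^ 2 ≤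
      K * √(2 + |t|) * ∑ z ∈ F, A z := by
    have h1 := Finset.sum_mul_sq_le_sq_mul_sq F (fun z : ℂ => Real.exp (-((z.im - t) ^ 2 / 2)))
      (fun z => Real.exp (-((z.im - t) ^ 2 / 2)) * cf V m z * (1 + 1 / ‖s - z‖))
    have e1 : ∀ z : ℂ, Real.exp (-((z.im - t) ^ 2 / 2)) * (Real.exp (-((z.im - t) ^ 2 / 2)) *
        cf V m z * (1 + 1 / ‖s - z‖)) =
        Real.exp (-(z.im - t) ^ 2) * cf V m z * (1 + 1 / ‖s - z‖) := by
      intro z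
      rw [← mul_assoc, ← mul_assoc, ← Real.exp_add]; congr 4; ring
    have e2 : ∀ z : ℂ, (Real.exp (-((z.im - t) ^ 2 / 2)) * cf V m z * (1 + 1 / ‖s - z‖)) ^ 2 =
        A z := by
      intro z
      simp only [A]
      rw [mul_pow, mul_pow, ← Real.exp_nat_mul]; congr 4; push_cast; ring
    have e3 : ∀ z : ℂ, Real.exp (-((z.im - t) ^ 2 / 2)) ^ 2 ≤ Real.exp (-((z.im - t) ^ 2 / 2)) := by
      intro z
      rw [sq]
      exact mul_le_of_le_one_left (Real.exp_pos _).le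
        (by rw [Real.exp_le_one_iff]; nlinarith [sq_nonneg (z.im - t)])
    simp only [e1, e2] at h1
    refine h1.trans (mul_le_mul_of_nonneg_right ((Finset.sum_le_sum fun z _ => e3 z).trans hg') ?_)
    exact Finset.sum_nonneg fun z _ => by simp only [A]; positivity
  have hAn : 0 ≤ ∑ z ∈ F, A z := Finset.sum_nonneg fun z _ => by simp only [A]; positivity
  have hgsq : ‖(s - 1) / ((s + 2) ^ m * V s)‖ ^ 2 ≤
      2 * C ^ 2 + 8 * (K * √(2 + |t|) * ∑ z ∈ F, A z) := by
    have := pow_le_pow_left₀ (norm_nonneg _) hb 2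
    nlinarith [sq_nonneg (C - 2 * ∑ z ∈ F,
      Real.exp (-(z.im - t) ^ 2) * cf V m z * (1 + 1 / ‖s - z‖))]
  have hH := norm_Hf_sq_le V m (s := s) (by rw [hre]; linarith)
  rw [him] at hH
  have hw := sqrt_div_le_wgt t
  have hw0 := wgt_pos t
  have hfin : ‖Hf V m s‖ ^ 2 ≤ 4 * 25 ^ m * (2 * C ^ 2 + 6400 * K) / (1 + t ^ 2) +
      ∑ z ∈ F, 4 * 25 ^ m * (2 * C ^ 2 + 6400 * K) * (cf V m z ^ 2 * wgt z.im) *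
        kern σ (t - z.im) := by
    have h1 : ∀ z ∈ F, 8 * K * (4 * wgt t) * A z ≤
        (2 * C ^ 2 + 6400 * K) * (cf V m z ^ 2 * wgt z.im) * kern σ (t - z.im) := by
      intro z hz
      have hzr := (h.zeros z (hF z hz).1 (hF z hz).2).2.1
      have hd : ‖s - z‖ ^ 2 = σ ^ 2 + (t - z.im) ^ 2 := by
        rw [← Complex.normSq_eq_norm_sq, Complex.normSq_apply, Complex.sub_re, Complex.sub_im,
          hre, him, hzr]; ring
      have hd0 : 0 < ‖s - z‖ := by
        rw [norm_pos_iff]; intro h0; rw [h0] at hd; simp at hd; nlinarith [sq_nonneg (t - z.im)]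
      have h2 := exp_mul_wgt_mul_le hσ hd hd0
      have h3 := kern_nonneg σ (t - z.im)
      have h4 := wgt_pos z.im
      have h5 : 0 ≤ 2 * C ^ 2 * (cf V m z ^ 2 * wgt z.im) * kern σ (t - z.im) := by positivity
      calc 8 * K * (4 * wgt t) * A z = 32 * K * cf V m z ^ 2 *
            (wgt t * (Real.exp (-(z.im - t) ^ 2) * (1 + 1 / ‖s - z‖) ^ 2)) := by
              simp only [A]; ring
        _ ≤ 32 * K * cf V m z ^ 2 * (200 * wgt z.im * kern σ (t - z.im)) := by gcongr
        _ ≤ _ := by nlinarith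
    refine hH.trans ?_
    calc _ ≤ 4 * 25 ^ m * (2 * C ^ 2 + 8 * (K * √(2 + |t|) * ∑ z ∈ F, A z)) / (1 + t ^ 2) := by
          gcongr
      _ = 4 * 25 ^ m * (2 * C ^ 2) / (1 + t ^ 2) + 4 * 25 ^ m *
          (8 * K * (√(2 + |t|) / (1 + t ^ 2)) * ∑ z ∈ F, A z) := by ring
      _ ≤ 4 * 25 ^ m * (2 * C ^ 2 + 6400 * K) / (1 + t ^ 2) + 4 * 25 ^ m *
          (8 * K * (4 * wgt t) * ∑ z ∈ F, A z) := by
          gcongr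
          linarith
      _ ≤ _ := by
          gcongr
          rw [Finset.mul_sum, Finset.mul_sum]
          refine Finset.sum_le_sum fun z hz => ?_
          have := mul_le_mul_of_nonneg_left (h1 z hz) (show (0 : ℝ) ≤ 4 * 25 ^ m by positivity)
          linarith
  have hnn : ∀ z : ℂ, 0 ≤ 4 * 25 ^ m * (2 * C ^ 2 + 6400 * K) * (cf V m z ^ 2 * wgt z.im) *
      kern σ (t - z.im) := by
    intro z
    have h3 := kern_nonneg σ (t - z.im)
    have h4 := wgt_pos z.im
    positivity
  refine (ENNReal.ofReal_le_ofReal hfin).trans ?_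
  rw [ENNReal.ofReal_add (by positivity) (Finset.sum_nonneg fun z _ => hnn z),
    ENNReal.ofReal_sum_of_nonneg fun z _ => hnn z]
  exact add_le_add_right (sum_le_tsum_zr F hF (fun z => ENNReal.ofReal
    (4 * 25 ^ m * (2 * C ^ 2 + 6400 * K) * (cf V m z ^ 2 * wgt z.im) * kern σ (t - z.im)))) _

end VPack

end LimDist

namespace LimDist
open scoped ENNReal

lemma lintegral_inv_one_add_sq : ∫⁻ x : ℝ, ENNReal.ofReal (1 / (1 + x ^ 2)) = ENNReal.ofReal Real.pi := by
  simp only [one_div]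
  rw [← integral_univ_inv_one_add_sq, ofReal_integral_eq_lintegral_ofReal integrable_inv_one_add_sq
    (ae_of_all _ fun x => by positivity)]

lemma lintegral_inv_sq_add_sq {σ : ℝ} (hσ : 0 < σ) :
    ∫⁻ x : ℝ, ENNReal.ofReal (1 / (σ ^ 2 + x ^ 2)) = ENNReal.ofReal (Real.pi / σ) := by
  have e : ∀ x : ℝ, 1 / (σ ^ 2 + x ^ 2) = (σ ^ 2)⁻¹ * (1 + (σ⁻¹ * x) ^ 2)⁻¹ := by
    intro x; rw [mul_pow, inv_pow]; field_simp
  simp only [e]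
  rw [← ofReal_integral_eq_lintegral_ofReal
    ((integrable_inv_one_add_sq.comp_mul_left' (inv_ne_zero hσ.ne')).const_mul _)
    (ae_of_all _ fun x => by positivity), integral_const_mul,
    Measure.integral_comp_mul_left (fun x : ℝ => (1 + x ^ 2)⁻¹), integral_univ_inv_one_add_sq,
    inv_inv, abs_of_pos hσ, smul_eq_mul]
  congr 1; field_simp

lemma measurable_kern (σ γ : ℝ) : Measurable fun t : ℝ => ENNReal.ofReal (kern σ (t - γ)) := by
  unfold kern; fun_prop

lemma lintegral_kern_le {σ : ℝ} (hσ : 0 < σ) (hσ1 : σ ≤ 1) (γ : ℝ) :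
    ∫⁻ t : ℝ, ENNReal.ofReal (kern σ (t - γ)) ≤ ENNReal.ofReal (3 * Real.pi / σ) := by
  rw [lintegral_sub_right_eq_self (fun t : ℝ => ENNReal.ofReal (kern σ t)) γ]
  have e : ∀ x : ℝ, ENNReal.ofReal (kern σ x) = ENNReal.ofReal 2 * ENNReal.ofReal (1 / (1 + x ^ 2)) +
      ENNReal.ofReal (1 / (σ ^ 2 + x ^ 2)) := by
    intro x
    rw [← ENNReal.ofReal_mul (by norm_num), ← ENNReal.ofReal_add (by positivity) (by positivity),
      kern]
    congr 1; ring
  simp only [e]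
  rw [lintegral_add_left (by fun_prop), lintegral_const_mul _ (by fun_prop),
    lintegral_inv_one_add_sq, lintegral_inv_sq_add_sq hσ, ← ENNReal.ofReal_mul (by norm_num),
    ← ENNReal.ofReal_add (by positivity) (by positivity)]
  apply ENNReal.ofReal_le_ofReal
  rw [le_div_iff₀ hσ, add_mul, div_mul_cancel₀ _ hσ.ne']
  nlinarith [Real.pi_pos]

lemma lintegral_kern_far_le {σ γ T : ℝ} (hγ : |γ| ≤ T - 1) :
    ∫⁻ t in {t : ℝ | T < |t|}, ENNReal.ofReal (kern σ (t - γ)) ≤ ENNReal.ofReal (4 * Real.pi) := by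
  have hm : MeasurableSet {t : ℝ | T < |t|} := measurableSet_lt measurable_const (by fun_prop)
  have h1 : ∀ t ∈ {t : ℝ | T < |t|}, ENNReal.ofReal (kern σ (t - γ)) ≤
      ENNReal.ofReal 4 * ENNReal.ofReal (1 / (1 + (t - γ) ^ 2)) := by
    intro t ht
    rw [← ENNReal.ofReal_mul (by norm_num)]
    apply ENNReal.ofReal_le_ofReal
    have h2 : 1 ≤ |t - γ| := by
      have := abs_sub_abs_le_abs_sub t γ
      have h3 : T < |t| := ht
      linarith
    have h3 : 1 ≤ (t - γ) ^ 2 := by rw [← sq_abs]; nlinarith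
    have h4 : 1 / (σ ^ 2 + (t - γ) ^ 2) ≤ 2 / (1 + (t - γ) ^ 2) := by
      rw [div_le_div_iff₀ (by positivity) (by positivity)]; nlinarith [sq_nonneg σ]
    rw [kern]
    calc _ ≤ 2 / (1 + (t - γ) ^ 2) + 2 / (1 + (t - γ) ^ 2) := by gcongr
      _ = _ := by ring
  refine (setLIntegral_mono' hm h1).trans ((setLIntegral_le_lintegral _ _).trans ?_)
  rw [lintegral_const_mul _ (by fun_prop),
    lintegral_sub_right_eq_self (fun t : ℝ => ENNReal.ofReal (1 / (1 + t ^ 2))) γ,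
    lintegral_inv_one_add_sq, ← ENNReal.ofReal_mul (by norm_num)]

namespace VPack
variable {Z V : ℂ → ℂ} {m : ℕ}

lemma countable_zr (h : VPack Z V m) : Countable (Zr V) := by
  have h1 : {z : ℂ | -1 < z.re ∧ V z = 0}.Countable := by
    refine Set.Countable.mono (s₂ := ⋃ n : ℕ, {z ∈ Metric.closedBall (0 : ℂ) n | V z = 0}) ?_ ?_
    · intro z hz
      obtain ⟨n, hn⟩ := exists_nat_ge ‖z‖
      exact Set.mem_iUnion.2 ⟨n, by simpa using hn, hz.2⟩
    · refine Set.countable_iUnion fun n => Set.Finite.countable ?_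
      exact finite_zeros h.diff (h.ne_zero_center 0) (isCompact_closedBall _ _)
  exact h1.to_subtype

lemma Hf_bounded (h : VPack Z V m)
    (hS : ∑' z : Zr V, ENNReal.ofReal (cf V m z.1 ^ 2 * wgt z.im) ≠ ∞) {σ₁ : ℝ} (hσ₁ : 0 < σ₁) :
    ∃ B : ℝ, ∀ σ t : ℝ, σ₁ ≤ σ → σ ≤ 1 → ‖Hf V m (1 / 2 + σ + t * I)‖ ≤ B := by
  obtain ⟨C, hC, hb⟩ := h.Hf_sq_le hS
  set S := ∑' z : Zr V, ENNReal.ofReal (cf V m z.1 ^ 2 * wgt z.im) with hSd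
  have hfin : ENNReal.ofReal C + ENNReal.ofReal (C * (2 + 1 / σ₁ ^ 2)) * S ≠ ∞ :=
    ENNReal.add_ne_top.2 ⟨ENNReal.ofReal_ne_top, ENNReal.mul_ne_top ENNReal.ofReal_ne_top hS⟩
  set B := (ENNReal.ofReal C + ENNReal.ofReal (C * (2 + 1 / σ₁ ^ 2)) * S).toReal with hB
  refine ⟨√B, fun σ t h1 h2 => Real.le_sqrt_of_sq_le ?_⟩
  have h3 := hb σ t (hσ₁.trans_le h1) h2
  rw [← ENNReal.ofReal_le_ofReal_iff ENNReal.toReal_nonneg, ENNReal.ofReal_toReal hfin]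
  refine h3.trans (add_le_add ?_ ?_)
  · apply ENNReal.ofReal_le_ofReal
    exact div_le_self hC.le (by nlinarith [sq_nonneg t])
  · rw [hSd, ← ENNReal.tsum_mul_left]
    refine ENNReal.tsum_le_tsum fun z => ?_
    rw [← ENNReal.ofReal_mul (by positivity)]
    apply ENNReal.ofReal_le_ofReal
    have hw := wgt_pos z.im
    have hk : kern σ (t - z.im) ≤ 2 + 1 / σ₁ ^ 2 := by
      unfold kern
      refine add_le_add (div_le_self (by norm_num) (by nlinarith [sq_nonneg (t - z.im)])) ?_
      apply one_div_le_one_div_of_le (by positivity)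
      nlinarith [sq_nonneg (t - z.im)]
    calc _ ≤ C * (cf V m z.1 ^ 2 * wgt z.im) * (2 + 1 / σ₁ ^ 2) := by gcongr
      _ = _ := by ring

set_option maxHeartbeats 400000 in
theorem Hf_tail (h : VPack Z V m)
    (hS : ∑' z : Zr V, ENNReal.ofReal (cf V m z.1 ^ 2 * wgt z.im) ≠ ∞) {ε : ℝ} (hε : 0 < ε) :
    ∃ T₀ : ℝ, ∀ T, T₀ ≤ T → ∃ σ₀ : ℝ, 0 < σ₀ ∧ σ₀ ≤ 1 ∧ ∀ σ : ℝ, 0 < σ → σ < σ₀ →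
      ∫⁻ t in {t : ℝ | T < |t|}, ENNReal.ofReal (‖Hf V m (1 / 2 + σ + t * I)‖ ^ 2) ≤
        ENNReal.ofReal (ε / σ) := by
  have := h.countable_zr
  obtain ⟨C, hC, hb⟩ := h.Hf_sq_le hS
  set D : Zr V → ℝ≥0∞ := fun z => ENNReal.ofReal (C * (cf V m z.1 ^ 2 * wgt z.im)) with hD
  have hDS : ∑' z, D z ≠ ∞ := by
    simp only [hD, ENNReal.ofReal_mul hC.le]
    rw [ENNReal.tsum_mul_left]
    exact ENNReal.mul_ne_top ENNReal.ofReal_ne_top hS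
  have hpi := Real.pi_pos
  have htail := ENNReal.tendsto_tsum_compl_atTop_zero hDS
  obtain ⟨F, hF⟩ := ((tendsto_order.1 htail).2 (ENNReal.ofReal (ε / (6 * Real.pi)))
    (ENNReal.ofReal_pos.2 (by positivity))).exists
  obtain ⟨T₀, hT₀⟩ := (F.image fun z => |z.im| + 1).bddAbove
  refine ⟨T₀, fun T hT => ?_⟩
  set A : ℝ := C * Real.pi + (∑' z, D z).toReal * (4 * Real.pi) with hA
  have hA0 : 0 < A := by have : 0 ≤ (∑' z, D z).toReal := ENNReal.toReal_nonneg; positivity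
  refine ⟨min 1 (ε / (2 * A)), by positivity, min_le_left _ _, fun σ hσ hσ1 => ?_⟩
  have hσ1' : σ ≤ 1 := (hσ1.trans_le (min_le_left _ _)).le
  have hσA : A ≤ ε / (2 * σ) := by
    have := hσ1.trans_le (min_le_right _ _)
    rw [lt_div_iff₀ (by positivity)] at this
    rw [le_div_iff₀ (by positivity)]
    linarith
  have h1 : ∀ t : ℝ, ENNReal.ofReal (‖Hf V m (1 / 2 + σ + t * I)‖ ^ 2) ≤
      ENNReal.ofReal C * ENNReal.ofReal (1 / (1 + t ^ 2)) +
        ∑' z : Zr V, D z * ENNReal.ofReal (kern σ (t - z.im)) := by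
    intro t
    refine (hb σ t hσ hσ1').trans_eq ?_
    rw [← ENNReal.ofReal_mul hC.le, mul_one_div]
    congr 1
    refine tsum_congr fun z => ?_
    rw [hD, ENNReal.ofReal_mul]
    have := wgt_pos z.im
    positivity
  refine (lintegral_mono h1).trans ?_
  have hm1 : Measurable fun t : ℝ => ENNReal.ofReal C * ENNReal.ofReal (1 / (1 + t ^ 2)) := by fun_prop
  rw [lintegral_add_left hm1]
  have h5 : ∫⁻ t in {t : ℝ | T < |t|}, ∑' z : Zr V, D z * ENNReal.ofReal (kern σ (t - z.im)) =
      ∑' z : Zr V, ∫⁻ t in {t : ℝ | T < |t|}, D z * ENNReal.ofReal (kern σ (t - z.im)) :=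
    lintegral_tsum fun z => ((measurable_kern σ z.im).const_mul _).aemeasurable
  rw [h5]
  have h2 : ∀ z : Zr V, ∫⁻ t in {t : ℝ | T < |t|}, D z * ENNReal.ofReal (kern σ (t - z.im)) ≤
      D z * ENNReal.ofReal (4 * Real.pi) +
        ((F : Set (Zr V))ᶜ.indicator D z) * ENNReal.ofReal (3 * Real.pi / σ) := by
    intro z
    rw [lintegral_const_mul _ (measurable_kern σ z.im)]
    by_cases hz : z ∈ F
    · refine le_add_right (mul_le_mul_right (lintegral_kern_far_le ?_) _)
      have : |z.im| + 1 ≤ T₀ := hT₀ (Finset.mem_coe.2 (Finset.mem_image_of_mem _ hz))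
      linarith
    · rw [Set.indicator_of_mem (by simpa using hz)]
      refine le_add_left (mul_le_mul_right ?_ _)
      exact (setLIntegral_le_lintegral _ _).trans (lintegral_kern_le hσ hσ1' _)
  have h3 : ∑' z : Zr V, (F : Set (Zr V))ᶜ.indicator D z ≤ ENNReal.ofReal (ε / (6 * Real.pi)) := by
    rw [← tsum_subtype]; exact hF.le
  have h4 : ∫⁻ t in {t : ℝ | T < |t|}, ENNReal.ofReal (1 / (1 + t ^ 2)) ≤ ENNReal.ofReal Real.pi :=
    (setLIntegral_le_lintegral _ _).trans lintegral_inv_one_add_sq.le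
  have h6 : ∫⁻ t in {t : ℝ | T < |t|}, ENNReal.ofReal C * ENNReal.ofReal (1 / (1 + t ^ 2)) ≤
      ENNReal.ofReal C * ENNReal.ofReal Real.pi := by
    have hm2 : Measurable fun t : ℝ => ENNReal.ofReal (1 / (1 + t ^ 2)) := by fun_prop
    rw [lintegral_const_mul _ hm2]
    exact mul_le_mul_right h4 _
  refine (add_le_add h6 (ENNReal.tsum_le_tsum h2)).trans ?_
  rw [ENNReal.tsum_add, ENNReal.tsum_mul_right, ENNReal.tsum_mul_right, ← add_assoc]
  have e1 : ENNReal.ofReal C * ENNReal.ofReal Real.pi +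
      (∑' z, D z) * ENNReal.ofReal (4 * Real.pi) = ENNReal.ofReal A := by
    rw [hA, ENNReal.ofReal_add (by positivity) (by positivity), ENNReal.ofReal_mul hC.le,
      ENNReal.ofReal_mul ENNReal.toReal_nonneg, ENNReal.ofReal_toReal hDS]
  rw [e1]
  refine (add_le_add_right (mul_le_mul_left h3 _) _).trans ?_
  rw [← ENNReal.ofReal_mul (by positivity), ← ENNReal.ofReal_add hA0.le (by positivity)]
  apply ENNReal.ofReal_le_ofReal
  have : ε / (6 * Real.pi) * (3 * Real.pi / σ) = ε / (2 * σ) := by field_simp; norm_num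
  rw [this]
  have : ε / σ = ε / (2 * σ) + ε / (2 * σ) := by field_simp; norm_num
  linarith

end VPack

end LimDist

namespace LimDist
open scoped ENNReal

/-- The residue of `Hf V m` at a simple zero of `V`. -/
def res (V : ℂ → ℂ) (m : ℕ) (z : ℂ) : ℂ := (z - 1) / (z ^ (m + 1) * deriv V z)

/-- `Hf V m` with finitely many principal parts removed. -/
def Gf (V : ℂ → ℂ) (m : ℕ) (F : Finset ℂ) (s : ℂ) : ℂ :=
  Hf V m s - ∑ z ∈ F, res V m z / (s - z)

lemma inv_abs_le_of_far {t γ T η : ℝ} (hη : 0 < η) (hT : 0 ≤ T) (ht : T < |t|)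
    (hγ : |γ| ≤ T - η) : 1 / |t - γ| ≤ (1 + (1 + T) / η) / (1 + |t|) := by
  have h1 : |t| - T + η ≤ |t - γ| := by
    have := abs_sub_abs_le_abs_sub t γ
    linarith
  have h2 : 0 < |t - γ| := by linarith
  rw [div_le_div_iff₀ h2 (by positivity)]
  have h3 : (1 + (1 + T) / η) * (|t| - T + η) ≤ (1 + (1 + T) / η) * |t - γ| := by gcongr
  have h4 : (1 + (1 + T) / η) * η = η + (1 + T) := by field_simp
  have h5 : 0 ≤ (1 + T) / η * (|t| - T) := mul_nonneg (by positivity) (by linarith)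
  nlinarith

namespace VPack
variable {Z V : ℂ → ℂ} {m : ℕ}

lemma Gf_bounded_rect (h : VPack Z V m) {T : ℝ} (hT : 0 < T) {F : Finset ℂ}
    (hF : ∀ z, z ∈ F ↔ (-1 < z.re ∧ |z.im| ≤ T) ∧ V z = 0)
    (hgap : ∀ z, -1 < z.re → V z = 0 → |z.im| ≠ T) :
    ∃ B : ℝ, 0 ≤ B ∧ ∀ s : ℂ, 1 / 2 < s.re → s.re ≤ 3 / 2 → |s.im| ≤ T → ‖Gf V m F s‖ ≤ B := by
  set R : Set ℂ := Set.Ioo (1 / 4 : ℝ) (3 / 2) ×ℂ Set.Ioo (-T) T with hR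
  have hcl : ∀ s : ℂ, s ∈ closure R ↔ (1 / 4 ≤ s.re ∧ s.re ≤ 3 / 2) ∧ |s.im| ≤ T := by
    intro s
    rw [hR, closure_reProdIm, closure_Ioo (by norm_num), closure_Ioo (by linarith), mem_reProdIm,
      Set.mem_Icc, Set.mem_Icc, abs_le]
  have hRo : IsOpen R := isOpen_Ioo.reProdIm isOpen_Ioo
  have hRb : Bornology.IsBounded R :=
    (Metric.isBounded_Ioo _ _).reProdIm (Metric.isBounded_Ioo _ _)
  set U : ℂ → ℂ := fun s => s ^ (m + 1) * V s with hU
  set p : ℂ → ℂ := fun s => s - 1 with hp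
  have hVd := h.diff
  have hUd : Differentiable ℂ U := by fun_prop
  have hpd : Differentiable ℂ p := by fun_prop
  have hne : ∀ s : ℂ, 1 / 4 ≤ s.re → s ^ (m + 1) ≠ 0 := fun s hs => by
    apply pow_ne_zero
    rintro rfl
    norm_num at hs
  have hFU : ∀ z, z ∈ F ↔ z ∈ closure R ∧ U z = 0 := by
    intro z
    rw [hF, hcl]
    constructor
    · rintro ⟨⟨h1, h2⟩, h3⟩
      have := (h.zeros z h1 h3).2.1
      exact ⟨⟨⟨by rw [this]; norm_num, by rw [this]; norm_num⟩, h2⟩, by simp [hU, h3]⟩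
    · rintro ⟨⟨⟨h1, h2⟩, h3⟩, h4⟩
      exact ⟨⟨by linarith, h3⟩, (mul_eq_zero.1 h4).resolve_left (hne z h1)⟩
  have hfrU : ∀ s ∈ frontier R, U s ≠ 0 := by
    intro s hs h0
    have h1 := (hF s).1 ((hFU s).2 ⟨frontier_subset_closure hs, h0⟩)
    have h2 := (h.zeros s h1.1.1 h1.2).2.1
    have h3 := lt_of_le_of_ne h1.1.2 (hgap s h1.1.1 h1.2)
    have h4 : s ∈ R := by
      rw [hR, mem_reProdIm, Set.mem_Ioo, Set.mem_Ioo, h2, ← abs_lt]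
      exact ⟨by norm_num, h3⟩
    rw [hRo.frontier_eq] at hs
    exact hs.2 h4
  have hFr : ∀ z ∈ F, z ∉ frontier R := fun z hz hz' => hfrU z hz' ((hFU z).1 hz).2
  have hdU : ∀ z ∈ F, deriv U z = z ^ (m + 1) * deriv V z := by
    intro z hz
    have h1 : HasDerivAt (fun s : ℂ => s ^ (m + 1)) (((m + 1 : ℕ) : ℂ) * z ^ (m + 1 - 1)) z :=
      hasDerivAt_pow (m + 1) z
    have h2 : HasDerivAt U _ z := h1.mul (h.diff z).hasDerivAt
    rw [h2.deriv, ((hF z).1 hz).2]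
    ring
  have hdne : ∀ z ∈ F, deriv U z ≠ 0 := fun z hz => by
    rw [hdU z hz]
    have h1 := (hF z).1 hz
    have h2 := h.zeros z h1.1.1 h1.2
    exact mul_ne_zero (hne z (by rw [h2.2.1]; norm_num)) h2.2.2
  have hG : ∀ s, Gf V m F s = p s / U s - ∑ z ∈ F, p z / deriv U z / (s - z) := by
    intro s
    rw [Gf, Hf]
    congr 1
    refine Finset.sum_congr rfl fun z hz => ?_
    rw [hdU z hz, res]
  have hcpt : IsCompact (frontier R) :=
    hRb.isCompact_closure.of_isClosed_subset isClosed_frontier frontier_subset_closure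
  have hcont : ContinuousOn (fun s => p s / U s - ∑ z ∈ F, p z / deriv U z / (s - z))
      (frontier R) := by
    refine (hpd.continuous.continuousOn.div hUd.continuous.continuousOn hfrU).sub
      (continuousOn_finsetSum _ fun z hz => ?_)
    refine continuousOn_const.div (by fun_prop) fun s hs h0 => ?_
    rw [sub_eq_zero] at h0
    exact hFr z hz (h0 ▸ hs)
  obtain ⟨B, hB⟩ := hcpt.exists_bound_of_continuousOn hcont
  refine ⟨max B 0, le_max_right _ _, fun s h1 h2 h3 => ?_⟩
  rw [hG]
  have hV0 : V s ≠ 0 := by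
    intro h0
    have := (h.zeros s (by linarith) h0).2.1
    linarith
  exact (norm_sub_residues_le hUd hpd hRb hFU hFr hdne hB ((hcl s).2 ⟨⟨by linarith, h2⟩, h3⟩)
    (mul_ne_zero (hne s (by linarith)) hV0)).trans (le_max_left _ _)

theorem exists_approx (h : VPack Z V m)
    (hS : ∑' z : Zr V, ENNReal.ofReal (cf V m z.1 ^ 2 * wgt z.im) ≠ ∞) {ε : ℝ} (hε : 0 < ε) :
    ∃ F : Finset ℂ, (∀ z ∈ F, z.re = 1 / 2 ∧ V z = 0) ∧ ∃ σ₀ : ℝ, 0 < σ₀ ∧ σ₀ ≤ 1 ∧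
      ∀ σ : ℝ, 0 < σ → σ < σ₀ →
        ∫⁻ t : ℝ, ENNReal.ofReal (‖Gf V m F (1 / 2 + σ + t * I)‖ ^ 2) ≤ ENNReal.ofReal (ε / σ) := by
  obtain ⟨T₀, hT₀⟩ := h.Hf_tail hS (show 0 < ε / 4 by positivity)
  obtain ⟨K, hK, hh⟩ := h.heights
  obtain ⟨n, hn⟩ := exists_nat_ge (max T₀ 1)
  obtain ⟨T, hnT, -, hgap, -⟩ := hh n
  have hTT : T₀ ≤ T := (le_max_left _ _).trans (hn.trans hnT)
  have hT1 : 1 ≤ T := (le_max_right _ _).trans (hn.trans hnT)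
  set η : ℝ := 1 / (K * (n + 3)) with hη
  have hη0 : 0 < η := by positivity
  have hgap' : ∀ z : ℂ, -1 < z.re → V z = 0 → |z.im| ≠ T := by
    intro z hz h0 he
    have := hgap z hz h0
    rcases (abs_eq (by linarith)).1 he with h1 | h1
    · rw [h1, sub_self, abs_zero] at this; linarith
    · rw [h1, sub_self, abs_zero] at this; linarith
  have hfar : ∀ z : ℂ, -1 < z.re → V z = 0 → |z.im| ≤ T → |z.im| ≤ T - η := by
    intro z hz h0 he
    have h1 := hgap z hz h0
    have h2 := abs_le.1 he
    rw [abs_of_nonpos (by linarith), abs_of_nonneg (a := z.im - -T) (by linarith)] at h1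
    rw [abs_le]
    constructor <;> linarith
  have hfin : {z : ℂ | (-1 < z.re ∧ |z.im| ≤ T) ∧ V z = 0}.Finite := by
    refine (finite_zeros h.diff (h.ne_zero_center 0)
      (isCompact_closedBall (0 : ℂ) (1 + T))).subset ?_
    rintro z ⟨⟨h1, h2⟩, h3⟩
    refine ⟨?_, h3⟩
    rw [mem_closedBall_zero_iff]
    refine (Complex.norm_le_abs_re_add_abs_im z).trans (add_le_add ?_ h2)
    rw [(h.zeros z h1 h3).2.1]; norm_num
  set F := hfin.toFinset with hFd
  have hF : ∀ z, z ∈ F ↔ (-1 < z.re ∧ |z.im| ≤ T) ∧ V z = 0 := fun z => by simp [hFd]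
  obtain ⟨B, hB0, hB⟩ := h.Gf_bounded_rect (by linarith) hF hgap'
  obtain ⟨σ₁, hσ₁, hσ₁1, htail⟩ := hT₀ T hTT
  set A : ℝ := (∑ z ∈ F, ‖res V m z‖) * (1 + (1 + T) / η) with hA
  set D : ℝ := 2 * (A ^ 2 * Real.pi) + B ^ 2 * (2 * T) with hD
  have hpi := Real.pi_pos
  have hA0 : 0 ≤ A := mul_nonneg (Finset.sum_nonneg fun z _ => norm_nonneg _) (by positivity)
  have hD0 : 0 ≤ D := by positivity
  refine ⟨F, fun z hz => ?_, min σ₁ (ε / (2 * (D + 1))), by positivity,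
    (min_le_left _ _).trans hσ₁1, fun σ hσ hσ' => ?_⟩
  · have h1 := (hF z).1 hz
    exact ⟨(h.zeros z h1.1.1 h1.2).2.1, h1.2⟩
  have hσ1 : σ < σ₁ := hσ'.trans_le (min_le_left _ _)
  have hσD : D ≤ ε / (2 * σ) := by
    have := hσ'.trans_le (min_le_right _ _)
    rw [lt_div_iff₀ (by positivity)] at this
    rw [le_div_iff₀ (by positivity)]
    nlinarith
  have hre : ∀ t : ℝ, (1 / 2 + σ + t * I : ℂ).re = 1 / 2 + σ := fun t => by simp
  have him : ∀ t : ℝ, (1 / 2 + σ + t * I : ℂ).im = t := fun t => by simp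
  have hm : MeasurableSet {t : ℝ | T < |t|} := measurableSet_lt measurable_const (by fun_prop)
  rw [← lintegral_add_compl _ hm]
  have hout : ∀ t ∈ {t : ℝ | T < |t|}, ENNReal.ofReal (‖Gf V m F (1 / 2 + σ + t * I)‖ ^ 2) ≤
      ENNReal.ofReal (2 * A ^ 2) * ENNReal.ofReal (1 / (1 + t ^ 2)) +
      ENNReal.ofReal 2 * ENNReal.ofReal (‖Hf V m (1 / 2 + σ + t * I)‖ ^ 2) := by
    intro t ht
    have ht' : T < |t| := ht
    have h1 : ‖∑ z ∈ F, res V m z / ((1 / 2 + σ + t * I) - z)‖ ≤ A / (1 + |t|) := by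
      rw [hA, mul_div_assoc, Finset.sum_mul]
      refine (norm_sum_le _ _).trans (Finset.sum_le_sum fun z hz => ?_)
      have h2 := (hF z).1 hz
      have h3 := inv_abs_le_of_far hη0 (by linarith) ht' (hfar z h2.1.1 h2.2 h2.1.2)
      rw [norm_div, ← mul_one_div]
      refine mul_le_mul_of_nonneg_left (le_trans ?_ h3) (norm_nonneg _)
      have h4 := Complex.abs_im_le_norm ((1 / 2 + σ + t * I) - z)
      rw [Complex.sub_im, him] at h4
      apply one_div_le_one_div_of_le _ h4
      have := abs_sub_abs_le_abs_sub t z.im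
      linarith [h2.1.2]
    have h5 : (A / (1 + |t|)) ^ 2 ≤ A ^ 2 * (1 / (1 + t ^ 2)) := by
      rw [div_pow, ← mul_one_div]
      refine mul_le_mul_of_nonneg_left ?_ (sq_nonneg _)
      apply one_div_le_one_div_of_le (by positivity)
      rw [← sq_abs t]
      nlinarith [abs_nonneg t]
    rw [← ENNReal.ofReal_mul (by positivity), ← ENNReal.ofReal_mul (by norm_num),
      ← ENNReal.ofReal_add (by positivity) (by positivity)]
    apply ENNReal.ofReal_le_ofReal
    have h6 : ‖Gf V m F (1 / 2 + σ + t * I)‖ ≤ ‖Hf V m (1 / 2 + σ + t * I)‖ + A / (1 + |t|) :=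
      (norm_sub_le _ _).trans (add_le_add_right h1 _)
    have h7 := pow_le_pow_left₀ (norm_nonneg _) h6 2
    nlinarith [sq_nonneg (‖Hf V m (1 / 2 + σ + t * I)‖ - A / (1 + |t|))]
  have hin : ∀ t ∈ {t : ℝ | T < |t|}ᶜ, ENNReal.ofReal (‖Gf V m F (1 / 2 + σ + t * I)‖ ^ 2) ≤
      ENNReal.ofReal (B ^ 2) := by
    intro t ht
    apply ENNReal.ofReal_le_ofReal
    refine pow_le_pow_left₀ (norm_nonneg _) (hB _ ?_ ?_ ?_) 2
    · rw [hre]; linarith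
    · rw [hre]; linarith
    · rw [him]; simpa using ht
  have hvol : volume {t : ℝ | T < |t|}ᶜ = ENNReal.ofReal (2 * T) := by
    have : {t : ℝ | T < |t|}ᶜ = Set.Icc (-T) T := by
      ext t; simp [abs_le]
    rw [this, Real.volume_Icc]; congr 1; ring
  have hm1 : Measurable fun t : ℝ => ENNReal.ofReal (2 * A ^ 2) *
    ENNReal.ofReal (1 / (1 + t ^ 2)) := by fun_prop
  have hm2 : Measurable fun t : ℝ => ENNReal.ofReal (1 / (1 + t ^ 2)) := by fun_prop
  have ho := setLIntegral_mono' (μ := volume) hm hout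
  have hi := setLIntegral_mono' (μ := volume) hm.compl hin
  rw [lintegral_add_left hm1, lintegral_const_mul _ hm2,
    lintegral_const_mul' _ _ ENNReal.ofReal_ne_top] at ho
  rw [lintegral_const, Measure.restrict_apply_univ, hvol, ← ENNReal.ofReal_mul (by positivity)] at hi
  have h1 : ∫⁻ t in {t : ℝ | T < |t|}, ENNReal.ofReal (1 / (1 + t ^ 2)) ≤ ENNReal.ofReal Real.pi :=
    (setLIntegral_le_lintegral _ _).trans lintegral_inv_one_add_sq.le
  have h2 := htail σ hσ hσ1
  refine (add_le_add (ho.trans (add_le_add (mul_le_mul_right h1 _) (mul_le_mul_right h2 _)))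
    hi).trans ?_
  rw [← ENNReal.ofReal_mul (by positivity), ← ENNReal.ofReal_mul (by norm_num),
    ← ENNReal.ofReal_add (by positivity) (by positivity),
    ← ENNReal.ofReal_add (by positivity) (by positivity)]
  apply ENNReal.ofReal_le_ofReal
  have e1 : 2 * (ε / 4 / σ) = ε / (2 * σ) := by field_simp; norm_num
  have e2 : ε / σ = ε / (2 * σ) + ε / (2 * σ) := by field_simp; norm_num
  rw [e1, e2]
  have : 2 * A ^ 2 * Real.pi + B ^ 2 * (2 * T) ≤ ε / (2 * σ) := by
    refine le_trans (le_of_eq ?_) hσD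
    rw [hD]; ring
  linarith

end VPack

end LimDist

namespace LimDist
open scoped ENNReal

namespace VPack
variable {Z V : ℂ → ℂ} {m : ℕ}

lemma cf_le (h : VPack Z V m) (hZd : ∀ s : ℂ, s ≠ 1 → DifferentiableAt ℂ Z s) {z : ℂ}
    (hz : -1 < z.re) (hz0 : V z = 0) : cf V m z ≤ 1 / ‖deriv Z z‖ := by
  obtain ⟨hZ0, hre, hd⟩ := h.zeros z hz hz0
  have hne0 : z ≠ 0 := by rintro rfl; norm_num at hre
  have hne1 : z ≠ 1 := by rintro rfl; norm_num at hre
  have hne2 : z + 2 ≠ 0 := by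
    intro h0
    have := congrArg Complex.re h0
    simp at this
    linarith
  have h1 : HasDerivAt (fun s : ℂ => (s - 1) * Z s) (1 * Z z + (z - 1) * deriv Z z) z :=
    ((hasDerivAt_id z).sub_const 1).mul (hZd z hne1).hasDerivAt
  have h2 : HasDerivAt (fun s : ℂ => s ^ m * V s) (m * z ^ (m - 1) * V z + z ^ m * deriv V z) z :=
    (hasDerivAt_pow m z).mul (h.diff z).hasDerivAt
  have h3 : (fun s : ℂ => (s - 1) * Z s) =ᶠ[𝓝 z] fun s => s ^ m * V s := by
    filter_upwards [isOpen_ne.mem_nhds hne0, isOpen_ne.mem_nhds hne1] with s hs0 hs1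
    exact h.zeta s hs0 hs1
  have h4 := h1.unique (h2.congr_of_eventuallyEq h3)
  rw [hZ0, hz0, mul_zero, mul_zero, zero_add, zero_add] at h4
  have hdZ : deriv Z z ≠ 0 := by
    intro h0
    rw [h0, mul_zero] at h4
    exact mul_ne_zero (pow_ne_zero m hne0) hd h4.symm
  have e : (z - 1) / ((z + 2) ^ m * deriv V z) = (z / (z + 2)) ^ m * (1 / deriv Z z) := by
    rw [div_pow]
    field_simp
    rw [h4, mul_comm]
  rw [cf, e, norm_mul, norm_pow, norm_div, norm_div, norm_one]
  refine mul_le_of_le_one_left (by positivity) (pow_le_one₀ (by positivity) ?_)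
  rw [div_le_one (norm_pos_iff.2 hne2), ← Real.sqrt_sq (norm_nonneg z),
    ← Real.sqrt_sq (norm_nonneg (z + 2)), ← Complex.normSq_eq_norm_sq, ← Complex.normSq_eq_norm_sq]
  apply Real.sqrt_le_sqrt
  rw [Complex.normSq_apply, Complex.normSq_apply]
  simp
  nlinarith

lemma cf_conj (h : VPack Z V m) (z : ℂ) : cf V m (starRingEnd ℂ z) = cf V m z := by
  have h1 : starRingEnd ℂ ∘ V ∘ starRingEnd ℂ = V := by
    funext s; simp [h.conj]
  have h2 := congrFun (deriv_conj_conj (f := V)) (starRingEnd ℂ z)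
  rw [h1] at h2
  have h3 : deriv V (starRingEnd ℂ z) = starRingEnd ℂ (deriv V z) := by rw [h2]; simp
  rw [cf, h3, cf, ← Complex.norm_conj ((z - 1) / _)]
  simp [Complex.conj_ofNat]

variable {C α : ℝ}

lemma sum_cf_sq_le_upper (h : VPack Z V m) (hZd : ∀ s : ℂ, s ≠ 1 → DifferentiableAt ℂ Z s)
    {T D : ℝ} (hJ : (∑' ρ : {ρ : ℂ // Z ρ = 0 ∧ ρ.re = 1 / 2 ∧ 0 ≤ ρ.im ∧ ρ.im ≤ T},
        1 / ‖deriv Z ρ.1‖ ^ 2) ≤ D) {G : Finset ℂ}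
    (hG : ∀ z ∈ G, (-1 < z.re ∧ V z = 0) ∧ 0 ≤ z.im ∧ z.im ≤ T) :
    ∑ z ∈ G, cf V m z ^ 2 ≤ D := by
  have hfin : {ρ : ℂ | Z ρ = 0 ∧ ρ.re = 1 / 2 ∧ 0 ≤ ρ.im ∧ ρ.im ≤ T}.Finite := by
    refine (finite_zeros h.diff (h.ne_zero_center 0)
      (isCompact_closedBall (0 : ℂ) (1 + T))).subset ?_
    rintro z ⟨h0, h1, h2, h3⟩
    have hne0 : z ≠ 0 := by rintro rfl; norm_num at h1
    have hne1 : z ≠ 1 := by rintro rfl; norm_num at h1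
    constructor
    · rw [mem_closedBall_zero_iff]
      refine (Complex.norm_le_abs_re_add_abs_im z).trans (add_le_add ?_ ?_)
      · rw [h1]; norm_num
      · rwa [abs_of_nonneg h2]
    · have := h.zeta z hne0 hne1
      rw [h0, mul_zero] at this
      exact (mul_eq_zero.1 this.symm).resolve_left (pow_ne_zero m hne0)
  have : Finite {ρ : ℂ // Z ρ = 0 ∧ ρ.re = 1 / 2 ∧ 0 ≤ ρ.im ∧ ρ.im ≤ T} := hfin.to_subtype
  have hs : Summable fun ρ : {ρ : ℂ // Z ρ = 0 ∧ ρ.re = 1 / 2 ∧ 0 ≤ ρ.im ∧ ρ.im ≤ T} =>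
      1 / ‖deriv Z ρ.1‖ ^ 2 := Summable.of_finite
  have hmem : ∀ z ∈ G, Z z = 0 ∧ z.re = 1 / 2 ∧ 0 ≤ z.im ∧ z.im ≤ T := by
    intro z hz
    obtain ⟨⟨h1, h2⟩, h3, h4⟩ := hG z hz
    have := h.zeros z h1 h2
    exact ⟨this.1, this.2.1, h3, h4⟩
  calc ∑ z ∈ G, cf V m z ^ 2 ≤ ∑ z ∈ G, 1 / ‖deriv Z z‖ ^ 2 := by
        refine Finset.sum_le_sum fun z hz => ?_
        rw [← one_div_pow]
        exact pow_le_pow_left₀ (cf_nonneg _ _ _) (h.cf_le hZd (hG z hz).1.1 (hG z hz).1.2) 2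
    _ = ∑ z ∈ G.subtype (fun ρ : ℂ => Z ρ = 0 ∧ ρ.re = 1 / 2 ∧ 0 ≤ ρ.im ∧ ρ.im ≤ T),
          1 / ‖deriv Z z.1‖ ^ 2 := by
        rw [Finset.sum_subtype_of_mem (fun z => 1 / ‖deriv Z z‖ ^ 2) hmem]
    _ ≤ _ := hs.sum_le_tsum _ fun z _ => by positivity
    _ ≤ D := hJ

lemma sum_cf_sq_le (h : VPack Z V m) (hZd : ∀ s : ℂ, s ≠ 1 → DifferentiableAt ℂ Z s)
    {T D : ℝ} (hJ : (∑' ρ : {ρ : ℂ // Z ρ = 0 ∧ ρ.re = 1 / 2 ∧ 0 ≤ ρ.im ∧ ρ.im ≤ T},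
        1 / ‖deriv Z ρ.1‖ ^ 2) ≤ D) {G : Finset ℂ}
    (hG : ∀ z ∈ G, (-1 < z.re ∧ V z = 0) ∧ |z.im| ≤ T) :
    ∑ z ∈ G, cf V m z ^ 2 ≤ 2 * D := by
  rw [← Finset.sum_filter_add_sum_filter_not G (fun z => 0 ≤ z.im), two_mul]
  refine add_le_add ?_ ?_
  · refine h.sum_cf_sq_le_upper hZd hJ fun z hz => ?_
    obtain ⟨h1, h2⟩ := Finset.mem_filter.1 hz
    exact ⟨(hG z h1).1, h2, (le_abs_self _).trans (hG z h1).2⟩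
  · have e : ∑ z ∈ G with ¬ 0 ≤ z.im, cf V m z ^ 2 =
        ∑ z ∈ (G.filter fun z => ¬ 0 ≤ z.im).image (starRingEnd ℂ), cf V m z ^ 2 := by
      rw [Finset.sum_image fun a _ b _ hab => (starRingEnd ℂ).injective hab]
      simp only [h.cf_conj]
    rw [e]
    refine h.sum_cf_sq_le_upper hZd hJ fun z hz => ?_
    obtain ⟨w, hw, rfl⟩ := Finset.mem_image.1 hz
    obtain ⟨h1, h2⟩ := Finset.mem_filter.1 hw
    obtain ⟨⟨h3, h4⟩, h5⟩ := hG w h1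
    push Not at h2
    refine ⟨⟨by simpa using h3, by rw [h.conj, h4, map_zero]⟩, ?_, ?_⟩
    · rw [Complex.conj_im]; linarith
    · rw [Complex.conj_im]; exact (neg_le_abs _).trans h5

theorem tsum_cf_sq_ne_top (h : VPack Z V m) (hZd : ∀ s : ℂ, s ≠ 1 → DifferentiableAt ℂ Z s)
    (hα : α < 1 / 2) (hJ : ∀ T : ℝ, 2 ≤ T →
      (∑' ρ : {ρ : ℂ // Z ρ = 0 ∧ ρ.re = 1 / 2 ∧ 0 ≤ ρ.im ∧ ρ.im ≤ T},
        1 / ‖deriv Z ρ.1‖ ^ 2) ≤ C * T ^ (1 + α)) :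
    ∑' z : Zr V, ENNReal.ofReal (cf V m z.1 ^ 2 * wgt z.im) ≠ ∞ := by
  have hC : 0 ≤ C := by
    have h1 := (tsum_nonneg fun ρ => by positivity).trans (hJ 2 le_rfl)
    exact nonneg_of_mul_nonneg_left h1 (by positivity)
  rw [← ENNReal.tsum_fiberwise _ (fun z : Zr V => Nat.log 2 (⌊|z.im|⌋₊ + 1))]
  set q : ℝ := 2 ^ (α - 1 / 2) with hq
  have hq0 : 0 < q := by positivity
  have hq1 : q < 1 := Real.rpow_lt_one_of_one_lt_of_neg (by norm_num) (by linarith)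
  have hfib : ∀ j : ℕ, ∑' b : (fun z : Zr V => Nat.log 2 (⌊|z.im|⌋₊ + 1)) ⁻¹' {j},
      ENNReal.ofReal (cf V m b.1.1 ^ 2 * wgt b.1.im) ≤
      ENNReal.ofReal (2 * C * 2 ^ (1 + α) * q ^ j) := by
    intro j
    rw [ENNReal.tsum_eq_iSup_sum]
    refine iSup_le fun s => ?_
    have hb : ∀ b ∈ s, |b.1.im| ≤ 2 ^ (j + 1) ∧ wgt b.1.im ≤ (2 ^ j : ℝ) ^ (-(3 / 2) : ℝ) := by
      intro b _
      have h1 : Nat.log 2 (⌊|b.1.im|⌋₊ + 1) = j := b.2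
      have h2 : ⌊|b.1.im|⌋₊ + 1 < 2 ^ (j + 1) := by
        exact Nat.lt_pow_of_log_lt (by norm_num) (by omega)
      have h3 : 2 ^ j ≤ ⌊|b.1.im|⌋₊ + 1 := by
        exact Nat.pow_le_of_le_log (by omega) h1.ge
      have h4 := Nat.lt_floor_add_one |b.1.im|
      have h5 := Nat.floor_le (abs_nonneg b.1.im)
      have h2' : ((⌊|b.1.im|⌋₊ + 1 : ℕ) : ℝ) ≤ ((2 ^ (j + 1) : ℕ) : ℝ) := Nat.cast_le.2 h2.le
      have h3' : ((2 ^ j : ℕ) : ℝ) ≤ ((⌊|b.1.im|⌋₊ + 1 : ℕ) : ℝ) := Nat.cast_le.2 h3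
      push_cast at h2' h3'
      refine ⟨h4.le.trans h2', ?_⟩
      rw [wgt]
      exact Real.rpow_le_rpow_of_nonpos (by positivity) (by linarith) (by norm_num)
    rw [← ENNReal.ofReal_sum_of_nonneg fun b _ =>
      mul_nonneg (sq_nonneg _) (wgt_pos b.1.im).le]
    apply ENNReal.ofReal_le_ofReal
    have hT : (2 : ℝ) ≤ 2 ^ (j + 1) := le_self_pow₀ (by norm_num) (by omega)
    have h1 := h.sum_cf_sq_le hZd (hJ _ hT) (G := s.image fun b => b.1.1) (by
      intro z hz
      obtain ⟨b, hbs, rfl⟩ := Finset.mem_image.1 hz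
      exact ⟨b.1.2, (hb b hbs).1⟩)
    have hinj : ∀ a ∈ s, ∀ b ∈ s, a.1.1 = b.1.1 → a = b := fun a _ b _ hab =>
      Subtype.ext (Subtype.ext hab)
    rw [Finset.sum_image hinj] at h1
    calc ∑ b ∈ s, cf V m b.1.1 ^ 2 * wgt b.1.im
        ≤ ∑ b ∈ s, cf V m b.1.1 ^ 2 * (2 ^ j : ℝ) ^ (-(3 / 2) : ℝ) := by
          refine Finset.sum_le_sum fun b hbs => ?_
          exact mul_le_mul_of_nonneg_left (hb b hbs).2 (sq_nonneg _)
      _ ≤ (2 * (C * (2 ^ (j + 1) : ℝ) ^ (1 + α))) * (2 ^ j : ℝ) ^ (-(3 / 2) : ℝ) := by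
          rw [← Finset.sum_mul]
          exact mul_le_mul_of_nonneg_right h1 (by positivity)
      _ = 2 * C * 2 ^ (1 + α) * q ^ j := by
          rw [pow_succ, Real.mul_rpow (by positivity) (by norm_num), hq, ← Real.rpow_natCast,
            ← Real.rpow_mul (by norm_num), ← Real.rpow_mul (by norm_num), ← Real.rpow_natCast,
            ← Real.rpow_mul (by norm_num)]
          have : (2 : ℝ) ^ ((α - 1 / 2) * (j : ℝ)) =
              2 ^ ((j : ℝ) * (1 + α)) * 2 ^ ((j : ℝ) * -(3 / 2)) := by
            rw [← Real.rpow_add (by norm_num)]; congr 1; ring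
          rw [this]; ring
  refine ne_top_of_le_ne_top ?_ (ENNReal.tsum_le_tsum hfib)
  have hsum : Summable fun j : ℕ => 2 * C * 2 ^ (1 + α) * q ^ j :=
    (summable_geometric_of_lt_one hq0.le hq1).mul_left _
  rw [← ENNReal.ofReal_tsum_of_nonneg (fun j => by positivity) hsum]
  exact ENNReal.ofReal_ne_top

end VPack

end LimDist

namespace LimDist
section Mert
variable {K : Type} [Field K] [NumberField K]

/-- The normalised Mertens function `e^{-y/2} M_K(e^y)`. -/
def phi (K : Type) [Field K] [NumberField K] (y : ℝ) : ℝ := Real.exp (-y / 2) * mertensK K (Real.exp y)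

lemma mertensK_eq (x : ℝ) : mertensK K x = ∑' I : NI K,
    if (Ideal.absNorm I.1 : ℝ) < x then (moebiusK K I.1 : ℝ)
    else if (Ideal.absNorm I.1 : ℝ) = x then (moebiusK K I.1 : ℝ) / 2 else 0 := by
  rw [mertensK, ← tsum_subtype_eq_of_support_subset (s := {I : Ideal (𝓞 K) | I ≠ ⊥})]
  · refine tsum_congr fun I => ?_
    have hI : I.1 ≠ ⊥ := I.2
    simp only [hI, ne_eq, not_false_eq_true, true_and]
  · intro I hI
    by_contra h0
    apply hI
    have : I = ⊥ := not_not.1 h0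
    simp [this]

lemma mertensK_eq_nat (x : ℝ) : mertensK K x = (fun p : ℕ × ℕ => ∑' I : NI K,
    if Ideal.absNorm I.1 < p.1 then (moebiusK K I.1 : ℝ)
    else if Ideal.absNorm I.1 = p.1 ∧ Ideal.absNorm I.1 = p.2 then (moebiusK K I.1 : ℝ) / 2 else 0)
      (⌈x⌉₊, ⌊x⌋₊) := by
  rw [mertensK_eq]
  refine tsum_congr fun I => ?_
  have hN := absNorm_posN I
  have h1 : (Ideal.absNorm I.1 : ℝ) < x ↔ Ideal.absNorm I.1 < ⌈x⌉₊ := Nat.lt_ceil.symm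
  have h2 : (Ideal.absNorm I.1 : ℝ) = x ↔
      Ideal.absNorm I.1 = ⌈x⌉₊ ∧ Ideal.absNorm I.1 = ⌊x⌋₊ := by
    constructor
    · rintro rfl; simp
    · rintro ⟨h, h'⟩
      apply le_antisymm
      · exact (Nat.le_floor_iff' hN.ne').1 h'.le
      · exact Nat.ceil_le.1 h.ge
  simp only [h1, h2]

lemma measurable_mertensK : Measurable (mertensK K) := by
  have : mertensK K = (fun p : ℕ × ℕ => ∑' I : NI K,
    if Ideal.absNorm I.1 < p.1 then (moebiusK K I.1 : ℝ)
    else if Ideal.absNorm I.1 = p.1 ∧ Ideal.absNorm I.1 = p.2 then (moebiusK K I.1 : ℝ) / 2 else 0) ∘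
      (fun x : ℝ => (⌈x⌉₊, ⌊x⌋₊)) := funext mertensK_eq_nat
  rw [this]
  exact (measurable_of_countable _).comp (Nat.measurable_ceil.prodMk Nat.measurable_floor)

lemma measurable_phi : Measurable (phi K) := by
  unfold phi
  exact (by fun_prop : Measurable fun y : ℝ => Real.exp (-y / 2)).mul
    (measurable_mertensK.comp Real.measurable_exp)

lemma phi_neg {y : ℝ} (hy : y < 0) : phi K y = 0 := by
  have hx : Real.exp y < 1 := Real.exp_lt_one_iff.2 hy
  rw [phi, mertensK_eq]
  have : ∀ I : NI K, (if (Ideal.absNorm I.1 : ℝ) < Real.exp y then (moebiusK K I.1 : ℝ)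
    else if (Ideal.absNorm I.1 : ℝ) = Real.exp y then (moebiusK K I.1 : ℝ) / 2 else 0) = 0 := by
    intro I
    have hN : (1 : ℝ) ≤ Ideal.absNorm I.1 := by exact_mod_cast absNorm_posN I
    rw [if_neg (by linarith), if_neg (by intro h; linarith)]
  simp [this]

lemma continuousAt_mertensK {x : ℝ} (hx0 : 0 < x) (hx : ∀ n : ℕ, x ≠ n) : ContinuousAt (mertensK K) x := by
  have h1 : (⌊x⌋₊ : ℝ) < x := lt_of_le_of_ne (Nat.floor_le hx0.le) (hx _).symm
  have h2 : x < ⌊x⌋₊ + 1 := Nat.lt_floor_add_one x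
  have key : ∀ z : ℝ, (⌊x⌋₊ : ℝ) < z → z < ⌊x⌋₊ + 1 → ⌈z⌉₊ = ⌊x⌋₊ + 1 ∧ ⌊z⌋₊ = ⌊x⌋₊ := by
    intro z hz1 hz2
    have hz0 : 0 ≤ z := (Nat.cast_nonneg _).trans hz1.le
    refine ⟨?_, (Nat.floor_eq_iff hz0).2 ⟨hz1.le, hz2⟩⟩
    rw [Nat.ceil_eq_iff (by omega)]
    constructor
    · simpa using hz1
    · push_cast; exact hz2.le
  have h3 : mertensK K =ᶠ[𝓝 x] fun _ => mertensK K x := by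
    filter_upwards [Ioo_mem_nhds h1 h2] with z hz
    rw [mertensK_eq_nat, mertensK_eq_nat, (key z hz.1 hz.2).1, (key z hz.1 hz.2).2,
      (key x h1 h2).1]
  exact continuousAt_const.congr h3.symm

lemma ae_continuousAt_phi : ∀ᵐ y : ℝ, (∀ n : ℕ, Real.exp y ≠ n) ∧ ContinuousAt (phi K) y := by
  have hc : (Set.range fun n : ℕ => Real.log n).Countable := Set.countable_range _
  have := hc.ae_notMem volume
  filter_upwards [this] with y hy
  have h : ∀ n : ℕ, Real.exp y ≠ n := by
    intro n hn
    exact hy ⟨n, by simp [← hn]⟩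
  refine ⟨h, ?_⟩
  unfold phi
  refine ContinuousAt.mul (by fun_prop) ?_
  exact (continuousAt_mertensK (Real.exp_pos y) h).comp Real.continuous_exp.continuousAt

variable (hS : ∀ s : ℝ, 1 < s → Summable fun I : NI K => (Ideal.absNorm I.1 : ℝ) ^ (-s))
include hS

lemma abs_mertensK_le {x : ℝ} (hx : 0 < x) : |mertensK K x| ≤
    (∑' I : NI K, (Ideal.absNorm I.1 : ℝ) ^ (-(5 / 4 : ℝ))) * x ^ (5 / 4 : ℝ) := by
  rw [mertensK_eq, ← tsum_mul_right, ← Real.norm_eq_abs]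
  refine tsum_of_norm_bounded ((hS _ (by norm_num)).mul_right _).hasSum fun I => ?_
  have hN : (0 : ℝ) < Ideal.absNorm I.1 := by exact_mod_cast absNorm_posN I
  have h1 := moebiusK_abs_le I.1
  have h2 : (Ideal.absNorm I.1 : ℝ) ≤ x → 1 ≤ (Ideal.absNorm I.1 : ℝ) ^ (-(5 / 4 : ℝ)) * x ^ (5 / 4 : ℝ) := by
    intro h
    rw [Real.rpow_neg hN.le, inv_mul_eq_div, one_le_div (by positivity)]
    exact Real.rpow_le_rpow hN.le h (by norm_num)
  rw [Real.norm_eq_abs]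
  split_ifs with h h'
  · exact h1.trans (h2 h.le)
  · rw [abs_div, abs_two]
    linarith [h2 h'.le, abs_nonneg (moebiusK K I.1 : ℝ)]
  · rw [abs_zero]; positivity

lemma exists_phi_bound : ∃ C : ℝ, 0 ≤ C ∧ ∀ y : ℝ, |phi K y| ≤ C * Real.exp (3 / 4 * y) := by
  refine ⟨∑' I : NI K, (Ideal.absNorm I.1 : ℝ) ^ (-(5 / 4 : ℝ)),
    tsum_nonneg fun I => by positivity, fun y => ?_⟩
  have h := abs_mertensK_le hS (Real.exp_pos y)
  rw [phi, abs_mul, Real.abs_exp]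
  calc _ ≤ Real.exp (-y / 2) * _ := mul_le_mul_of_nonneg_left h (Real.exp_pos _).le
    _ = _ := by
      rw [← Real.exp_mul, mul_left_comm, ← Real.exp_add]
      ring_nf

lemma laplace_phi {Z V : ℂ → ℂ} {m : ℕ} (h : VPack Z V m)
    (hZ : ∀ s : ℂ, 1 < s.re → Z s = ∑' I : NI K, (Ideal.absNorm I.1 : ℂ) ^ (-s))
    {w : ℂ} (hw : w.re = 1) :
    ∫ y : ℝ, (phi K y : ℂ) * Complex.exp (-w * y) = Hf V m (1 / 2 + w) := by
  set s : ℂ := 1 / 2 + w with hs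
  have hre : s.re = 3 / 2 := by rw [hs]; simp [hw]; norm_num
  have hre' : (-s).re < 0 := by rw [neg_re, hre]; norm_num
  have hs0 : s ≠ 0 := by intro h0; rw [h0] at hre; norm_num at hre
  have hs1 : s ≠ 1 := by intro h0; rw [h0] at hre; norm_num at hre
  obtain ⟨hz0, hzi, -, -⟩ := zeta_basic hS hZ
  have hHf : Hf V m s = (Z s)⁻¹ / s := by
    have h1 := h.zeta s hs0 hs1
    have h2 := hz0 s (by rw [hre]; norm_num)
    have h4 : V s ≠ 0 := by
      intro h0; rw [h0, mul_zero] at h1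
      exact (mul_ne_zero (sub_ne_zero.2 hs1) h2) h1
    rw [Hf]
    field_simp
    rw [pow_succ]
    linear_combination s * h1
  let f : NI K → ℝ → ℂ := fun I => (Set.Ioi (Real.log (Ideal.absNorm I.1))).indicator
    fun y => (moebiusK K I.1 : ℂ) * Complex.exp (-s * y)
  have hcpow : ∀ I : NI K, Complex.exp (-s * (Real.log (Ideal.absNorm I.1) : ℝ)) = nrm s I.1 := by
    intro I
    have hN := absNorm_posN I
    rw [nrm, cpow_def_of_ne_zero (by exact_mod_cast hN.ne'), mul_comm, ← natCast_log]
  have hintg : ∀ I : NI K, Integrable (f I) := by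
    intro I
    exact (integrable_indicator_iff measurableSet_Ioi).2
      ((integrableOn_exp_mul_complex_Ioi hre' _).const_mul _)
  have hI1 : ∀ I : NI K, ∫ y, f I y = (moebiusK K I.1 : ℂ) * nrm s I.1 / s := by
    intro I
    rw [integral_indicator measurableSet_Ioi, integral_const_mul, integral_exp_mul_complex_Ioi hre',
      hcpow]
    field_simp
  have hI2 : ∀ I : NI K, ∫ y, ‖f I y‖ ≤ (Ideal.absNorm I.1 : ℝ) ^ (-(3 / 2 : ℝ)) := by
    intro I
    have hN : (0 : ℝ) < Ideal.absNorm I.1 := by exact_mod_cast absNorm_posN I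
    have h3 : ∀ y, ‖f I y‖ = (Set.Ioi (Real.log (Ideal.absNorm I.1))).indicator
        (fun y => |(moebiusK K I.1 : ℝ)| * Real.exp (-(3 / 2) * y)) y := by
      intro y
      rw [norm_indicator_eq_indicator_norm]
      congr 1
      ext y
      rw [norm_mul, Complex.norm_exp, ← Complex.ofReal_intCast, Complex.norm_real, Real.norm_eq_abs]
      congr 2
      simp [hre]
    simp_rw [h3]
    rw [integral_indicator measurableSet_Ioi, integral_const_mul,
      integral_exp_mul_Ioi (by norm_num), Real.rpow_def_of_pos hN, mul_comm (Real.log _)]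
    have := moebiusK_abs_le I.1
    have h5 := Real.exp_pos (-(3 / 2) * Real.log (Ideal.absNorm I.1))
    have h6 : -Real.exp (-(3 / 2) * Real.log (Ideal.absNorm I.1)) / -(3 / 2) ≤
        Real.exp (-(3 / 2) * Real.log (Ideal.absNorm I.1)) := by linarith
    have h7 : 0 ≤ -Real.exp (-(3 / 2) * Real.log (Ideal.absNorm I.1)) / -(3 / 2) := by linarith
    nlinarith [abs_nonneg (moebiusK K I.1 : ℝ)]
  have hsum : Summable fun I : NI K => ∫ y, ‖f I y‖ :=
    Summable.of_nonneg_of_le (fun I => integral_nonneg fun y => norm_nonneg _) hI2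
      (hS _ (by norm_num))
  have hcount : Countable (NI K) := by
    have h9 := (hS 2 (by norm_num)).countable_support
    have h10 : Function.support (fun I : NI K => (Ideal.absNorm I.1 : ℝ) ^ (-(2 : ℝ))) = Set.univ := by
      ext I
      have hN : (0 : ℝ) < Ideal.absNorm I.1 := by exact_mod_cast absNorm_posN I
      exact iff_of_true (Real.rpow_pos_of_pos hN _).ne' trivial
    rwa [h10, Set.countable_univ_iff] at h9
  have key := (hasSum_integral_of_summable_integral_norm hintg hsum).tsum_eq
  rw [hHf, hzi s (by rw [hre]; norm_num), ← tsum_div_const]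
  simp_rw [← hI1]
  rw [key]
  apply integral_congr_ae
  filter_upwards [ae_continuousAt_phi (K := K)] with y hy
  rw [phi, mertensK_eq]
  push_cast
  rw [mul_assoc, mul_comm, mul_assoc, ← Complex.exp_add, ← tsum_mul_right]
  refine tsum_congr fun I => ?_
  have hN : (0 : ℝ) < Ideal.absNorm I.1 := by exact_mod_cast absNorm_posN I
  have h8 : Real.log (Ideal.absNorm I.1) < y ↔ (Ideal.absNorm I.1 : ℝ) < Real.exp y :=
    Real.log_lt_iff_lt_exp hN
  simp only [f, Set.indicator, Set.mem_Ioi, h8, (hy.1 _).symm, if_false]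
  split_ifs
  · rw [hs]; push_cast; ring_nf
  · simp
end Mert
end LimDist

namespace LimDist
section Planch
open scoped FourierTransform RealInnerProductSpace

lemma tendsto_gauss_fourier {f : ℝ → ℂ} (hf : Integrable f) {v : ℝ} (hv : ContinuousAt f v) :
    Tendsto (fun c : ℝ => ∫ w : ℝ, cexp (-c⁻¹ * (w : ℂ) ^ 2 + 2 * Real.pi * I * (v * w : ℝ)) * 𝓕 f w)
      atTop (𝓝 (f v)) := by
  have A := Real.tendsto_integral_gaussian_smul' hf hv
  apply A.congr'
  filter_upwards [Ioi_mem_atTop 0] with c (hc : 0 < c)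
  have J : Integrable (fun w : ℝ ↦ cexp (- c⁻¹ * ‖w‖ ^ 2 + 2 * Real.pi * I * ⟪v, w⟫)) :=
    GaussianFourier.integrable_cexp_neg_mul_sq_norm_add (by simpa) _ _
  have h1 := (VectorFourier.integral_fourierIntegral_smul_eq_flip (L := innerₗ ℝ)
      Real.continuous_fourierChar continuous_inner J hf)
  have h2 : ∫ w : ℝ, 𝓕 (fun w : ℝ ↦ cexp (- c⁻¹ * ‖w‖ ^ 2 + 2 * Real.pi * I * ⟪v, w⟫)) w • f w =
      ∫ w : ℝ, cexp (- c⁻¹ * ‖w‖ ^ 2 + 2 * Real.pi * I * ⟪v, w⟫) • 𝓕 f w := by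
    simpa using! h1
  have h3 : ∫ w : ℝ, cexp (-c⁻¹ * (w : ℂ) ^ 2 + 2 * Real.pi * I * (v * w : ℝ)) * 𝓕 f w =
      ∫ w : ℝ, cexp (- c⁻¹ * ‖w‖ ^ 2 + 2 * Real.pi * I * ⟪v, w⟫) • 𝓕 f w := by
    refine integral_congr_ae (Eventually.of_forall fun w => ?_)
    simp only [smul_eq_mul, Real.norm_eq_abs, ← Complex.ofReal_pow, sq_abs,
      RCLike.inner_apply]
    congr 3
    simp
    ring
  rw [h3, ← h2]
  congr with w
  rw [fourier_gaussian_innerProductSpace' (by simpa)]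
  congr 2
  · simp
  · congr 1
    push_cast
    rw [div_inv_eq_mul]
    ring

lemma plancherel {F : ℝ → ℂ} (hc : Continuous F) (hF : Integrable F) (hF' : Integrable (𝓕 F))
    {B : ℝ} (hB : ∀ t, ‖F t‖ ≤ B) :
    ∫⁻ y, ENNReal.ofReal (‖𝓕 F y‖ ^ 2) = ∫⁻ t, ENNReal.ofReal (‖F t‖ ^ 2) := by
  have hG : Integrable fun y => (starRingEnd ℂ) (𝓕 F y) :=
    (Complex.conjCLE : ℂ →L[ℝ] ℂ).integrable_comp hF'
  have hcF : Continuous (𝓕 F) := by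
    have := VectorFourier.fourierIntegral_continuous (L := innerₗ ℝ) Real.continuous_fourierChar
      continuous_inner hF
    exact this
  have hbF : ∀ y, ‖𝓕 F y‖ ≤ ∫ t, ‖F t‖ := fun y =>
    VectorFourier.norm_fourierIntegral_le_integral_norm _ _ _ _ _
  have h1 : ∫ y, 𝓕 F y • (starRingEnd ℂ) (𝓕 F y) = ∫ t, F t • 𝓕 (fun y => (starRingEnd ℂ) (𝓕 F y)) t := by
    simpa using! (VectorFourier.integral_fourierIntegral_smul_eq_flip (L := innerₗ ℝ)
      Real.continuous_fourierChar continuous_inner hF hG)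
  have h2 : ∀ t, 𝓕 (fun y => (starRingEnd ℂ) (𝓕 F y)) t = (starRingEnd ℂ) (F t) := by
    intro t
    rw [← congrFun (hc.fourierInv_fourier_eq hF hF') t, Real.fourier_eq', Real.fourierInv_eq',
      ← integral_conj]
    refine integral_congr_ae (Eventually.of_forall fun w => ?_)
    simp only [smul_eq_mul, map_mul, ← Complex.exp_conj, Complex.conj_I, Complex.conj_ofReal]
    congr 2
    push_cast
    ring
  simp_rw [h2, smul_eq_mul, Complex.mul_conj, Complex.normSq_eq_norm_sq, integral_complex_ofReal] at h1
  have h3 : ∫ y, ‖𝓕 F y‖ ^ 2 = ∫ t, ‖F t‖ ^ 2 := by exact_mod_cast h1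
  have h4 : Integrable fun y => ‖𝓕 F y‖ ^ 2 := by
    simp_rw [sq]
    exact hF'.norm.bdd_mul (c := ∫ t, ‖F t‖) hcF.norm.aestronglyMeasurable
      (Eventually.of_forall fun y => by rw [norm_norm]; exact hbF y)
  have h5 : Integrable fun y => ‖F y‖ ^ 2 := by
    simp_rw [sq]
    exact hF.norm.bdd_mul (c := B) hc.norm.aestronglyMeasurable
      (Eventually.of_forall fun y => by rw [norm_norm]; exact hB y)
  rw [← ofReal_integral_eq_lintegral_ofReal h4 (Eventually.of_forall fun y => by positivity), h3,
    ofReal_integral_eq_lintegral_ofReal h5 (Eventually.of_forall fun y => by positivity)]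

lemma integral_line_eq {g : ℂ → ℂ} {σ : ℝ} (hσ : σ ≤ 1)
    (hg : ∀ z : ℂ, σ ≤ z.re → z.re ≤ 1 → DifferentiableAt ℂ g z) {b : ℝ → ℝ} (hb : Integrable b)
    (hb0 : Tendsto b atTop (𝓝 0)) (hb1 : Tendsto b atBot (𝓝 0))
    (hgb : ∀ x t : ℝ, σ ≤ x → x ≤ 1 → ‖g (x + t * I)‖ ≤ b t) :
    ∫ t : ℝ, g (σ + t * I) = ∫ t : ℝ, g (1 + t * I) := by
  have hintg : ∀ x : ℝ, σ ≤ x → x ≤ 1 → Integrable fun t : ℝ => g (x + t * I) := by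
    intro x h1 h2
    refine hb.mono' ?_ (Eventually.of_forall fun t => hgb x t h1 h2)
    apply Continuous.aestronglyMeasurable
    rw [continuous_iff_continuousAt]
    intro t
    refine ContinuousAt.comp (f := fun t : ℝ => (x + t * I : ℂ)) (hg _ ?_ ?_).continuousAt (by fun_prop)
    · simpa using h1
    · simpa using h2
  have l1 := intervalIntegral_tendsto_integral (hintg σ le_rfl hσ) tendsto_neg_atTop_atBot tendsto_id
  have l2 := intervalIntegral_tendsto_integral (hintg 1 hσ le_rfl) tendsto_neg_atTop_atBot tendsto_id
  have hlim : Tendsto (fun T : ℝ => (b (-T) + b T) * |1 - σ|) atTop (𝓝 0) := by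
    have := ((hb1.comp tendsto_neg_atTop_atBot).add hb0).mul_const |1 - σ|
    simpa using this
  have key : ∀ T : ℝ, ‖(∫ t in (-T)..T, g ((1 : ℝ) + t * I)) - ∫ t in (-T)..T, g (σ + t * I)‖ ≤
      (b (-T) + b T) * |1 - σ| := by
    intro T
    have h := Complex.integral_boundary_rect_eq_zero_of_differentiableOn g (σ + (-T : ℝ) * I)
      ((1 : ℝ) + T * I) (fun z hz => by
        rw [mem_reProdIm] at hz
        simp only [add_re, ofReal_re, mul_re, I_re, mul_zero, ofReal_im, I_im, mul_one, sub_self,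
          add_zero, Set.uIcc_of_le hσ] at hz
        exact (hg z hz.1.1 hz.1.2).differentiableWithinAt)
    simp only [add_re, ofReal_re, mul_re, I_re, mul_zero, ofReal_im, I_im, mul_one, sub_self,
      add_zero, add_im, mul_im, zero_add, smul_eq_mul] at h
    have e1 : ‖∫ x in σ..1, g (x + (-T : ℝ) * I)‖ ≤ b (-T) * |1 - σ| := by
      apply intervalIntegral.norm_integral_le_of_norm_le_const
      intro x hx
      rw [Set.uIoc_of_le hσ] at hx
      exact hgb x _ hx.1.le hx.2
    have e2 : ‖∫ x in σ..1, g (x + T * I)‖ ≤ b T * |1 - σ| := by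
      apply intervalIntegral.norm_integral_le_of_norm_le_const
      intro x hx
      rw [Set.uIoc_of_le hσ] at hx
      exact hgb x _ hx.1.le hx.2
    have e3 : I * ((∫ t in (-T)..T, g ((1 : ℝ) + t * I)) - ∫ t in (-T)..T, g (σ + t * I)) =
        (∫ x in σ..1, g (x + T * I)) - ∫ x in σ..1, g (x + (-T : ℝ) * I) := by
      linear_combination h
    have e4 := congrArg norm e3
    rw [norm_mul, norm_I, one_mul] at e4
    rw [e4]
    refine (norm_sub_le _ _).trans ?_
    linarith
  have l3 : Tendsto (fun T : ℝ => (∫ t in (-T)..T, g ((1 : ℝ) + t * I)) - ∫ t in (-T)..T, g (σ + t * I))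
      atTop (𝓝 0) := squeeze_zero_norm key hlim
  have := tendsto_nhds_unique (l2.sub l1) l3
  have h := sub_eq_zero.1 this
  rw [← h]; simp
end Planch
end LimDist

namespace LimDist
section Strip
open scoped FourierTransform

/-- A Gaussian damping of `H` along the vertical line `Re = σ`, in the Fourier variable. -/
def damp (H : ℂ → ℂ) (a σ w : ℝ) : ℂ :=
  H (σ + (2 * Real.pi * w : ℝ) * I) * cexp (a * ((σ - 1 : ℝ) + (2 * Real.pi * w : ℝ) * I) ^ 2)

lemma norm_gauss_line (a x t : ℝ) : ‖cexp (a * ((x : ℝ) + (t : ℝ) * I) ^ 2)‖ =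
    Real.exp (a * x ^ 2) * Real.exp (-a * t ^ 2) := by
  rw [Complex.norm_exp, ← Real.exp_add]
  congr 1
  simp [sq]
  ring

variable {H : ℂ → ℂ} (hH : ∀ z, 0 < z.re → DifferentiableAt ℂ H z)
  (hHb : ∀ σ₁ : ℝ, 0 < σ₁ → ∃ B, ∀ σ t : ℝ, σ₁ ≤ σ → σ ≤ 1 → ‖H (σ + t * I)‖ ≤ B)

include hHb in
lemma damp_bound {a σ : ℝ} (hσ : 0 < σ) (hσ1 : σ ≤ 1) : ∃ A, ∀ w,
    ‖damp H a σ w‖ ≤ A * Real.exp (-(a * (2 * Real.pi) ^ 2) * w ^ 2) := by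
  obtain ⟨B, hB⟩ := hHb σ hσ
  refine ⟨B * Real.exp (a * (σ - 1) ^ 2), fun w => ?_⟩
  have hB0 : 0 ≤ B := (norm_nonneg _).trans (hB _ 0 le_rfl hσ1)
  rw [damp, norm_mul, norm_gauss_line, mul_assoc B]
  refine mul_le_mul (hB _ _ le_rfl hσ1) (le_of_eq ?_) (by positivity) hB0
  congr 2
  ring

include hH in
lemma continuous_damp {a σ : ℝ} (hσ : 0 < σ) : Continuous (damp H a σ) := by
  unfold damp
  refine Continuous.mul ?_ (by fun_prop)
  rw [continuous_iff_continuousAt]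
  intro w
  refine ContinuousAt.comp (f := fun w : ℝ => (σ + (2 * Real.pi * w : ℝ) * I : ℂ))
    (hH _ (by simpa using hσ)).continuousAt (by fun_prop)

include hH hHb in
lemma integrable_damp {a σ : ℝ} (ha : 0 < a) (hσ : 0 < σ) (hσ1 : σ ≤ 1) : Integrable (damp H a σ) := by
  obtain ⟨A, hA⟩ := damp_bound (a := a) hHb hσ hσ1
  exact ((integrable_exp_neg_mul_sq (by positivity)).const_mul A).mono'
    (continuous_damp hH hσ).aestronglyMeasurable (Eventually.of_forall hA)

lemma tendsto_gauss_cocompact {a : ℝ} (ha : 0 < a) (A : ℝ) :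
    Tendsto (fun t : ℝ => A * Real.exp (-a * t ^ 2)) atTop (𝓝 0) ∧
    Tendsto (fun t : ℝ => A * Real.exp (-a * t ^ 2)) atBot (𝓝 0) := by
  have h1 : Tendsto (fun t : ℝ => A * Real.exp (-a * t ^ 2)) atTop (𝓝 0) := by
    rw [← mul_zero A]
    refine Tendsto.const_mul A (Real.tendsto_exp_atBot.comp ?_)
    exact (tendsto_pow_atTop two_ne_zero).const_mul_atTop_of_neg (by linarith)
  refine ⟨h1, ?_⟩
  have := h1.comp tendsto_neg_atBot_atTop
  simpa [Function.comp_def] using this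

include hH hHb in
lemma fourierInv_damp_shift {a σ : ℝ} (ha : 0 < a) (hσ : 0 < σ) (hσ1 : σ ≤ 1) (y : ℝ) :
    cexp (((σ - 1) * y : ℝ)) * 𝓕⁻ (damp H a σ) y = 𝓕⁻ (damp H a 1) y := by
  let g : ℂ → ℂ := fun z => H z * cexp (a * (z - 1) ^ 2 + y * (z - 1))
  obtain ⟨B, hB⟩ := hHb σ hσ
  have hB0 : 0 ≤ B := (norm_nonneg _).trans (hB _ 0 le_rfl hσ1)
  have hline : ∫ t : ℝ, g (σ + t * I) = ∫ t : ℝ, g (1 + t * I) := by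
    have hl := tendsto_gauss_cocompact ha (B * Real.exp (a + |y|))
    refine integral_line_eq hσ1 (fun z h1 h2 => ?_)
      ((integrable_exp_neg_mul_sq ha).const_mul (B * Real.exp (a + |y|))) hl.1 hl.2 ?_
    · have := hH z (hσ.trans_le h1)
      fun_prop
    · intro x t h1 h2
      have e1 : (x + t * I - 1 : ℂ) = ((x - 1 : ℝ) + t * I) := by push_cast; ring
      have e2 : ‖cexp (y * (x + t * I - 1 : ℂ))‖ = Real.exp (y * (x - 1)) := by
        rw [Complex.norm_exp]; simp
      simp only [g]
      rw [norm_mul, Complex.exp_add, norm_mul, e2, e1, norm_gauss_line, mul_assoc B]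
      refine mul_le_mul (hB _ _ h1 h2) ?_ (by positivity) hB0
      have hx : |x - 1| ≤ 1 := abs_le.2 ⟨by linarith, by linarith⟩
      have e3 : a * (x - 1) ^ 2 ≤ a := by
        have := (sq_le_one_iff_abs_le_one (x - 1)).2 hx
        nlinarith
      have e4 : y * (x - 1) ≤ |y| := by
        refine (le_abs_self _).trans ?_
        rw [abs_mul]
        exact mul_le_of_le_one_right (abs_nonneg _) hx
      calc _ = Real.exp (a * (x - 1) ^ 2 + y * (x - 1)) * Real.exp (-a * t ^ 2) := by
            rw [Real.exp_add]; ring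
        _ ≤ _ := by gcongr
  have hscale : ∀ x : ℝ, 𝓕⁻ (damp H a x) y * cexp (((x - 1) * y : ℝ)) =
      |(2 * Real.pi)⁻¹| • ∫ t : ℝ, g (x + t * I) := by
    intro x
    rw [← Measure.integral_comp_mul_left (fun t : ℝ => g (x + t * I)), Real.fourierInv_eq',
      ← integral_mul_const]
    refine integral_congr_ae (Eventually.of_forall fun w => ?_)
    simp only [damp, g, smul_eq_mul]
    rw [mul_left_comm, mul_assoc, mul_assoc, mul_assoc, ← Complex.exp_add, ← Complex.exp_add]
    congr 2
    simp
    ring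
  have h1 := hscale 1
  rw [mul_comm, hscale σ, hline]
  simp only [ofReal_one] at h1
  rw [← h1]
  simp

include hH hHb in
lemma integrable_fourierInv_damp {a σ : ℝ} (ha : 0 < a) (hσ : 0 < σ) (hσ1 : σ < 1) :
    Integrable (𝓕⁻ (damp H a σ)) := by
  have hcont : Continuous (𝓕⁻ (damp H a σ)) := by
    have h1 : Continuous (𝓕 (damp H a σ)) :=
      VectorFourier.fourierIntegral_continuous (L := innerₗ ℝ) Real.continuous_fourierChar
        continuous_inner (integrable_damp hH hHb ha hσ hσ1.le)
    have : 𝓕⁻ (damp H a σ) = fun y => 𝓕 (damp H a σ) (-y) := by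
      ext y; rw [Real.fourierInv_eq_fourier_neg]
    rw [this]
    exact h1.comp continuous_neg
  have hb : ∀ σ' : ℝ, 0 < σ' → σ' ≤ 1 → ∀ y, ‖𝓕⁻ (damp H a σ) y‖ ≤
      (∫ w, ‖damp H a σ' w‖) * Real.exp ((σ' - σ) * y) := by
    intro σ' h0 h1 y
    have e1 := (fourierInv_damp_shift hH hHb ha hσ hσ1.le y).trans
      (fourierInv_damp_shift hH hHb ha h0 h1 y).symm
    have e2 := congrArg norm e1
    rw [norm_mul, norm_mul, ← Complex.ofReal_exp, ← Complex.ofReal_exp, Complex.norm_real,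
      Complex.norm_real, Real.norm_eq_abs, Real.norm_eq_abs, Real.abs_exp, Real.abs_exp] at e2
    have e3 : ‖𝓕⁻ (damp H a σ') y‖ ≤ ∫ w, ‖damp H a σ' w‖ := by
      rw [Real.fourierInv_eq_fourier_neg]
      exact VectorFourier.norm_fourierIntegral_le_integral_norm _ _ _ _ _
    have e4 : ‖𝓕⁻ (damp H a σ) y‖ = Real.exp ((σ' - σ) * y) * ‖𝓕⁻ (damp H a σ') y‖ := by
      have : Real.exp ((σ' - σ) * y) = Real.exp ((σ' - 1) * y) / Real.exp ((σ - 1) * y) := by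
        rw [← Real.exp_sub]; ring_nf
      rw [this, div_mul_eq_mul_div, ← e2]
      field_simp
    rw [e4, mul_comm]
    gcongr
  rw [← integrableOn_univ, ← Set.Iic_union_Ioi (a := (0 : ℝ))]
  refine IntegrableOn.union ?_ ?_
  · refine Integrable.mono' ((integrableOn_exp_mul_Iic (a := 1 - σ) (by linarith) 0).const_mul
      (∫ w, ‖damp H a 1 w‖)) hcont.aestronglyMeasurable (Eventually.of_forall (hb 1 one_pos le_rfl))
  · refine Integrable.mono' ((integrableOn_exp_mul_Ioi (a := σ / 2 - σ) (by linarith) 0).const_mul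
      (∫ w, ‖damp H a (σ / 2) w‖)) hcont.aestronglyMeasurable
      (Eventually.of_forall (hb (σ / 2) (by linarith) (by linarith)))

include hH hHb in
lemma lintegral_shift_le {a σ : ℝ} (ha : 0 < a) (hσ : 0 < σ) (hσ1 : σ < 1) :
    ∫⁻ y : ℝ, ENNReal.ofReal (‖cexp (((1 - σ) * y : ℝ)) * 𝓕⁻ (damp H a 1) y‖ ^ 2) ≤
      ENNReal.ofReal (Real.exp (2 * a)) * ∫⁻ t : ℝ, ENNReal.ofReal (‖H (σ + t * I)‖ ^ 2) := by
  have h1 : ∀ y : ℝ, cexp (((1 - σ) * y : ℝ)) * 𝓕⁻ (damp H a 1) y = 𝓕 (damp H a σ) (-y) := by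
    intro y
    rw [← fourierInv_damp_shift hH hHb ha hσ hσ1.le y, ← mul_assoc, ← Complex.exp_add,
      Real.fourierInv_eq_fourier_neg, ← Complex.ofReal_add,
      show (1 - σ) * y + (σ - 1) * y = 0 by ring]
    simp
  obtain ⟨A, hA⟩ := damp_bound (a := a) hHb hσ hσ1.le
  have hA0 : 0 ≤ A := by
    have := (norm_nonneg _).trans (hA 0)
    simpa using this
  have hA' : ∀ w, ‖damp H a σ w‖ ≤ A := fun w => (hA w).trans
    (mul_le_of_le_one_right hA0 (Real.exp_le_one_iff.2 (by
      have : 0 ≤ (a * (2 * Real.pi) ^ 2) * w ^ 2 := by positivity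
      linarith)))
  have hFi : Integrable (𝓕 (damp H a σ)) := by
    have := (integrable_fourierInv_damp hH hHb ha hσ hσ1).comp_neg
    refine this.congr (Eventually.of_forall fun y => ?_)
    simp only [Real.fourierInv_eq_fourier_neg, neg_neg]
  have hpl := plancherel (continuous_damp hH hσ) (integrable_damp hH hHb ha hσ hσ1.le) hFi hA'
  simp_rw [h1]
  rw [lintegral_neg_eq_self (fun y => ENNReal.ofReal (‖𝓕 (damp H a σ) y‖ ^ 2)), hpl]
  have hHm : Measurable fun t : ℝ => ENNReal.ofReal (‖H (σ + t * I)‖ ^ 2) := by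
    have : Continuous fun t : ℝ => H (σ + t * I) := by
      rw [continuous_iff_continuousAt]
      intro w
      exact ContinuousAt.comp (f := fun w : ℝ => (σ + w * I : ℂ))
        (hH _ (by simpa using hσ)).continuousAt (by fun_prop)
    exact ENNReal.measurable_ofReal.comp (this.norm.pow 2).measurable
  have hsc : ∫⁻ w : ℝ, ENNReal.ofReal (‖H (σ + (2 * Real.pi * w : ℝ) * I)‖ ^ 2) ≤
      ∫⁻ t : ℝ, ENNReal.ofReal (‖H (σ + t * I)‖ ^ 2) := by
    have e1 := lintegral_map (μ := volume) hHm (measurable_const_mul (2 * Real.pi))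
    rw [← e1, Real.map_volume_mul_left (by positivity), lintegral_smul_measure, smul_eq_mul]
    refine mul_le_of_le_one_left (by positivity) ?_
    rw [ENNReal.ofReal_le_one, abs_of_pos (by positivity)]
    exact inv_le_one_of_one_le₀ (by linarith [Real.pi_gt_three])
  refine le_trans ?_ (mul_le_mul_right hsc _)
  rw [← lintegral_const_mul' _ _ ENNReal.ofReal_ne_top]
  refine lintegral_mono fun w => ?_
  rw [← ENNReal.ofReal_mul (by positivity)]
  apply ENNReal.ofReal_le_ofReal
  rw [damp, norm_mul, mul_pow, mul_comm, norm_gauss_line, ← Real.exp_add, ← Real.exp_nat_mul]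
  refine mul_le_mul_of_nonneg_right (Real.exp_le_exp.2 ?_) (by positivity)
  push_cast
  have h2 : 0 ≤ a * (2 * Real.pi * w) ^ 2 := by positivity
  have h3 : (σ - 1) ^ 2 ≤ 1 := (sq_le_one_iff_abs_le_one _).2 (abs_le.2 ⟨by linarith, by linarith⟩)
  nlinarith
end Strip
end LimDist

namespace LimDist
section Transfer
open scoped FourierTransform

theorem transfer {u : ℝ → ℂ} (hum : Measurable u) (hu0 : ∀ y < 0, u y = 0) {C : ℝ}
    (huC : ∀ y, ‖u y‖ ≤ C * Real.exp (3 / 4 * y)) (huc : ∀ᵐ y, ContinuousAt u y) {H : ℂ → ℂ}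
    (hH : ∀ z, 0 < z.re → DifferentiableAt ℂ H z)
    (hHb : ∀ σ₁ : ℝ, 0 < σ₁ → ∃ B, ∀ σ t : ℝ, σ₁ ≤ σ → σ ≤ 1 → ‖H (σ + t * I)‖ ≤ B)
    (hL : ∀ w : ℂ, w.re = 1 → ∫ y : ℝ, u y * cexp (-w * y) = H w) {σ : ℝ} (hσ : 0 < σ) (hσ1 : σ < 1) :
    ∫⁻ y : ℝ, ENNReal.ofReal (‖u y‖ ^ 2 * Real.exp (-(2 * σ * y))) ≤
      ∫⁻ t : ℝ, ENNReal.ofReal (‖H (σ + t * I)‖ ^ 2) := by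
  set f : ℝ → ℂ := fun y => u y * cexp (-y) with hf
  have hfm : Measurable f := hum.mul (by fun_prop)
  have hfn : ∀ y, ‖f y‖ = ‖u y‖ * Real.exp (-y) := by
    intro y
    rw [hf, norm_mul, Complex.norm_exp]; simp
  have hfi : Integrable f := by
    rw [← integrableOn_univ, ← Set.Iio_union_Ici (a := (0 : ℝ))]
    refine IntegrableOn.union ?_ ?_
    · refine IntegrableOn.congr_fun (f := fun _ => (0 : ℂ)) integrableOn_zero (fun y hy => ?_) measurableSet_Iio
      simp [hf, hu0 y hy]
    · rw [integrableOn_Ici_iff_integrableOn_Ioi]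
      refine Integrable.mono' ((integrableOn_exp_mul_Ioi (a := -(1 / 4)) (by norm_num) 0).const_mul C)
        hfm.aestronglyMeasurable (Eventually.of_forall fun y => ?_)
      rw [hfn]
      calc _ ≤ (C * Real.exp (3 / 4 * y)) * Real.exp (-y) :=
            mul_le_mul_of_nonneg_right (huC y) (Real.exp_pos _).le
        _ = _ := by rw [mul_assoc, ← Real.exp_add]; ring_nf
  have hFf : ∀ w : ℝ, 𝓕 f w = H (1 + (2 * Real.pi * w : ℝ) * I) := by
    intro w
    rw [← hL _ (by simp), Real.fourier_real_eq_integral_exp_smul]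
    refine integral_congr_ae (Eventually.of_forall fun y => ?_)
    simp only [hf, smul_eq_mul]
    rw [mul_left_comm, ← Complex.exp_add]
    congr 2
    push_cast
    ring
  let a : ℕ → ℝ := fun n => ((n : ℝ) + 1)⁻¹ / (2 * Real.pi) ^ 2
  have ha : ∀ n, 0 < a n := fun n => by positivity
  have hc : Tendsto (fun n : ℕ => (n : ℝ) + 1) atTop atTop :=
    tendsto_atTop_add_const_right _ _ tendsto_natCast_atTop_atTop
  have ha0 : Tendsto a atTop (𝓝 0) := by
    have := (tendsto_inv_atTop_zero.comp hc).div_const ((2 * Real.pi) ^ 2)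
    simpa [Function.comp_def] using this
  have hconv : ∀ᵐ y, Tendsto (fun n => 𝓕⁻ (damp H (a n) 1) y) atTop (𝓝 (f y)) := by
    filter_upwards [huc] with y hy
    have hcy : ContinuousAt f y := hy.mul (by fun_prop)
    have := (tendsto_gauss_fourier hfi hcy).comp hc
    refine this.congr fun n => ?_
    rw [Function.comp_apply, Real.fourierInv_eq']
    refine integral_congr_ae (Eventually.of_forall fun w => ?_)
    simp only [hFf, damp, smul_eq_mul]
    rw [mul_comm, mul_left_comm, ← Complex.exp_add]
    congr 1
    · congr 1
      have hpi : (Real.pi : ℂ) ≠ 0 := by exact_mod_cast Real.pi_ne_zero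
      have hn : ((n : ℂ) + 1) ≠ 0 := by exact_mod_cast n.succ_ne_zero
      have hI : (I : ℂ) ^ 2 = -1 := I_sq
      simp only [a]
      push_cast
      simp only [RCLike.inner_apply, conj_trivial]
      push_cast
      field_simp
      linear_combination (-(w * 2 * Real.pi) ^ 2 : ℂ) * hI
  set M := ∫⁻ t : ℝ, ENNReal.ofReal (‖H (σ + t * I)‖ ^ 2) with hM
  have hbd := fun n => lintegral_shift_le hH hHb (ha n) hσ hσ1
  have hmeas : ∀ n, Measurable fun y : ℝ =>
      ENNReal.ofReal (‖cexp (((1 - σ) * y : ℝ)) * 𝓕⁻ (damp H (a n) 1) y‖ ^ 2) := by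
    intro n
    have h1 : Continuous (𝓕 (damp H (a n) 1)) :=
      VectorFourier.fourierIntegral_continuous (L := innerₗ ℝ) Real.continuous_fourierChar
        continuous_inner (integrable_damp hH hHb (ha n) one_pos le_rfl)
    have h2 : Continuous (𝓕⁻ (damp H (a n) 1)) := by
      have : 𝓕⁻ (damp H (a n) 1) = fun y => 𝓕 (damp H (a n) 1) (-y) := by
        ext y; rw [Real.fourierInv_eq_fourier_neg]
      rw [this]
      exact h1.comp continuous_neg
    have h3 : Continuous fun y : ℝ => cexp (((1 - σ) * y : ℝ)) * 𝓕⁻ (damp H (a n) 1) y :=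
      (by fun_prop : Continuous fun y : ℝ => cexp (((1 - σ) * y : ℝ))).mul h2
    exact ENNReal.measurable_ofReal.comp (h3.norm.pow 2).measurable
  have hlimM : Tendsto (fun n => ENNReal.ofReal (Real.exp (2 * a n)) * M) atTop (𝓝 M) := by
    have h1 : Tendsto (fun n => ENNReal.ofReal (Real.exp (2 * a n))) atTop (𝓝 1) := by
      rw [← ENNReal.ofReal_one, ← Real.exp_zero]
      refine ENNReal.tendsto_ofReal ((Real.continuous_exp.tendsto 0).comp ?_)
      simpa using ha0.const_mul 2
    have := ENNReal.Tendsto.mul_const (b := M) h1 (Or.inl one_ne_zero)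
    rwa [one_mul] at this
  calc ∫⁻ y : ℝ, ENNReal.ofReal (‖u y‖ ^ 2 * Real.exp (-(2 * σ * y)))
      = ∫⁻ y : ℝ, liminf (fun n =>
        ENNReal.ofReal (‖cexp (((1 - σ) * y : ℝ)) * 𝓕⁻ (damp H (a n) 1) y‖ ^ 2)) atTop := by
        apply lintegral_congr_ae
        filter_upwards [hconv] with y hy
        have h1 : Tendsto (fun n =>
          ENNReal.ofReal (‖cexp (((1 - σ) * y : ℝ)) * 𝓕⁻ (damp H (a n) 1) y‖ ^ 2)) atTop
            (𝓝 (ENNReal.ofReal (‖cexp (((1 - σ) * y : ℝ)) * f y‖ ^ 2))) :=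
          ENNReal.tendsto_ofReal ((hy.const_mul _).norm.pow 2)
        rw [h1.liminf_eq]
        congr 1
        rw [norm_mul, hfn, ← Complex.ofReal_exp, Complex.norm_real, Real.norm_eq_abs, Real.abs_exp,
          mul_pow, mul_pow, mul_left_comm, ← mul_pow, ← Real.exp_add, ← Real.exp_nat_mul]
        congr 2
        push_cast
        ring
    _ ≤ liminf (fun n => ∫⁻ y : ℝ,
        ENNReal.ofReal (‖cexp (((1 - σ) * y : ℝ)) * 𝓕⁻ (damp H (a n) 1) y‖ ^ 2)) atTop :=
        lintegral_liminf_le hmeas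
    _ ≤ liminf (fun n => ENNReal.ofReal (Real.exp (2 * a n)) * M) atTop :=
        liminf_le_liminf (Eventually.of_forall hbd)
    _ = M := hlimM.liminf_eq
end Transfer
end LimDist

namespace LimDist
open scoped ENNReal

section TrigSum

/-- The trigonometric sum with frequencies the imaginary parts of the points of `F`. -/
def trigSum (c : ℂ → ℂ) (F : Finset ℂ) (y : ℝ) : ℂ := ∑ z ∈ F, c z * cexp (z.im * I * y)

variable (c : ℂ → ℂ) (F : Finset ℂ)

lemma continuous_trigSum : Continuous (trigSum c F) := by unfold trigSum; fun_prop

lemma norm_trigSum_le (y : ℝ) : ‖trigSum c F y‖ ≤ ∑ z ∈ F, ‖c z‖ := by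
  refine (norm_sum_le _ _).trans (Finset.sum_le_sum fun z _ => ?_)
  rw [norm_mul, Complex.norm_exp]
  simp

lemma trigSum_mul_exp (w : ℂ) : (fun y : ℝ => trigSum c F y * cexp (-w * y)) =
    fun y : ℝ => ∑ z ∈ F, c z * cexp ((z.im * I - w) * y) := by
  funext y
  rw [trigSum, Finset.sum_mul]
  refine Finset.sum_congr rfl fun z _ => ?_
  rw [mul_assoc, ← Complex.exp_add]
  congr 2; ring

variable {w : ℂ} (hw : 0 < w.re)
include hw

lemma re_sub_neg (z : ℂ) : ((z.im * I - w : ℂ)).re < 0 := by simpa using hw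

lemma integrableOn_trigSum_mul_exp :
    IntegrableOn (fun y : ℝ => trigSum c F y * cexp (-w * y)) (Set.Ioi 0) := by
  rw [trigSum_mul_exp]
  exact integrable_finset_sum _ fun z _ =>
    (integrableOn_exp_mul_complex_Ioi (re_sub_neg hw z) 0).const_mul _

lemma laplace_trigSum : ∫ y in Set.Ioi (0 : ℝ), trigSum c F y * cexp (-w * y) =
    ∑ z ∈ F, c z / (w - z.im * I) := by
  rw [trigSum_mul_exp, integral_finset_sum _ fun z _ =>
    (integrableOn_exp_mul_complex_Ioi (re_sub_neg hw z) 0).const_mul _]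
  refine Finset.sum_congr rfl fun z _ => ?_
  rw [integral_const_mul, integral_exp_mul_complex_Ioi (re_sub_neg hw z)]
  simp only [ofReal_zero, mul_zero, Complex.exp_zero, div_eq_mul_inv]
  rw [← neg_sub w, inv_neg]
  ring

end TrigSum

section MeanSquare
variable {K : Type} [Field K] [NumberField K] {Z V : ℂ → ℂ} {m : ℕ}
variable (hS : ∀ s : ℝ, 1 < s → Summable fun I : NI K => (Ideal.absNorm I.1 : ℝ) ^ (-s))
include hS

lemma integrable_phi_mul_exp {w : ℂ} (hw : w.re = 1) :
    Integrable fun y : ℝ => (phi K y : ℂ) * cexp (-w * y) := by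
  obtain ⟨C, hC, hb⟩ := exists_phi_bound (K := K) hS
  rw [← integrableOn_univ, ← Set.Iio_union_Ici (a := (0 : ℝ))]
  refine IntegrableOn.union ?_ ?_
  · refine IntegrableOn.congr_fun (f := fun _ => (0 : ℂ)) integrableOn_zero (fun y hy => ?_)
      measurableSet_Iio
    simp [phi_neg (K := K) hy]
  · rw [integrableOn_Ici_iff_integrableOn_Ioi]
    refine Integrable.mono' ((integrableOn_exp_mul_Ioi (show (-(1 / 4) : ℝ) < 0 by norm_num) 0).const_mul C)
      ((Complex.measurable_ofReal.comp measurable_phi).mul (by fun_prop)).aestronglyMeasurable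
      (ae_of_all _ fun y => ?_)
    rw [norm_mul, Complex.norm_real, Real.norm_eq_abs, Complex.norm_exp]
    have : (-w * y).re = -y := by simp [hw]
    rw [this]
    refine (mul_le_mul_of_nonneg_right (hb y) (Real.exp_pos _).le).trans (le_of_eq ?_)
    rw [mul_assoc, ← Real.exp_add]
    congr 2; ring

lemma lintegral_sub_trigSum_le (h : VPack Z V m)
    (hZ : ∀ s : ℂ, 1 < s.re → Z s = ∑' I : NI K, (Ideal.absNorm I.1 : ℂ) ^ (-s))
    (hT : ∑' z : Zr V, ENNReal.ofReal (cf V m z.1 ^ 2 * wgt z.im) ≠ ∞) {F : Finset ℂ}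
    (hF : ∀ z ∈ F, z.re = 1 / 2 ∧ V z = 0) {σ : ℝ} (hσ : 0 < σ) (hσ1 : σ < 1) :
    ∫⁻ y in Set.Ici (0 : ℝ), ENNReal.ofReal
      (‖(phi K y : ℂ) - trigSum (res V m) F y‖ ^ 2 * Real.exp (-(2 * σ * y))) ≤
      ∫⁻ t : ℝ, ENNReal.ofReal (‖Gf V m F (1 / 2 + σ + t * I)‖ ^ 2) := by
  obtain ⟨C, hC, hb⟩ := exists_phi_bound (K := K) hS
  set P := trigSum (res V m) F with hP
  set S := ∑ z ∈ F, ‖res V m z‖ with hSd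
  have hS0 : 0 ≤ S := Finset.sum_nonneg fun z _ => norm_nonneg _
  have hzw : ∀ z ∈ F, ∀ w : ℂ, 1 / 2 + w - z = w - z.im * I := by
    intro z hz w
    apply Complex.ext <;> simp [(hF z hz).1]
  set u : ℝ → ℂ := (Set.Ici 0).indicator fun y => (phi K y : ℂ) - P y with hu
  have hPc : Continuous P := continuous_trigSum _ _
  have key := transfer (u := u) (C := C + S) (H := fun w => Gf V m F (1 / 2 + w)) (σ := σ)
    (((Complex.measurable_ofReal.comp measurable_phi).sub hPc.measurable).indicator measurableSet_Ici)
    (fun y hy => Set.indicator_of_notMem (by simpa using hy) _) ?_ ?_ ?_ ?_ ?_ hσ hσ1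
  · refine le_trans (le_trans (le_of_eq ?_) key) (le_of_eq ?_)
    · rw [← lintegral_indicator measurableSet_Ici]
      refine lintegral_congr fun y => ?_
      by_cases hy : y ∈ Set.Ici (0 : ℝ)
      · simp only [hu, Set.indicator_of_mem hy]
      · simp [hu, Set.indicator_of_notMem hy]
    · refine lintegral_congr fun t => ?_
      simp only [add_assoc]
  · intro y
    by_cases hy : y ∈ Set.Ici (0 : ℝ)
    · rw [hu, Set.indicator_of_mem hy, add_mul]
      refine (norm_sub_le _ _).trans (add_le_add ?_ ?_)
      · simpa using hb y
      · have h1 : 1 ≤ Real.exp (3 / 4 * y) := Real.one_le_exp (mul_nonneg (by norm_num) hy)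
        exact (norm_trigSum_le _ _ _).trans (le_mul_of_one_le_right hS0 h1)
    · rw [hu, Set.indicator_of_notMem hy, norm_zero]
      positivity
  · filter_upwards [ae_continuousAt_phi (K := K)] with y hy
    have hy0 : y ≠ 0 := by rintro rfl; exact hy.1 1 (by simp)
    have hc : ContinuousAt (fun y => (phi K y : ℂ) - P y) y :=
      (Complex.continuous_ofReal.continuousAt.comp hy.2).sub hPc.continuousAt
    rcases lt_or_gt_of_ne hy0 with h0 | h0
    · refine (continuousAt_const (y := (0 : ℂ))).congr ?_
      filter_upwards [Iio_mem_nhds h0] with x hx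
      rw [hu, Set.indicator_of_notMem (by simpa using hx)]
    · refine hc.congr ?_
      filter_upwards [Ioi_mem_nhds h0] with x hx
      rw [hu, Set.indicator_of_mem (show x ∈ Set.Ici (0 : ℝ) from (Set.mem_Ioi.1 hx).le)]
  · intro z hz
    have hz1 : DifferentiableAt ℂ (fun w : ℂ => 1 / 2 + w) z := by fun_prop
    refine DifferentiableAt.comp z (g := Gf V m F) ?_ hz1
    have hre : (1 / 2 + z).re = 1 / 2 + z.re := by simp
    have hs0 : 1 / 2 + z ≠ 0 := by
      intro h0; have := congrArg Complex.re h0; rw [hre, Complex.zero_re] at this; linarith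
    have hV : V (1 / 2 + z) ≠ 0 := by
      intro h0
      have := (h.zeros _ (by rw [hre]; linarith) h0).2.1
      rw [hre] at this; linarith
    have hd := h.diff (1 / 2 + z)
    unfold Gf Hf
    refine DifferentiableAt.sub (DifferentiableAt.div (by fun_prop) (by fun_prop)
      (mul_ne_zero (pow_ne_zero _ hs0) hV)) (DifferentiableAt.fun_sum fun z' hz' => ?_)
    refine DifferentiableAt.div (by fun_prop) (by fun_prop) fun h0 => ?_
    rw [hzw z' hz'] at h0
    have := congrArg Complex.re h0
    simp at this; linarith
  · intro σ₁ hσ₁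
    obtain ⟨B, hB⟩ := h.Hf_bounded hT hσ₁
    refine ⟨B + S / σ₁, fun τ t h1 h2 => ?_⟩
    have hB' := hB τ t h1 h2
    rw [add_assoc] at hB'
    refine (norm_sub_le _ _).trans (add_le_add hB' ?_)
    rw [hSd, Finset.sum_div]
    refine (norm_sum_le _ _).trans (Finset.sum_le_sum fun z hz => ?_)
    rw [norm_div, hzw z hz]
    refine div_le_div_of_nonneg_left (norm_nonneg _) hσ₁ ?_
    refine le_trans ?_ (Complex.abs_re_le_norm _)
    refine le_trans h1 (le_trans (le_abs_self _) (le_of_eq ?_))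
    simp
  · intro w hw
    have hw0 : 0 < w.re := by rw [hw]; norm_num
    have h1 : (fun y : ℝ => u y * cexp (-w * y)) = fun y : ℝ => (phi K y : ℂ) * cexp (-w * y) -
        (Set.Ici 0).indicator (fun y : ℝ => P y * cexp (-w * y)) y := by
      funext y
      by_cases hy : y ∈ Set.Ici (0 : ℝ)
      · simp only [hu, Set.indicator_of_mem hy, sub_mul]
      · have : phi K y = 0 := phi_neg (by simpa using hy)
        simp [hu, Set.indicator_of_notMem hy, this]
    have h2 : IntegrableOn (fun y : ℝ => P y * cexp (-w * y)) (Set.Ici 0) := by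
      rw [integrableOn_Ici_iff_integrableOn_Ioi]
      exact integrableOn_trigSum_mul_exp _ _ hw0
    rw [h1, integral_sub (integrable_phi_mul_exp hS hw) (h2.integrable_indicator measurableSet_Ici),
      laplace_phi hS h hZ hw, integral_indicator measurableSet_Ici, integral_Ici_eq_integral_Ioi,
      laplace_trigSum _ _ hw0, Gf]
    congr 1
    exact Finset.sum_congr rfl fun z hz => by rw [hzw z hz]

/-- The function `phi K` is approximated in mean square by trigonometric sums. -/
theorem exists_trigSum_approx (h : VPack Z V m)
    (hZ : ∀ s : ℂ, 1 < s.re → Z s = ∑' I : NI K, (Ideal.absNorm I.1 : ℂ) ^ (-s))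
    (hT : ∑' z : Zr V, ENNReal.ofReal (cf V m z.1 ^ 2 * wgt z.im) ≠ ∞) {ε : ℝ} (hε : 0 < ε) :
    ∃ (c : ℂ → ℂ) (F : Finset ℂ) (Y₀ : ℝ), ∀ Y, Y₀ < Y → 0 < Y →
      ∫⁻ y in Set.Ioc 0 Y, ENNReal.ofReal (‖(phi K y : ℂ) - trigSum c F y‖ ^ 2) ≤
        ENNReal.ofReal (ε * Y) := by
  obtain ⟨F, hF, σ₀, h0, h01, hh⟩ := h.exists_approx hT (show 0 < ε / Real.exp 2 by positivity)
  refine ⟨res V m, F, 1 / σ₀, fun Y hY hY0 => ?_⟩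
  have hY1 : 1 / Y < σ₀ := by
    rw [div_lt_iff₀ hY0]; rw [div_lt_iff₀ h0] at hY; linarith
  have h1 := (lintegral_sub_trigSum_le hS h hZ hT hF (one_div_pos.2 hY0)
    (hY1.trans_le h01)).trans (hh (1 / Y) (one_div_pos.2 hY0) hY1)
  calc ∫⁻ y in Set.Ioc 0 Y, ENNReal.ofReal (‖(phi K y : ℂ) - trigSum (res V m) F y‖ ^ 2)
      ≤ ∫⁻ y in Set.Ioc 0 Y, ENNReal.ofReal (Real.exp 2) * ENNReal.ofReal
        (‖(phi K y : ℂ) - trigSum (res V m) F y‖ ^ 2 * Real.exp (-(2 * (1 / Y) * y))) := by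
        refine setLIntegral_mono' measurableSet_Ioc fun y hy => ?_
        rw [← ENNReal.ofReal_mul (Real.exp_pos _).le]
        refine ENNReal.ofReal_le_ofReal ?_
        rw [mul_left_comm, ← Real.exp_add]
        refine le_mul_of_one_le_right (by positivity) (Real.one_le_exp ?_)
        have : y / Y ≤ 1 := (div_le_one hY0).2 hy.2
        have e : 2 * (1 / Y) * y = 2 * (y / Y) := by ring
        rw [e]; linarith
    _ ≤ ENNReal.ofReal (Real.exp 2) * ∫⁻ y in Set.Ici 0, ENNReal.ofReal
        (‖(phi K y : ℂ) - trigSum (res V m) F y‖ ^ 2 * Real.exp (-(2 * (1 / Y) * y))) := by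
        rw [lintegral_const_mul' _ _ ENNReal.ofReal_ne_top]
        exact mul_le_mul_right (lintegral_mono_set fun y hy => hy.1.le) _
    _ ≤ ENNReal.ofReal (Real.exp 2) * ENNReal.ofReal (ε / Real.exp 2 / (1 / Y)) :=
        mul_le_mul_right h1 _
    _ = ENNReal.ofReal (ε * Y) := by
        rw [← ENNReal.ofReal_mul (Real.exp_pos _).le]
        congr 1
        have := (Real.exp_pos 2).ne'
        field_simp

end MeanSquare

end LimDist

namespace LimDist
open scoped ENNReal

section Mean

/-- The uniform probability measure on `(0, Y]`. -/
def unif (Y : ℝ) : Measure ℝ := (ENNReal.ofReal Y)⁻¹ • volume.restrict (Set.Ioc 0 Y)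

lemma isProbabilityMeasure_unif {Y : ℝ} (hY : 0 < Y) : IsProbabilityMeasure (unif Y) := by
  constructor
  rw [unif, Measure.smul_apply, Measure.restrict_apply_univ, Real.volume_Ioc, sub_zero, smul_eq_mul]
  exact ENNReal.inv_mul_cancel (by simpa using hY) ENNReal.ofReal_ne_top

lemma integral_unif {E : Type*} [NormedAddCommGroup E] [NormedSpace ℝ E] (g : ℝ → E) {Y : ℝ}
    (hY : 0 < Y) : ∫ y, g y ∂unif Y = (1 / Y) • ∫ y in (0 : ℝ)..Y, g y := by
  rw [unif, integral_smul_measure, intervalIntegral.integral_of_le hY.le, ENNReal.toReal_inv,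
    ENNReal.toReal_ofReal hY.le, one_div]

lemma integrable_unif_of_bounded {g : ℝ → ℂ} (hg : Measurable g) {B : ℝ} (hB : ∀ y, ‖g y‖ ≤ B)
    {Y : ℝ} (hY : 0 < Y) : Integrable g (unif Y) := by
  have := isProbabilityMeasure_unif hY
  exact Integrable.of_bound hg.aestronglyMeasurable B (ae_of_all _ hB)

/-- The function `g` has a mean value along `(0, Y]`, `Y → ∞`. -/
def HasMean (g : ℝ → ℂ) : Prop := ∃ L, Tendsto (fun Y => ∫ y, g y ∂unif Y) atTop (𝓝 L)

lemma hasMean_of_approx {g : ℝ → ℂ} (h : ∀ ε : ℝ, 0 < ε → ∃ g', HasMean g' ∧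
    ∀ᶠ Y in atTop, ‖(∫ y, g y ∂unif Y) - ∫ y, g' y ∂unif Y‖ ≤ ε) : HasMean g := by
  refine cauchySeq_tendsto_of_complete (Metric.cauchySeq_iff'.2 fun ε hε => ?_)
  obtain ⟨g', ⟨L, hL⟩, hg⟩ := h (ε / 5) (by positivity)
  have h1 := hL.eventually (Metric.ball_mem_nhds L (show 0 < ε / 5 by positivity))
  obtain ⟨N, hN⟩ := eventually_atTop.1 (hg.and h1)
  refine ⟨N, fun n hn => ?_⟩
  have a := hN n hn
  have b := hN N le_rfl
  simp only [← dist_eq_norm] at a b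
  have t1 := dist_triangle4 (∫ y, g y ∂unif n) (∫ y, g' y ∂unif n) (∫ y, g' y ∂unif N)
    (∫ y, g y ∂unif N)
  have t2 := dist_triangle_right (∫ y, g' y ∂unif n) (∫ y, g' y ∂unif N) L
  have t3 := dist_comm (∫ y, g' y ∂unif N) (∫ y, g y ∂unif N)
  linarith [a.1, a.2, b.1, b.2]

/-- The exponentials `y ↦ exp (i γ y)`. -/
def expo (γ : ℝ) (y : ℝ) : ℂ := cexp (γ * I * y)

lemma hasMean_expo (γ : ℝ) : HasMean (expo γ) := by
  rcases eq_or_ne γ 0 with rfl | hγ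
  · refine ⟨1, tendsto_const_nhds.congr' ?_⟩
    filter_upwards [eventually_gt_atTop 0] with Y hY
    have := isProbabilityMeasure_unif hY
    simp [expo]
  · refine ⟨0, ?_⟩
    have hc : (γ * I : ℂ) ≠ 0 := by simp [hγ]
    refine squeeze_zero_norm' (a := fun Y : ℝ => 2 / |γ| * Y⁻¹) ?_ ?_
    · filter_upwards [eventually_gt_atTop 0] with Y hY
      rw [integral_unif _ hY]
      unfold expo
      rw [integral_exp_mul_complex hc, norm_smul, norm_div _ (γ * I : ℂ), norm_mul, Complex.norm_real,
        Complex.norm_I, mul_one, Real.norm_eq_abs, Real.norm_eq_abs,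
        abs_of_pos (one_div_pos.2 hY)]
      have : ‖cexp (γ * I * Y) - cexp (γ * I * (0 : ℝ))‖ ≤ 2 := by
        refine (norm_sub_le _ _).trans (le_of_eq ?_)
        rw [Complex.norm_exp, Complex.norm_exp]
        norm_num
      calc 1 / Y * (‖cexp (γ * I * Y) - cexp (γ * I * (0 : ℝ))‖ / |γ|) ≤ 1 / Y * (2 / |γ|) := by
            gcongr
        _ = _ := by ring
    · simpa using tendsto_inv_atTop_zero.const_mul (2 / |γ|)

/-- Trigonometric polynomials. -/
def trigPoly : Submodule ℂ (ℝ → ℂ) := Submodule.span ℂ (Set.range expo)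

lemma trigPoly_mul {f g : ℝ → ℂ} (hf : f ∈ trigPoly) (hg : g ∈ trigPoly) : f * g ∈ trigPoly := by
  have h := Submodule.mul_mem_mul hf hg
  rw [trigPoly, Submodule.span_mul_span] at h
  refine Submodule.span_mono ?_ h
  rintro _ ⟨_, ⟨a, rfl⟩, _, ⟨b, rfl⟩, rfl⟩
  refine ⟨a + b, ?_⟩
  funext y
  simp only [expo, Pi.mul_apply, ← Complex.exp_add]
  congr 1; push_cast; ring

lemma one_mem_trigPoly : (1 : ℝ → ℂ) ∈ trigPoly :=
  Submodule.subset_span ⟨0, by funext y; simp [expo]⟩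

lemma trigPoly_pow {f : ℝ → ℂ} (hf : f ∈ trigPoly) (n : ℕ) : f ^ n ∈ trigPoly := by
  induction n with
  | zero => simpa using one_mem_trigPoly
  | succ n ih => rw [pow_succ]; exact trigPoly_mul ih hf

lemma trigPoly_spec {f : ℝ → ℂ} (hf : f ∈ trigPoly) :
    Measurable f ∧ (∃ B, ∀ y, ‖f y‖ ≤ B) ∧ HasMean f := by
  induction hf using Submodule.span_induction with
  | mem x h =>
    obtain ⟨γ, rfl⟩ := h
    refine ⟨by unfold expo; fun_prop, ⟨1, fun y => ?_⟩, hasMean_expo γ⟩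
    rw [expo, Complex.norm_exp]
    simp
  | zero => exact ⟨measurable_zero, ⟨0, by simp⟩, 0, by simp⟩
  | add f g _ _ hf hg =>
    obtain ⟨mf, ⟨A, hA⟩, L, hL⟩ := hf
    obtain ⟨mg, ⟨B, hB⟩, M, hM⟩ := hg
    refine ⟨mf.add mg, ⟨A + B, fun y => (norm_add_le _ _).trans (add_le_add (hA y) (hB y))⟩,
      L + M, (hL.add hM).congr' ?_⟩
    filter_upwards [eventually_gt_atTop 0] with Y hY
    exact (integral_add (integrable_unif_of_bounded mf hA hY)
      (integrable_unif_of_bounded mg hB hY)).symm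
  | smul c f _ hf =>
    obtain ⟨mf, ⟨A, hA⟩, L, hL⟩ := hf
    refine ⟨mf.const_smul c, ⟨‖c‖ * A, fun y => ?_⟩, c • L, (hL.const_smul c).congr fun Y => ?_⟩
    · rw [Pi.smul_apply, norm_smul]
      exact mul_le_mul_of_nonneg_left (hA y) (norm_nonneg _)
    · exact (integral_smul c f).symm

lemma norm_integral_unif_le {g : ℝ → ℂ} {Y δ : ℝ} (hY : 0 < Y) (h : ∀ y, ‖g y‖ ≤ δ) :
    ‖∫ y, g y ∂unif Y‖ ≤ δ := by
  have := isProbabilityMeasure_unif hY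
  simpa using norm_integral_le_of_norm_le_const (μ := unif Y) (ae_of_all _ h)

lemma hasMean_exp {f : ℝ → ℂ} (hf : f ∈ trigPoly) : HasMean fun y => cexp (f y) := by
  obtain ⟨mf, ⟨R, hR⟩, -⟩ := trigPoly_spec hf
  have hu := tendstoUniformly_tsum_nat (f := fun (n : ℕ) (y : ℝ) => f y ^ n / n.factorial)
    (Real.summable_pow_div_factorial R) (fun n y => by
      rw [norm_div, norm_pow, Complex.norm_natCast]
      gcongr
      exact hR y)
  have he : ∀ y, ∑' n : ℕ, f y ^ n / n.factorial = cexp (f y) := fun y => by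
    rw [Complex.exp_eq_exp_ℂ, NormedSpace.exp_eq_tsum_div]
  simp only [he] at hu
  refine hasMean_of_approx fun ε hε => ?_
  obtain ⟨N, hN⟩ := (Metric.tendstoUniformly_iff.1 hu ε hε).exists
  have hmem : (fun y => ∑ n ∈ Finset.range N, f y ^ n / n.factorial) ∈ trigPoly := by
    have : (fun y => ∑ n ∈ Finset.range N, f y ^ n / n.factorial) =
        ∑ n ∈ Finset.range N, ((n.factorial : ℂ)⁻¹) • f ^ n := by
      funext y
      rw [Finset.sum_apply]
      exact Finset.sum_congr rfl fun n _ => by simp [div_eq_inv_mul]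
    rw [this]
    exact Submodule.sum_mem _ fun n _ => Submodule.smul_mem _ _ (trigPoly_pow hf n)
  obtain ⟨mg, ⟨B, hB⟩, hm⟩ := trigPoly_spec hmem
  refine ⟨_, hm, ?_⟩
  filter_upwards [eventually_gt_atTop 0] with Y hY
  rw [← integral_sub (integrable_unif_of_bounded (B := Real.exp R) (by fun_prop) (fun y => ?_) hY)
    (integrable_unif_of_bounded mg hB hY)]
  · refine norm_integral_unif_le hY fun y => ?_
    rw [← dist_eq_norm]
    exact (hN y).le
  · rw [Complex.norm_exp]
    exact Real.exp_le_exp.2 ((Complex.re_le_norm _).trans (hR y))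

lemma trigSum_re_mem (c : ℂ → ℂ) (F : Finset ℂ) :
    (fun y => ((trigSum c F y).re : ℂ)) ∈ trigPoly := by
  have : (fun y => ((trigSum c F y).re : ℂ)) = ∑ z ∈ F, ((c z / 2) • expo z.im +
      (starRingEnd ℂ (c z) / 2) • expo (-z.im)) := by
    funext y
    rw [Finset.sum_apply, Complex.re_eq_add_conj, trigSum, map_sum, ← Finset.sum_add_distrib,
      Finset.sum_div]
    refine Finset.sum_congr rfl fun z _ => ?_
    simp only [expo, Pi.add_apply, Pi.smul_apply, smul_eq_mul, map_mul, ← Complex.exp_conj,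
      Complex.conj_ofReal, Complex.conj_I, Complex.ofReal_neg]
    rw [mul_neg, ← neg_mul (z.im : ℂ)]
    ring
  rw [this]
  exact Submodule.sum_mem _ fun z _ => Submodule.add_mem _
    (Submodule.smul_mem _ _ (Submodule.subset_span ⟨_, rfl⟩))
    (Submodule.smul_mem _ _ (Submodule.subset_span ⟨_, rfl⟩))

end Mean

end LimDist

namespace LimDist
open scoped ENNReal

section Law

lemma mean_abs_le {g : ℝ → ℝ} {G : ℝ → ℂ} (hg : Measurable g)
    (hgG : ∀ y, |g y| ≤ ‖G y‖) {δ Y : ℝ} (hδ : 0 < δ) (hY : 0 < Y)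
    (h : ∫⁻ y in Set.Ioc 0 Y, ENNReal.ofReal (‖G y‖ ^ 2) ≤ ENNReal.ofReal (δ ^ 2 * Y)) :
    Integrable g (unif Y) ∧ ∫ y, |g y| ∂unif Y ≤ δ := by
  have := isProbabilityMeasure_unif hY
  have h1 : ∫⁻ y, ENNReal.ofReal (‖G y‖ ^ 2) ∂unif Y ≤ ENNReal.ofReal (δ ^ 2) := by
    rw [unif, lintegral_smul_measure, smul_eq_mul]
    refine (mul_le_mul_right h _).trans (le_of_eq ?_)
    rw [ENNReal.ofReal_mul (by positivity), mul_comm, mul_assoc,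
      ENNReal.mul_inv_cancel (by simpa using hY) ENNReal.ofReal_ne_top, mul_one]
  have h2 : ∫⁻ y, ENNReal.ofReal |g y| ∂unif Y ≤ ENNReal.ofReal δ := by
    calc ∫⁻ y, ENNReal.ofReal |g y| ∂unif Y
        ≤ ∫⁻ y, (ENNReal.ofReal (δ / 2) +
          ENNReal.ofReal (1 / (2 * δ)) * ENNReal.ofReal (‖G y‖ ^ 2)) ∂unif Y := by
          refine lintegral_mono fun y => ?_
          rw [← ENNReal.ofReal_mul (by positivity), ← ENNReal.ofReal_add (by positivity) (by positivity)]
          refine ENNReal.ofReal_le_ofReal ((hgG y).trans ?_)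
          have : δ / 2 + 1 / (2 * δ) * ‖G y‖ ^ 2 - ‖G y‖ = (‖G y‖ - δ) ^ 2 / (2 * δ) := by
            field_simp; ring
          have h0 : 0 ≤ (‖G y‖ - δ) ^ 2 / (2 * δ) := by positivity
          linarith
      _ = ENNReal.ofReal (δ / 2) +
          ENNReal.ofReal (1 / (2 * δ)) * ∫⁻ y, ENNReal.ofReal (‖G y‖ ^ 2) ∂unif Y := by
          rw [lintegral_add_left measurable_const, lintegral_const_mul' _ _ ENNReal.ofReal_ne_top]
          simp
      _ ≤ ENNReal.ofReal (δ / 2) + ENNReal.ofReal (1 / (2 * δ)) * ENNReal.ofReal (δ ^ 2) := by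
          gcongr
      _ = ENNReal.ofReal δ := by
          rw [← ENNReal.ofReal_mul (by positivity), ← ENNReal.ofReal_add (by positivity) (by positivity)]
          congr 1
          field_simp; ring
  refine ⟨⟨hg.aestronglyMeasurable, ?_⟩, ?_⟩
  · rw [hasFiniteIntegral_iff_norm]
    exact h2.trans_lt ENNReal.ofReal_lt_top
  · rw [integral_eq_lintegral_of_nonneg_ae (ae_of_all _ fun y => abs_nonneg _)
      hg.abs.aestronglyMeasurable]
    exact ENNReal.toReal_le_of_le_ofReal hδ.le h2

lemma norm_cexp_sub_cexp_le (a b : ℝ) : ‖cexp (a * I) - cexp (b * I)‖ ≤ |a - b| := by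
  have : cexp (a * I) - cexp (b * I) = cexp (b * I) * (cexp (I * (a - b : ℝ)) - 1) := by
    rw [mul_sub, ← Complex.exp_add, mul_one]
    congr 2; push_cast; ring
  rw [this, norm_mul, Complex.norm_exp_ofReal_mul_I, one_mul]
  exact Real.norm_exp_I_mul_ofReal_sub_one_le

variable {φ : ℝ → ℝ} (hφ : Measurable φ) (hA : ∀ ε : ℝ, 0 < ε →
  ∃ (c : ℂ → ℂ) (F : Finset ℂ) (Y₀ : ℝ), ∀ Y, Y₀ < Y → 0 < Y →
    ∫⁻ y in Set.Ioc 0 Y, ENNReal.ofReal (‖(φ y : ℂ) - trigSum c F y‖ ^ 2) ≤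
      ENNReal.ofReal (ε * Y))
include hφ hA

lemma exists_mean_abs_sub_le {δ : ℝ} (hδ : 0 < δ) : ∃ (c : ℂ → ℂ) (F : Finset ℂ), ∀ᶠ Y in atTop,
    Integrable (fun y => φ y - (trigSum c F y).re) (unif Y) ∧
      ∫ y, |φ y - (trigSum c F y).re| ∂unif Y ≤ δ := by
  obtain ⟨c, F, Y₀, h⟩ := hA (δ ^ 2) (by positivity)
  have hm := (continuous_trigSum c F).measurable
  refine ⟨c, F, ?_⟩
  filter_upwards [eventually_gt_atTop 0, eventually_gt_atTop Y₀] with Y hY hY₀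
  refine mean_abs_le (hφ.sub (Complex.measurable_re.comp hm)) (fun y => ?_) hδ hY (h Y hY₀ hY)
  simpa using Complex.abs_re_le_norm ((φ y : ℂ) - trigSum c F y)

lemma norm_mean_cexp_sub_le {g : ℝ → ℝ} (hg : Measurable g) {ξ δ Y : ℝ} (hY : 0 < Y)
    (hi : Integrable (fun y => φ y - g y) (unif Y)) (h : ∫ y, |φ y - g y| ∂unif Y ≤ δ) :
    ‖(∫ y, cexp (ξ * φ y * I) ∂unif Y) - ∫ y, cexp (ξ * g y * I) ∂unif Y‖ ≤ |ξ| * δ := by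
  have hb : ∀ a : ℝ, ‖cexp (ξ * a * I)‖ ≤ 1 := fun a => by
    rw [← Complex.ofReal_mul, Complex.norm_exp_ofReal_mul_I]
  rw [← integral_sub (integrable_unif_of_bounded (by fun_prop) (fun y => hb (φ y)) hY)
    (integrable_unif_of_bounded (by fun_prop) (fun y => hb (g y)) hY)]
  refine (norm_integral_le_of_norm_le (hi.abs.const_mul |ξ|) (ae_of_all _ fun y => ?_)).trans ?_
  · have := norm_cexp_sub_cexp_le (ξ * φ y) (ξ * g y)
    rw [← mul_sub, abs_mul] at this
    simpa using this
  · rw [integral_const_mul]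
    exact mul_le_mul_of_nonneg_left h (abs_nonneg _)

lemma hasMean_cexp (ξ : ℝ) : HasMean fun y => cexp (ξ * φ y * I) := by
  refine hasMean_of_approx fun ε hε => ?_
  obtain ⟨c, F, h⟩ := exists_mean_abs_sub_le hφ hA (show 0 < ε / (|ξ| + 1) by positivity)
  refine ⟨fun y => cexp (ξ * (trigSum c F y).re * I), ?_, ?_⟩
  · have : (fun y => cexp (ξ * (trigSum c F y).re * I)) =
        fun y => cexp (((ξ * I : ℂ) • fun y => ((trigSum c F y).re : ℂ)) y) := by
      funext y
      simp only [Pi.smul_apply, smul_eq_mul]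
      congr 1; ring
    rw [this]
    exact hasMean_exp (Submodule.smul_mem _ _ (trigSum_re_mem c F))
  · filter_upwards [h, eventually_gt_atTop 0] with Y hY hY0
    refine (norm_mean_cexp_sub_le hφ hA
      (Complex.measurable_re.comp (continuous_trigSum c F).measurable) hY0 hY.1 hY.2).trans ?_
    rw [mul_div_assoc', div_le_iff₀ (by positivity)]
    nlinarith [abs_nonneg ξ]

lemma exists_mean_abs_le : ∃ M : ℝ, ∀ᶠ Y in atTop, Integrable φ (unif Y) ∧
    ∫ y, |φ y| ∂unif Y ≤ M := by
  obtain ⟨c, F, h⟩ := exists_mean_abs_sub_le hφ hA one_pos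
  refine ⟨1 + ∑ z ∈ F, ‖c z‖, ?_⟩
  filter_upwards [h, eventually_gt_atTop 0] with Y hY hY0
  have := isProbabilityMeasure_unif hY0
  have hb : ∀ y, |(trigSum c F y).re| ≤ ∑ z ∈ F, ‖c z‖ := fun y =>
    (Complex.abs_re_le_norm _).trans (norm_trigSum_le c F y)
  have hi : Integrable (fun y => (trigSum c F y).re) (unif Y) :=
    Integrable.of_bound (Complex.measurable_re.comp
      (continuous_trigSum c F).measurable).aestronglyMeasurable _ (ae_of_all _ hb)
  have hφi : Integrable φ (unif Y) :=     (hY.1.add hi).congr (ae_of_all _ fun y => by simp)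
  refine ⟨hφi, ?_⟩
  calc ∫ y, |φ y| ∂unif Y ≤ ∫ y, (|φ y - (trigSum c F y).re| + ∑ z ∈ F, ‖c z‖) ∂unif Y := by
        refine integral_mono hφi.abs (hY.1.abs.add (integrable_const _)) fun y => ?_
        have := abs_sub_abs_le_abs_sub (φ y) (trigSum c F y).re
        linarith [hb y]
    _ ≤ _ := by
        rw [integral_add hY.1.abs (integrable_const _)]
        simpa using hY.2

/-- A function approximable in mean square by trigonometric sums has a limiting distribution. -/
theorem exists_limiting_distribution : ∃ ν : Measure ℝ, IsProbabilityMeasure ν ∧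
    ∀ f : ℝ → ℝ, Continuous f → (∃ B, ∀ x, |f x| ≤ B) →
      Tendsto (fun Y => ∫ y, f (φ y) ∂unif Y) atTop (𝓝 (∫ x, f x ∂ν)) := by
  choose χ hχ using hasMean_cexp hφ hA
  obtain ⟨M, hM⟩ := exists_mean_abs_le hφ hA
  have hex : ∀ Y, ∃ p : ProbabilityMeasure ℝ, 0 < Y → (p : Measure ℝ) = (unif Y).map φ := by
    intro Y
    by_cases hY : 0 < Y
    · have := isProbabilityMeasure_unif hY
      exact ⟨⟨_, Measure.isProbabilityMeasure_map hφ.aemeasurable⟩, fun _ => rfl⟩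
    · exact ⟨⟨Measure.dirac 0, inferInstance⟩, fun h => absurd h hY⟩
  choose P hP using hex
  have hcf : ∀ ξ, Tendsto (fun Y => charFun (P Y : Measure ℝ) ξ) atTop (𝓝 (χ ξ)) := fun ξ => by
    refine (hχ ξ).congr' ?_
    filter_upwards [eventually_gt_atTop 0] with Y hY
    rw [hP Y hY, charFun_apply_real, integral_map hφ.aemeasurable
      (by fun_prop : Measurable fun x : ℝ => cexp (ξ * x * I)).aestronglyMeasurable]
  have hb : ∀ ξ, ‖χ ξ - 1‖ ≤ |ξ| * M := fun ξ => by
    refine le_of_tendsto (((hχ ξ).sub_const 1).norm) ?_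
    filter_upwards [hM, eventually_gt_atTop 0] with Y hY hY0
    have := isProbabilityMeasure_unif hY0
    have h := norm_mean_cexp_sub_le hφ hA (g := fun _ => 0) measurable_const (ξ := ξ) hY0
      (by simpa using hY.1) (by simpa using hY.2)
    simpa using h
  have hχ0 : χ 0 = 1 := by simpa [sub_eq_zero] using hb 0
  have hcont : ContinuousAt χ 0 := by
    rw [ContinuousAt, hχ0, tendsto_iff_norm_sub_tendsto_zero]
    refine squeeze_zero (fun _ => norm_nonneg _) hb ?_
    have : Continuous fun ξ : ℝ => |ξ| * M := by fun_prop
    simpa using this.tendsto 0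
  have hnat : Tendsto (fun n : ℕ => (n : ℝ)) atTop atTop := tendsto_natCast_atTop_atTop
  have htight := isTightMeasureSet_of_tendsto_charFun (μ := fun n : ℕ => (P n : Measure ℝ)) hcont
    fun ξ => (hcf ξ).comp hnat
  have hcomp := isCompact_closure_of_isTightMeasureSet
    (S := Set.range fun n : ℕ => P n) (by simpa [Set.range] using htight)
  let U : Ultrafilter ℕ := Ultrafilter.of atTop
  have hU : (U : Filter ℕ) ≤ atTop := Ultrafilter.of_le atTop
  obtain ⟨ν, -, hν⟩ := hcomp.ultrafilter_le_nhds (U.map fun n : ℕ => P n)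
    (le_principal_iff.2 (mem_of_superset (Ultrafilter.mem_coe.2 (Ultrafilter.mem_map.2
      (univ_mem' fun n => Set.mem_range_self n))) subset_closure))
  have hν' : Tendsto (fun n : ℕ => P n) U (𝓝 ν) := hν
  have hνχ : ∀ ξ, charFun (ν : Measure ℝ) ξ = χ ξ := fun ξ => by
    have h1 := (ProbabilityMeasure.tendsto_iff_forall_integral_rclike_tendsto ℂ).1 hν'
      (BoundedContinuousFunction.innerProbChar ξ)
    simp only [← charFun_eq_integral_innerProbChar] at h1
    exact tendsto_nhds_unique h1 (((hcf ξ).comp hnat).mono_left hU)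
  have hlim : Tendsto P atTop (𝓝 ν) := by
    refine tendsto_of_seq_tendsto fun x hx => ?_
    refine ProbabilityMeasure.tendsto_of_tendsto_charFun fun ξ => ?_
    rw [hνχ]
    exact (hcf ξ).comp hx
  refine ⟨ν, inferInstance, fun f hf ⟨B, hB⟩ => ?_⟩
  have := ProbabilityMeasure.tendsto_iff_forall_integral_tendsto.1 hlim
    (BoundedContinuousFunction.ofNormedAddCommGroup f hf B hB)
  refine this.congr' ?_
  filter_upwards [eventually_gt_atTop 0] with Y hY
  rw [hP Y hY, integral_map hφ.aemeasurable (by fun_prop)]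
  rfl

end Law

end LimDist

/-- **Existence of a limiting distribution (Theorem 1.4).**
Let `K` be an abelian number field. Assume the Riemann hypothesis for `ζ_K`, that all
nontrivial zeros of `ζ_K` are simple, and that `J₋₁^K(T) ≪ T^{1+α}` for some fixed
`0 ≤ α < 2 - √3`. Then `φ_K(y) = e^{-y/2} M_K(e^y)` possesses a limiting distribution
`ν_K` on `ℝ`. -/
theorem limiting_distribution_abelian
    (K : Type) [Field K] [NumberField K]
    (hGal : IsGalois ℚ K) (hab : ∀ σ τ : (K ≃ₐ[ℚ] K), σ * τ = τ * σ)
    (Z : ℂ → ℂ) (hZ : IsDedekindZeta K Z) (hRH : ZetaRH Z)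
    (hsimple : ∀ ρ : ℂ, Z ρ = 0 → 0 < ρ.re → ρ.re < 1 → deriv Z ρ ≠ 0)
    (α : ℝ) (hα0 : 0 ≤ α) (hα : α < 2 - Real.sqrt 3)
    (C : ℝ)
    (hJ : ∀ T : ℝ, 2 ≤ T →
      (∑' ρ : {ρ : ℂ // Z ρ = 0 ∧ ρ.re = 1 / 2 ∧ 0 ≤ ρ.im ∧ ρ.im ≤ T},
        1 / ‖deriv Z ρ.1‖ ^ 2) ≤ C * T ^ (1 + α)) :
    ∃ ν : Measure ℝ, IsProbabilityMeasure ν ∧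
      ∀ f : ℝ → ℝ, Continuous f → (∃ B : ℝ, ∀ x : ℝ, |f x| ≤ B) →
        Tendsto
          (fun Y : ℝ => (1 / Y) *
            ∫ y in (0:ℝ)..Y, f (Real.exp (-y / 2) * mertensK K (Real.exp y)))
          atTop (𝓝 (∫ x : ℝ, f x ∂ν)) := by
  have hα' : α < 1 / 2 := by
    have h3 : (3 / 2 : ℝ) < √3 := Real.lt_sqrt_of_sq_lt (by norm_num)
    linarith
  obtain ⟨hS, V, m, h⟩ := LimDist.exists_VPack hZ.1 hZ.2 hRH hsimple
  have hT := h.tsum_cf_sq_ne_top hZ.1 hα' hJ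
  obtain ⟨ν, hν, hf⟩ := LimDist.exists_limiting_distribution (LimDist.measurable_phi (K := K))
    fun ε hε => LimDist.exists_trigSum_approx hS h hZ.2 hT hε
  refine ⟨ν, hν, fun f hfc hfb => (hf f hfc hfb).congr' ?_⟩
  filter_upwards [eventually_gt_atTop 0] with Y hY
  rw [LimDist.integral_unif _ hY]
  rfl
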